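/- For every Δ ∈ ℕ and all 0 < α, ν < 1, there exist ξ₀ > 0 and n₀, C ∈ ℕ such that the following holds for all ξ ≤ ξ₀ and n ≥ n₀. Suppose G is an n-vertex graph such that d_G(v) = (α ± ξ)n for all vertices v ∈ V(G) except at most ξn vertices, and 𝐆(n, C/n) is a binomial random graph on the vertex set V(G). Then with high probability (probability tending to 1 as n → ∞), the following holds: every collection 𝒯 of trees T satisfying (i) |T| ≤ (1−ν)n and Δ(T) ≤ Δ for all T ∈ 𝒯, and (ii) e(𝒯) ≤ (1−ν)e(G), packs into G ∪ 𝐆(n, C/n). -/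

import Mathlib

open SimpleGraph

namespace ApproxDecomp

/-- The degree of a vertex, as the cardinality of its neighbour set. -/
noncomputable def deg {V : Type*} (G : SimpleGraph V) (v : V) : ℕ :=
  (G.neighborSet v).ncard

/-- A collection of graphs `T i` packs into `G`: there are embeddings whose
edge images are pairwise disjoint. -/
def PacksInto {V : Type*} {τ : ℕ} {m : Fin τ → ℕ}
    (T : ∀ i, SimpleGraph (Fin (m i))) (G : SimpleGraph V) : Prop :=
  ∃ φ : ∀ i, Fin (m i) → V,
    (∀ i, Function.Injective (φ i)) ∧
    (∀ i a b, (T i).Adj a b → G.Adj (φ i a) (φ i b)) ∧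
    (∀ i j, i ≠ j → ∀ e ∈ (T i).edgeSet, ∀ f ∈ (T j).edgeSet,
      Sym2.map (φ i) e ≠ Sym2.map (φ j) f)

/-- The set of potential edges (non-diagonal unordered pairs) on `Fin n`. -/
def potentialEdges (n : ℕ) : Finset (Sym2 (Fin n)) :=
  Finset.univ.filter fun e : Sym2 (Fin n) => ¬ e.IsDiag

open scoped Classical in
/-- The probability that the binomial random graph `G(n,p)` on `Fin n`
satisfies the property `P`: each potential edge is included independently
with probability `p`. -/
noncomputable def binomialProb (n : ℕ) (p : ℝ) (P : SimpleGraph (Fin n) → Prop) : ℝ :=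
  ∑ s ∈ (potentialEdges n).powerset,
    if P (SimpleGraph.fromEdgeSet (↑s)) then
      p ^ s.card * (1 - p) ^ ((potentialEdges n).card - s.card)
    else 0

end ApproxDecomp

open SimpleGraph
namespace ApproxDecomp
section ModA
open scoped Classical
open Finset

/-- pseudo-random properties of the random graph. -/
def GoodG (n : ℕ) (δ : ℝ) (K : ℕ) (γ : ℝ) (g : SimpleGraph (Fin n)) : Prop :=
  (∀ S S' : Finset (Fin n), Disjoint S S' → δ * n ≤ (#S : ℝ) → δ * n ≤ (#S' : ℝ) →
    K * n ≤ #((S ×ˢ S').filter fun q => g.Adj q.1 q.2)) ∧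
  (#((univ : Finset (Fin n × Fin n)).filter fun q => g.Adj q.1 q.2) : ℝ) ≤ γ * n ^ 2

/-- weight of an edge set -/
noncomputable def wt (n : ℕ) (p : ℝ) (s : Finset (Sym2 (Fin n))) : ℝ :=
  p ^ s.card * (1 - p) ^ ((potentialEdges n).card - s.card)

lemma wt_nonneg {n : ℕ} {p : ℝ} (h0 : 0 ≤ p) (h1 : p ≤ 1) (s) : 0 ≤ wt n p s := by
  unfold wt
  have : 0 ≤ 1 - p := by linarith
  positivity

lemma sum_wt_prod (n : ℕ) (p : ℝ) (c : Sym2 (Fin n) → ℝ) :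
    ∑ s ∈ (potentialEdges n).powerset, wt n p s * ∏ e ∈ s, c e
      = ∏ e ∈ potentialEdges n, (p * c e + (1 - p)) := by
  rw [Finset.prod_add]
  refine Finset.sum_congr rfl fun s hs => ?_
  rw [Finset.mem_powerset] at hs
  rw [Finset.prod_mul_distrib, Finset.prod_const, Finset.prod_const, Finset.card_sdiff_of_subset hs]
  unfold wt
  ring

lemma binomialProb_eq (n : ℕ) (p : ℝ) (P : SimpleGraph (Fin n) → Prop) :
    binomialProb n p P = ∑ s ∈ (potentialEdges n).powerset,
      if P (SimpleGraph.fromEdgeSet (↑s)) then wt n p s else 0 := by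
  unfold binomialProb wt
  rfl

lemma sum_wt (n : ℕ) (p : ℝ) : ∑ s ∈ (potentialEdges n).powerset, wt n p s = 1 := by
  have := sum_wt_prod n p (fun _ => 1)
  simpa using this

lemma binomialProb_mono {n : ℕ} {p : ℝ} (h0 : 0 ≤ p) (h1 : p ≤ 1)
    {P Q : SimpleGraph (Fin n) → Prop} (h : ∀ g, P g → Q g) :
    binomialProb n p P ≤ binomialProb n p Q := by
  rw [binomialProb_eq, binomialProb_eq]
  refine Finset.sum_le_sum fun s _ => ?_
  have := wt_nonneg h0 h1 (n := n) s
  split_ifs with a b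
  · exact le_rfl
  · exact absurd (h _ a) b
  · exact this
  · exact le_rfl

lemma binomialProb_union {n : ℕ} {p : ℝ} (h0 : 0 ≤ p) (h1 : p ≤ 1) {ι : Type*} (I : Finset ι)
    {P : SimpleGraph (Fin n) → Prop} (B : ι → SimpleGraph (Fin n) → Prop)
    (h : ∀ g, (∀ i ∈ I, ¬ B i g) → P g) :
    1 - ∑ i ∈ I, binomialProb n p (B i) ≤ binomialProb n p P := by
  rw [← sum_wt n p]
  simp only [binomialProb_eq]
  rw [Finset.sum_comm, ← Finset.sum_sub_distrib]
  refine Finset.sum_le_sum fun s _ => ?_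
  have hw := wt_nonneg h0 h1 (n := n) s
  have hnn : ∀ i ∈ I, 0 ≤ (if B i (SimpleGraph.fromEdgeSet (↑s)) then wt n p s else 0) := by
    intro i _; split_ifs <;> simp [hw]
  split_ifs with a
  · have := Finset.sum_nonneg hnn
    linarith
  · have : ∃ i ∈ I, B i (SimpleGraph.fromEdgeSet (↑s)) := by
      by_contra hc
      push Not at hc
      exact a (h _ hc)
    obtain ⟨i, hi, hb⟩ := this
    have := Finset.single_le_sum hnn hi
    rw [if_pos hb] at this
    linarith

lemma binomialProb_markov {n : ℕ} {p : ℝ} (h0 : 0 ≤ p) (h1 : p ≤ 1)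
    (Q : SimpleGraph (Fin n) → Prop) (c : Sym2 (Fin n) → ℝ) (hc : ∀ e, 0 ≤ c e) (l : ℝ) (hl : 0 ≤ l)
    (h : ∀ s ⊆ potentialEdges n, Q (SimpleGraph.fromEdgeSet (↑s)) → 1 ≤ l * ∏ e ∈ s, c e) :
    binomialProb n p Q ≤ l * ∏ e ∈ potentialEdges n, (p * c e + (1 - p)) := by
  rw [← sum_wt_prod, binomialProb_eq, Finset.mul_sum]
  refine Finset.sum_le_sum fun s hs => ?_
  have hw := wt_nonneg h0 h1 (n := n) s
  have hp : 0 ≤ ∏ e ∈ s, c e := Finset.prod_nonneg fun e _ => hc e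
  split_ifs with a
  · have := h s (Finset.mem_powerset.1 hs) a
    nlinarith
  · positivity

lemma card_potentialEdges_le (n : ℕ) : #(potentialEdges n) ≤ n ^ 2 := by
  have h1 : #(potentialEdges n) ≤ #(univ.image (fun q : Fin n × Fin n => s(q.1, q.2))) := by
    refine Finset.card_le_card fun e _ => ?_
    induction e with
    | h x y => exact Finset.mem_image.2 ⟨(x, y), Finset.mem_univ _, rfl⟩
  refine h1.trans (Finset.card_image_le.trans ?_)
  simp [sq]

lemma prob_few_between {n : ℕ} {p : ℝ} (h0 : 0 ≤ p) (h1 : p ≤ 1) (S S' : Finset (Fin n))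
    (hd : Disjoint S S') (k : ℕ) :
    binomialProb n p (fun g => #((S ×ˢ S').filter fun q => g.Adj q.1 q.2) < k)
      ≤ 2 ^ k * Real.exp (-(p * (#S * #S') / 2)) := by
  set E0 : Finset (Sym2 (Fin n)) := (S ×ˢ S').image (fun q => s(q.1, q.2)) with hE0
  have hinj : Set.InjOn (fun q : Fin n × Fin n => s(q.1, q.2)) (S ×ˢ S' : Finset _) := by
    rintro ⟨x, y⟩ hx ⟨x', y'⟩ hx' he
    simp only [Finset.coe_product, Set.mem_prod, Finset.mem_coe] at hx hx'
    simp only [Sym2.eq_iff] at he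
    rcases he with ⟨rfl, rfl⟩ | ⟨rfl, rfl⟩
    · rfl
    · exact absurd hx'.2 (Finset.disjoint_left.1 hd hx.1)
  have hcard : #E0 = #S * #S' := by
    rw [hE0, Finset.card_image_of_injOn hinj, Finset.card_product]
  have hsub : E0 ⊆ potentialEdges n := by
    intro e he
    obtain ⟨⟨x, y⟩, hq, rfl⟩ := Finset.mem_image.1 he
    rw [Finset.mem_product] at hq
    simp only [potentialEdges, Finset.mem_filter, Finset.mem_univ, true_and, Sym2.mk_isDiag_iff]
    rintro rfl
    exact Finset.disjoint_left.1 hd hq.1 hq.2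
  refine (binomialProb_markov h0 h1 _ (fun e => if e ∈ E0 then 1/2 else 1) ?_ (2 ^ k) (by positivity) ?_).trans ?_
  · intro e; split_ifs <;> norm_num
  · intro s hs hQ
    have e1 : ((S ×ˢ S').filter fun q => (SimpleGraph.fromEdgeSet (s : Set (Sym2 (Fin n)))).Adj q.1 q.2).image
        (fun q : Fin n × Fin n => s(q.1, q.2)) = s.filter (· ∈ E0) := by
      ext e
      simp only [Finset.mem_image, Finset.mem_filter, SimpleGraph.fromEdgeSet_adj, Finset.mem_coe, hE0]
      constructor
      · rintro ⟨q, ⟨hq, hq1, hq2⟩, rfl⟩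
        exact ⟨hq1, q, hq, rfl⟩
      · rintro ⟨he, q, hq, rfl⟩
        refine ⟨q, ⟨hq, he, ?_⟩, rfl⟩
        rw [Finset.mem_product] at hq
        intro h
        rw [h] at hq
        exact Finset.disjoint_left.1 hd hq.1 hq.2
    have e2 : #(s.filter (· ∈ E0)) < k := by
      rw [← e1]
      refine lt_of_le_of_lt Finset.card_image_le ?_
      refine lt_of_eq_of_lt (congrArg Finset.card ?_) hQ
      ext q; simp only [Finset.mem_filter]
    rw [Finset.prod_ite, Finset.prod_const, Finset.prod_const_one, mul_one]
    have : (1:ℝ) = 2 ^ k * (1/2) ^ k := by rw [← mul_pow]; norm_num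
    refine this.le.trans ?_
    refine mul_le_mul_of_nonneg_left ?_ (by positivity)
    exact pow_le_pow_of_le_one (a := (1/2 : ℝ)) (by norm_num) (by norm_num) e2.le
  · refine mul_le_mul_of_nonneg_left ?_ (by positivity)
    have : ∀ e ∈ potentialEdges n, (p * (if e ∈ E0 then 1/2 else 1) + (1 - p)) = if e ∈ E0 then (1 - p/2) else 1 := by
      intro e _; split_ifs <;> ring
    rw [Finset.prod_congr rfl this, Finset.prod_ite, Finset.prod_const, Finset.prod_const_one, mul_one]
    have hf : (potentialEdges n).filter (· ∈ E0) = E0 := by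
      ext e; simp only [Finset.mem_filter]; exact ⟨fun h => h.2, fun h => ⟨hsub h, h⟩⟩
    rw [hf, hcard]
    have h3 : 1 - p/2 ≤ Real.exp (-(p/2)) := by
      have := Real.add_one_le_exp (-(p/2)); linarith
    calc (1 - p/2) ^ (#S * #S') ≤ (Real.exp (-(p/2))) ^ (#S * #S') :=
          pow_le_pow_left₀ (by linarith) h3 _
      _ = Real.exp (-(p * (#S * #S') / 2)) := by
          rw [← Real.exp_nat_mul]; congr 1; push_cast; ring

lemma prob_many_edges {n : ℕ} {p : ℝ} (h0 : 0 ≤ p) (h1 : p ≤ 1) (b : ℝ) :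
    binomialProb n p (fun g => b < (#((univ : Finset (Fin n × Fin n)).filter fun q => g.Adj q.1 q.2) : ℝ))
      ≤ Real.exp (2 * p * n ^ 2 - b / 2) := by
  have key : ∀ s : Finset (Sym2 (Fin n)), s ⊆ potentialEdges n →
      #((univ : Finset (Fin n × Fin n)).filter fun q => (SimpleGraph.fromEdgeSet (s : Set (Sym2 (Fin n)))).Adj q.1 q.2) ≤ 2 * #s := by
    intro s _
    have : ((univ : Finset (Fin n × Fin n)).filter fun q => (SimpleGraph.fromEdgeSet (s : Set (Sym2 (Fin n)))).Adj q.1 q.2) ⊆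
        s.biUnion (fun e => univ.filter fun q : Fin n × Fin n => s(q.1, q.2) = e) := by
      intro q hq
      simp only [Finset.mem_filter, SimpleGraph.fromEdgeSet_adj, Finset.mem_coe, Finset.mem_univ, true_and] at hq
      simp only [Finset.mem_biUnion, Finset.mem_filter, Finset.mem_univ, true_and]
      exact ⟨_, hq.1, rfl⟩
    refine (Finset.card_le_card this).trans ?_
    rw [mul_comm]
    refine Finset.card_biUnion_le_card_mul _ _ _ fun e _ => ?_
    induction e with
    | h x y =>
      have : (univ.filter fun q : Fin n × Fin n => s(q.1, q.2) = s(x, y)) ⊆ {(x, y), (y, x)} := by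
        rintro ⟨a, b⟩ hq
        simp only [Finset.mem_filter, Finset.mem_univ, true_and, Sym2.eq_iff] at hq
        simp only [Finset.mem_insert, Finset.mem_singleton, Prod.mk.injEq]
        exact hq
      exact (Finset.card_le_card this).trans Finset.card_le_two
  refine (binomialProb_markov h0 h1 _ (fun _ => Real.exp 1) (fun _ => (Real.exp_pos _).le)
    (Real.exp (-(b/2))) (Real.exp_pos _).le ?_).trans ?_
  · intro s hs hQ
    have := key s hs
    have h2 : (#((univ : Finset (Fin n × Fin n)).filter fun q => (SimpleGraph.fromEdgeSet (s : Set (Sym2 (Fin n)))).Adj q.1 q.2) : ℝ) ≤ 2 * #s := by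
      exact_mod_cast this
    rw [Finset.prod_const, ← Real.exp_nat_mul, ← Real.exp_add]
    apply Real.one_le_exp
    have hQ' : b < (#((univ : Finset (Fin n × Fin n)).filter fun q => (SimpleGraph.fromEdgeSet (s : Set (Sym2 (Fin n)))).Adj q.1 q.2) : ℝ) := by
      refine lt_of_lt_of_eq hQ ?_
      congr 2; ext q; simp only [Finset.mem_filter]
    linarith
  · rw [Finset.prod_const]
    have he : Real.exp 1 ≤ 3 := by
      have := Real.exp_one_lt_d9; linarith
    have h3 : p * Real.exp 1 + (1 - p) ≤ Real.exp (2 * p) := by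
      have := Real.add_one_le_exp (2 * p); nlinarith
    have h4 : 0 ≤ p * Real.exp 1 + (1 - p) := by
      have := Real.exp_pos 1
      have : 0 ≤ 1 - p := by linarith
      positivity
    have hc : (#(potentialEdges n) : ℝ) ≤ n ^ 2 := by exact_mod_cast card_potentialEdges_le n
    calc _ ≤ Real.exp (-(b/2)) * (Real.exp (2 * p)) ^ #(potentialEdges n) := by
            refine mul_le_mul_of_nonneg_left ?_ (Real.exp_pos _).le
            exact pow_le_pow_left₀ h4 h3 _
      _ ≤ _ := by
            rw [← Real.exp_nat_mul, ← Real.exp_add]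
            apply Real.exp_le_exp.2
            nlinarith

/-- whp the random graph is good -/
theorem goodG_whp (δ : ℝ) (hδ : 0 < δ) (K : ℕ) (γ : ℝ) (hγ : 0 < γ) :
    ∃ C : ℕ, ∀ εP : ℝ, 0 < εP → ∃ n₁ : ℕ, ∀ n : ℕ, n₁ ≤ n →
      0 ≤ ((C:ℝ)/n) ∧ ((C:ℝ)/n) ≤ 1 ∧
      1 - εP ≤ binomialProb n ((C : ℝ) / n) (GoodG n δ K γ) := by
  obtain ⟨C, hC⟩ := exists_nat_ge (2 * (3 + K) / δ ^ 2)
  refine ⟨C, fun εP hε => ?_⟩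
  obtain ⟨k1, hk1⟩ := exists_nat_ge (2 / εP)
  obtain ⟨k2, hk2⟩ := exists_nat_ge ((4 * C + 2) / γ)
  refine ⟨C + k1 + k2 + 1, fun n hn => ?_⟩
  have hn1 : (C:ℝ) + k1 + k2 + 1 ≤ n := by exact_mod_cast hn
  have hCn : (0:ℝ) ≤ C := Nat.cast_nonneg _
  have hk1n : (0:ℝ) ≤ k1 := Nat.cast_nonneg _
  have hk2n : (0:ℝ) ≤ k2 := Nat.cast_nonneg _
  have hKn : (0:ℝ) ≤ K := Nat.cast_nonneg _
  have hnpos : (0:ℝ) < n := by linarith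
  have h0 : 0 ≤ ((C:ℝ)/n) := by positivity
  have h1 : ((C:ℝ)/n) ≤ 1 := by rw [div_le_one hnpos]; linarith
  refine ⟨h0, h1, ?_⟩
  set p := ((C:ℝ)/n) with hp
  have hpn : p * n = C := by rw [hp]; field_simp
  let I : Finset (Option (Finset (Fin n) × Finset (Fin n))) :=
    insert none ((univ.filter fun q : Finset (Fin n) × Finset (Fin n) =>
      Disjoint q.1 q.2 ∧ δ * n ≤ (#q.1 : ℝ) ∧ δ * n ≤ (#q.2 : ℝ)).image some)
  let B : Option (Finset (Fin n) × Finset (Fin n)) → SimpleGraph (Fin n) → Prop := fun o g =>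
    match o with
    | none => γ * n ^ 2 < (#((univ : Finset (Fin n × Fin n)).filter fun q => g.Adj q.1 q.2) : ℝ)
    | some q => #((q.1 ×ˢ q.2).filter fun q => g.Adj q.1 q.2) < K * n
  have hU := binomialProb_union (P := GoodG n δ K γ) h0 h1 I B (by
    intro g hg
    refine ⟨fun S S' hd hS hS' => ?_, ?_⟩
    · have := hg (some (S, S')) (by
        refine Finset.mem_insert_of_mem (Finset.mem_image.2 ⟨(S, S'), ?_, rfl⟩)
        simp only [Finset.mem_filter, Finset.mem_univ, true_and]
        exact ⟨hd, hS, hS'⟩)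
      exact not_lt.1 this
    · have := hg none (Finset.mem_insert_self _ _)
      exact not_lt.1 this)
  have hnone : binomialProb n p (B none) ≤ Real.exp (-n) := by
    refine (prob_many_edges h0 h1 (γ * n ^ 2)).trans (Real.exp_le_exp.2 ?_)
    have : (4 * C + 2) ≤ γ * n := by
      rw [div_le_iff₀ hγ] at hk2
      nlinarith
    have e : 2 * p * n ^ 2 = 2 * C * n := by rw [← hpn]; ring
    rw [e]
    nlinarith
  have hsome : ∀ q : Finset (Fin n) × Finset (Fin n), (Disjoint q.1 q.2 ∧ δ * n ≤ (#q.1 : ℝ) ∧ δ * n ≤ (#q.2 : ℝ)) →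
      binomialProb n p (B (some q)) ≤ Real.exp (K * n - (3 + K) * n) := by
    rintro ⟨S, S'⟩ ⟨hd, hS, hS'⟩
    refine (prob_few_between h0 h1 S S' hd (K * n)).trans ?_
    dsimp only at hS hS'
    have h2 : (2:ℝ) ^ (K * n) ≤ Real.exp (K * n) := by
      have : (2:ℝ) ≤ Real.exp 1 := by have := Real.exp_one_gt_d9; linarith
      calc (2:ℝ) ^ (K * n) ≤ (Real.exp 1) ^ (K * n) := pow_le_pow_left₀ (by norm_num) this _
        _ = _ := by rw [← Real.exp_nat_mul]; push_cast; ring_nf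
    have h3 : (3 + K) * n ≤ p * (#S * #S') / 2 := by
      have hm : (δ * n) * (δ * n) ≤ (#S * #S' : ℝ) := mul_le_mul hS hS' (by positivity) (by positivity)
      have : p * ((δ * n) * (δ * n)) ≤ p * (#S * #S') := mul_le_mul_of_nonneg_left hm h0
      have e : p * ((δ * n) * (δ * n)) = C * δ ^ 2 * n := by rw [← hpn]; ring
      rw [div_le_iff₀ (by positivity)] at hC
      have : 2 * (3 + K) * n ≤ C * δ ^ 2 * n := mul_le_mul_of_nonneg_right hC hnpos.le
      linarith
    calc _ ≤ Real.exp (K * n) * Real.exp (-((3 + K) * n)) :=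
          mul_le_mul h2 (Real.exp_le_exp.2 (by linarith)) (Real.exp_pos _).le (Real.exp_pos _).le
      _ = _ := by rw [← Real.exp_add]; congr 1
  have hexp : Real.exp (-n) ≤ εP / 2 := by
    have h2 : (n:ℝ) + 1 ≤ Real.exp n := Real.add_one_le_exp _
    rw [Real.exp_neg, inv_le_comm₀ (Real.exp_pos _) (by positivity), inv_div]
    linarith
  have hsum : ∑ i ∈ I, binomialProb n p (B i) ≤ εP := by
    rw [Finset.sum_insert (by simp)]
    rw [Finset.sum_image (by simp)]
    have : ∑ q ∈ (univ.filter fun q : Finset (Fin n) × Finset (Fin n) =>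
      Disjoint q.1 q.2 ∧ δ * n ≤ (#q.1 : ℝ) ∧ δ * n ≤ (#q.2 : ℝ)), binomialProb n p (B (some q)) ≤
        (4:ℝ) ^ n * Real.exp (K * n - (3 + K) * n) := by
      refine (Finset.sum_le_card_nsmul _ _ _ fun q hq => hsome q (Finset.mem_filter.1 hq).2).trans ?_
      rw [nsmul_eq_mul]
      refine mul_le_mul_of_nonneg_right ?_ (Real.exp_pos _).le
      have h4 := Finset.card_filter_le (univ : Finset (Finset (Fin n) × Finset (Fin n))) (fun q =>
        Disjoint q.1 q.2 ∧ δ * n ≤ (#q.1 : ℝ) ∧ δ * n ≤ (#q.2 : ℝ))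
      have h5 : #(univ : Finset (Finset (Fin n) × Finset (Fin n))) = 4 ^ n := by
        rw [Finset.card_univ, Fintype.card_prod, Fintype.card_finset, Fintype.card_fin, ← mul_pow]; norm_num
      rw [h5] at h4
      exact_mod_cast h4
    have h6 : (4:ℝ) ^ n * Real.exp (K * n - (3 + K) * n) ≤ Real.exp (-n) := by
      have : (4:ℝ) ≤ Real.exp 2 := by
        have h := Real.exp_one_gt_d9
        have : Real.exp 2 = Real.exp 1 * Real.exp 1 := by rw [← Real.exp_add]; norm_num
        nlinarith
      calc _ ≤ (Real.exp 2) ^ n * Real.exp (K * n - (3 + K) * n) :=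
            mul_le_mul_of_nonneg_right (pow_le_pow_left₀ (by norm_num) this _) (Real.exp_pos _).le
        _ = _ := by rw [← Real.exp_nat_mul, ← Real.exp_add]; congr 1; ring
    linarith
  linarith

end ModA
end ApproxDecomp

open SimpleGraph
namespace ApproxDecomp
section ModD
open scoped Classical
open Finset

lemma balance_step {Ω E : Type*} [Fintype Ω] [Fintype E] (w : Ω → ℝ) (hw : ∀ ω, 0 ≤ w ω)
    (hw1 : ∑ ω, w ω = 1) (v : Ω → E → ℝ) (B : ℝ) (hv0 : ∀ ω e, 0 ≤ v ω e) (hvB : ∀ ω e, v ω e ≤ B)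
    (D : E → ℝ) :
    ∃ ω, 0 < w ω ∧ ∑ e, (D e + (v ω e - ∑ ω', w ω' * v ω' e)) ^ 2
      ≤ ∑ e, D e ^ 2 + Fintype.card E * B ^ 2 := by
  set m : E → ℝ := fun e => ∑ ω', w ω' * v ω' e with hm
  have hm0 : ∀ e, 0 ≤ m e := fun e => Finset.sum_nonneg fun ω _ => mul_nonneg (hw _) (hv0 _ _)
  have hmB : ∀ e, m e ≤ B := by
    intro e
    calc m e ≤ ∑ ω', w ω' * B := Finset.sum_le_sum fun ω _ => mul_le_mul_of_nonneg_left (hvB _ _) (hw _)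
      _ = B := by rw [← Finset.sum_mul, hw1, one_mul]
  by_contra hcon
  push Not at hcon
  have h1 : ∑ ω, w ω * ∑ e, (D e + (v ω e - m e)) ^ 2 ≤ ∑ e, D e ^ 2 + Fintype.card E * B ^ 2 := by
    have e1 : ∑ ω, w ω * ∑ e, (D e + (v ω e - m e)) ^ 2 =
        ∑ e, ∑ ω, w ω * (D e + (v ω e - m e)) ^ 2 := by
      rw [Finset.sum_comm]; simp only [Finset.mul_sum]
    have e2 : ∀ e, ∑ ω, w ω * (D e + (v ω e - m e)) ^ 2 ≤ D e ^ 2 + B ^ 2 := by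
      intro e
      have e3' : ∀ M : ℝ, ∑ ω, w ω * (D e + (v ω e - M)) ^ 2 =
          (D e ^ 2 - 2 * D e * M) * ∑ ω, w ω + 2 * D e * (∑ ω, w ω * v ω e) + ∑ ω, w ω * (v ω e - M) ^ 2 := by
        intro M
        rw [Finset.mul_sum, Finset.mul_sum, ← Finset.sum_add_distrib, ← Finset.sum_add_distrib]
        exact Finset.sum_congr rfl fun ω _ => by ring
      have e3 := e3' (m e)
      have e4 : ∑ ω, w ω * (v ω e - m e) ^ 2 ≤ ∑ ω, w ω * B ^ 2 := by
        refine Finset.sum_le_sum fun ω _ => mul_le_mul_of_nonneg_left ?_ (hw _)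
        have := hv0 ω e; have := hvB ω e; have := hm0 e; have := hmB e
        exact sq_le_sq' (by linarith) (by linarith)
      rw [← Finset.sum_mul, hw1, one_mul] at e4
      rw [e3, hw1]
      have : (∑ ω, w ω * v ω e) = m e := rfl
      rw [this]
      linarith
    rw [e1]
    refine (Finset.sum_le_sum fun e _ => e2 e).trans ?_
    rw [Finset.sum_add_distrib, Finset.sum_const, nsmul_eq_mul, Finset.card_univ]
  have h2 : ∑ ω, w ω * (∑ e, D e ^ 2 + Fintype.card E * B ^ 2) < ∑ ω, w ω * ∑ e, (D e + (v ω e - m e)) ^ 2 := by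
    have hex : ∃ ω, 0 < w ω := by
      by_contra hc
      push Not at hc
      have : ∑ ω, w ω ≤ 0 := Finset.sum_nonpos fun ω _ => hc ω
      linarith
    obtain ⟨ω0, h0⟩ := hex
    refine Finset.sum_lt_sum (fun ω _ => ?_) ⟨ω0, Finset.mem_univ _, ?_⟩
    · rcases (hw ω).eq_or_lt with h | h
      · rw [← h]; simp
      · exact mul_le_mul_of_nonneg_left (hcon ω h).le h.le
    · exact mul_lt_mul_of_pos_left (hcon ω0 h0) h0
  rw [← Finset.sum_mul, hw1, one_mul] at h2
  linarith

/-- derandomised second moment balancing -/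
lemma balance_aux {J Ω E : Type*} [Fintype Ω] [Fintype E] [Nonempty Ω] (S : Finset J)
    (w : J → Ω → ℝ) (hw : ∀ j ∈ S, ∀ ω, 0 ≤ w j ω) (hw1 : ∀ j ∈ S, ∑ ω, w j ω = 1) (v : J → Ω → E → ℝ) (B : J → ℝ)
    (hv0 : ∀ j ∈ S, ∀ ω e, 0 ≤ v j ω e) (hvB : ∀ j ∈ S, ∀ ω e, v j ω e ≤ B j) :
    ∃ f : J → Ω, (∀ j ∈ S, 0 < w j (f j)) ∧
      ∑ e, (∑ j ∈ S, (v j (f j) e - ∑ ω, w j ω * v j ω e)) ^ 2 ≤ Fintype.card E * ∑ j ∈ S, B j ^ 2 := by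
  induction S using Finset.induction_on with
  | empty => exact ⟨fun _ => Classical.arbitrary Ω, by simp, by simp⟩
  | insert a s ha ih =>
    obtain ⟨f, hf, hf2⟩ := ih (fun j hj => hw j (Finset.mem_insert_of_mem hj)) (fun j hj => hw1 j (Finset.mem_insert_of_mem hj))
      (fun j hj => hv0 j (Finset.mem_insert_of_mem hj)) (fun j hj => hvB j (Finset.mem_insert_of_mem hj))
    have hm := Finset.mem_insert_self a s
    obtain ⟨ω, h1, h2⟩ := balance_step (w a) (hw a hm) (hw1 a hm) (v a) (B a) (hv0 a hm) (hvB a hm)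
      (fun e => ∑ j ∈ s, (v j (f j) e - ∑ ω, w j ω * v j ω e))
    refine ⟨Function.update f a ω, ?_, ?_⟩
    · intro j hj
      by_cases hja : j = a
      · subst hja; simpa using h1
      · rw [Function.update_of_ne hja]
        exact hf j ((Finset.mem_insert.1 hj).resolve_left hja)
    · have : ∀ e, ∑ j ∈ insert a s, (v j (Function.update f a ω j) e - ∑ ω, w j ω * v j ω e) =
          ∑ j ∈ s, (v j (f j) e - ∑ ω, w j ω * v j ω e) + (v a ω e - ∑ ω', w a ω' * v a ω' e) := by
        intro e
        rw [Finset.sum_insert ha, add_comm]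
        congr 1
        · refine Finset.sum_congr rfl fun j hj => ?_
          have : j ≠ a := fun h => ha (h ▸ hj)
          rw [Function.update_of_ne this]
        · simp
      rw [Finset.sum_congr rfl fun e _ => by rw [this e], Finset.sum_insert ha]
      linarith

lemma balance {J Ω E : Type*} [Fintype Ω] [Fintype E] [Nonempty Ω] (S : Finset J)
    (w : J → Ω → ℝ) (hw : ∀ j ∈ S, ∀ ω, 0 ≤ w j ω) (hw1 : ∀ j ∈ S, ∑ ω, w j ω = 1) (v : J → Ω → E → ℝ) (B : J → ℝ)
    (hv0 : ∀ j ∈ S, ∀ ω e, 0 ≤ v j ω e) (hvB : ∀ j ∈ S, ∀ ω e, v j ω e ≤ B j)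
    (err : ℝ) (herr : 0 ≤ err) (hB : Fintype.card E * ∑ j ∈ S, B j ^ 2 ≤ err ^ 2) :
    ∃ f : J → Ω, (∀ j ∈ S, 0 < w j (f j)) ∧
      ∀ e, ∑ j ∈ S, v j (f j) e ≤ ∑ j ∈ S, ∑ ω, w j ω * v j ω e + err := by
  obtain ⟨f, h1, h2⟩ := balance_aux S w hw hw1 v B hv0 hvB
  refine ⟨f, h1, fun e => ?_⟩
  have h3 := Finset.single_le_sum (f := fun e => (∑ j ∈ S, (v j (f j) e - ∑ ω, w j ω * v j ω e)) ^ 2)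
    (fun e _ => sq_nonneg _) (Finset.mem_univ e)
  have h4 : (∑ j ∈ S, (v j (f j) e - ∑ ω, w j ω * v j ω e)) ^ 2 ≤ err ^ 2 := h3.trans (h2.trans hB)
  have h5 := (abs_le.1 (abs_le_of_sq_le_sq h4 herr)).2
  rw [Finset.sum_sub_distrib] at h5
  linarith

end ModD
end ApproxDecomp

open SimpleGraph
namespace ApproxDecomp
section ModE
open scoped Classical
open Finset

lemma permMatrix_val {ι : Type*} [DecidableEq ι] (σ : Equiv.Perm ι) (i j : ι) :
    (σ.permMatrix ℝ) i j = if σ i = j then 1 else 0 := by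
  simp [Equiv.Perm.permMatrix, PEquiv.toMatrix_apply]

lemma exists_perm_support {ι : Type*} [Fintype ι] (A : ι → ι → ℕ) (D : ℕ) (hD : 0 < D)
    (hr : ∀ x, ∑ y, A x y = D) (hc : ∀ y, ∑ x, A x y = D) :
    ∃ σ : Equiv.Perm ι, ∀ x, 0 < A x (σ x) := by
  have hD' : (0:ℝ) < D := by exact_mod_cast hD
  let M : Matrix ι ι ℝ := fun x y => (A x y : ℝ) / D
  have hM : M ∈ doublyStochastic ℝ ι := by
    rw [mem_doublyStochastic_iff_sum]
    refine ⟨fun i j => by positivity, fun i => ?_, fun j => ?_⟩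
    · have : ∑ y, (A i y : ℝ) = D := by exact_mod_cast hr i
      simp only [M]
      rw [← Finset.sum_div, this, div_self hD'.ne']
    · have : ∑ x, (A x j : ℝ) = D := by exact_mod_cast hc j
      simp only [M]
      rw [← Finset.sum_div, this, div_self hD'.ne']
  obtain ⟨w, hw0, hw1, hw2⟩ := exists_eq_sum_perm_of_mem_doublyStochastic hM
  have : ∃ σ, 0 < w σ := by
    by_contra h
    push Not at h
    have : ∑ σ, w σ ≤ 0 := Finset.sum_nonpos fun ω _ => h ω
    linarith
  obtain ⟨σ, hσ⟩ := this
  refine ⟨σ, fun x => ?_⟩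
  have h1 : M x (σ x) = ∑ τ, w τ * (if τ x = σ x then 1 else 0) := by
    rw [← hw2, Matrix.sum_apply]
    refine Finset.sum_congr rfl fun τ _ => ?_
    rw [Matrix.smul_apply, permMatrix_val, smul_eq_mul]
  have h2 : w σ ≤ M x (σ x) := by
    rw [h1]
    refine le_trans (by simp) (Finset.single_le_sum (f := fun τ => w τ * (if τ x = σ x then 1 else 0)) ?_ (Finset.mem_univ σ))
    intro τ _
    have := hw0 τ
    split_ifs <;> simp [this]
  have h3 : 0 < (A x (σ x) : ℝ) / D := lt_of_lt_of_le hσ h2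
  by_contra h
  have : A x (σ x) = 0 := by omega
  rw [this] at h3
  simp at h3

lemma nat_birkhoff {ι : Type*} [Fintype ι] [DecidableEq ι] (D : ℕ) : ∀ (A : ι → ι → ℕ)
    (_ : ∀ x, ∑ y, A x y = D) (_ : ∀ y, ∑ x, A x y = D),
    ∃ π : Fin D → Equiv.Perm ι, ∀ x y, A x y = #(univ.filter fun c => π c x = y) := by
  induction D with
  | zero =>
    intro A hr hc
    refine ⟨fun c => c.elim0, fun x y => ?_⟩
    have := Finset.single_le_sum (f := fun y => A x y) (fun _ _ => Nat.zero_le _) (Finset.mem_univ y)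
    rw [hr x] at this
    simp only [Finset.univ_eq_empty, Finset.filter_empty, Finset.card_empty]
    omega
  | succ D ih =>
    intro A hr hc
    obtain ⟨σ, hσ⟩ := exists_perm_support A (D+1) (Nat.succ_pos _) hr hc
    have hle : ∀ x y, (if σ x = y then 1 else 0) ≤ A x y := by
      intro x y
      split_ifs with h
      · have := hσ x; rw [h] at this; exact this
      · exact Nat.zero_le _
    obtain ⟨π, hπ⟩ := ih (fun x y => A x y - if σ x = y then 1 else 0) (by
        intro x
        rw [Finset.sum_tsub_distrib _ (fun y _ => hle x y), hr x]
        simp) (by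
        intro y
        rw [Finset.sum_tsub_distrib _ (fun x _ => hle x y), hc y]
        have : ∀ x, (σ x = y) = (x = σ.symm y) := by
          intro x; rw [Equiv.eq_symm_apply]
        simp only [this]
        simp)
    refine ⟨Fin.cons σ π, fun x y => ?_⟩
    have h1 := hπ x y
    have h2 := hle x y
    rw [Finset.card_filter, Fin.sum_univ_succ]
    simp only [Fin.cons_zero, Fin.cons_succ]
    rw [← Finset.card_filter, ← h1]
    omega

lemma matchings (p D : ℕ) (H : Fin p → Fin p → Prop)
    (hr : ∀ x, #(univ.filter fun y => H x y) ≤ D) (hc : ∀ y, #(univ.filter fun x => H x y) ≤ D)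
    (δ : ℝ) (hδ : 0 < δ) :
    ∃ (q : ℕ) (π : Fin q → Equiv.Perm (Fin p)) (gd : Fin q → Fin p → Prop),
      (∀ c x, gd c x → H x (π c x)) ∧
      (∀ c, (#(univ.filter fun x => ¬ gd c x) : ℝ) ≤ δ * p) ∧
      (∀ c c' x, gd c x → gd c' x → π c x = π c' x → c = c') ∧
      (D - q : ℝ) * (δ * p) ≤ D * p - #((univ : Finset (Fin p × Fin p)).filter fun e => H e.1 e.2) := by
  let A : (Fin p ⊕ Fin p) → (Fin p ⊕ Fin p) → ℕ := fun u v =>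
    match u, v with
    | Sum.inl x, Sum.inl y => if H x y then 1 else 0
    | Sum.inl x, Sum.inr y => if x = y then D - #(univ.filter fun y => H x y) else 0
    | Sum.inr x, Sum.inl y => if x = y then D - #(univ.filter fun z => H z x) else 0
    | Sum.inr x, Sum.inr y => if H y x then 1 else 0
  obtain ⟨π, hπ⟩ := nat_birkhoff D A (by
    rintro (x | x)
    · rw [Fintype.sum_sum_type]
      simp only [A, Finset.sum_ite_eq, Finset.mem_univ, if_true, ← Finset.card_filter]
      have := hr x; omega
    · rw [Fintype.sum_sum_type]
      simp only [A, Finset.sum_ite_eq, Finset.mem_univ, if_true, ← Finset.card_filter]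
      have := hc x; omega) (by
    rintro (y | y)
    · rw [Fintype.sum_sum_type]
      simp only [A, Finset.sum_ite_eq', Finset.mem_univ, if_true, ← Finset.card_filter]
      have := hc y; omega
    · rw [Fintype.sum_sum_type]
      simp only [A, Finset.sum_ite_eq', Finset.mem_univ, if_true, ← Finset.card_filter]
      have := hr y; omega)
  -- matched vertices of colour c
  let mt : Fin D → Finset (Fin p) := fun c => univ.filter fun x => ∃ y, π c (Sum.inl x) = Sum.inl y
  have hH : ∀ c x y, π c (Sum.inl x) = Sum.inl y → H x y := by
    intro c x y h
    by_contra hn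
    have h1 := hπ (Sum.inl x) (Sum.inl y)
    simp only [A, if_neg hn] at h1
    have : c ∈ (univ.filter fun c => π c (Sum.inl x) = Sum.inl y) := by simp [h]
    rw [Finset.card_eq_zero.1 h1.symm] at this
    simp at this
  have huniq : ∀ c c' x y, π c (Sum.inl x) = Sum.inl y → π c' (Sum.inl x) = Sum.inl y → c = c' := by
    intro c c' x y h h'
    have h1 := hπ (Sum.inl x) (Sum.inl y)
    have hh := hH c x y h
    simp only [A, if_pos hh] at h1
    exact Finset.card_le_one.1 h1.ge c (by simp [h]) c' (by simp [h'])
  have hcard : ∑ c, #(mt c) = #((univ : Finset (Fin p × Fin p)).filter fun e => H e.1 e.2) := by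
    have h1 : ∀ c, #(mt c) = ∑ x, ∑ y, if π c (Sum.inl x) = Sum.inl y then 1 else 0 := by
      intro c
      simp only [mt]
      rw [Finset.card_filter]
      refine Finset.sum_congr rfl fun x _ => ?_
      split_ifs with h
      · obtain ⟨y, hy⟩ := h
        rw [hy]
        simp
      · symm
        apply Finset.sum_eq_zero
        intro y _
        rw [if_neg fun hh => h ⟨y, hh⟩]
    simp only [h1]
    rw [Finset.sum_comm]
    rw [Finset.card_filter, Fintype.sum_prod_type]
    refine Finset.sum_congr rfl fun x _ => ?_
    rw [Finset.sum_comm]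
    refine Finset.sum_congr rfl fun y _ => ?_
    have := hπ (Sum.inl x) (Sum.inl y)
    rw [← Finset.card_filter, ← this]
  have hperm : ∀ c, ∃ τ : Equiv.Perm (Fin p), ∀ x ∈ mt c, π c (Sum.inl x) = Sum.inl (τ x) := by
    intro c
    let f : Fin p → Fin p := fun x => Sum.elim id id (π c (Sum.inl x))
    have hf : ∀ x ∈ mt c, π c (Sum.inl x) = Sum.inl (f x) := by
      intro x hx
      obtain ⟨y, hy⟩ := (Finset.mem_filter.1 hx).2
      simp [f, hy]
    have hinj : Set.InjOn f (mt c) := by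
      intro x hx y hy h
      have h1 := hf x hx
      rw [h, ← hf y hy] at h1
      exact Sum.inl_injective ((π c).injective h1)
    obtain ⟨g, hg⟩ := Finset.exists_equiv_extend_of_card_eq (t := (univ : Finset (Fin p))) (by simp) (s := mt c) (f := f)
      (Finset.subset_univ _) hinj
    refine ⟨g.trans (Equiv.subtypeUnivEquiv (fun x => Finset.mem_univ x)), fun x hx => ?_⟩
    rw [hf x hx]
    congr 1
    exact (hg x hx).symm
  choose τ hτ using hperm
  let good : Finset (Fin D) := univ.filter fun c => (1 - δ) * p ≤ (#(mt c) : ℝ)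
  let en := good.equivFin.symm
  refine ⟨#good, fun c => τ (en c), fun c x => x ∈ mt (en c), ?_, ?_, ?_, ?_⟩
  · intro c x hx
    exact hH _ _ _ (hτ _ x hx)
  · intro c
    have h1 := (Finset.mem_filter.1 (en c).2).2
    have h2 : #(univ.filter fun x => ¬ x ∈ mt (en c)) + #(mt (en c)) = p := by
      have := Finset.card_filter_add_card_filter_not (s := (univ : Finset (Fin p))) (fun x => x ∈ mt (en c))
      rw [Finset.card_univ, Fintype.card_fin] at this
      have h3 : (univ.filter fun x => x ∈ mt (en c)) = mt (en c) := by ext; simp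
      rw [h3] at this
      omega
    have h3 : (#(univ.filter fun x => ¬ x ∈ mt (en c)) : ℝ) + #(mt (en c)) = p := by exact_mod_cast h2
    have h4 : (#(univ.filter fun x => ¬ x ∈ mt (en c)) : ℝ) ≤ δ * p := by linarith
    convert h4
  · intro c c' x h h' he
    have h1 := hτ _ x h
    have h2 := hτ _ x h'
    dsimp only at he
    rw [← he] at h2
    exact en.injective (Subtype.ext (huniq _ _ _ _ h1 h2))
  · rw [← hcard]
    push_cast
    have hsplit := Finset.sum_filter_add_sum_filter_not (univ : Finset (Fin D))
      (fun c => (1 - δ) * p ≤ (#(mt c) : ℝ)) (fun c => (#(mt c) : ℝ))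
    have hA : ∑ c ∈ good, (#(mt c) : ℝ) ≤ #good * p := by
      rw [← nsmul_eq_mul]
      refine Finset.sum_le_card_nsmul _ _ _ fun c _ => ?_
      have : #(mt c) ≤ p := by
        have := Finset.card_le_univ (mt c); simpa using this
      exact_mod_cast this
    have hB : ∑ c ∈ univ.filter (fun c => ¬ (1 - δ) * p ≤ (#(mt c) : ℝ)), (#(mt c) : ℝ) ≤
        #(univ.filter (fun c => ¬ (1 - δ) * p ≤ (#(mt c) : ℝ))) * ((1 - δ) * p) := by
      rw [← nsmul_eq_mul]
      refine Finset.sum_le_card_nsmul _ _ _ fun c hc => ?_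
      have := (Finset.mem_filter.1 hc).2
      linarith
    have hC : (#good : ℝ) + #(univ.filter (fun c => ¬ (1 - δ) * p ≤ (#(mt c) : ℝ))) = D := by
      have := Finset.card_filter_add_card_filter_not (s := (univ : Finset (Fin D))) (fun c => (1 - δ) * p ≤ (#(mt c) : ℝ))
      rw [Finset.card_univ, Fintype.card_fin] at this
      exact_mod_cast this
    have hD : (#(univ.filter (fun c => ¬ (1 - δ) * p ≤ (#(mt c) : ℝ))) : ℝ) = D - #good := by linarith
    rw [hD] at hB
    have : ∑ c ∈ good, (#(mt c) : ℝ) = ∑ c ∈ univ.filter (fun c => (1 - δ) * p ≤ (#(mt c) : ℝ)), (#(mt c) : ℝ) := rfl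
    nlinarith

end ModE
end ApproxDecomp

open SimpleGraph
namespace ApproxDecomp
section ModE
open scoped Classical
open Finset

/-- partial injection from a permutation of the doubled set -/
def ps {A : Type*} (π : Equiv.Perm (A ⊕ A)) (a : A) : Option A :=
  Sum.elim some (fun _ => none) (π (Sum.inl a))

lemma ps_eq_some {A : Type*} (π : Equiv.Perm (A ⊕ A)) (a b : A) :
    ps π a = some b ↔ π (Sum.inl a) = Sum.inl b := by
  unfold ps
  cases h : π (Sum.inl a) <;> simp

lemma ps_inj {A : Type*} (π : Equiv.Perm (A ⊕ A)) {a a' b : A}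
    (h : ps π a = some b) (h' : ps π a' = some b) : a = a' := by
  rw [ps_eq_some] at h h'
  exact Sum.inl_injective (π.injective (h.trans h'.symm))

lemma partial_perms {A : Type*} [Fintype A] [DecidableEq A] (D : A → A → ℝ) (hD : ∀ a b, 0 ≤ D a b)
    (hr : ∀ a, ∑ b, D a b ≤ 1) (hc : ∀ b, ∑ a, D a b ≤ 1) (η : ℝ) (hη : 0 < η) (hη1 : η < 1)
    (htot : (1 - η ^ 2) * Fintype.card A ≤ ∑ a, ∑ b, D a b) :
    ∃ w : Equiv.Perm (A ⊕ A) → ℝ, (∀ π, 0 ≤ w π) ∧ ∑ π, w π = 1 ∧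
      (∀ π, 0 < w π → (1 - η) * Fintype.card A ≤ (#(univ.filter fun a => ∃ b, ps π a = some b) : ℝ)) ∧
      (∀ π, 0 < w π → ∀ a b, ps π a = some b → 0 < D a b) ∧
      (∀ a b, ∑ π, w π * (if ps π a = some b then 1 else 0) ≤ D a b / (1 - η)) := by
  let M : Matrix (A ⊕ A) (A ⊕ A) ℝ := fun u v =>
    match u, v with
    | Sum.inl x, Sum.inl y => D x y
    | Sum.inl x, Sum.inr y => if x = y then 1 - ∑ b, D x b else 0
    | Sum.inr x, Sum.inl y => if x = y then 1 - ∑ a, D a x else 0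
    | Sum.inr x, Sum.inr y => D y x
  have hM : M ∈ doublyStochastic ℝ (A ⊕ A) := by
    rw [mem_doublyStochastic_iff_sum]
    refine ⟨?_, ?_, ?_⟩
    · rintro (x | x) (y | y)
      · exact hD _ _
      · simp only [M]; split_ifs
        · have := hr x; linarith
        · exact le_rfl
      · simp only [M]; split_ifs
        · have := hc x; linarith
        · exact le_rfl
      · exact hD _ _
    · rintro (x | x) <;> rw [Fintype.sum_sum_type] <;> simp [M]
    · rintro (x | x) <;> rw [Fintype.sum_sum_type] <;> simp [M]
  obtain ⟨w, hw0, hw1, hw2⟩ := exists_eq_sum_perm_of_mem_doublyStochastic hM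
  have hDab : ∀ a b, ∑ π, w π * (if ps π a = some b then 1 else 0) = D a b := by
    intro a b
    have h1 : M (Sum.inl a) (Sum.inl b) = D a b := rfl
    rw [← h1, ← hw2, Matrix.sum_apply]
    refine Finset.sum_congr rfl fun τ _ => ?_
    rw [Matrix.smul_apply, permMatrix_val, smul_eq_mul]
    simp only [ps_eq_some]
  set L : ℝ := ((Fintype.card A : ℕ) : ℝ) with hL
  let dm : Equiv.Perm (A ⊕ A) → ℝ := fun π => (#(univ.filter fun a => ∃ b, ps π a = some b) : ℝ)
  have hdm : ∀ π, dm π = ∑ a, ∑ b, (if ps π a = some b then (1:ℝ) else 0) := by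
    intro π
    simp only [dm]
    rw [Finset.card_filter]
    push_cast
    refine Finset.sum_congr rfl fun a _ => ?_
    split_ifs with h
    · obtain ⟨b, hb⟩ := h
      rw [hb]; simp
    · symm
      apply Finset.sum_eq_zero
      intro b _
      rw [if_neg fun hh => h ⟨b, hh⟩]
  have hE : ∑ π, w π * dm π = ∑ a, ∑ b, D a b := by
    simp only [hdm, ← hDab, Finset.mul_sum]
    rw [Finset.sum_comm]
    refine Finset.sum_congr rfl fun a _ => ?_
    rw [Finset.sum_comm]
  have hdmL : ∀ π, dm π ≤ L := by
    intro π
    simp only [dm, hL]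
    exact_mod_cast Finset.card_le_univ _
  have hdm0 : ∀ π, 0 ≤ dm π := fun π => Nat.cast_nonneg _
  by_cases hA : Fintype.card A = 0
  · have : IsEmpty A := Fintype.card_eq_zero_iff.1 hA
    refine ⟨w, hw0, hw1, ?_, fun _ _ a => isEmptyElim a, fun a => isEmptyElim a⟩
    intro π _
    rw [hL, hA]; simp
  have hLpos : 0 < L := by rw [hL]; exact_mod_cast Nat.pos_of_ne_zero hA
  set W := ∑ π ∈ univ.filter (fun π => (1 - η) * L ≤ dm π), w π with hW
  have hW1 : 1 - η ≤ W := by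
    have hsplit := Finset.sum_filter_add_sum_filter_not univ (fun π => (1 - η) * L ≤ dm π) w
    rw [hw1] at hsplit
    set W' := ∑ π ∈ univ.filter (fun π => ¬ (1 - η) * L ≤ dm π), w π with hW'
    have hbad : W' * (η * L) ≤ ∑ π, w π * (L - dm π) := by
      rw [hW', Finset.sum_mul]
      calc _ ≤ ∑ π ∈ univ.filter (fun π => ¬ (1 - η) * L ≤ dm π), w π * (L - dm π) := by
            refine Finset.sum_le_sum fun π hπ => mul_le_mul_of_nonneg_left ?_ (hw0 π)
            have := (Finset.mem_filter.1 hπ).2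
            linarith
        _ ≤ _ := Finset.sum_le_sum_of_subset_of_nonneg (Finset.filter_subset _ _)
            fun π _ _ => mul_nonneg (hw0 π) (by linarith [hdmL π])
    have h3 : ∑ π, w π * (L - dm π) = L - ∑ a, ∑ b, D a b := by
      rw [← hE]
      simp only [mul_sub, Finset.sum_sub_distrib]
      rw [← Finset.sum_mul, hw1, one_mul]
    rw [h3] at hbad
    have h4 : W' * (η * L) ≤ η * (η * L) := by nlinarith
    have h5 : W' ≤ η := le_of_mul_le_mul_right h4 (by positivity)
    linarith
  have hWpos : 0 < W := by linarith
  refine ⟨fun π => if (1 - η) * L ≤ dm π then w π / W else 0, ?_, ?_, ?_, ?_, ?_⟩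
  · intro π
    have := hw0 π
    dsimp only
    split_ifs <;> positivity
  · rw [← Finset.sum_filter, ← Finset.sum_div, ← hW, div_self hWpos.ne']
  · intro π hπ
    by_contra h
    have : ¬ (1 - η) * L ≤ dm π := h
    beta_reduce at hπ
    rw [if_neg this] at hπ
    exact lt_irrefl _ hπ
  · intro π hπ a b hab
    beta_reduce at hπ
    have h1 : 0 < w π := by
      rcases (hw0 π).eq_or_lt with h | h
      · rw [← h] at hπ; simp at hπ
      · exact h
    rw [← hDab]
    refine lt_of_lt_of_le ?_ (Finset.single_le_sum (f := fun τ => w τ * (if ps τ a = some b then 1 else 0)) ?_ (Finset.mem_univ π))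
    · rw [if_pos hab]; linarith
    · intro τ _
      have := hw0 τ
      split_ifs <;> simp [this]
  · intro a b
    rw [← hDab, Finset.sum_div]
    refine Finset.sum_le_sum fun π _ => ?_
    have := hw0 π
    beta_reduce
    by_cases hab : ps π a = some b
    · rw [if_pos hab, mul_one, mul_one]
      have : w π / W ≤ w π / (1 - η) := div_le_div_of_nonneg_left this (by linarith) hW1
      have h0 : 0 ≤ w π / (1 - η) := div_nonneg (hw0 π) (by linarith)
      split_ifs <;> linarith
    · rw [if_neg hab]; simp

end ModE
end ApproxDecomp

open SimpleGraph
namespace ApproxDecomp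
section ModC
open scoped Classical
open Finset

variable {N : ℕ} {par : Fin N → Fin N}

/-- recursion along parents -/
lemma forest_rec (hpar : ∀ v, par v ≤ v) {β : Type*} (r : Fin N → β) (s : Fin N → β → β) :
    ∃ f : Fin N → β, ∀ v, f v = if par v = v then r v else s v (f (par v)) := by
  let F : ∀ v : Fin N, (∀ u : Fin N, u < v → β) → β := fun v ih =>
    if h : par v = v then r v else s v (ih (par v) (lt_of_le_of_ne (hpar v) h))
  refine ⟨(wellFounded_lt (α := Fin N)).fix F, fun v => ?_⟩
  rw [WellFounded.fix_eq]
  simp only [F]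
  split_ifs <;> rfl

/-- `Reach S u v`: walking up from `u` we reach `v` without leaving vertices of `S` upward. -/
inductive Reach (par : Fin N → Fin N) (S : Finset (Fin N)) : Fin N → Fin N → Prop
  | refl (v) : Reach par S v v
  | step (u v) : u ∉ S → par u ≠ u → Reach par S (par u) v → Reach par S u v

lemma Reach.le (hpar : ∀ v, par v ≤ v) {S : Finset (Fin N)} {u v : Fin N} (h : Reach par S u v) : v ≤ u := by
  induction h with
  | refl v => exact le_rfl
  | step u v _ _ _ ih => exact ih.trans (hpar u)

lemma Reach.congr (hpar : ∀ v, par v ≤ v) {S S' : Finset (Fin N)} {u v : Fin N}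
    (hS : ∀ w, v < w → w ∈ S' → w ∈ S) (h : Reach par S u v) : Reach par S' u v := by
  induction h with
  | refl v => exact Reach.refl v
  | step u v h1 h2 h3 ih =>
    refine Reach.step u v (fun h => h1 (hS u ?_ h)) h2 (ih hS)
    exact lt_of_le_of_lt (h3.le hpar) (lt_of_le_of_ne (hpar u) h2)

lemma Reach.last {S : Finset (Fin N)} {u v : Fin N} (h : Reach par S u v) :
    u = v ∨ ∃ c, par c = v ∧ c ≠ v ∧ c ∉ S ∧ Reach par S u c := by
  induction h with
  | refl v => exact Or.inl rfl
  | step u v h1 h2 h3 ih =>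
    right
    rcases ih with h | ⟨c, hc1, hc2, hc3, hc4⟩
    · exact ⟨u, h, fun h' => h2 (h.trans h'.symm), h1, Reach.refl u⟩
    · exact ⟨c, hc1, hc2, hc3, Reach.step u c h1 h2 hc4⟩

/-- number of vertices reaching `v` -/
noncomputable def reachCard (par : Fin N → Fin N) (S : Finset (Fin N)) (v : Fin N) : ℕ :=
  #(univ.filter fun u => Reach par S u v)

lemma reachCard_congr (hpar : ∀ v, par v ≤ v) {S S' : Finset (Fin N)} {v : Fin N}
    (hS : ∀ w, v < w → (w ∈ S ↔ w ∈ S')) : reachCard par S v = reachCard par S' v := by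
  unfold reachCard
  congr 1
  ext u
  simp only [Finset.mem_filter, Finset.mem_univ, true_and]
  exact ⟨Reach.congr hpar fun w hw h => (hS w hw).2 h, Reach.congr hpar fun w hw h => (hS w hw).1 h⟩

lemma reachCard_le (S : Finset (Fin N)) (Δ B : ℕ) (hΔ : ∀ v, #(univ.filter fun u => par u = v ∧ u ≠ v) ≤ Δ)
    (v : Fin N) (hB : ∀ c, par c = v → c ≠ v → c ∉ S → reachCard par S c ≤ B) :
    reachCard par S v ≤ 1 + Δ * B := by
  have hsub : (univ.filter fun u => Reach par S u v) ⊆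
      {v} ∪ (univ.filter fun c => (par c = v ∧ c ≠ v) ∧ c ∉ S).biUnion (fun c => univ.filter fun u => Reach par S u c) := by
    intro u hu
    simp only [Finset.mem_filter, Finset.mem_univ, true_and] at hu
    simp only [Finset.mem_union, Finset.mem_singleton, Finset.mem_biUnion, Finset.mem_filter, Finset.mem_univ, true_and]
    rcases hu.last with h | ⟨c, h1, h2, h3, h4⟩
    · exact Or.inl h
    · exact Or.inr ⟨c, ⟨⟨h1, h2⟩, h3⟩, h4⟩
  unfold reachCard
  refine (Finset.card_le_card hsub).trans ((Finset.card_union_le _ _).trans ?_)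
  rw [Finset.card_singleton]
  refine Nat.add_le_add_left ?_ 1
  refine (Finset.card_biUnion_le_card_mul _ _ B fun c hc => ?_).trans ?_
  · simp only [Finset.mem_filter, Finset.mem_univ, true_and] at hc
    exact hB c hc.1.1 hc.1.2 hc.2
  · refine Nat.mul_le_mul_right B (le_trans (Finset.card_le_card ?_) (hΔ v))
    intro c hc
    simp only [Finset.mem_filter, Finset.mem_univ, true_and] at hc ⊢
    exact hc.1

lemma cut_greedy (hpar : ∀ v, par v ≤ v) (P : Fin N → Prop) (s : ℕ) :
    ∃ S : Finset (Fin N), ∀ v, v ∈ S ↔ P v ∧ s ≤ reachCard par S v := by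
  have key : ∀ k : ℕ, ∃ S : Finset (Fin N), ∀ v : Fin N, N ≤ v.val + k → (v ∈ S ↔ P v ∧ s ≤ reachCard par S v) := by
    intro k
    induction k with
    | zero =>
      refine ⟨∅, fun v hv => ?_⟩
      have := v.2; omega
    | succ k ih =>
      obtain ⟨S, hS⟩ := ih
      by_cases hk : k + 1 ≤ N
      · let v0 : Fin N := ⟨N - (k+1), by omega⟩
        let S' : Finset (Fin N) := if P v0 ∧ s ≤ reachCard par S v0 then insert v0 S else S.erase v0
        have hmem : ∀ w, w ≠ v0 → (w ∈ S' ↔ w ∈ S) := by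
          intro w hw
          simp only [S']
          split_ifs
          · simp [hw]
          · simp [hw]
        have hrc : ∀ v, v0 ≤ v → reachCard par S' v = reachCard par S v := by
          intro v hv
          exact reachCard_congr hpar fun w hw => hmem w (lt_of_le_of_lt hv hw).ne'
        refine ⟨S', fun v hv => ?_⟩
        have hle : v0 ≤ v := by
          rw [Fin.le_def]; simp only [v0]; omega
        rw [hrc v hle]
        by_cases h : v = v0
        · subst h
          simp only [S']
          split_ifs with hc
          · simp [hc]
          · simp [hc]
        · rw [hmem v h]
          apply hS v
          have : v.val ≠ N - (k+1) := fun h' => h (Fin.ext h')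
          omega
      · exact ⟨S, fun v hv => hS v (by have := v.2; omega)⟩
  obtain ⟨S, hS⟩ := key N
  exact ⟨S, fun v => hS v (by omega)⟩

/-- topmost vertex before crossing `S` -/
lemma exists_top (hpar : ∀ v, par v ≤ v) (S : Finset (Fin N)) :
    ∃ top : Fin N → Fin N, (∀ v, par v = v → top v = v) ∧ (∀ v, v ∈ S → top v = v) ∧
      (∀ v, v ∉ S → par v ≠ v → top v = top (par v)) ∧ (∀ v, Reach par S v (top v)) ∧ (∀ v, top v ≤ v) ∧
      (∀ v, par (top v) = top v ∨ top v ∈ S) := by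
  obtain ⟨f, hf⟩ := forest_rec hpar (fun v => v) (fun v b => if v ∈ S then v else b)
  have h1 : ∀ v, par v = v → f v = v := fun v h => by rw [hf v, if_pos h]
  have h2 : ∀ v, v ∈ S → f v = v := fun v h => by
    rw [hf v]; split_ifs <;> rfl
  have h3 : ∀ v, v ∉ S → par v ≠ v → f v = f (par v) := fun v h h' => by
    rw [hf v, if_neg h', if_neg h]
  have h4 : ∀ v, Reach par S v (f v) := by
    intro v
    induction v using (wellFounded_lt (α := Fin N)).induction with
    | h v ih =>
      by_cases ha : par v = v
      · rw [h1 v ha]; exact Reach.refl v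
      by_cases hb : v ∈ S
      · rw [h2 v hb]; exact Reach.refl v
      · rw [h3 v hb ha]
        exact Reach.step v _ hb ha (ih _ (lt_of_le_of_ne (hpar v) ha))
  refine ⟨f, h1, h2, h3, h4, fun v => (h4 v).le hpar, ?_⟩
  intro v
  induction v using (wellFounded_lt (α := Fin N)).induction with
  | h v ih =>
    by_cases ha : par v = v
    · rw [h1 v ha]; exact Or.inl ha
    by_cases hb : v ∈ S
    · rw [h2 v hb]; exact Or.inr hb
    · rw [h3 v hb ha]
      exact ih _ (lt_of_le_of_ne (hpar v) ha)

lemma cut_parity (hpar : ∀ v, par v ≤ v) (Δ : ℕ) (hΔ : ∀ v, #(univ.filter fun u => par u = v ∧ u ≠ v) ≤ Δ)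
    (odd : Fin N → Bool) (hodd : ∀ v, par v ≠ v → odd v = !odd (par v)) (q : Bool) (s : ℕ) (hs : 1 ≤ s) :
    ∃ S : Finset (Fin N), (∀ v ∈ S, par v ≠ v ∧ odd v = q) ∧ #S * s ≤ N ∧
      ∀ v, reachCard par S v ≤ (Δ + 1) ^ 2 * s := by
  obtain ⟨S, hS⟩ := cut_greedy hpar (fun v => par v ≠ v ∧ odd v = q) s
  refine ⟨S, fun v hv => ((hS v).1 hv).1, ?_, ?_⟩
  · obtain ⟨top, _, ht2, ht3, ht4, _, ht6⟩ := exists_top hpar S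
    have hdisj : ∀ u v, v ∈ S → Reach par S u v → top u = v := by
      intro u v hv h
      induction h with
      | refl v => exact ht2 v hv
      | step u v h1 h2 h3 ih => rw [ht3 u h1 h2]; exact ih hv
    have h1 : ∑ v ∈ S, reachCard par S v ≤ N := by
      unfold reachCard
      rw [← Finset.card_biUnion]
      · exact (Finset.card_le_univ _).trans (by simp)
      · intro v hv w hw hvw
        refine Finset.disjoint_left.2 ?_
        intro u hu hu'
        simp only [Finset.mem_filter, Finset.mem_univ, true_and] at hu hu'
        exact hvw ((hdisj u v hv hu).symm.trans (hdisj u w hw hu'))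
    refine le_trans ?_ h1
    rw [← smul_eq_mul]
    exact Finset.card_nsmul_le_sum _ _ _ fun v hv => ((hS v).1 hv).2
  · have h1 : ∀ c, par c ≠ c → odd c = q → c ∉ S → reachCard par S c ≤ s := by
      intro c h1 h2 h3
      rw [hS c] at h3
      by_contra h
      exact h3 ⟨⟨h1, h2⟩, by omega⟩
    have h2 : ∀ v, odd v ≠ q → reachCard par S v ≤ 1 + Δ * s := by
      intro v hv
      refine reachCard_le S Δ s hΔ v fun c hc hcv hcS => h1 c (fun h => hcv (h.symm.trans hc)) ?_ hcS
      have := hodd c (fun h => hcv (h.symm.trans hc))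
      rw [hc] at this
      rw [this]
      revert hv; cases odd v <;> cases q <;> simp
    intro v
    have h3 : reachCard par S v ≤ 1 + Δ * (1 + Δ * s) := by
      by_cases hv : odd v = q
      · refine reachCard_le S Δ _ hΔ v fun c hc hcv _ => h2 c ?_
        have := hodd c (fun h => hcv (h.symm.trans hc))
        rw [hc, hv] at this
        rw [this]; cases q <;> simp
      · refine (h2 v hv).trans ?_
        nlinarith [Nat.mul_le_mul_right s (Nat.le_mul_self Δ)]
    refine h3.trans ?_
    nlinarith [Nat.mul_le_mul_left Δ hs]

/-- Decomposition of a parent forest into cut vertices `X`, link vertices `R` and components. -/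
structure Cut (N : ℕ) (par : Fin N → Fin N) where
  odd : Fin N → Bool
  X : Finset (Fin N)
  R : Finset (Fin N)
  top : Fin N → Fin N
  topR : Fin N → Fin N
  odd_root : ∀ v, par v = v → odd v = false
  odd_par : ∀ v, par v ≠ v → odd v = !odd (par v)
  X_odd : ∀ v ∈ X, odd v = true
  R_even : ∀ v ∈ R, odd v = false
  R_nonroot : ∀ v ∈ R, par v ≠ v
  R_par : ∀ v ∈ R, par v ∈ X
  R_child : ∀ c, par c ∈ R → c ∈ X
  top_le : ∀ v, top v ≤ v
  top_comp : ∀ v, v ∉ X → v ∉ R → top v ∉ X ∧ top v ∉ R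
  top_top : ∀ v, top (top v) = top v
  top_par : ∀ v, v ∉ X → v ∉ R → top v ≠ v → par v ∉ X ∧ par v ∉ R ∧ top (par v) = top v ∧ par v ≠ v
  top_root : ∀ v, v ∉ X → v ∉ R → top v = v → par v = v ∨ par v ∈ X
  top_XR : ∀ v, v ∈ X ∨ v ∈ R → top v = v
  topR_par : ∀ v, v ∉ R → topR v = topR (par v)

theorem cut_exists (hpar : ∀ v, par v ≤ v) (Δ : ℕ) (hΔ : ∀ v, #(univ.filter fun u => par u = v ∧ u ≠ v) ≤ Δ)
    (k0 sR : ℕ) (hk0 : 1 ≤ k0) (hsR : 1 ≤ sR) :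
    ∃ C : Cut N par, #C.R * sR ≤ N ∧ #C.X * k0 ≤ N + k0 * ((Δ + 1) * #C.R) ∧
      (∀ c, #(univ.filter fun u => C.top u = c) ≤ (Δ + 1) ^ 2 * k0) ∧
      (∀ c, #(univ.filter fun u => C.topR u = c) ≤ (Δ + 1) ^ 2 * sR) := by
  obtain ⟨odd, hodd⟩ := forest_rec hpar (fun _ => false) (fun _ b => !b)
  have ho1 : ∀ v, par v = v → odd v = false := fun v h => by rw [hodd v, if_pos h]
  have ho2 : ∀ v, par v ≠ v → odd v = !odd (par v) := fun v h => by rw [hodd v, if_neg h]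
  obtain ⟨R, hR1, hR2, hR3⟩ := cut_parity hpar Δ hΔ odd ho2 false sR hsR
  obtain ⟨X0, hX1, hX2, hX3⟩ := cut_parity hpar Δ hΔ odd ho2 true k0 hk0
  let X : Finset (Fin N) := X0 ∪ (R.image par ∪ R.biUnion fun r => univ.filter fun u => par u = r ∧ u ≠ r)
  have hXmem : ∀ v, v ∈ X ↔ v ∈ X0 ∨ (∃ r ∈ R, par r = v) ∨ (par v ∈ R ∧ v ≠ par v) := by
    intro v
    simp only [X, Finset.mem_union, Finset.mem_image, Finset.mem_biUnion, Finset.mem_filter, Finset.mem_univ, true_and]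
    constructor
    · rintro (h | ⟨r, h1, h2⟩ | ⟨r, h1, h2, h3⟩)
      · exact Or.inl h
      · exact Or.inr (Or.inl ⟨r, h1, h2⟩)
      · exact Or.inr (Or.inr ⟨h2 ▸ h1, h2 ▸ h3⟩)
    · rintro (h | ⟨r, h1, h2⟩ | ⟨h1, h2⟩)
      · exact Or.inl h
      · exact Or.inr (Or.inl ⟨r, h1, h2⟩)
      · exact Or.inr (Or.inr ⟨par v, h1, rfl, h2⟩)
  have hXodd : ∀ v ∈ X, odd v = true := by
    intro v hv
    rcases (hXmem v).1 hv with h | ⟨r, h1, h2⟩ | ⟨h1, h2⟩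
    · exact (hX1 v h).2
    · have := ho2 r (hR1 r h1).1
      rw [(hR1 r h1).2, h2] at this
      simpa using this.symm
    · rw [ho2 v (Ne.symm h2), (hR1 _ h1).2]; rfl
  have hRX : ∀ v ∈ R, v ∉ X := by
    intro v hv hx
    have := hXodd v hx
    rw [(hR1 v hv).2] at this
    exact absurd this (by simp)
  have hXroot : ∀ v ∈ X, par v ≠ v := by
    intro v hv h
    have := hXodd v hv
    rw [ho1 v h] at this
    exact absurd this (by simp)
  obtain ⟨topR, tR1, tR2, tR3, tR4, _, _⟩ := exists_top hpar R
  let S : Finset (Fin N) := univ.filter fun v => v ∈ X ∨ v ∈ R ∨ par v ∈ X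
  have hSmem : ∀ v, v ∈ S ↔ (v ∈ X ∨ v ∈ R ∨ par v ∈ X) := by intro v; simp [S]
  obtain ⟨top, t1, t2, t3, t4, t5, t6⟩ := exists_top hpar S
  have nonstop : ∀ v, v ∉ X → v ∉ R → top v ≠ v → par v ∉ X ∧ par v ∉ R ∧ top (par v) = top v ∧ par v ≠ v := by
    intro v h1 h2 h3
    have ha : par v ≠ v := fun h => h3 (t1 v h)
    have hb : v ∉ S := fun h => h3 (t2 v h)
    rw [hSmem] at hb
    push Not at hb
    refine ⟨hb.2.2, fun h => h1 ((hXmem v).2 (Or.inr (Or.inr ⟨h, ha.symm⟩))), (t3 v ?_ ha).symm, ha⟩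
    rw [hSmem]; push Not; exact hb
  refine ⟨{ odd := odd, X := X, R := R, top := top, topR := topR, odd_root := ho1, odd_par := ho2,
            X_odd := hXodd, R_even := fun v hv => (hR1 v hv).2, R_nonroot := fun v hv => (hR1 v hv).1,
            R_par := fun v hv => (hXmem _).2 (Or.inr (Or.inl ⟨v, hv, rfl⟩)),
            R_child := ?_, top_le := t5, top_comp := ?_, top_top := ?_, top_par := nonstop, top_root := ?_,
            top_XR := ?_, topR_par := ?_ }, hR2, ?_, ?_, ?_⟩
  · intro c hc
    by_cases h : par c = c
    · rw [h] at hc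
      exact absurd h (hR1 c hc).1
    · exact (hXmem c).2 (Or.inr (Or.inr ⟨hc, Ne.symm h⟩))
  · intro v
    induction v using (wellFounded_lt (α := Fin N)).induction with
    | h v ih =>
      intro h1 h2
      by_cases h3 : top v = v
      · rw [h3]; exact ⟨h1, h2⟩
      · obtain ⟨ha, hb, hc, hd⟩ := nonstop v h1 h2 h3
        rw [← hc]
        exact ih _ (lt_of_le_of_ne (hpar v) hd) ha hb
  · intro v
    rcases t6 v with h | h
    · exact t1 _ h
    · exact t2 _ h
  · intro v h1 h2 h3
    rcases t6 v with h | h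
    · rw [h3] at h; exact Or.inl h
    · rw [h3, hSmem] at h
      rcases h with h | h | h
      · exact absurd h h1
      · exact absurd h h2
      · exact Or.inr h
  · intro v hv
    refine t2 v ((hSmem v).2 ?_)
    tauto
  · intro v hv
    by_cases h : par v = v
    · rw [h]
    · exact tR3 v hv h
  · have c1 : #X ≤ #X0 + (#R + #R * Δ) := by
      refine (Finset.card_union_le _ _).trans (Nat.add_le_add_left ((Finset.card_union_le _ _).trans ?_) _)
      refine Nat.add_le_add Finset.card_image_le ?_
      exact Finset.card_biUnion_le_card_mul _ _ _ fun r _ => hΔ r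
    have : #X * k0 ≤ (#X0 + (#R + #R * Δ)) * k0 := Nat.mul_le_mul_right _ c1
    simp only
    nlinarith
  · intro c
    refine le_trans (Finset.card_le_card ?_) (hX3 c)
    intro u hu
    simp only [Finset.mem_filter, Finset.mem_univ, true_and] at hu ⊢
    refine Reach.congr hpar ?_ (hu ▸ t4 u)
    intro w _ hw
    exact (hSmem w).2 (Or.inl ((hXmem w).2 (Or.inl hw)))
  · intro c
    refine le_trans (Finset.card_le_card ?_) (hR3 c)
    intro u hu
    simp only [Finset.mem_filter, Finset.mem_univ, true_and] at hu ⊢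
    exact hu ▸ tR4 u

end ModC
end ApproxDecomp

open SimpleGraph
namespace ApproxDecomp
section ModH
open scoped Classical
open Finset

lemma distinct_reps {ι Cp : Type*} [Nonempty Cp] (C : Finset ι) (A : ι → Finset Cp)
    (h : ∀ c ∈ C, #C ≤ #(A c)) : ∃ f : ι → Cp, (∀ c ∈ C, f c ∈ A c) ∧ Set.InjOn f C := by
  induction C using Finset.induction_on with
  | empty => exact ⟨fun _ => Classical.arbitrary Cp, by simp, by simp⟩
  | insert a s ha ih =>
    obtain ⟨f, hf1, hf2⟩ := ih fun c hc => by
      have := h c (Finset.mem_insert_of_mem hc)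
      rw [Finset.card_insert_of_notMem ha] at this
      omega
    have h1 := h a (Finset.mem_insert_self a s)
    rw [Finset.card_insert_of_notMem ha] at h1
    have h2 : #(s.image f) < #(A a) := lt_of_le_of_lt Finset.card_image_le (by omega)
    obtain ⟨q, hq, hq'⟩ := Finset.exists_mem_notMem_of_card_lt_card h2
    refine ⟨Function.update f a q, ?_, ?_⟩
    · intro c hc
      by_cases hca : c = a
      · subst hca; simpa using hq
      · rw [Function.update_of_ne hca]
        exact hf1 c ((Finset.mem_insert.1 hc).resolve_left hca)
    · intro c hc d hd hcd
      rw [Finset.mem_coe, Finset.mem_insert] at hc hd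
      have hne : ∀ e ∈ s, e ≠ a := fun e he hh => ha (hh ▸ he)
      rcases hc with rfl | hc <;> rcases hd with rfl | hd
      · rfl
      · rw [Function.update_self, Function.update_of_ne (hne d hd)] at hcd
        exact absurd (Finset.mem_image.2 ⟨d, hd, hcd.symm⟩) hq'
      · rw [Function.update_self, Function.update_of_ne (hne c hc)] at hcd
        exact absurd (Finset.mem_image.2 ⟨c, hc, hcd⟩) hq'
      · rw [Function.update_of_ne (hne c hc), Function.update_of_ne (hne d hd)] at hcd
        exact hf2 hc hd hcd

variable {N : ℕ} {par : Fin N → Fin N}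

/-- component tops -/
def Cut.ptop (C : Cut N par) (c : Fin N) : Prop := c ∉ C.X ∧ c ∉ C.R ∧ C.top c = c

/-- invariant of the greedy embedding -/
structure GInv (C : Cut N par) {V A Kt Cp : Type*} (Gu gl : V → V → Prop) (Y : A → Finset V)
    (pc : Fin N → A) (σ : A → A) (κ : Fin N → Kt) (Copies : Kt → Finset Cp) (vpos : Fin N → Cp → V)
    (q1 : ℕ) (i : ℕ) (y : Fin N → V) (z : Fin N → Cp) : Prop where
  yX : ∀ x ∈ C.X, x.val < i → y x ∈ Y (pc x)
  yR : ∀ r ∈ C.R, (par r).val < i → y r ∈ Y (σ (pc r)) ∧ q1 ≤ #((Y (pc r)).filter fun v => Gu v (y r))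
  injXX : ∀ x ∈ C.X, ∀ x' ∈ C.X, x.val < i → x'.val < i → y x = y x' → x = x'
  injRR : ∀ x ∈ C.R, ∀ x' ∈ C.R, (par x).val < i → (par x').val < i → y x = y x' → x = x'
  injXR : ∀ x ∈ C.X, ∀ x' ∈ C.R, x.val < i → (par x').val < i → y x ≠ y x'
  zC : ∀ c, C.ptop c → (par c).val < i → z c ∈ Copies (κ c)
  injC : ∀ c, C.ptop c → ∀ c', C.ptop c' → (par c).val < i → (par c').val < i → κ c = κ c' → z c = z c' → c = c'
  aXR : ∀ x ∈ C.X, x.val < i → par x ∈ C.R → Gu (y x) (y (par x))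
  aXC : ∀ x ∈ C.X, x.val < i → par x ∉ C.R → Gu (y x) (vpos (par x) (z (C.top (par x))))
  aC : ∀ c, C.ptop c → par c ≠ c → (par c).val < i → Gu (y (par c)) (vpos c (z c))
  aR : ∀ r ∈ C.R, (par r).val < i → gl (y (par r)) (y r)

theorem greedy (hpar : ∀ v, par v ≤ v) (C : Cut N par) (Δ : ℕ)
    (hΔ : ∀ v, #(univ.filter fun u => par u = v ∧ u ≠ v) ≤ Δ)
    {V A Kt Cp : Type*} [Nonempty V] [Nonempty Cp] (Gu gl : V → V → Prop) (hgl : ∀ v, ¬ gl v v)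
    (Y : A → Finset V) (hY : ∀ a b, a ≠ b → Disjoint (Y a) (Y b))
    (pc : Fin N → A) (hpc : ∀ v, v ∉ C.R → pc v = pc (par v)) (σ : A → A)
    (κ : Fin N → Kt) (Copies : Kt → Finset Cp) (vpos : Fin N → Cp → V)
    (q1 q2 q3 q4 q5 q6 : ℕ)
    (h0 : ∀ c, C.ptop c → #(univ.filter fun c' => C.ptop c' ∧ κ c' = κ c) ≤ #(Copies (κ c)))
    (h1 : ∀ x ∈ C.X, par x ∉ C.R → ∀ q ∈ Copies (κ (C.top (par x))),
      q1 ≤ #((Y (pc x)).filter fun v => Gu v (vpos (par x) q)))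
    (h2 : ∀ c, C.ptop c → par c ≠ c → ∀ D ⊆ Copies (κ c),
      #D < #(univ.filter fun c' => C.ptop c' ∧ κ c' = κ c) →
      #((Y (pc c)).filter fun v => #((Copies (κ c) \ D).filter fun q => Gu v (vpos c q)) ≤ Δ) ≤ q2)
    (h3 : ∀ a b, ∀ S ⊆ Y b, q3 ≤ #S → #((Y a).filter fun v => #(S.filter fun w => gl v w) ≤ Δ) ≤ q4)
    (h4 : ∀ r ∈ C.R, #((Y (σ (pc r))).filter fun w => #((Y (pc r)).filter fun v => Gu v w) < q1) ≤ q5)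
    (h5 : q6 + Δ * q2 + Δ * q4 < q1)
    (h5' : ∀ r ∈ C.R, q3 + q5 + q6 ≤ #(Y (σ (pc r))))
    (h6 : ∀ a, #(C.X.filter fun x => pc x = a) + #C.R ≤ q6) :
    ∃ (y : Fin N → V) (z : Fin N → Cp), GInv C Gu gl Y pc σ κ Copies vpos q1 N y z := by
  suffices key : ∀ i : ℕ, i ≤ N → ∃ (y : Fin N → V) (z : Fin N → Cp), GInv C Gu gl Y pc σ κ Copies vpos q1 i y z from
    key N le_rfl
  have rootpar : ∀ c, C.ptop c → par c = c ∨ par c ∈ C.X := fun c hc => C.top_root c hc.1 hc.2.1 hc.2.2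
  have Xnr : ∀ x ∈ C.X, par x ≠ x := by
    intro x hx h
    have h1 := C.X_odd x hx
    rw [C.odd_root x h] at h1
    exact absurd h1 (by simp)
  have XR : ∀ x ∈ C.X, x ∉ C.R := by
    intro x hx h
    have h1 := C.X_odd x hx
    rw [C.R_even x h] at h1
    exact absurd h1 (by simp)
  intro i
  induction i with
  | zero =>
    intro _
    refine ⟨fun _ => Classical.arbitrary V, fun _ => Classical.arbitrary Cp, ?_⟩
    constructor <;> intros <;> omega
  | succ i ih =>
    intro hi
    obtain ⟨y, z, I⟩ := ih (by omega)
    set v : Fin N := ⟨i, hi⟩ with hv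
    have hlt : ∀ w : Fin N, w.val < i + 1 → w.val < i ∨ w = v := by
      intro w hw
      by_cases h : w.val = i
      · exact Or.inr (Fin.ext h)
      · left; omega
    have hparlt : ∀ x ∈ C.X, ∀ j : ℕ, x.val < j → (par x).val < j := by
      intro x hx j hj
      have := hpar x
      rw [Fin.le_def] at this
      omega
    by_cases hvX : v ∈ C.X
    · -- the main case
      set U : Finset V := (C.X.filter fun x => x.val < i).image y ∪ (C.R.filter fun r => (par r).val < i).image y with hU
      have hUcard : ∀ a, #((Y a).filter fun w => w ∈ U) ≤ q6 := by
        intro a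
        refine le_trans (Finset.card_le_card (t := (C.X.filter fun x => pc x = a).image y ∪ C.R.image y) ?_) ?_
        · intro w hw
          simp only [hU, Finset.mem_filter, Finset.mem_union, Finset.mem_image] at hw ⊢
          obtain ⟨hw, ⟨x, ⟨hx, hxi⟩, rfl⟩ | ⟨r, ⟨hr, _⟩, rfl⟩⟩ := hw
          · left
            refine ⟨x, ⟨hx, ?_⟩, rfl⟩
            by_contra hne
            exact Finset.disjoint_left.1 (hY _ _ hne) (I.yX x hx hxi) hw
          · exact Or.inr ⟨r, hr, rfl⟩
        · exact (Finset.card_union_le _ _).trans ((Nat.add_le_add Finset.card_image_le Finset.card_image_le).trans (h6 a))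
      set b : V := if par v ∈ C.R then y (par v) else vpos (par v) (z (C.top (par v))) with hb
      have hparv : (par v).val < i := by
        have := hpar v
        have h' := Xnr v hvX
        have := lt_of_le_of_ne this h'
        rw [Fin.lt_def] at this
        exact this
      have htopv : par v ∉ C.R → C.ptop (C.top (par v)) ∧ (par (C.top (par v))).val < i := by
        intro hR
        have hX : par v ∉ C.X := by
          intro h
          have h1 := C.X_odd v hvX
          rw [C.odd_par v (Xnr v hvX), C.X_odd _ h] at h1
          exact absurd h1 (by simp)
        have h1 := C.top_comp _ hX hR
        refine ⟨⟨h1.1, h1.2, C.top_top _⟩, ?_⟩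
        have h2 := hpar (C.top (par v))
        have h3 := C.top_le (par v)
        rw [Fin.le_def] at h2 h3
        omega
      have hbq : q1 ≤ #((Y (pc v)).filter fun w => Gu w b) := by
        simp only [hb]
        split_ifs with hR
        · have h1 : (par (par v)).val < i := by
            have := hpar (par v); rw [Fin.le_def] at this; omega
          have := (I.yR _ hR h1).2
          rw [hpc v (XR v hvX)]
          exact this
        · obtain ⟨ha, hb'⟩ := htopv hR
          exact h1 v hvX hR _ (I.zC _ ha hb')
      let Cv : Finset (Fin N) := univ.filter fun c => C.ptop c ∧ par c = v ∧ c ≠ v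
      let Rv : Finset (Fin N) := C.R.filter fun r => par r = v
      have hCv : #Cv ≤ Δ := le_trans (Finset.card_le_card (by
        intro c hc
        simp only [Cv, Finset.mem_filter, Finset.mem_univ, true_and] at hc ⊢
        exact hc.2)) (hΔ v)
      have hRv : #Rv ≤ Δ := le_trans (Finset.card_le_card (by
        intro c hc
        simp only [Rv, Finset.mem_filter, Finset.mem_univ, true_and] at hc ⊢
        refine ⟨hc.2, fun h => ?_⟩
        have h' := hc.2
        rw [← h] at h'
        exact C.R_nonroot c hc.1 h')) (hΔ v)
      let Dk : Kt → Finset Cp := fun k0 => (univ.filter fun c' => C.ptop c' ∧ (par c').val < i ∧ κ c' = k0).image z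
      have hDsub : ∀ k0, Dk k0 ⊆ Copies k0 := by
        intro k0 q hq
        simp only [Dk, Finset.mem_image, Finset.mem_filter, Finset.mem_univ, true_and] at hq
        obtain ⟨c, ⟨hc1, hc2, rfl⟩, rfl⟩ := hq
        exact I.zC c hc1 hc2
      have hDcard : ∀ c ∈ Cv, #(Dk (κ c)) < #(univ.filter fun c' => C.ptop c' ∧ κ c' = κ c) := by
        intro c hc
        simp only [Cv, Finset.mem_filter, Finset.mem_univ, true_and] at hc
        refine lt_of_le_of_lt Finset.card_image_le (Finset.card_lt_card ?_)
        rw [Finset.ssubset_iff_of_subset]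
        · refine ⟨c, ?_, ?_⟩
          · simp only [Finset.mem_filter, Finset.mem_univ, true_and]
            exact ⟨hc.1, trivial⟩
          · simp only [Finset.mem_filter, Finset.mem_univ, true_and, hc.2.1, hv]
            rintro ⟨_, h, _⟩
            exact lt_irrefl _ h
        · intro c' hc'
          simp only [Finset.mem_filter, Finset.mem_univ, true_and] at hc' ⊢
          exact ⟨hc'.1, hc'.2.2⟩
      let Sr : Fin N → Finset V := fun r => (Y (σ (pc r))).filter fun w => w ∉ U ∧ q1 ≤ #((Y (pc r)).filter fun u => Gu u w)
      have hSr : ∀ r ∈ C.R, q3 ≤ #(Sr r) := by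
        intro r hr
        have e1 : Y (σ (pc r)) ⊆ Sr r ∪ (((Y (σ (pc r))).filter fun w => w ∈ U) ∪
            ((Y (σ (pc r))).filter fun w => #((Y (pc r)).filter fun v => Gu v w) < q1)) := by
          intro w hw
          simp only [Sr, Finset.mem_union, Finset.mem_filter]
          by_cases ha : w ∈ U
          · exact Or.inr (Or.inl ⟨hw, ha⟩)
          · by_cases hb : q1 ≤ #((Y (pc r)).filter fun u => Gu u w)
            · exact Or.inl ⟨hw, ha, hb⟩
            · exact Or.inr (Or.inr ⟨hw, not_le.1 hb⟩)
        have e2 := Finset.card_le_card e1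
        have e3 := Finset.card_union_le (Sr r) (((Y (σ (pc r))).filter fun w => w ∈ U) ∪
            ((Y (σ (pc r))).filter fun w => #((Y (pc r)).filter fun v => Gu v w) < q1))
        have e4 := Finset.card_union_le ((Y (σ (pc r))).filter fun w => w ∈ U)
            ((Y (σ (pc r))).filter fun w => #((Y (pc r)).filter fun v => Gu v w) < q1)
        have e5 := hUcard (σ (pc r))
        have e6 := h4 r hr
        have e7 := h5' r hr
        omega
      let B1 : Finset V := Cv.biUnion fun c => (Y (pc v)).filter fun w =>
        #((Copies (κ c) \ Dk (κ c)).filter fun q => Gu w (vpos c q)) ≤ Δ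
      let B2 : Finset V := Rv.biUnion fun r => (Y (pc v)).filter fun w => #((Sr r).filter fun u => gl w u) ≤ Δ
      have hB1 : #B1 ≤ Δ * q2 := by
        refine (Finset.card_biUnion_le_card_mul _ _ q2 fun c hc => ?_).trans (Nat.mul_le_mul_right _ hCv)
        have hc' := hc
        simp only [Cv, Finset.mem_filter, Finset.mem_univ, true_and] at hc'
        have := h2 c hc'.1 (by rw [hc'.2.1]; exact hc'.2.2.symm) (Dk (κ c)) (hDsub _) (hDcard c hc)
        rw [hpc c hc'.1.2.1, hc'.2.1] at this
        exact this
      have hB2 : #B2 ≤ Δ * q4 := by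
        refine (Finset.card_biUnion_le_card_mul _ _ q4 fun r hr => ?_).trans (Nat.mul_le_mul_right _ hRv)
        simp only [Rv, Finset.mem_filter] at hr
        exact h3 (pc v) (σ (pc r)) (Sr r) (Finset.filter_subset _ _) (hSr r hr.1)
      have hex : ∃ y', y' ∈ Y (pc v) ∧ Gu y' b ∧ y' ∉ U ∧ y' ∉ B1 ∧ y' ∉ B2 := by
        by_contra hcon
        push Not at hcon
        have e1 : ((Y (pc v)).filter fun w => Gu w b) ⊆ ((Y (pc v)).filter fun w => w ∈ U) ∪ (B1 ∪ B2) := by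
          intro w hw
          simp only [Finset.mem_filter] at hw
          rw [Finset.mem_union, Finset.mem_union, Finset.mem_filter]
          by_cases ha : w ∈ U
          · exact Or.inl ⟨hw.1, ha⟩
          · by_cases hb : w ∈ B1
            · exact Or.inr (Or.inl hb)
            · exact Or.inr (Or.inr (hcon w hw.1 hw.2 ha hb))
        have e2 := Finset.card_le_card e1
        have e3 := Finset.card_union_le ((Y (pc v)).filter fun w => w ∈ U) (B1 ∪ B2)
        have e4 := Finset.card_union_le B1 B2
        have e5 := hUcard (pc v)
        omega
      obtain ⟨y', hy1, hy2, hy3, hy4, hy5⟩ := hex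
      obtain ⟨f, hf1, hf2⟩ := distinct_reps Cv (fun c => (Copies (κ c) \ Dk (κ c)).filter fun q => Gu y' (vpos c q)) (by
        intro c hc
        refine hCv.trans ?_
        by_contra hcon
        exact hy4 (Finset.mem_biUnion.2 ⟨c, hc, Finset.mem_filter.2 ⟨hy1, by omega⟩⟩))
      obtain ⟨ρ, hρ1, hρ2⟩ := distinct_reps Rv (fun r => (Sr r).filter fun u => gl y' u) (by
        intro r hr
        refine hRv.trans ?_
        by_contra hcon
        exact hy5 (Finset.mem_biUnion.2 ⟨r, hr, Finset.mem_filter.2 ⟨hy1, by omega⟩⟩))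
      have memCv : ∀ c, c ∈ Cv ↔ C.ptop c ∧ par c = v ∧ c ≠ v := by intro c; simp [Cv]
      have memRv : ∀ r, r ∈ Rv ↔ r ∈ C.R ∧ par r = v := by intro r; simp [Rv]
      have hptopv : ∀ c, C.ptop c → c ≠ v := fun c hc h => hc.1 (h ▸ hvX)
      have hρ3 : ∀ r ∈ Rv, ρ r ∈ Y (σ (pc r)) ∧ ρ r ∉ U ∧ q1 ≤ #((Y (pc r)).filter fun u => Gu u (ρ r)) ∧ gl y' (ρ r) := by
        intro r hr
        have := hρ1 r hr
        simp only [Sr, Finset.mem_filter] at this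
        tauto
      have hf3 : ∀ c ∈ Cv, f c ∈ Copies (κ c) ∧ f c ∉ Dk (κ c) ∧ Gu y' (vpos c (f c)) := by
        intro c hc
        have := hf1 c hc
        simp only [Finset.mem_filter, Finset.mem_sdiff] at this
        tauto
      have UX : ∀ x ∈ C.X, x.val < i → y x ∈ U := fun x hx hxi =>
        Finset.mem_union_left _ (Finset.mem_image.2 ⟨x, Finset.mem_filter.2 ⟨hx, hxi⟩, rfl⟩)
      have UR : ∀ x ∈ C.R, (par x).val < i → y x ∈ U := fun x hx hxi =>
        Finset.mem_union_right _ (Finset.mem_image.2 ⟨x, Finset.mem_filter.2 ⟨hx, hxi⟩, rfl⟩)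
      have hne_v : ∀ w : Fin N, w.val < i → w ≠ v := by
        intro w hw h; rw [h] at hw; exact lt_irrefl _ hw
      set yn : Fin N → V := fun w => if w = v then y' else if w ∈ Rv then ρ w else y w with hyn
      set zn : Fin N → Cp := fun c => if c ∈ Cv then f c else z c with hzn
      have yn_v : yn v = y' := by simp [hyn]
      have yn_X : ∀ x ∈ C.X, x.val < i → yn x = y x := by
        intro x hx hxi
        simp only [hyn]
        rw [if_neg (hne_v x hxi), if_neg]
        rw [memRv]
        exact fun h => XR x hx h.1
      have yn_R : ∀ r ∈ C.R, (par r).val < i → yn r = y r := by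
        intro r hr hri
        simp only [hyn]
        rw [if_neg (fun h : r = v => XR v hvX (h ▸ hr)), if_neg]
        rw [memRv]
        exact fun h => hne_v _ hri h.2
      have yn_Rv : ∀ r ∈ Rv, yn r = ρ r := by
        intro r hr
        simp only [hyn]
        rw [if_neg (fun h : r = v => XR v hvX (h ▸ ((memRv r).1 hr).1)), if_pos hr]
      have zn_C : ∀ c, (par c).val < i → zn c = z c := by
        intro c hci
        simp only [hzn]
        rw [if_neg]
        rw [memCv]
        exact fun h => hne_v _ hci h.2.1
      have zn_Cv : ∀ c ∈ Cv, zn c = f c := by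
        intro c hc
        simp only [hzn]
        rw [if_pos hc]
      have sR : ∀ r ∈ C.R, (par r).val < i + 1 → (par r).val < i ∨ r ∈ Rv := by
        intro r hr h
        rcases hlt _ h with h | h
        · exact Or.inl h
        · exact Or.inr ((memRv r).2 ⟨hr, h⟩)
      have sC : ∀ c, C.ptop c → (par c).val < i + 1 → (par c).val < i ∨ c ∈ Cv := by
        intro c hc h
        rcases hlt _ h with h | h
        · exact Or.inl h
        · exact Or.inr ((memCv c).2 ⟨hc, h, hptopv c hc⟩)
      refine ⟨yn, zn, ?_⟩
      constructor
      · intro x hx hxi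
        rcases hlt x hxi with h | h
        · rw [yn_X x hx h]; exact I.yX x hx h
        · rw [h, yn_v]; exact hy1
      · intro r hr hri
        rcases sR r hr hri with h | h
        · rw [yn_R r hr h]; exact I.yR r hr h
        · rw [yn_Rv r h]; exact ⟨(hρ3 r h).1, (hρ3 r h).2.2.1⟩
      · intro x hx x' hx' hxi hxi' he
        rcases hlt x hxi with h | h <;> rcases hlt x' hxi' with h' | h'
        · rw [yn_X x hx h, yn_X x' hx' h'] at he
          exact I.injXX x hx x' hx' h h' he
        · rw [yn_X x hx h, h', yn_v] at he
          exact absurd (he ▸ UX x hx h) hy3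
        · rw [yn_X x' hx' h', h, yn_v] at he
          exact absurd (he ▸ UX x' hx' h') hy3
        · rw [h, h']
      · intro x hx x' hx' hxi hxi' he
        rcases sR x hx hxi with h | h <;> rcases sR x' hx' hxi' with h' | h'
        · rw [yn_R x hx h, yn_R x' hx' h'] at he
          exact I.injRR x hx x' hx' h h' he
        · rw [yn_R x hx h, yn_Rv x' h'] at he
          exact absurd (he ▸ UR x hx h) (hρ3 x' h').2.1
        · rw [yn_R x' hx' h', yn_Rv x h] at he
          exact absurd (he ▸ UR x' hx' h') (hρ3 x h).2.1
        · rw [yn_Rv x h, yn_Rv x' h'] at he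
          exact hρ2 h h' he
      · intro x hx x' hx' hxi hxi' he
        rcases hlt x hxi with h | h <;> rcases sR x' hx' hxi' with h' | h'
        · rw [yn_X x hx h, yn_R x' hx' h'] at he
          exact I.injXR x hx x' hx' h h' he
        · rw [yn_X x hx h, yn_Rv x' h'] at he
          exact (hρ3 x' h').2.1 (he ▸ UX x hx h)
        · rw [yn_R x' hx' h', h, yn_v] at he
          exact hy3 (he ▸ UR x' hx' h')
        · rw [h, yn_v, yn_Rv x' h'] at he
          have := (hρ3 x' h').2.2.2
          rw [← he] at this
          exact hgl _ this
      · intro c hc hci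
        rcases sC c hc hci with h | h
        · rw [zn_C c h]; exact I.zC c hc h
        · rw [zn_Cv c h]; exact (hf3 c h).1
      · intro c hc c' hc' hci hci' hk he
        have memD : ∀ c, C.ptop c → (par c).val < i → z c ∈ Dk (κ c) := fun c hc h =>
          Finset.mem_image.2 ⟨c, by simp only [Finset.mem_filter, Finset.mem_univ, true_and]; exact ⟨hc, h, trivial⟩, rfl⟩
        rcases sC c hc hci with h | h <;> rcases sC c' hc' hci' with h' | h'
        · rw [zn_C c h, zn_C c' h'] at he
          exact I.injC c hc c' hc' h h' hk he
        · rw [zn_C c h, zn_Cv c' h'] at he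
          have := memD c hc h
          rw [he, hk] at this
          exact absurd this (hf3 c' h').2.1
        · rw [zn_C c' h', zn_Cv c h] at he
          have := memD c' hc' h'
          rw [← he, ← hk] at this
          exact absurd this (hf3 c h).2.1
        · rw [zn_Cv c h, zn_Cv c' h'] at he
          exact hf2 h h' he
      · intro x hx hxi hR
        rcases hlt x hxi with h | h
        · have hp : (par (par x)).val < i := by
            have h1 := hpar (par x); have h2 := hpar x
            rw [Fin.le_def] at h1 h2; omega
          rw [yn_X x hx h, yn_R _ hR hp]
          exact I.aXR x hx h hR
        · rw [h] at hR ⊢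
          have hp : (par (par v)).val < i := by
            have h1 := hpar (par v)
            have h2 := hparv
            rw [Fin.le_def] at h1; omega
          rw [yn_v, yn_R _ hR hp]
          simp only [hb, if_pos hR] at hy2
          exact hy2
      · intro x hx hxi hR
        rcases hlt x hxi with h | h
        · have hp : (par (C.top (par x))).val < i := by
            have h1 := hpar (C.top (par x)); have h2 := hpar x; have h3 := C.top_le (par x)
            rw [Fin.le_def] at h1 h2 h3; omega
          rw [yn_X x hx h, zn_C _ hp]
          exact I.aXC x hx h hR
        · subst h
          rw [yn_v, zn_C _ (htopv hR).2]
          simp only [hb, if_neg hR] at hy2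
          exact hy2
      · intro c hc hcn hci
        rcases sC c hc hci with h | h
        · have hX := (rootpar c hc).resolve_left hcn
          rw [zn_C c h, yn_X _ hX h]
          exact I.aC c hc hcn h
        · rw [zn_Cv c h, ((memCv c).1 h).2.1, yn_v]
          exact (hf3 c h).2.2
      · intro r hr hri
        rcases sR r hr hri with h | h
        · rw [yn_R r hr h, yn_X _ (C.R_par r hr) h]
          exact I.aR r hr h
        · rw [yn_Rv r h, ((memRv r).1 h).2, yn_v]
          exact (hρ3 r h).2.2.2
    · have hX : ∀ x ∈ C.X, x.val < i + 1 → x.val < i := by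
        intro x hx h
        rcases hlt x h with h | h
        · exact h
        · exact absurd (h ▸ hx) hvX
      have hR : ∀ r ∈ C.R, (par r).val < i + 1 → (par r).val < i := fun r hr h => hX _ (C.R_par r hr) h
      have hC : ∀ c, C.ptop c → (par c).val < i + 1 → (par c).val < i ∨ (c = v ∧ par v = v) := by
        intro c hc h
        rcases hlt _ h with h' | h'
        · exact Or.inl h'
        · rcases rootpar c hc with h2 | h2
          · have : c = v := h2.symm.trans h'
            exact Or.inr ⟨this, this ▸ h2⟩
          · exact absurd (h' ▸ h2) hvX
      by_cases hroot : par v = v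
      · have hvR : v ∉ C.R := fun h => C.R_nonroot v h hroot
        have hpt : C.ptop v := by
          refine ⟨hvX, hvR, ?_⟩
          by_contra h
          exact (C.top_par v hvX hvR h).2.2.2 hroot
        let D : Finset Cp := (univ.filter fun c' => C.ptop c' ∧ (par c').val < i ∧ κ c' = κ v).image z
        have hD : #D < #(Copies (κ v)) := by
          refine lt_of_lt_of_le ?_ (h0 v hpt)
          refine lt_of_le_of_lt Finset.card_image_le (Finset.card_lt_card ?_)
          rw [Finset.ssubset_iff_of_subset]
          · refine ⟨v, ?_, ?_⟩
            · simp only [Finset.mem_filter, Finset.mem_univ, true_and]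
              exact ⟨hpt, trivial⟩
            · simp only [Finset.mem_filter, Finset.mem_univ, true_and]
              rintro ⟨_, h, _⟩
              rw [hroot] at h
              exact lt_irrefl _ h
          · intro c' hc'
            simp only [Finset.mem_filter, Finset.mem_univ, true_and] at hc' ⊢
            exact ⟨hc'.1, hc'.2.2⟩
        obtain ⟨q, hq1, hq2⟩ := Finset.exists_mem_notMem_of_card_lt_card hD
        have hz : ∀ c, (par c).val < i → Function.update z v q c = z c := by
          intro c hc
          rw [Function.update_of_ne]
          rintro rfl
          rw [hroot] at hc
          exact lt_irrefl _ hc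
        have memD : ∀ c, C.ptop c → (par c).val < i → κ c = κ v → z c ∈ D := fun c hc h hk =>
          Finset.mem_image.2 ⟨c, by simp only [Finset.mem_filter, Finset.mem_univ, true_and]; exact ⟨hc, h, hk⟩, rfl⟩
        refine ⟨y, Function.update z v q, ?_⟩
        constructor
        · exact fun x hx h => I.yX x hx (hX x hx h)
        · exact fun x hx h => I.yR x hx (hR x hx h)
        · exact fun x hx x' hx' h h' => I.injXX x hx x' hx' (hX x hx h) (hX x' hx' h')
        · exact fun x hx x' hx' h h' => I.injRR x hx x' hx' (hR x hx h) (hR x' hx' h')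
        · exact fun x hx x' hx' h h' => I.injXR x hx x' hx' (hX x hx h) (hR x' hx' h')
        · intro c hc hci
          rcases hC c hc hci with h | ⟨h, _⟩
          · rw [hz c h]; exact I.zC c hc h
          · rw [h, Function.update_self]; exact hq1
        · intro c hc c' hc' hci hci' hk he
          rcases hC c hc hci with h | ⟨h, _⟩ <;> rcases hC c' hc' hci' with h' | ⟨h', _⟩
          · rw [hz c h, hz c' h'] at he
            exact I.injC c hc c' hc' h h' hk he
          · rw [hz c h, h', Function.update_self] at he
            exact absurd (he ▸ memD c hc h (h' ▸ hk)) hq2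
          · rw [hz c' h', h, Function.update_self] at he
            exact absurd (he ▸ memD c' hc' h' (h ▸ hk.symm)) hq2
          · rw [h, h']
        · exact fun x hx h => I.aXR x hx (hX x hx h)
        · intro x hx h hR'
          have hp : (par (C.top (par x))).val < i := by
            have h1 := hpar (C.top (par x)); have h2 := hpar x; have h3 := C.top_le (par x)
            have h4 := hX x hx h
            rw [Fin.le_def] at h1 h2 h3; omega
          rw [hz _ hp]
          exact I.aXC x hx (hX x hx h) hR'
        · intro c hc hcn hci
          rcases hC c hc hci with h | ⟨h, h'⟩
          · rw [hz c h]; exact I.aC c hc hcn h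
          · exact absurd (h ▸ h') hcn
        · exact fun r hr h => I.aR r hr (hR r hr h)
      · have hC' : ∀ c, C.ptop c → (par c).val < i + 1 → (par c).val < i := by
          intro c hc h
          rcases hC c hc h with h | ⟨_, h⟩
          · exact h
          · exact absurd h hroot
        refine ⟨y, z, ?_⟩
        constructor
        · exact fun x hx h => I.yX x hx (hX x hx h)
        · exact fun x hx h => I.yR x hx (hR x hx h)
        · exact fun x hx x' hx' h h' => I.injXX x hx x' hx' (hX x hx h) (hX x' hx' h')
        · exact fun x hx x' hx' h h' => I.injRR x hx x' hx' (hR x hx h) (hR x' hx' h')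
        · exact fun x hx x' hx' h h' => I.injXR x hx x' hx' (hX x hx h) (hR x' hx' h')
        · exact fun c hc h => I.zC c hc (hC' c hc h)
        · exact fun c hc c' hc' h h' => I.injC c hc c' hc' (hC' c hc h) (hC' c' hc' h')
        · exact fun x hx h => I.aXR x hx (hX x hx h)
        · exact fun x hx h => I.aXC x hx (hX x hx h)
        · exact fun c hc hcn h => I.aC c hc hcn (hC' c hc h)
        · exact fun r hr h => I.aR r hr (hR r hr h)

end ModH
end ApproxDecomp

open SimpleGraph
namespace ApproxDecomp
section ModF
open scoped Classical
open Finset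

/-- number of adjacent ordered pairs -/
noncomputable def ec {n : ℕ} (G : SimpleGraph (Fin n)) (A B : Finset (Fin n)) : ℕ :=
  #((A ×ˢ B).filter fun q => G.Adj q.1 q.2)

lemma ec_comm {n : ℕ} (G : SimpleGraph (Fin n)) (A B : Finset (Fin n)) : ec G A B = ec G B A := by
  unfold ec
  refine Finset.card_bij (fun q _ => (q.2, q.1)) ?_ ?_ ?_
  · rintro ⟨a, b⟩ h
    simp only [Finset.mem_filter, Finset.mem_product] at h ⊢
    exact ⟨⟨h.1.2, h.1.1⟩, h.2.symm⟩
  · rintro ⟨a, b⟩ _ ⟨c, d⟩ _ h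
    simp only [Prod.mk.injEq] at h ⊢
    exact ⟨h.2, h.1⟩
  · rintro ⟨a, b⟩ h
    simp only [Finset.mem_filter, Finset.mem_product] at h
    exact ⟨(b, a), by simp only [Finset.mem_filter, Finset.mem_product]; exact ⟨⟨h.1.2, h.1.1⟩, h.2.symm⟩, rfl⟩

lemma ec_sum_left {n : ℕ} (G : SimpleGraph (Fin n)) (A B : Finset (Fin n)) :
    ec G A B = ∑ v ∈ A, #(B.filter fun w => G.Adj v w) := by
  unfold ec
  rw [Finset.card_filter, Finset.sum_product]
  refine Finset.sum_congr rfl fun v _ => ?_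
  rw [Finset.card_filter]

lemma ec_sum_right {n : ℕ} (G : SimpleGraph (Fin n)) (A B : Finset (Fin n)) :
    ec G A B = ∑ w ∈ B, #(A.filter fun v => G.Adj v w) := by
  rw [ec_comm, ec_sum_left]
  refine Finset.sum_congr rfl fun v _ => ?_
  congr 1; ext w; simp only [Finset.mem_filter]
  exact and_congr_right fun _ => ⟨fun h => h.symm, fun h => h.symm⟩

lemma ec_le {n : ℕ} (G : SimpleGraph (Fin n)) (A B : Finset (Fin n)) : ec G A B ≤ #A * #B := by
  unfold ec
  exact le_trans (Finset.card_filter_le _ _) (by rw [Finset.card_product])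

lemma deg_eq {n : ℕ} (G : SimpleGraph (Fin n)) (v : Fin n) :
    deg G v = #((univ : Finset (Fin n)).filter fun w => G.Adj v w) := by
  unfold deg
  rw [← Set.ncard_coe_finset]
  congr 1; ext w; simp

/-- a regularised host graph -/
structure Host {n : ℕ} (G : SimpleGraph (Fin n)) (α ε d0 : ℝ) (L s : ℕ)
    (V : Fin L → Finset (Fin n)) (d : Fin L → Fin L → ℝ) : Prop where
  disj : ∀ a b, a ≠ b → Disjoint (V a) (V b)
  card : ∀ a, #(V a) = s
  cover : (n : ℝ) ≤ s * L + L
  symm : ∀ a b, d a b = d b a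
  diag : ∀ a, d a a = 0
  nonneg : ∀ a b, 0 ≤ d a b
  le_one : ∀ a b, d a b ≤ 1
  lower : ∀ a b, d a b ≠ 0 → d0 ≤ d a b
  reg : ∀ a b, d a b ≠ 0 → ∀ A' ⊆ V a, ∀ B' ⊆ V b, ε * s ≤ (#A' : ℝ) → ε * s ≤ (#B' : ℝ) →
    |(ec G A' B' : ℝ) - d a b * #A' * #B'| ≤ ε * #A' * #B'
  row : ∀ a, ∑ b, d a b ≤ (α + ε) * L
  tot : (α - ε - d0) * L ^ 2 ≤ ∑ a, ∑ b, d a b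

lemma host_arith1 (α ε ξ Lm s L n S : ℝ) (hα : 0 < α) (hα1 : α < 1) (hε : 0 < ε) (hε1 : ε < 1) (hξ0 : 0 < ξ)
    (hξL : ξ * Lm = ε / 32) (hξ1 : ξ ≤ ε / 32) (hsR : 0 < s) (hLR : 0 < L) (hLsle : L ≤ Lm) (hs64' : 64 ≤ ε * s)
    (hnR : n ≤ s * L + L) (hn2 : n ≤ 2 * (s * L)) (hn0 : 0 ≤ n)
    (h5 : S * s ^ 2 ≤ s * ((α + ξ) * n) + ξ * n * n) : S * s ^ 2 ≤ ((α + ε) * L) * s ^ 2 := by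
  have h6 : s * ((α + ξ) * n) ≤ (α + ξ) * s ^ 2 * L + 2 * s * L := by
    have : s * ((α + ξ) * n) ≤ s * ((α + ξ) * (s * L + L)) := by gcongr
    have h7 : α + ξ ≤ 2 := by linarith
    have h8 : s * ((α + ξ) * (s * L + L)) = (α + ξ) * s ^ 2 * L + (α + ξ) * (s * L) := by ring
    have h9 : (α + ξ) * (s * L) ≤ 2 * (s * L) := by gcongr
    linarith
  have h7 : ξ * n * n ≤ (ε / 8) * s ^ 2 * L := by
    have : ξ * n * n ≤ ξ * (2 * (s * L)) * (2 * (s * L)) := by gcongr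
    have h8 : ξ * (2 * (s * L)) * (2 * (s * L)) = 4 * (ξ * L) * (s ^ 2 * L) := by ring
    have h9 : ξ * L ≤ ε / 32 := by rw [← hξL]; gcongr
    have h10 : 4 * (ξ * L) * (s ^ 2 * L) ≤ 4 * (ε / 32) * (s ^ 2 * L) := by gcongr
    linarith
  have h8 : 2 * s * L ≤ (ε / 32) * s ^ 2 * L := by
    have : 0 ≤ (ε * s - 64) * (s * L) := by apply mul_nonneg; linarith; positivity
    nlinarith
  have h9 : S * s ^ 2 ≤ ((α + ε) * L) * s ^ 2 := by
    have : ξ * (s ^ 2 * L) ≤ (ε / 32) * (s ^ 2 * L) := by gcongr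
    have : 0 ≤ ε * (s ^ 2 * L) := by positivity
    nlinarith
  exact h9

lemma host_arith2 (α ε ξ d0 s L n S E1 E2 : ℝ) (hα : 0 < α) (hεα : ε ≤ α) (hα1 : α < 1) (hε : 0 < ε) (hε1 : ε < 1) (hξ0 : 0 < ξ)
    (hξ1 : ξ ≤ ε / 32) (hsR : 0 < s) (hLR : 0 < L) (hs64' : 64 ≤ ε * s) (hL8 : 8 ≤ ε * L) (hsn : s * L ≤ n)
    (hn2 : n ≤ 2 * (s * L)) (hn0 : 0 ≤ n)
    (hS : E1 ≤ S * s ^ 2 + L ^ 2 * (d0 * s ^ 2) + L * s ^ 2 + (ε / 4) * L ^ 2 * s ^ 2) (hS' : E2 ≤ E1 + 2 * (L * n))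
    (hdegsum : (α - ξ) * n * (n - ξ * n) ≤ E2) : (α - ε - d0) * L ^ 2 * s ^ 2 ≤ S * s ^ 2 := by
  have e1 : 2 * (L * n) ≤ (ε / 16) * (L ^ 2 * s ^ 2) := by
    have : 2 * (L * n) ≤ 2 * (L * (2 * (s * L))) := by gcongr
    have h : 0 ≤ (ε * s - 64) * (s * L ^ 2) := by apply mul_nonneg; linarith; positivity
    nlinarith
  have e2 : L * s ^ 2 ≤ (ε / 8) * (L ^ 2 * s ^ 2) := by
    have h : 0 ≤ (ε * L - 8) * (s ^ 2 * L) := by apply mul_nonneg; linarith; positivity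
    nlinarith
  have e3 : (α - ε / 16) * (L ^ 2 * s ^ 2) ≤ (α - ξ) * n * (n - ξ * n) := by
    have h1 : (α - ξ) * n * (n - ξ * n) = (α - ξ) * (1 - ξ) * n ^ 2 := by ring
    have h2 : α - ε / 16 ≤ (α - ξ) * (1 - ξ) := by nlinarith
    have h3 : (L ^ 2 * s ^ 2) ≤ n ^ 2 := by
      have : (L ^ 2 * s ^ 2) = (s * L) ^ 2 := by ring
      rw [this]; gcongr
    have h0 : 0 ≤ L ^ 2 * s ^ 2 := by positivity
    rw [h1]
    by_cases hneg : 0 ≤ (α - ξ) * (1 - ξ)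
    · calc (α - ε / 16) * (L ^ 2 * s ^ 2) ≤ (α - ξ) * (1 - ξ) * (L ^ 2 * s ^ 2) := by gcongr
        _ ≤ _ := by gcongr
    · exfalso
      apply hneg
      apply mul_nonneg <;> linarith
  have fin : (α - ε - d0) * L ^ 2 * s ^ 2 ≤ S * s ^ 2 := by
    have h0 : 0 ≤ ε * (L ^ 2 * s ^ 2) := by positivity
    nlinarith
  exact fin

lemma deg_lower {n : ℕ} (G : SimpleGraph (Fin n)) (α ξ : ℝ) (hneg : 0 ≤ α - ξ) (Bd : Finset (Fin n))
    (hG : (#Bd : ℝ) ≤ ξ * n)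
    (memBd : ∀ v, v ∉ Bd → (α - ξ) * n ≤ (deg G v : ℝ) ∧ (deg G v : ℝ) ≤ (α + ξ) * n) :
    (α - ξ) * n * (n - ξ * n) ≤ ec G univ univ := by
  rw [ec_sum_left]
  have h1 : ∑ v ∈ Bdᶜ, ((α - ξ) * n) ≤ ∑ v ∈ Bdᶜ, (#((univ : Finset (Fin n)).filter fun w => G.Adj v w) : ℝ) := by
    refine Finset.sum_le_sum fun v hv => ?_
    rw [← deg_eq]; exact (memBd v (Finset.mem_compl.1 hv)).1
  rw [Finset.sum_const, nsmul_eq_mul] at h1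
  have h2 : (#Bdᶜ : ℝ) = n - #Bd := by
    rw [Finset.card_compl, Nat.cast_sub]
    · simp
    · exact Finset.card_le_univ _
  push_cast
  have h3 : ∑ v ∈ Bdᶜ, (#((univ : Finset (Fin n)).filter fun w => G.Adj v w) : ℝ) ≤ ∑ v, (#((univ : Finset (Fin n)).filter fun w => G.Adj v w) : ℝ) :=
    Finset.sum_le_sum_of_subset_of_nonneg (Finset.subset_univ _) (fun _ _ _ => by positivity)
  have h4 : (n - ξ * n) * ((α - ξ) * n) ≤ (#Bdᶜ:ℝ) * ((α - ξ) * n) := by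
    apply mul_le_mul_of_nonneg_right _ (by positivity)
    rw [h2]; linarith
  linarith

set_option maxHeartbeats 800000 in
theorem host_exists (α ε d0 : ℝ) (hα : 0 < α) (hεα : ε ≤ α) (hα1 : α < 1) (hε : 0 < ε) (hε1 : ε < 1) (hd : 0 < d0) :
    ∃ (Lmax : ℕ) (ξ0 : ℝ), 0 < ξ0 ∧ 0 < Lmax ∧ ∀ s0 : ℕ, ∃ n0 : ℕ, ∀ n : ℕ, n0 ≤ n → ∀ G : SimpleGraph (Fin n),
      ((#((univ : Finset (Fin n)).filter fun v => ¬ ((α - ξ0) * n ≤ (deg G v : ℝ) ∧ (deg G v : ℝ) ≤ (α + ξ0) * n)) : ℝ)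
        ≤ ξ0 * n) →
      ∃ (L s : ℕ) (V : Fin L → Finset (Fin n)) (d : Fin L → Fin L → ℝ), 0 < L ∧ L ≤ Lmax ∧ s0 ≤ s ∧ s * L ≤ n ∧
        Host G α ε d0 L s V d := by
  set ε1 : ℝ := ε / 4 with hεdef
  obtain ⟨l, hl⟩ := exists_nat_gt (8 / ε)
  obtain ⟨Lm, hLm⟩ : ∃ Lm, Lm = SzemerediRegularity.bound ε1 l := ⟨_, rfl⟩
  have hLmpos : 0 < Lm := hLm ▸ SzemerediRegularity.bound_pos _ _
  have hLmR : (0:ℝ) < Lm := by exact_mod_cast hLmpos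
  refine ⟨Lm, ε / (32 * Lm), by positivity, hLmpos, fun s0 => ?_⟩
  obtain ⟨s1, hs1⟩ := exists_nat_gt (64 / ε)
  refine ⟨l + Lm * (s0 + s1 + 1), fun n hn G hG => ?_⟩
  set ξ : ℝ := ε / (32 * Lm) with hξ
  have hξ0 : 0 < ξ := by positivity
  have hξL : ξ * Lm = ε / 32 := by rw [hξ]; field_simp
  have hLm1 : (1:ℝ) ≤ Lm := by exact_mod_cast hLmpos
  have hξ1 : ξ ≤ ε / 32 := by nlinarith
  clear_value ξ
  obtain ⟨P, hP1, hP2, hP3, hP4⟩ := szemeredi_regularity G (ε := ε1) (l := l) (by positivity) (by simp; omega)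
  rw [← hLm] at hP3
  set L := #P.parts with hL
  set s := n / L with hs
  have hl0 : 0 < l := by
    rcases Nat.eq_zero_or_pos l with h | h
    · rw [h] at hl; have : 0 < 8 / ε := by positivity
      push_cast at hl; linarith
    · exact h
  have hL0 : 0 < L := lt_of_lt_of_le hl0 hP2
  have hss : s0 + s1 + 1 ≤ s := by
    rw [hs, Nat.le_div_iff_mul_le hL0]
    calc (s0 + s1 + 1) * L ≤ (s0 + s1 + 1) * Lm := Nat.mul_le_mul_left _ hP3
      _ ≤ n := by rw [mul_comm]; omega
  have hsL : s * L ≤ n := Nat.div_mul_le_self n L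
  have hsL' : n ≤ s * L + L := by
    have := Nat.lt_div_mul_add (a := n) hL0
    exact le_of_lt (by simpa [hs] using this)
  have hcard : ∀ U ∈ P.parts, s ≤ #U ∧ #U ≤ s + 1 := by
    intro U hU
    have h1 := hP1.average_le_card_part hU
    have h2 := hP1.card_part_le_average_add_one hU
    simp only [Finset.card_univ, Fintype.card_fin] at h1 h2
    exact ⟨h1, h2⟩
  clear_value s
  set eq := P.parts.equivFin with heq
  let U : Fin L → Finset (Fin n) := fun a => (eq.symm a).1
  have hU : ∀ a, U a ∈ P.parts := fun a => (eq.symm a).2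
  have hUinj : Function.Injective U := fun a b h => eq.symm.injective (Subtype.ext h)
  choose V hVU hVc using fun a => Finset.exists_subset_card_eq (hcard (U a) (hU a)).1
  have hUd : ∀ a b, a ≠ b → Disjoint (U a) (U b) := fun a b h =>
    P.disjoint (hU a) (hU b) (fun hh => h (hUinj hh))
  have hVd : ∀ a b, a ≠ b → Disjoint (V a) (V b) := fun a b h =>
    Finset.disjoint_of_subset_left (hVU a) (Finset.disjoint_of_subset_right (hVU b) (hUd a b h))
  have hspos : 0 < s := by omega
  have hsR : (0:ℝ) < s := by exact_mod_cast hspos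
  have hLR : (0:ℝ) < L := by exact_mod_cast hL0
  let good : Fin L → Fin L → Prop := fun a b => a ≠ b ∧ G.IsUniform ε1 (U a) (U b) ∧ d0 ≤ (ec G (V a) (V b) : ℝ) / s ^ 2
  obtain ⟨d, hdp, hdn⟩ : ∃ d : Fin L → Fin L → ℝ, (∀ a b, good a b → d a b = (ec G (V a) (V b) : ℝ) / s ^ 2) ∧
      (∀ a b, ¬ good a b → d a b = 0) :=
    ⟨fun a b => if good a b then (ec G (V a) (V b) : ℝ) / s ^ 2 else 0, fun a b h => if_pos h, fun a b h => if_neg h⟩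
  have hdnn : ∀ a b, 0 ≤ d a b := by
    intro a b
    by_cases hg : good a b
    · rw [hdp a b hg]; positivity
    · rw [hdn a b hg]
  have hgs : ∀ a b, good a b → good b a := by
    rintro a b ⟨h1, h2, h3⟩
    exact ⟨h1.symm, h2.symm, by rw [ec_comm]; exact h3⟩
  have hdg : ∀ a b, d a b ≠ 0 → good a b ∧ d a b = (ec G (V a) (V b) : ℝ) / s ^ 2 := by
    intro a b h
    by_cases hg : good a b
    · exact ⟨hg, hdp a b hg⟩
    · exact absurd (hdn a b hg) h
  have hdens : ∀ A' B' : Finset (Fin n), (G.edgeDensity A' B' : ℝ) = (ec G A' B' : ℝ) / (#A' * #B') := by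
    intro A' B'
    rw [SimpleGraph.edgeDensity_def]
    push_cast
    congr 1
  have hdle : ∀ a b, d a b * (s:ℝ) ^ 2 ≤ ec G (V a) (V b) := by
    intro a b
    by_cases hg : good a b
    · rw [hdp a b hg, div_mul_cancel₀]; positivity
    · rw [hdn a b hg, zero_mul]; positivity
  have hnR : (n:ℝ) ≤ s * L + L := by exact_mod_cast hsL'
  have hLsle : (L:ℝ) ≤ Lm := by exact_mod_cast hP3
  have hs64 : 64 / ε ≤ s := le_trans hs1.le (by exact_mod_cast (by omega : s1 ≤ s))
  have hs64' : 64 ≤ ε * s := by rw [div_le_iff₀ hε] at hs64; linarith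
  have hs1R : (1:ℝ) ≤ s := by exact_mod_cast hspos
  have hL8 : 8 ≤ ε * L := by
    have : 8 / ε ≤ L := le_trans hl.le (by exact_mod_cast hP2)
    rw [div_le_iff₀ hε] at this; linarith
  have hn2 : (n:ℝ) ≤ 2 * (s * L) := by nlinarith
  have hsn : (s:ℝ) * L ≤ n := by exact_mod_cast hsL
  set Bd := (univ : Finset (Fin n)).filter fun v => ¬ ((α - ξ) * n ≤ (deg G v : ℝ) ∧ (deg G v : ℝ) ≤ (α + ξ) * n) with hBd
  have memBd : ∀ v, v ∉ Bd → (α - ξ) * n ≤ (deg G v : ℝ) ∧ (deg G v : ℝ) ≤ (α + ξ) * n := by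
    intro v hv
    by_contra h
    exact hv (Finset.mem_filter.2 ⟨Finset.mem_univ _, h⟩)
  refine ⟨L, s, V, d, hL0, hP3, by omega, hsL, ?_⟩
  refine ⟨hVd, hVc, hnR, ?_, ?_, ?_, ?_, ?_, ?_, ?_, ?_⟩
  · intro a b
    by_cases hg : good a b
    · rw [hdp a b hg, hdp b a (hgs a b hg), ec_comm]
    · rw [hdn a b hg, hdn b a (fun h => hg (hgs b a h))]
  · intro a
    exact hdn a a (fun h => h.1 rfl)
  · exact hdnn
  · intro a b
    have h1 := hdle a b
    have h2 : (ec G (V a) (V b) : ℝ) ≤ s * s := by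
      have := ec_le G (V a) (V b)
      rw [hVc, hVc] at this
      exact_mod_cast this
    by_contra h
    push Not at h
    nlinarith [sq_nonneg (s:ℝ), mul_pos hsR hsR]
  · intro a b h
    obtain ⟨hg, he⟩ := hdg a b h
    rw [he]; exact hg.2.2
  · intro a b h A' hA' B' hB' hAc hBc
    obtain ⟨hg, he⟩ := hdg a b h
    have hUc : ∀ a, (#(U a) : ℝ) * ε1 ≤ ε * s := by
      intro a
      have : (#(U a) : ℝ) ≤ s + 1 := by exact_mod_cast (hcard _ (hU a)).2
      rw [hεdef]; nlinarith
    have hVcR : ∀ a, (#(V a) : ℝ) = s := fun a => by rw [hVc]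
    have hes : ε * s ≤ s := by nlinarith
    have h1 := hg.2.1 (hA'.trans (hVU a)) (hB'.trans (hVU b)) (le_trans (hUc a) hAc) (le_trans (hUc b) hBc)
    have h2 := hg.2.1 (hVU a) (hVU b) (le_trans (hUc a) (by rw [hVcR]; exact hes)) (le_trans (hUc b) (by rw [hVcR]; exact hes))
    have hd' : (G.edgeDensity (V a) (V b) : ℝ) = d a b := by
      rw [hdens, hVcR, hVcR, he]; congr 1; ring
    have hA0 : (0:ℝ) < #A' := lt_of_lt_of_le (by positivity) hAc
    have hB0 : (0:ℝ) < #B' := lt_of_lt_of_le (by positivity) hBc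
    rw [hd'] at h2
    rw [hdens] at h1
    rw [abs_lt] at h1 h2
    have hx : |(ec G A' B' : ℝ) / (#A' * #B') - d a b| ≤ ε := by
      rw [abs_le]; constructor <;> linarith
    have hy : (ec G A' B' : ℝ) - d a b * #A' * #B' = ((ec G A' B' : ℝ) / (#A' * #B') - d a b) * (#A' * #B') := by
      rw [sub_mul, div_mul_cancel₀ _ (mul_pos hA0 hB0).ne', mul_assoc]
    rw [hy, abs_mul, abs_of_pos (mul_pos hA0 hB0), mul_assoc]
    exact mul_le_mul_of_nonneg_right hx (mul_pos hA0 hB0).le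
  · intro a
    have h1 : (∑ b, d a b) * (s:ℝ) ^ 2 ≤ ∑ b, (ec G (V a) (V b) : ℝ) := by
      rw [Finset.sum_mul]; exact Finset.sum_le_sum fun b _ => hdle a b
    have h2 : ∑ b, ec G (V a) (V b) ≤ ∑ v ∈ V a, deg G v := by
      simp only [ec_sum_left]
      rw [Finset.sum_comm]
      refine Finset.sum_le_sum fun v _ => ?_
      rw [deg_eq, ← Finset.card_biUnion]
      · refine Finset.card_le_card fun w hw => ?_
        simp only [Finset.mem_biUnion, Finset.mem_filter, Finset.mem_univ, true_and] at hw ⊢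
        obtain ⟨_, _, h⟩ := hw; exact h
      · intro b _ b' _ hbb
        exact Finset.disjoint_filter_filter (hVd b b' hbb)
    have h3 : (∑ v ∈ V a, (deg G v : ℝ)) ≤ ∑ v ∈ V a, ((α + ξ) * n + if v ∈ Bd then (n:ℝ) else 0) := by
      refine Finset.sum_le_sum fun v _ => ?_
      split_ifs with hv
      · have : (deg G v : ℝ) ≤ n := by
          rw [deg_eq]
          have := Finset.card_filter_le (univ : Finset (Fin n)) (fun w => G.Adj v w)
          simp only [Finset.card_univ, Fintype.card_fin] at this
          exact_mod_cast this
        have : 0 ≤ (α + ξ) * n := by positivity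
        linarith
      · linarith [(memBd v hv).2]
    have h4 : ∑ v ∈ V a, ((α + ξ) * n + if v ∈ Bd then (n:ℝ) else 0) ≤ s * ((α + ξ) * n) + ξ * n * n := by
      rw [Finset.sum_add_distrib, Finset.sum_const, hVc, nsmul_eq_mul]
      refine add_le_add le_rfl ?_
      rw [← Finset.sum_filter, Finset.sum_const, nsmul_eq_mul]
      refine mul_le_mul_of_nonneg_right (le_trans ?_ hG) (by positivity)
      exact_mod_cast Finset.card_le_card fun v hv => (Finset.mem_filter.1 hv).2
    have h2' : ∑ b, (ec G (V a) (V b) : ℝ) ≤ ∑ v ∈ V a, (deg G v : ℝ) := by exact_mod_cast h2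
    have h5 : (∑ b, d a b) * (s:ℝ) ^ 2 ≤ s * ((α + ξ) * n) + ξ * n * n := by linarith
    have hsq : (0:ℝ) < (s:ℝ) ^ 2 := by positivity
    have h9 := host_arith1 α ε ξ Lm s L n (∑ b, d a b) hα hα1 hε hε1 hξ0 hξL hξ1 hsR hLR hLsle hs64' hnR hn2 (Nat.cast_nonneg n) h5
    exact le_of_mul_le_mul_right h9 hsq
  · -- total
    set W := (univ : Finset (Fin L)).biUnion V with hW
    have hWc : #W = L * s := by
      rw [hW, Finset.card_biUnion (fun a _ b _ h => hVd a b h)]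
      simp [hVc]
    have hWn : #Wᶜ ≤ L := by
      rw [Finset.card_compl, hWc, Fintype.card_fin]
      have : n ≤ L * s + L := by rw [mul_comm L s]; exact hsL'
      omega
    have hsumW : ec G W W = ∑ a, ∑ b, ec G (V a) (V b) := by
      rw [ec_sum_left, hW, Finset.sum_biUnion (fun a _ b _ h => hVd a b h)]
      refine Finset.sum_congr rfl fun a _ => ?_
      simp only [ec_sum_left]
      rw [Finset.sum_comm]
      refine Finset.sum_congr rfl fun v _ => ?_
      rw [← Finset.card_biUnion]
      · congr 1; ext w
        simp only [Finset.mem_filter, Finset.mem_biUnion, Finset.mem_univ, true_and]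
        constructor
        · rintro ⟨⟨b, hb⟩, h⟩; exact ⟨b, hb, h⟩
        · rintro ⟨b, hb, h⟩; exact ⟨⟨b, hb⟩, h⟩
      · intro b _ b' _ hbb
        exact Finset.disjoint_filter_filter (hVd b b' hbb)
    have hall : ec G univ univ ≤ ec G W W + 2 * (L * n) := by
      have : (((univ : Finset (Fin n)) ×ˢ (univ : Finset (Fin n))).filter fun q => G.Adj q.1 q.2) ⊆
          ((W ×ˢ W).filter fun q => G.Adj q.1 q.2) ∪ ((Wᶜ ×ˢ univ) ∪ (univ ×ˢ Wᶜ)) := by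
        rintro ⟨v, w⟩ h
        simp only [Finset.mem_filter, Finset.mem_union, Finset.mem_product, Finset.mem_univ, true_and, and_true, Finset.mem_compl] at h ⊢
        by_cases h1 : v ∈ W
        · by_cases h2 : w ∈ W
          · exact Or.inl ⟨⟨h1, h2⟩, h⟩
          · exact Or.inr (Or.inr h2)
        · exact Or.inr (Or.inl h1)
      have h2 := Finset.card_le_card this
      have h3 := Finset.card_union_le ((W ×ˢ W).filter fun q => G.Adj q.1 q.2) ((Wᶜ ×ˢ univ) ∪ (univ ×ˢ Wᶜ))
      have h4 := Finset.card_union_le (Wᶜ ×ˢ (univ : Finset (Fin n))) ((univ : Finset (Fin n)) ×ˢ Wᶜ)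
      rw [Finset.card_product, Finset.card_product, Finset.card_univ, Fintype.card_fin] at h4
      have h5 : #Wᶜ * n ≤ L * n := Nat.mul_le_mul_right _ hWn
      unfold ec
      rw [mul_comm n] at h4
      omega
    have hdegsum := deg_lower G α ξ (by linarith) Bd hG memBd
    -- pairwise estimate
    obtain ⟨nu, hnud⟩ : ∃ nu : Fin L → Fin L → ℝ, nu = fun a b => if a ≠ b ∧ ¬ G.IsUniform ε1 (U a) (U b) then 1 else 0 := ⟨_, rfl⟩
    have nu1 : ∀ a b, (a ≠ b ∧ ¬ G.IsUniform ε1 (U a) (U b)) → nu a b = 1 := fun a b h => by rw [hnud]; exact if_pos h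
    have nu0 : ∀ a b, ¬ (a ≠ b ∧ ¬ G.IsUniform ε1 (U a) (U b)) → nu a b = 0 := fun a b h => by rw [hnud]; exact if_neg h
    have hpair : ∀ a b, (ec G (V a) (V b) : ℝ) ≤ d a b * s ^ 2 + d0 * s ^ 2 + (if a = b then (s:ℝ)^2 else 0) + nu a b * s ^ 2 := by
      intro a b
      have h2 : (ec G (V a) (V b) : ℝ) ≤ (s:ℝ) ^ 2 := by
        have := ec_le G (V a) (V b)
        rw [hVc, hVc] at this
        rw [sq]
        exact_mod_cast this
      have hs2 : (0:ℝ) < (s:ℝ) ^ 2 := by positivity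
      have hd0 : 0 ≤ d a b * (s:ℝ)^2 := by
        exact mul_nonneg (hdnn a b) hs2.le
      have hd1 : 0 ≤ d0 * (s:ℝ)^2 := by positivity
      by_cases hab : a = b
      · rw [if_pos hab]
        have : nu a b = 0 := nu0 a b (fun h => h.1 hab)
        rw [this]; linarith
      · rw [if_neg hab]
        by_cases hun : G.IsUniform ε1 (U a) (U b)
        · have : nu a b = 0 := nu0 a b (fun h => h.2 hun)
          rw [this]
          by_cases hlow : d0 ≤ (ec G (V a) (V b) : ℝ) / s ^ 2
          · have : d a b = (ec G (V a) (V b) : ℝ) / s ^ 2 := hdp a b ⟨hab, hun, hlow⟩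
            have h3 : d a b * (s:ℝ) ^ 2 = ec G (V a) (V b) := by rw [this, div_mul_cancel₀]; positivity
            linarith
          · push Not at hlow
            rw [div_lt_iff₀ hs2] at hlow
            linarith
        · have : nu a b = 1 := nu1 a b ⟨hab, hun⟩
          rw [this]; linarith
    have hnu : ∑ a, ∑ b, nu a b ≤ ε1 * (L:ℝ) ^ 2 := by
      have h1 : ∑ a, ∑ b, nu a b = (#((univ : Finset (Fin L × Fin L)).filter fun q => q.1 ≠ q.2 ∧ ¬ G.IsUniform ε1 (U q.1) (U q.2)) : ℝ) := by
        rw [← Fintype.sum_prod_type' (f := nu), Finset.card_filter]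
        push_cast
        rw [hnud]
      have h2 : #((univ : Finset (Fin L × Fin L)).filter fun q => q.1 ≠ q.2 ∧ ¬ G.IsUniform ε1 (U q.1) (U q.2)) ≤ #(P.nonUniforms G ε1) := by
        refine Finset.card_le_card_of_injOn (fun q => (U q.1, U q.2)) ?_ ?_
        · intro q hq
          simp only [Finset.coe_filter, Finset.mem_univ, true_and, Set.mem_setOf_eq] at hq
          rw [Finset.mem_coe, Finpartition.mk_mem_nonUniforms]
          exact ⟨hU _, hU _, fun h => hq.1 (hUinj h), hq.2⟩
        · rintro ⟨a, b⟩ _ ⟨c, e⟩ _ h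
          simp only [Prod.mk.injEq] at h
          rw [hUinj h.1, hUinj h.2]
      have h3 : (#(P.nonUniforms G ε1) : ℝ) ≤ ((L * (L - 1) : ℕ) : ℝ) * ε1 := hP4
      have h4 : ((L * (L - 1) : ℕ) : ℝ) ≤ (L:ℝ) ^ 2 := by
        rw [sq]; exact_mod_cast Nat.mul_le_mul_left L (Nat.sub_le L 1)
      have h2' : (#((univ : Finset (Fin L × Fin L)).filter fun q => q.1 ≠ q.2 ∧ ¬ G.IsUniform ε1 (U q.1) (U q.2)) : ℝ) ≤ #(P.nonUniforms G ε1) := by exact_mod_cast h2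
      have : 0 < ε1 := by positivity
      rw [h1]
      nlinarith
    have hS : (∑ a, ∑ b, (ec G (V a) (V b) : ℝ)) ≤ (∑ a, ∑ b, d a b) * s ^ 2 + L ^ 2 * (d0 * s ^ 2) + L * s ^ 2 + ε1 * L ^ 2 * s ^ 2 := by
      refine le_trans (Finset.sum_le_sum fun a _ => Finset.sum_le_sum fun b _ => hpair a b) ?_
      simp only [Finset.sum_add_distrib, ← Finset.sum_mul, Finset.sum_const, Finset.card_univ, Fintype.card_fin,
        Finset.sum_ite_eq, Finset.mem_univ, if_true, nsmul_eq_mul]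
      have : (∑ a, ∑ b, nu a b) * (s:ℝ) ^ 2 ≤ ε1 * L ^ 2 * s ^ 2 := by gcongr
      nlinarith
    have hS' : (ec G univ univ : ℝ) ≤ (∑ a, ∑ b, (ec G (V a) (V b) : ℝ)) + 2 * (L * n) := by
      have := hall
      rw [hsumW] at this
      exact_mod_cast this
    have hsq : (0:ℝ) < (s:ℝ) ^ 2 := by positivity
    have fin := host_arith2 α ε ξ d0 s L n (∑ a, ∑ b, d a b) _ _ hα hεα hα1 hε hε1 hξ0 hξ1 hsR hLR hs64' hL8 hsn hn2 (Nat.cast_nonneg n) hS hS' hdegsum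
    exact le_of_mul_le_mul_right fin hsq

end ModF
end ApproxDecomp

open SimpleGraph
namespace ApproxDecomp
section ModG1
open scoped Classical
open Finset

/-- component types -/
abbrev QT (k : ℕ) := Fin k → Bool × Bool × Bool × Fin k

def QT.pres {k : ℕ} (Q : QT k) (i : Fin k) : Prop := (Q i).1 = true
def QT.odd {k : ℕ} (Q : QT k) (i : Fin k) : Bool := (Q i).2.1
def QT.mark {k : ℕ} (Q : QT k) (i : Fin k) : Prop := (Q i).2.2.1 = true
def QT.qpar {k : ℕ} (Q : QT k) (i : Fin k) : Fin k := (Q i).2.2.2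

variable {N : ℕ} {par : Fin N → Fin N}

/-- a vertex of a component -/
def Cut.comp (C : Cut N par) (v : Fin N) : Prop := v ∉ C.X ∧ v ∉ C.R

/-- a marked vertex -/
def Cut.mk' (C : Cut N par) (v : Fin N) : Prop := (C.top v = v ∧ par v ∈ C.X) ∨ ∃ x ∈ C.X, par x = v

structure Typed (C : Cut N par) (k : ℕ) (idx : Fin N → Fin k) (Q : Fin N → QT k) : Prop where
  inj : ∀ u v, C.comp u → C.comp v → C.top u = C.top v → idx u = idx v → u = v
  pres : ∀ v, C.comp v → (Q (C.top v)).pres (idx v)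
  odd : ∀ v, C.comp v → (Q (C.top v)).odd (idx v) = C.odd v
  mark : ∀ v, C.comp v → ((Q (C.top v)).mark (idx v) ↔ C.mk' v)
  rt : ∀ v, C.comp v → C.top v = v → (Q (C.top v)).qpar (idx v) = idx v ∧ (idx v).val = 0
  nrt : ∀ v, C.comp v → C.top v ≠ v → (Q (C.top v)).qpar (idx v) = idx (par v) ∧ idx (par v) < idx v
  surj : ∀ c, C.ptop c → ∀ i, (Q c).pres i → ∃ v, C.comp v ∧ C.top v = c ∧ idx v = i

theorem typed_exists (hpar : ∀ v, par v ≤ v) (C : Cut N par) (k : ℕ)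
    (hk : ∀ c, #(univ.filter fun u => C.top u = c) ≤ k) :
    ∃ idx Q, Typed C k idx Q := by
  have hlt : ∀ v, #(univ.filter fun u => C.top u = C.top v ∧ u < v) < k := by
    intro v
    refine lt_of_lt_of_le (Finset.card_lt_card ?_) (hk (C.top v))
    rw [Finset.ssubset_iff_of_subset]
    · exact ⟨v, by simp, by simp⟩
    · intro u; simp only [Finset.mem_filter, Finset.mem_univ, true_and]; exact fun h => h.1
  obtain ⟨idx, hidx⟩ : ∃ idx : Fin N → Fin k, ∀ v, (idx v).val = #(univ.filter fun u => C.top u = C.top v ∧ u < v) :=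
    ⟨fun v => ⟨_, hlt v⟩, fun v => rfl⟩
  have hmono : ∀ u v, C.top u = C.top v → u < v → idx u < idx v := by
    intro u v h huv
    rw [Fin.lt_def, hidx, hidx]
    refine Finset.card_lt_card ?_
    rw [Finset.ssubset_iff_of_subset]
    · exact ⟨u, by simp [h, huv], by simp⟩
    · intro w; simp only [Finset.mem_filter, Finset.mem_univ, true_and]
      exact fun hw => ⟨hw.1.trans h, hw.2.trans huv⟩
  have hinj : ∀ u v, C.top u = C.top v → idx u = idx v → u = v := by
    intro u v h he
    rcases lt_trichotomy u v with h1 | h1 | h1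
    · exact absurd he (hmono u v h h1).ne
    · exact h1
    · exact absurd he (hmono v u h.symm h1).ne'
  let Q : Fin N → QT k := fun c i =>
    if h : ∃ v, C.comp v ∧ C.top v = c ∧ idx v = i then
      (true, C.odd h.choose, decide (C.mk' h.choose), if C.top h.choose = h.choose then i else idx (par h.choose))
    else (false, false, false, i)
  have hQ : ∀ v, C.comp v → Q (C.top v) (idx v) =
      (true, C.odd v, decide (C.mk' v), if C.top v = v then idx v else idx (par v)) := by
    intro v hv
    have h : ∃ u, C.comp u ∧ C.top u = C.top v ∧ idx u = idx v := ⟨v, hv, rfl, rfl⟩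
    have hc : h.choose = v := hinj _ _ h.choose_spec.2.1 h.choose_spec.2.2
    simp only [Q]
    rw [dif_pos h, hc]
  refine ⟨idx, Q, ⟨fun u v _ _ h1 h2 => hinj u v h1 h2, ?_, ?_, ?_, ?_, ?_, ?_⟩⟩
  · intro v hv; unfold QT.pres; rw [hQ v hv]
  · intro v hv; unfold QT.odd; rw [hQ v hv]
  · intro v hv; unfold QT.mark; rw [hQ v hv]; simp
  · intro v hv ht; unfold QT.qpar; rw [hQ v hv]
    refine ⟨by simp [ht], ?_⟩
    rw [hidx, Finset.card_eq_zero, Finset.filter_eq_empty_iff]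
    rintro u _ ⟨h1, h2⟩
    have := C.top_le u
    rw [h1, ht] at this
    exact absurd h2 (not_lt.2 this)
  · intro v hv ht; unfold QT.qpar; rw [hQ v hv]
    have h := C.top_par v hv.1 hv.2 ht
    refine ⟨by simp [ht], hmono _ _ h.2.2.1 (lt_of_le_of_ne (hpar v) h.2.2.2)⟩
  · intro c hc i hi
    by_contra h
    have : Q c i = (false, false, false, i) := dif_neg h
    unfold QT.pres at hi
    rw [this] at hi
    exact absurd hi (by simp)

/-- number of components of a given colour -/
noncomputable def Cut.ncol (C : Cut N par) {A : Type*} {k : ℕ} (pc : Fin N → A) (Q : Fin N → QT k) (κ : A × QT k) : ℕ :=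
  #(univ.filter fun c => C.ptop c ∧ (pc c, Q c) = κ)

/-- number of copies of the type needed -/
noncomputable def multOf (B x : ℕ) : ℕ := (x + (B - 1)) / B

lemma multOf_zero (B : ℕ) (hB : 0 < B) : multOf B 0 = 0 := by
  unfold multOf; exact Nat.div_eq_of_lt (by omega)

lemma multOf_le (B x : ℕ) (hB : 0 < B) : x ≤ multOf B x * B := by
  unfold multOf
  have := Nat.lt_div_mul_add (a := x + (B - 1)) hB
  omega

lemma multOf_le' (B x : ℕ) (hB : 0 < B) : multOf B x * B ≤ x + (B - 1) := by
  unfold multOf; exact Nat.div_mul_le_self _ _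

theorem role_count (C : Cut N par) {k m : ℕ} {idx : Fin N → Fin k} {Q : Fin N → QT k} (T : Typed C k idx Q)
    {A : Type*} (pc : Fin N → A) (hpc : ∀ v, C.comp v → pc v = pc (C.top v)) (B : ℕ) (hB : 0 < B)
    (F : QT k → Fin k → Prop) (a : A) :
    (#((univ : Finset (QT k × Fin m × Fin k)).filter fun r =>
      r.2.1.val < multOf B (C.ncol pc Q (a, r.1)) ∧ r.1.pres r.2.2 ∧ F r.1 r.2.2) : ℝ) ≤
    (#((univ : Finset (Fin N)).filter fun v => C.comp v ∧ pc v = a ∧ F (Q (C.top v)) (idx v)) : ℝ) / B +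
      (Fintype.card (QT k) * k : ℕ) := by
  set g : QT k → ℕ := fun q => #((univ : Finset (Fin k)).filter fun i => q.pres i ∧ F q i) with hg
  have hgk : ∀ q, g q ≤ k := fun q => by
    have := Finset.card_filter_le (univ : Finset (Fin k)) (fun i => q.pres i ∧ F q i)
    simpa using this
  have h1 : #((univ : Finset (QT k × Fin m × Fin k)).filter fun r =>
      r.2.1.val < multOf B (C.ncol pc Q (a, r.1)) ∧ r.1.pres r.2.2 ∧ F r.1 r.2.2) ≤
      ∑ q, multOf B (C.ncol pc Q (a, q)) * g q := by
    rw [Finset.card_filter, Fintype.sum_prod_type]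
    refine Finset.sum_le_sum fun q _ => ?_
    rw [← Finset.card_filter]
    have : (univ.filter fun x : Fin m × Fin k => x.1.val < multOf B (C.ncol pc Q (a, q)) ∧ q.pres x.2 ∧ F q x.2) =
        (univ.filter fun j : Fin m => j.val < multOf B (C.ncol pc Q (a, q))) ×ˢ (univ.filter fun i => q.pres i ∧ F q i) := by
      ext ⟨j, i⟩
      simp only [Finset.mem_filter, Finset.mem_univ, true_and, Finset.mem_product]
    rw [this, Finset.card_product]
    refine Nat.mul_le_mul_right _ ?_
    calc #(univ.filter fun j : Fin m => j.val < multOf B (C.ncol pc Q (a, q))) ≤ #(Finset.range (multOf B (C.ncol pc Q (a, q)))) :=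
          Finset.card_le_card_of_injOn (fun j => j.val) (fun j hj => by
            simpa using hj) (fun i _ j _ h => Fin.ext h)
      _ = _ := Finset.card_range _
  have h2 : ∑ q, C.ncol pc Q (a, q) * g q ≤ #((univ : Finset (Fin N)).filter fun v => C.comp v ∧ pc v = a ∧ F (Q (C.top v)) (idx v)) := by
    have e1 : ∀ q, C.ncol pc Q (a, q) * g q =
        ∑ c ∈ (univ.filter fun c => C.ptop c ∧ pc c = a) with Q c = q, g (Q c) := by
      intro q
      rw [Finset.sum_congr rfl (g := fun _ => g q) (fun c hc => by rw [(Finset.mem_filter.1 hc).2]), Finset.sum_const, smul_eq_mul]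
      congr 1
      unfold Cut.ncol
      congr 1; ext c
      simp only [Finset.mem_filter, Finset.mem_univ, true_and, Prod.mk.injEq, and_assoc]
    rw [Finset.sum_congr rfl fun q _ => e1 q]
    rw [Finset.sum_fiberwise]
    rw [hg]
    rw [← Finset.card_sigma]
    have hx : ∀ x : (Σ _ : Fin N, Fin k), ∃ v : Fin N, (C.ptop x.1 ∧ (Q x.1).pres x.2) → C.comp v ∧ C.top v = x.1 ∧ idx v = x.2 := by
      intro x
      by_cases h : C.ptop x.1 ∧ (Q x.1).pres x.2
      · obtain ⟨v, hv⟩ := T.surj x.1 h.1 x.2 h.2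
        exact ⟨v, fun _ => hv⟩
      · exact ⟨x.1, fun h' => absurd h' h⟩
    choose f hf using hx
    refine Finset.card_le_card_of_injOn f ?_ ?_
    · intro x hx
      simp only [Finset.coe_sigma, Set.mem_sigma_iff, Finset.mem_coe, Finset.mem_filter, Finset.mem_univ, true_and] at hx ⊢
      obtain ⟨h1, h2, h3⟩ := hf x ⟨hx.1.1, hx.2.1⟩
      refine ⟨h1, ?_, ?_⟩
      · rw [hpc _ h1, h2]; exact hx.1.2
      · rw [h2, h3]; exact hx.2.2
    · intro x hx x' hx' he
      simp only [Finset.coe_sigma, Set.mem_sigma_iff, Finset.mem_coe, Finset.mem_filter, Finset.mem_univ, true_and] at hx hx'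
      obtain ⟨_, h2, h3⟩ := hf x ⟨hx.1.1, hx.2.1⟩
      obtain ⟨_, h2', h3'⟩ := hf x' ⟨hx'.1.1, hx'.2.1⟩
      rw [he] at h2 h3
      obtain ⟨c, i⟩ := x
      obtain ⟨c', i'⟩ := x'
      simp only at h2 h3 h2' h3'
      have hc : c = c' := h2.symm.trans h2'
      have hi : i = i' := h3.symm.trans h3'
      subst hc; subst hi; rfl
  have hBR : (0:ℝ) < B := by exact_mod_cast hB
  have h3 : ∀ q, (multOf B (C.ncol pc Q (a, q)) * g q : ℝ) ≤ (C.ncol pc Q (a, q) * g q : ℝ) / B + k := by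
    intro q
    have e1 : (multOf B (C.ncol pc Q (a, q)) : ℝ) * B ≤ C.ncol pc Q (a, q) + B := by
      have := multOf_le' B (C.ncol pc Q (a, q)) hB
      exact_mod_cast (by omega : multOf B (C.ncol pc Q (a, q)) * B ≤ C.ncol pc Q (a, q) + B)
    have e2 : (multOf B (C.ncol pc Q (a, q)) : ℝ) ≤ (C.ncol pc Q (a, q) : ℝ) / B + 1 := by
      rw [div_add_one hBR.ne', le_div_iff₀ hBR]; exact e1
    have e3 : (g q : ℝ) ≤ k := by exact_mod_cast hgk q
    calc (multOf B (C.ncol pc Q (a, q)) * g q : ℝ) ≤ ((C.ncol pc Q (a, q) : ℝ) / B + 1) * g q := by gcongr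
      _ = (C.ncol pc Q (a, q) * g q : ℝ) / B + g q := by ring
      _ ≤ _ := by gcongr
  calc _ ≤ ((∑ q, multOf B (C.ncol pc Q (a, q)) * g q : ℕ) : ℝ) := by exact_mod_cast h1
    _ = ∑ q, (multOf B (C.ncol pc Q (a, q)) * g q : ℝ) := by push_cast; rfl
    _ ≤ ∑ q, ((C.ncol pc Q (a, q) * g q : ℝ) / B + k) := Finset.sum_le_sum fun q _ => h3 q
    _ = ((∑ q, C.ncol pc Q (a, q) * g q : ℕ) : ℝ) / B + (Fintype.card (QT k) * k : ℕ) := by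
      rw [Finset.sum_add_distrib, ← Finset.sum_div, Finset.sum_const, Finset.card_univ, nsmul_eq_mul]; push_cast; rfl
    _ ≤ _ := by
      gcongr

end ModG1
end ApproxDecomp

open SimpleGraph
namespace ApproxDecomp
section ModG2
open scoped Classical
open Finset

theorem piece_balance {N L : ℕ} (topR : Fin N → Fin N) (sz : ℕ)
    (hsz : ∀ c, #(univ.filter fun u => topR u = c) ≤ sz) {ι : Type*} [Fintype ι] (P : ι → Fin N → Prop)
    (dom : Finset (Fin L)) (hdom : dom.Nonempty) (err : ℝ) (herr0 : 0 ≤ err)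
    (herr : (Fintype.card ι * L : ℕ) * ((sz : ℝ) * N) ≤ err ^ 2) :
    ∃ f : Fin N → Fin L, (∀ j, f j ∈ dom) ∧ ∀ i a,
      (#(univ.filter fun v => P i v ∧ f (topR v) = a) : ℝ) ≤ (#(univ.filter fun v => P i v) : ℝ) / #dom + err := by
  have hne : Nonempty (Fin L) := ⟨hdom.choose⟩
  have hdc : (0:ℝ) < #dom := by exact_mod_cast hdom.card_pos
  obtain ⟨f, hf1, hf2⟩ := balance (univ : Finset (Fin N)) (Ω := Fin L) (E := ι × Fin L)
    (fun _ ω => if ω ∈ dom then (1:ℝ) / #dom else 0)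
    (by intro j _ ω; beta_reduce; split_ifs <;> positivity)
    (by
      intro j _
      rw [← Finset.sum_filter, Finset.sum_const, Finset.filter_mem_eq_inter, Finset.univ_inter, nsmul_eq_mul]
      field_simp)
    (fun j ω e => if ω = e.2 then (#(univ.filter fun v => P e.1 v ∧ topR v = j) : ℝ) else 0)
    (fun j => (#(univ.filter fun v => topR v = j) : ℝ))
    (by intro j _ ω e; beta_reduce; split_ifs <;> positivity)
    (by
      intro j _ ω e; beta_reduce
      split_ifs
      · exact_mod_cast Finset.card_le_card fun v hv => by
          simp only [Finset.mem_filter, Finset.mem_univ, true_and] at hv ⊢; exact hv.2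
      · positivity)
    err herr0
    (by
      refine le_trans ?_ herr
      rw [Fintype.card_prod, Fintype.card_fin]
      refine mul_le_mul_of_nonneg_left ?_ (by positivity)
      have h1 : ∑ j : Fin N, #(univ.filter fun v => topR v = j) = N := by
        have := Finset.sum_card_fiberwise_eq_card_filter (univ : Finset (Fin N)) (univ : Finset (Fin N)) topR
        simpa using this
      calc ∑ j : Fin N, (#(univ.filter fun v => topR v = j) : ℝ) ^ 2 ≤ ∑ j : Fin N, (sz : ℝ) * (#(univ.filter fun v => topR v = j) : ℝ) := by
            refine Finset.sum_le_sum fun j _ => ?_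
            rw [sq]
            refine mul_le_mul_of_nonneg_right ?_ (by positivity)
            exact_mod_cast hsz j
        _ = sz * N := by rw [← Finset.mul_sum]; congr 1; exact_mod_cast h1)
  refine ⟨f, ?_, ?_⟩
  · intro j
    have := hf1 j (Finset.mem_univ j)
    by_contra h
    simp only [if_neg h] at this
    exact lt_irrefl _ this
  · intro i a
    have h := hf2 (i, a)
    have e1 : ∑ j : Fin N, (if f j = a then (#(univ.filter fun v => P i v ∧ topR v = j) : ℝ) else 0) =
        (#(univ.filter fun v => P i v ∧ f (topR v) = a) : ℝ) := by
      rw [← Finset.sum_filter]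
      have : (univ.filter fun v => P i v ∧ f (topR v) = a) =
          (univ.filter fun j => f j = a).biUnion fun j => univ.filter fun v => P i v ∧ topR v = j := by
        ext v
        simp only [Finset.mem_filter, Finset.mem_univ, true_and, Finset.mem_biUnion]
        constructor
        · rintro ⟨h1, h2⟩; exact ⟨_, h2, h1, rfl⟩
        · rintro ⟨j, h2, h1, rfl⟩; exact ⟨h1, h2⟩
      rw [this, Finset.card_biUnion]
      · push_cast; rfl
      · intro j _ j' _ hjj
        refine Finset.disjoint_left.2 fun v h1 h2 => ?_
        simp only [Finset.mem_filter, Finset.mem_univ, true_and] at h1 h2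
        exact hjj (h1.2.symm.trans h2.2)
    have e2 : ∑ j : Fin N, ∑ ω : Fin L, (if ω ∈ dom then (1:ℝ) / #dom else 0) *
        (if ω = a then (#(univ.filter fun v => P i v ∧ topR v = j) : ℝ) else 0) ≤ (#(univ.filter fun v => P i v) : ℝ) / #dom := by
      have h3 : ∑ j : Fin N, (#(univ.filter fun v => P i v ∧ topR v = j) : ℝ) = (#(univ.filter fun v => P i v) : ℝ) := by
        have := Finset.sum_card_fiberwise_eq_card_filter (univ.filter fun v => P i v) (univ : Finset (Fin N)) topR
        simp only [Finset.filter_filter, Finset.mem_univ, and_true] at this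
        exact_mod_cast this
      rw [← h3, Finset.sum_div]
      refine Finset.sum_le_sum fun j _ => ?_
      simp only [mul_ite, mul_zero, Finset.sum_ite_eq', Finset.mem_univ, if_true]
      split_ifs
      · rw [one_div, mul_comm, div_eq_mul_inv]
      · rw [zero_mul]; positivity
    simp only at h
    rw [e1] at h
    linarith

end ModG2
end ApproxDecomp

open SimpleGraph
namespace ApproxDecomp
section ModG3
open scoped Classical
open Finset

theorem sigma_select {L T : ℕ} (hL : 0 < L) (D : Fin L → Fin L → ℝ) (hD : ∀ a b, 0 ≤ D a b)
    (hr : ∀ a, ∑ b, D a b ≤ 1) (hc : ∀ b, ∑ a, D a b ≤ 1) (η : ℝ) (hη : 0 < η) (hη1 : η < 1)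
    (htot : (1 - η ^ 2) * L ≤ ∑ a, ∑ b, D a b)
    {ι : Type*} [Fintype ι] (x : ι → Fin T → ℝ) (hx0 : ∀ i t, 0 ≤ x i t) (hx1 : ∀ i t, x i t ≤ 1)
    (err : ℝ) (herr0 : 0 ≤ err) (herr : (Fintype.card ι * L ^ 2 : ℕ) * (T : ℝ) ≤ err ^ 2) :
    ∃ (σ : Fin T → Fin L → Fin L) (dom : Fin T → Finset (Fin L)),
      (∀ t, (1 - η) * L ≤ (#(dom t) : ℝ)) ∧ (∀ t, Set.InjOn (σ t) (dom t)) ∧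
      (∀ t, ∀ a ∈ dom t, D a (σ t a) ≠ 0) ∧
      (∀ i a b, ∑ t, (if a ∈ dom t ∧ σ t a = b then x i t else 0) ≤ (∑ t, x i t) * (D a b / (1 - η)) + err) := by
  have hA : Nonempty (Fin L) := ⟨⟨0, hL⟩⟩
  obtain ⟨w, hw0, hw1, hw2, hw3, hw4⟩ := partial_perms D hD hr hc η hη hη1 (by simpa using htot)
  obtain ⟨f, hf1, hf2⟩ := balance (univ : Finset (Fin T)) (Ω := Equiv.Perm (Fin L ⊕ Fin L)) (E := ι × Fin L × Fin L)
    (fun _ π => w π) (fun _ _ => hw0) (fun _ _ => hw1)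
    (fun t π e => if ps π e.2.1 = some e.2.2 then x e.1 t else 0) (fun _ => 1)
    (by intro t _ π e; split_ifs; exact hx0 _ _; exact le_rfl)
    (by intro t _ π e; split_ifs; exact hx1 _ _; exact zero_le_one)
    err herr0 (by
      refine le_trans (le_of_eq ?_) herr
      simp [Fintype.card_prod, sq])
  have hσ : ∀ t a, ∃ b, (∃ b', ps (f t) a = some b') → ps (f t) a = some b := by
    intro t a
    by_cases h : ∃ b', ps (f t) a = some b'
    · exact ⟨h.choose, fun _ => h.choose_spec⟩
    · exact ⟨a, fun h' => absurd h' h⟩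
  choose σ hσ using hσ
  refine ⟨σ, fun t => univ.filter fun a => ∃ b, ps (f t) a = some b, ?_, ?_, ?_, ?_⟩
  · intro t
    have := hw2 (f t) (hf1 t (Finset.mem_univ t))
    rw [Fintype.card_fin] at this
    convert this using 4
  · intro t a ha a' ha' h
    simp only [Finset.coe_filter, Finset.mem_univ, true_and, Set.mem_setOf_eq] at ha ha'
    have h1 := hσ t a ha
    have h2 := hσ t a' ha'
    rw [← h] at h2
    exact ps_inj _ h1 h2
  · intro t a ha
    simp only [Finset.mem_filter, Finset.mem_univ, true_and] at ha
    exact (hw3 (f t) (hf1 t (Finset.mem_univ t)) a _ (hσ t a ha)).ne'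
  · intro i a b
    have h := hf2 (i, a, b)
    simp only at h
    have e1 : ∀ t, (if a ∈ (univ.filter fun a => ∃ b, ps (f t) a = some b) ∧ σ t a = b then x i t else 0) =
        if ps (f t) a = some b then x i t else 0 := by
      intro t
      have : (a ∈ (univ.filter fun a => ∃ b, ps (f t) a = some b) ∧ σ t a = b) ↔ ps (f t) a = some b := by
        simp only [Finset.mem_filter, Finset.mem_univ, true_and]
        constructor
        · rintro ⟨h1, h2⟩; rw [← h2]; exact hσ t a h1
        · intro h1
          refine ⟨⟨b, h1⟩, ?_⟩
          have := hσ t a ⟨b, h1⟩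
          rw [h1] at this
          exact (Option.some.inj this).symm
      by_cases h : ps (f t) a = some b
      · rw [if_pos h, if_pos (this.2 h)]
      · rw [if_neg h, if_neg (fun hh => h (this.1 hh))]
    simp only [e1]
    refine le_trans h ?_
    refine add_le_add ?_ le_rfl
    rw [Finset.sum_mul]
    refine Finset.sum_le_sum fun t _ => ?_
    calc ∑ π, w π * (if ps π a = some b then x i t else 0) = x i t * ∑ π, w π * (if ps π a = some b then 1 else 0) := by
          rw [Finset.mul_sum]
          refine Finset.sum_congr rfl fun π _ => ?_
          split_ifs <;> ring
      _ ≤ _ := mul_le_mul_of_nonneg_left (hw4 a b) (hx0 i t)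

end ModG3
end ApproxDecomp

open SimpleGraph
namespace ApproxDecomp
section ModG4
open scoped Classical
open Finset

lemma shift_count2 {L m : ℕ} (b b' : Fin L) (hb : b ≠ b') (i i' : Fin m) :
    #((univ : Finset (Fin L → Fin m)).filter fun s => s b = i ∧ s b' = i') * (m * m) = m ^ L := by
  have h1 : ((univ : Finset (Fin L → Fin m)).filter fun s => s b = i ∧ s b' = i') =
      Fintype.piFinset (fun c => if c = b then {i} else if c = b' then {i'} else univ) := by
    ext s
    simp only [Finset.mem_filter, Finset.mem_univ, true_and, Fintype.mem_piFinset]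
    constructor
    · rintro ⟨h1, h2⟩ c
      split_ifs with h3 h4
      · rw [h3, h1]; simp
      · rw [h4, h2]; simp
      · simp
    · intro h
      refine ⟨?_, ?_⟩
      · have := h b; simpa using this
      · have := h b'; rw [if_neg hb.symm, if_pos rfl] at this; simpa using this
  have h2 : ∀ c : Fin L, #((if c = b then {i} else if c = b' then {i'} else univ : Finset (Fin m))) *
      ((if c = b then m else 1) * (if c = b' then m else 1)) = m := by
    intro c
    by_cases h : c = b
    · have h' : c ≠ b' := fun hh => hb (h.symm.trans hh)
      rw [if_pos h, if_pos h, if_neg h']; simp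
    · by_cases h' : c = b'
      · rw [if_neg h, if_pos h', if_neg h, if_pos h']; simp
      · rw [if_neg h, if_neg h', if_neg h, if_neg h']; simp
  rw [h1, Fintype.card_piFinset]
  calc _ = ∏ c : Fin L, (#((if c = b then {i} else if c = b' then {i'} else univ : Finset (Fin m))) *
      ((if c = b then m else 1) * (if c = b' then m else 1))) := by
        rw [Finset.prod_mul_distrib, Finset.prod_mul_distrib]
        simp
    _ = m ^ L := by
        rw [Finset.prod_congr rfl fun c _ => h2 c]; simp

lemma shift_count1 {L m : ℕ} (b : Fin L) (i : Fin m) :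
    #((univ : Finset (Fin L → Fin m)).filter fun s => s b = i) * m = m ^ L := by
  have h1 : ((univ : Finset (Fin L → Fin m)).filter fun s => s b = i) =
      Fintype.piFinset (fun c => if c = b then {i} else univ) := by
    ext s
    simp only [Finset.mem_filter, Finset.mem_univ, true_and, Fintype.mem_piFinset]
    constructor
    · rintro h1 c
      split_ifs with h3
      · rw [h3, h1]; simp
      · simp
    · intro h
      have := h b; simpa using this
  have h2 : ∀ c : Fin L, #((if c = b then {i} else univ : Finset (Fin m))) * (if c = b then m else 1) = m := by
    intro c
    by_cases h : c = b
    · rw [if_pos h, if_pos h]; simp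
    · rw [if_neg h, if_neg h]; simp
  rw [h1, Fintype.card_piFinset]
  calc _ = ∏ c : Fin L, (#((if c = b then {i} else univ : Finset (Fin m))) * (if c = b then m else 1)) := by
        rw [Finset.prod_mul_distrib]
        simp
    _ = m ^ L := by
        rw [Finset.prod_congr rfl fun c _ => h2 c]; simp

lemma place_exists {Ro : Type*} {L m : ℕ} (hm : 0 < m) (act : Finset Ro) (cl : Ro → Fin L)
    (h : ∀ b, #(act.filter fun ρ => cl ρ = b) ≤ m) :
    ∃ pl : Ro → Fin m, ∀ ρ ∈ act, ∀ ρ' ∈ act, cl ρ = cl ρ' → pl ρ = pl ρ' → ρ = ρ' := by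
  have h1 : ∀ b, ∃ f : Ro → Fin m, Set.InjOn f (act.filter fun ρ => cl ρ = b) := by
    intro b
    have hne : Nonempty (Fin m) := ⟨⟨0, hm⟩⟩
    obtain ⟨f, _, hf⟩ := distinct_reps (act.filter fun ρ => cl ρ = b) (fun _ => (univ : Finset (Fin m)))
      (by intro c _; simpa using h b)
    exact ⟨f, hf⟩
  choose f hf using h1
  refine ⟨fun ρ => f (cl ρ) ρ, fun ρ hρ ρ' hρ' hc he => ?_⟩
  simp only at he
  rw [hc] at he
  exact hf (cl ρ') (by simp [hρ, hc]) (by simp [hρ']) he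

theorem shifts_exist {Ro : Type*} [Fintype Ro] {L m T : ℕ} (hm : 0 < m)
    (act : Fin T → Finset Ro) (cl : Fin T → Ro → Fin L) (hact : ∀ t b, #((act t).filter fun ρ => cl t ρ = b) ≤ m)
    (pr : Ro → Ro) (eg mkd : Fin T → Finset Ro) (cs : Ro → Fin L) (err : ℝ) (herr0 : 0 ≤ err)
    (herr : (((L * m) * (L * m) + L * (L * m) : ℕ) : ℝ) * (T * (Fintype.card Ro : ℝ) ^ 2) ≤ err ^ 2) :
    ∃ part : Fin T → Ro → Fin L × Fin m,
      (∀ t ρ, (part t ρ).1 = cl t ρ) ∧ (∀ t, Set.InjOn (part t) (act t)) ∧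
      (∀ P P' : Fin L × Fin m, P.1 ≠ P'.1 →
        ∑ t, (#((eg t).filter fun ρ => part t ρ = P ∧ part t (pr ρ) = P') : ℝ) ≤
          (∑ t, (#((eg t).filter fun ρ => cl t ρ = P.1 ∧ cl t (pr ρ) = P'.1) : ℝ)) / (m * m) + err) ∧
      (∀ a (P : Fin L × Fin m),
        ∑ t, (#((mkd t).filter fun ρ => cs ρ = a ∧ part t ρ = P) : ℝ) ≤
          (∑ t, (#((mkd t).filter fun ρ => cs ρ = a ∧ cl t ρ = P.1) : ℝ)) / m + err) := by
  choose pl hpl using fun t => place_exists hm (act t) (cl t) (hact t)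
  haveI : NeZero m := ⟨hm.ne'⟩
  have hmR : (0:ℝ) < m := by exact_mod_cast hm
  have hmL : (0:ℝ) < (m:ℝ) ^ L := by positivity
  obtain ⟨f, -, hf⟩ := balance (univ : Finset (Fin T)) (Ω := Fin L → Fin m)
    (E := ((Fin L × Fin m) × (Fin L × Fin m)) ⊕ (Fin L × (Fin L × Fin m)))
    (fun _ _ => 1 / (m:ℝ) ^ L) (fun _ _ _ => by positivity)
    (fun _ _ => by simp)
    (fun t s e => Sum.elim
      (fun e => (#((eg t).filter fun ρ => (cl t ρ, pl t ρ + s (cl t ρ)) = e.1 ∧ (cl t (pr ρ), pl t (pr ρ) + s (cl t (pr ρ))) = e.2) : ℝ))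
      (fun e => (#((mkd t).filter fun ρ => cs ρ = e.1 ∧ (cl t ρ, pl t ρ + s (cl t ρ)) = e.2) : ℝ)) e)
    (fun _ => (Fintype.card Ro : ℝ))
    (by rintro t _ s (e | e) <;> simp)
    (by
      rintro t _ s (e | e)
      · simp only [Sum.elim_inl]; exact_mod_cast Finset.card_le_univ _
      · simp only [Sum.elim_inr]; exact_mod_cast Finset.card_le_univ _)
    err herr0 (by
      refine le_trans (le_of_eq ?_) herr
      simp only [Finset.sum_const, Finset.card_univ, Fintype.card_fin, nsmul_eq_mul, Fintype.card_sum, Fintype.card_prod])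
  refine ⟨fun t ρ => (cl t ρ, pl t ρ + f t (cl t ρ)), fun t ρ => rfl, ?_, ?_, ?_⟩
  · intro t ρ hρ ρ' hρ' h
    simp only [Prod.mk.injEq] at h
    refine hpl t ρ hρ ρ' hρ' h.1 ?_
    have h2 := h.2
    rw [h.1] at h2
    exact add_right_cancel h2
  · intro P P' hP
    refine le_trans (hf (Sum.inl (P, P'))) (add_le_add ?_ le_rfl)
    rw [Finset.sum_div]
    refine Finset.sum_le_sum fun t _ => ?_
    simp only [Sum.elim_inl]
    rw [← Finset.mul_sum]
    have h1 : ∑ s : Fin L → Fin m, (#((eg t).filter fun ρ => (cl t ρ, pl t ρ + s (cl t ρ)) = P ∧ (cl t (pr ρ), pl t (pr ρ) + s (cl t (pr ρ))) = P') : ℝ)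
        = ∑ ρ ∈ (eg t).filter (fun ρ => cl t ρ = P.1 ∧ cl t (pr ρ) = P'.1),
          (#((univ : Finset (Fin L → Fin m)).filter fun s => s P.1 = P.2 - pl t ρ ∧ s P'.1 = P'.2 - pl t (pr ρ)) : ℝ) := by
      simp only [Finset.card_filter]
      push_cast
      rw [Finset.sum_comm, Finset.sum_filter]
      refine Finset.sum_congr rfl fun ρ _ => ?_
      by_cases h : cl t ρ = P.1 ∧ cl t (pr ρ) = P'.1
      · rw [if_pos h]
        refine Finset.sum_congr rfl fun s _ => ?_
        congr 1
        obtain ⟨p1, p2⟩ := P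
        obtain ⟨p1', p2'⟩ := P'
        simp only [Prod.mk.injEq, eq_iff_iff]
        simp only at h
        rw [h.1, h.2]
        simp only [true_and, eq_sub_iff_add_eq']
      · rw [if_neg h]
        refine Finset.sum_eq_zero fun s _ => if_neg ?_
        rintro ⟨h1, h2⟩
        exact h ⟨by rw [← h1], by rw [← h2]⟩
    rw [h1]
    have h2 : ∀ ρ, (#((univ : Finset (Fin L → Fin m)).filter fun s => s P.1 = P.2 - pl t ρ ∧ s P'.1 = P'.2 - pl t (pr ρ)) : ℝ) = m ^ L / (m * m) := by
      intro ρ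
      rw [eq_div_iff (by positivity)]
      exact_mod_cast shift_count2 P.1 P'.1 hP _ _
    rw [Finset.sum_congr rfl fun ρ _ => h2 ρ, Finset.sum_const, nsmul_eq_mul]
    apply le_of_eq
    field_simp
  · intro a P
    refine le_trans (hf (Sum.inr (a, P))) (add_le_add ?_ le_rfl)
    rw [Finset.sum_div]
    refine Finset.sum_le_sum fun t _ => ?_
    simp only [Sum.elim_inr]
    rw [← Finset.mul_sum]
    have h1 : ∑ s : Fin L → Fin m, (#((mkd t).filter fun ρ => cs ρ = a ∧ (cl t ρ, pl t ρ + s (cl t ρ)) = P) : ℝ)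
        = ∑ ρ ∈ (mkd t).filter (fun ρ => cs ρ = a ∧ cl t ρ = P.1),
          (#((univ : Finset (Fin L → Fin m)).filter fun s => s P.1 = P.2 - pl t ρ) : ℝ) := by
      simp only [Finset.card_filter]
      push_cast
      rw [Finset.sum_comm, Finset.sum_filter]
      refine Finset.sum_congr rfl fun ρ _ => ?_
      by_cases h : cs ρ = a ∧ cl t ρ = P.1
      · rw [if_pos h]
        refine Finset.sum_congr rfl fun s _ => ?_
        congr 1
        obtain ⟨p1, p2⟩ := P
        simp only [Prod.mk.injEq, eq_iff_iff]
        simp only at h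
        rw [h.1, h.2]
        simp only [true_and, eq_sub_iff_add_eq']
      · rw [if_neg h]
        refine Finset.sum_eq_zero fun s _ => if_neg ?_
        rintro ⟨h1, h2⟩
        exact h ⟨h1, by rw [← h2]⟩
    rw [h1]
    have h2 : ∀ ρ, (#((univ : Finset (Fin L → Fin m)).filter fun s => s P.1 = P.2 - pl t ρ) : ℝ) = m ^ L / m := by
      intro ρ
      rw [eq_div_iff (by positivity)]
      exact_mod_cast shift_count1 P.1 _
    rw [Finset.sum_congr rfl fun ρ _ => h2 ρ, Finset.sum_const, nsmul_eq_mul]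
    apply le_of_eq
    field_simp

end ModG4
end ApproxDecomp

open SimpleGraph
namespace ApproxDecomp
section ModG5
open scoped Classical
open Finset

lemma heavy_few {n : ℕ} {G : SimpleGraph (Fin n)} {α ε d0 : ℝ} {L s : ℕ} {V : Fin L → Finset (Fin n)}
    {d : Fin L → Fin L → ℝ} (H : Host G α ε d0 L s V d) (hε : 0 ≤ ε) (a b : Fin L) (hd : d a b ≠ 0)
    (W : Finset (Fin n)) (hW : W ⊆ V b) (hWs : ε * s ≤ #W) (A : Finset (Fin n)) (hA : A ⊆ V a)
    (hsp : 0 < s)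
    (hA' : ∀ v ∈ A, (d a b + ε) * #W < (#(W.filter fun w => G.Adj v w) : ℝ)) : (#A : ℝ) ≤ ε * s := by
  by_contra hcon
  push Not at hcon
  have h1 := H.reg a b hd A hA W hW hcon.le hWs
  have h2 : (ec G A W : ℝ) ≤ (d a b + ε) * #W * #A := by
    have := (abs_le.1 h1).2
    nlinarith
  have h3 : (ec G A W : ℝ) = ∑ v ∈ A, (#(W.filter fun w => G.Adj v w) : ℝ) := by
    rw [ec_sum_left]; push_cast; rfl
  have hne : A.Nonempty := by
    rw [← Finset.card_pos]
    have : (0:ℝ) < #A := lt_of_le_of_lt (by positivity) hcon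
    exact_mod_cast this
  have h4 : ∑ v ∈ A, (d a b + ε) * (#W:ℝ) < ∑ v ∈ A, (#(W.filter fun w => G.Adj v w) : ℝ) :=
    Finset.sum_lt_sum_of_nonempty hne hA'
  rw [Finset.sum_const, nsmul_eq_mul] at h4
  nlinarith

lemma light_few {n : ℕ} {G : SimpleGraph (Fin n)} {α ε d0 : ℝ} {L s : ℕ} {V : Fin L → Finset (Fin n)}
    {d : Fin L → Fin L → ℝ} (H : Host G α ε d0 L s V d) (hε : 0 ≤ ε) (a b : Fin L) (hd : d a b ≠ 0)
    (W : Finset (Fin n)) (hW : W ⊆ V b) (hWs : ε * s ≤ #W) (A : Finset (Fin n)) (hA : A ⊆ V a)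
    (hsp : 0 < s)
    (hA' : ∀ v ∈ A, (#(W.filter fun w => G.Adj v w) : ℝ) < (d a b - ε) * #W) : (#A : ℝ) ≤ ε * s := by
  by_contra hcon
  push Not at hcon
  have h1 := H.reg a b hd A hA W hW hcon.le hWs
  have h2 : (d a b - ε) * #W * #A ≤ (ec G A W : ℝ) := by
    have := (abs_le.1 h1).1
    nlinarith
  have h3 : (ec G A W : ℝ) = ∑ v ∈ A, (#(W.filter fun w => G.Adj v w) : ℝ) := by
    rw [ec_sum_left]; push_cast; rfl
  have hne : A.Nonempty := by
    rw [← Finset.card_pos]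
    have : (0:ℝ) < #A := lt_of_le_of_lt (by positivity) hcon
    exact_mod_cast this
  have h4 : ∑ v ∈ A, (#(W.filter fun w => G.Adj v w) : ℝ) < ∑ v ∈ A, (d a b - ε) * (#W:ℝ) :=
    Finset.sum_lt_sum_of_nonempty hne hA'
  rw [Finset.sum_const, nsmul_eq_mul] at h4
  nlinarith

lemma pm_arith (D q δ p dd ε s η d0 E : ℝ) (hδ : 0 < δ) (hp : 0 < p) (hε : 0 ≤ ε)
    (h1 : (D - q) * (δ * p) ≤ D * p - E) (hD1 : (dd + ε) * p ≤ D) (hD2 : D ≤ (dd + ε) * p + 1)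
    (hE : (dd - ε) * p * p - 2 * (ε * s * p) ≤ E) (hη : 0 ≤ η) (hdd : d0 ≤ dd)
    (hsm : 2 * ε * p + 1 + 2 * ε * s ≤ δ * (η * d0 * p)) : (1 - η) * dd * p ≤ q := by
  have h2 : (D - q) * δ * p ≤ (2 * ε * p + 1 + 2 * ε * s) * p := by nlinarith
  have h3 : (D - q) * δ ≤ (2 * ε * p + 1 + 2 * ε * s) := le_of_mul_le_mul_right h2 hp
  have h4 : (D - q) * δ ≤ (η * d0 * p) * δ := by linarith
  have h5 : D - q ≤ η * d0 * p := le_of_mul_le_mul_right h4 hδ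
  have h6 : η * d0 * p ≤ η * dd * p := by gcongr
  nlinarith

lemma pair_match {n : ℕ} {G : SimpleGraph (Fin n)} {α ε d0 : ℝ} {L s : ℕ} {V : Fin L → Finset (Fin n)}
    {d : Fin L → Fin L → ℝ} (H : Host G α ε d0 L s V d) (hε : 0 ≤ ε) (a b : Fin L) (hd : d a b ≠ 0)
    (hs : 0 < s) (p : ℕ) (hp : 0 < p) (hps : ε * s ≤ p) (δ η : ℝ) (hδ : 0 < δ) (hη : 0 ≤ η)
    (hsm : 2 * ε * p + 1 + 2 * ε * s ≤ δ * (η * d0 * p))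
    (x y : Fin p → Fin n) (hx : Function.Injective x) (hy : Function.Injective y)
    (hxV : ∀ i, x i ∈ V a) (hyV : ∀ i, y i ∈ V b) :
    ∃ (q : ℕ) (π : Fin q → Equiv.Perm (Fin p)) (gd : Fin q → Fin p → Prop),
      (∀ c i, gd c i → G.Adj (x i) (y (π c i))) ∧
      (∀ c, (#(univ.filter fun i => ¬ gd c i) : ℝ) ≤ δ * p) ∧
      (∀ c c' i, gd c i → gd c' i → π c i = π c' i → c = c') ∧
      (1 - η) * d a b * p ≤ q := by
  have hW : ∀ z : Fin p → Fin n, Function.Injective z → ∀ (P : Fin n → Prop),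
      #((univ.image z).filter P) = #(univ.filter fun i => P (z i)) := by
    intro z hz P
    rw [Finset.filter_image, Finset.card_image_of_injective _ hz]
  have hcx : ∀ z : Fin p → Fin n, Function.Injective z → #(univ.image z) = p := by
    intro z hz; rw [Finset.card_image_of_injective _ hz]; simp
  obtain ⟨D, hD⟩ : ∃ D : ℕ, D = ⌈(d a b + ε) * p⌉₊ := ⟨_, rfl⟩
  have hd0 : 0 ≤ (d a b + ε) * p := by have := H.nonneg a b; positivity
  have hD1 : (d a b + ε) * p ≤ D := by rw [hD]; exact Nat.le_ceil _
  have hD2 : (D : ℝ) ≤ (d a b + ε) * p + 1 := by rw [hD]; exact (Nat.ceil_lt_add_one hd0).le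
  obtain ⟨rg, hrg⟩ : ∃ rg : Fin p → ℕ, rg = fun i => #(univ.filter fun j => G.Adj (x i) (y j)) := ⟨_, rfl⟩
  obtain ⟨cg, hcg⟩ : ∃ cg : Fin p → ℕ, cg = fun j => #(univ.filter fun i => G.Adj (x i) (y j)) := ⟨_, rfl⟩
  obtain ⟨HH, hHH⟩ : ∃ HH : Fin p → Fin p → Prop, ∀ i j, HH i j ↔ G.Adj (x i) (y j) ∧ rg i ≤ D ∧ cg j ≤ D := ⟨fun i j => G.Adj (x i) (y j) ∧ rg i ≤ D ∧ cg j ≤ D, fun _ _ => Iff.rfl⟩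
  have hbr : (#(univ.filter fun i => ¬ rg i ≤ D) : ℝ) ≤ ε * s := by
    have := heavy_few H hε a b hd (univ.image y) (by intro v hv; simp only [Finset.mem_image, Finset.mem_univ, true_and] at hv; obtain ⟨i, rfl⟩ := hv; exact hyV i)
      (by rw [hcx y hy]; exact hps) ((univ.filter fun i => ¬ rg i ≤ D).image x)
      (by intro v hv; simp only [Finset.mem_image, Finset.mem_filter] at hv; obtain ⟨i, _, rfl⟩ := hv; exact hxV i) hs
      (by
        intro v hv
        simp only [Finset.mem_image, Finset.mem_filter, Finset.mem_univ, true_and, not_le] at hv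
        obtain ⟨i, hi, rfl⟩ := hv
        rw [hW y hy, hcx y hy]
        refine lt_of_le_of_lt hD1 ?_
        rw [hrg] at hi
        exact_mod_cast hi)
    rwa [Finset.card_image_of_injective _ hx] at this
  have hbc : (#(univ.filter fun i => ¬ cg i ≤ D) : ℝ) ≤ ε * s := by
    have := heavy_few H hε b a (by rw [H.symm]; exact hd) (univ.image x) (by intro v hv; simp only [Finset.mem_image, Finset.mem_univ, true_and] at hv; obtain ⟨i, rfl⟩ := hv; exact hxV i)
      (by rw [hcx x hx]; exact hps) ((univ.filter fun i => ¬ cg i ≤ D).image y)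
      (by intro v hv; simp only [Finset.mem_image, Finset.mem_filter] at hv; obtain ⟨i, _, rfl⟩ := hv; exact hyV i) hs
      (by
        intro v hv
        simp only [Finset.mem_image, Finset.mem_filter, Finset.mem_univ, true_and, not_le] at hv
        obtain ⟨i, hi, rfl⟩ := hv
        rw [hW x hx, hcx x hx, H.symm]
        refine lt_of_le_of_lt hD1 ?_
        have h2 : cg i = #(univ.filter fun j => G.Adj (y i) (x j)) := by
          simp only [hcg]; congr 1; ext j; simp only [Finset.mem_filter, Finset.mem_univ, true_and]; exact G.adj_comm _ _
        rw [h2] at hi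
        exact_mod_cast hi)
    rwa [Finset.card_image_of_injective _ hy] at this
  have hE0 : (ec G (univ.image x) (univ.image y) : ℝ) = #(univ.filter fun e : Fin p × Fin p => G.Adj (x e.1) (y e.2)) := by
    rw [ec_sum_left, Finset.sum_image (fun a _ b _ h => hx h)]
    have : ∀ i, #((univ.image y).filter fun w => G.Adj (x i) w) = rg i := fun i => by rw [hrg]; exact hW y hy _
    rw [Finset.sum_congr rfl fun i _ => this i]
    simp only [hrg, Finset.card_filter]
    rw [← Finset.univ_product_univ, Finset.sum_product]
  have hE1 : (d a b - ε) * p * p ≤ (ec G (univ.image x) (univ.image y) : ℝ) := by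
    have := (abs_le.1 (H.reg a b hd (univ.image x) (by intro v hv; simp only [Finset.mem_image, Finset.mem_univ, true_and] at hv; obtain ⟨i, rfl⟩ := hv; exact hxV i)
      (univ.image y) (by intro v hv; simp only [Finset.mem_image, Finset.mem_univ, true_and] at hv; obtain ⟨i, rfl⟩ := hv; exact hyV i)
      (by rw [hcx x hx]; exact hps) (by rw [hcx y hy]; exact hps))).1
    rw [hcx x hx, hcx y hy] at this
    nlinarith
  have hE2 : #(univ.filter fun e : Fin p × Fin p => G.Adj (x e.1) (y e.2)) ≤
      #(univ.filter fun e : Fin p × Fin p => HH e.1 e.2) + (#(univ.filter fun i => ¬ rg i ≤ D) * p + p * #(univ.filter fun i => ¬ cg i ≤ D)) := by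
    have hsub : (univ.filter fun e : Fin p × Fin p => G.Adj (x e.1) (y e.2)) ⊆
        (univ.filter fun e : Fin p × Fin p => HH e.1 e.2) ∪
          (((univ.filter fun i => ¬ rg i ≤ D) ×ˢ univ) ∪ (univ ×ˢ (univ.filter fun i => ¬ cg i ≤ D))) := by
      rintro ⟨i, j⟩ h
      simp only [Finset.mem_filter, Finset.mem_univ, true_and, Finset.mem_union, Finset.mem_product, and_true, hHH] at h ⊢
      tauto
    refine le_trans (Finset.card_le_card hsub) (le_trans (Finset.card_union_le _ _) (add_le_add le_rfl (le_trans (Finset.card_union_le _ _) ?_)))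
    rw [Finset.card_product, Finset.card_product]; simp
  obtain ⟨q, π, gd, h1, h2, h3, h4⟩ := matchings p D HH
    (by
      intro i
      by_cases h : rg i ≤ D
      · rw [hrg] at h
        refine le_trans (Finset.card_le_card ?_) h
        intro j; simp only [hHH, Finset.mem_filter, Finset.mem_univ, true_and]; exact fun h => h.1
      · refine le_trans (le_of_eq ?_) (Nat.zero_le _)
        rw [Finset.card_eq_zero, Finset.filter_eq_empty_iff]
        intro j _ hj; exact h ((hHH _ _).1 hj).2.1)
    (by
      intro i
      by_cases h : cg i ≤ D
      · rw [hcg] at h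
        refine le_trans (Finset.card_le_card ?_) h
        intro j; simp only [hHH, Finset.mem_filter, Finset.mem_univ, true_and]; exact fun h => h.1
      · refine le_trans (le_of_eq ?_) (Nat.zero_le _)
        rw [Finset.card_eq_zero, Finset.filter_eq_empty_iff]
        intro j _ hj; exact h ((hHH _ _).1 hj).2.2) δ hδ
  refine ⟨q, π, gd, fun c i h => ((hHH _ _).1 (h1 c i h)).1, h2, h3, ?_⟩
  have hpR : (0:ℝ) < p := by exact_mod_cast hp
  refine pm_arith D q δ p (d a b) ε s η d0 _ hδ hpR hε h4 hD1 hD2 ?_ hη (H.lower a b hd) hsm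
  have hE3 : (#(univ.filter fun e : Fin p × Fin p => G.Adj (x e.1) (y e.2)) : ℝ) ≤
      #(univ.filter fun e : Fin p × Fin p => HH e.1 e.2) + (#(univ.filter fun i => ¬ rg i ≤ D) * p + p * #(univ.filter fun i => ¬ cg i ≤ D)) := by
    exact_mod_cast hE2
  rw [hE0] at hE1
  have e1 : (#(univ.filter fun i => ¬ rg i ≤ D) : ℝ) * p ≤ ε * s * p := by gcongr
  have e2 : (p:ℝ) * (#(univ.filter fun i => ¬ cg i ≤ D) : ℝ) ≤ ε * s * p := by rw [mul_comm]; gcongr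
  linarith

lemma perm_apply_inv {A : Type*} (f : Equiv.Perm A) (x : A) : f (f⁻¹ x) = x := by simp

/-- parts, reservoirs and symmetric matchings -/
structure Parts {n : ℕ} (G : SimpleGraph (Fin n)) {L s : ℕ} (V : Fin L → Finset (Fin n)) (d : Fin L → Fin L → ℝ)
    (η δ : ℝ) (m p : ℕ) (vtx : Fin L × Fin m → Fin p → Fin n) (Y : Fin L → Finset (Fin n))
    (q : Fin L × Fin m → Fin L × Fin m → ℕ) (mt : Fin L × Fin m → Fin L × Fin m → ℕ → Equiv.Perm (Fin p))
    (gd : Fin L × Fin m → Fin L × Fin m → ℕ → Fin p → Prop) : Prop where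
  vinj : ∀ P x P' x', vtx P x = vtx P' x' → P = P' ∧ x = x'
  vmem : ∀ P x, vtx P x ∈ V P.1
  Ysub : ∀ a, Y a ⊆ V a
  vY : ∀ P x a, vtx P x ∉ Y a
  Ycard : ∀ a, #(Y a) + m * p = s
  qsymm : ∀ P P', P.1 ≠ P'.1 → q P P' = q P' P
  msymm : ∀ P P', P.1 ≠ P'.1 → ∀ c, mt P P' c = (mt P' P c)⁻¹
  gsymm : ∀ P P', P.1 ≠ P'.1 → ∀ c x, gd P P' c x ↔ gd P' P c (mt P P' c x)
  gadj : ∀ P P' c x, P.1 ≠ P'.1 → gd P P' c x → G.Adj (vtx P x) (vtx P' (mt P P' c x))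
  bad : ∀ P P' c, P.1 ≠ P'.1 → c < q P P' → (#(univ.filter fun i => ¬ gd P P' c i) : ℝ) ≤ δ * p
  once : ∀ P P' c c' x, P.1 ≠ P'.1 → gd P P' c x → gd P P' c' x → mt P P' c x = mt P P' c' x → c = c'
  qlow : ∀ P P', d P.1 P'.1 ≠ 0 → (1 - η) * d P.1 P'.1 * p ≤ q P P'

theorem parts_exist {n : ℕ} {G : SimpleGraph (Fin n)} {α ε d0 : ℝ} {L s : ℕ} {V : Fin L → Finset (Fin n)}
    {d : Fin L → Fin L → ℝ} (H : Host G α ε d0 L s V d) (hε : 0 ≤ ε)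
    (hs : 0 < s) (m p : ℕ) (hmp : m * p ≤ s) (hp : 0 < p) (hps : ε * s ≤ p) (δ η : ℝ) (hδ : 0 < δ) (hη : 0 ≤ η)
    (hsm : 2 * ε * p + 1 + 2 * ε * s ≤ δ * (η * d0 * p)) :
    ∃ vtx Y q mt gd, Parts (s := s) G V d η δ m p vtx Y q mt gd := by
  obtain ⟨e, he, heV⟩ : ∃ e : Fin L → Fin s → Fin n, (∀ a, Function.Injective (e a)) ∧ ∀ a i, e a i ∈ V a :=
    ⟨fun a i => (V a).orderEmbOfFin (H.card a) i, fun a => ((V a).orderEmbOfFin (H.card a)).injective,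
      fun a i => Finset.orderEmbOfFin_mem _ _ _⟩
  have hlt : ∀ (j : Fin m) (x : Fin p), j.val * p + x.val < m * p := by
    intro j x
    have : (j.val + 1) * p ≤ m * p := Nat.mul_le_mul_right _ j.2
    have h2 := x.2
    nlinarith
  obtain ⟨vtx, hvtx⟩ : ∃ vtx : Fin L × Fin m → Fin p → Fin n, ∀ P x, vtx P x = e P.1 ⟨P.2.val * p + x.val, lt_of_lt_of_le (hlt P.2 x) hmp⟩ :=
    ⟨_, fun _ _ => rfl⟩
  have hinj : ∀ P x P' x', vtx P x = vtx P' x' → P = P' ∧ x = x' := by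
    rintro ⟨a, j⟩ x ⟨a', j'⟩ x' h
    rw [hvtx, hvtx] at h
    have ha : a = a' := by
      by_contra hne
      exact Finset.disjoint_left.1 (H.disj a a' hne) (heV a _) (h ▸ heV a' _)
    subst ha
    have h2 := congrArg Fin.val (he a h)
    simp only at h2
    have h3 : j.val = j'.val := by
      have e1 := congrArg (· / p) h2
      simp only [mul_comm _ p, Nat.mul_add_div hp, Nat.div_eq_of_lt x.2, Nat.div_eq_of_lt x'.2] at e1
      simpa using e1
    rw [h3] at h2
    exact ⟨by rw [Fin.ext h3], Fin.ext (by omega)⟩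
  have hvm : ∀ P x, vtx P x ∈ V P.1 := fun P x => by rw [hvtx]; exact heV _ _
  have hpm : ∀ P P' : Fin L × Fin m, ∃ (q : ℕ) (π : Fin q → Equiv.Perm (Fin p)) (gd : Fin q → Fin p → Prop),
      (∀ c i, gd c i → G.Adj (vtx P i) (vtx P' (π c i))) ∧
      (∀ c, (#(univ.filter fun i => ¬ gd c i) : ℝ) ≤ δ * p) ∧
      (∀ c c' i, gd c i → gd c' i → π c i = π c' i → c = c') ∧
      (d P.1 P'.1 ≠ 0 → (1 - η) * d P.1 P'.1 * p ≤ q) := by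
    intro P P'
    by_cases hd : d P.1 P'.1 = 0
    · exact ⟨0, fun c => 1, fun _ _ => False, fun c => c.elim0, fun c => c.elim0, fun c => c.elim0, fun h => absurd hd h⟩
    · obtain ⟨q, π, gd, h1, h2, h3, h4⟩ := pair_match H hε P.1 P'.1 hd hs p hp hps δ η hδ hη hsm (vtx P) (vtx P')
        (fun x x' h => (hinj _ _ _ _ h).2) (fun x x' h => (hinj _ _ _ _ h).2) (hvm P) (hvm P')
      exact ⟨q, π, gd, h1, h2, h3, fun _ => h4⟩
  choose q0 π0 gd0 hadj hbad hone hlow using hpm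
  -- natural number indexed versions
  obtain ⟨π1, hπ1⟩ : ∃ π1 : Fin L × Fin m → Fin L × Fin m → ℕ → Equiv.Perm (Fin p),
      ∀ P P' c, π1 P P' c = if h : c < q0 P P' then π0 P P' ⟨c, h⟩ else 1 := ⟨_, fun _ _ _ => rfl⟩
  obtain ⟨gd1, hgd1⟩ : ∃ gd1 : Fin L × Fin m → Fin L × Fin m → ℕ → Fin p → Prop,
      ∀ P P' c x, gd1 P P' c x ↔ ∃ h : c < q0 P P', gd0 P P' ⟨c, h⟩ x := ⟨fun P P' c x => _, fun _ _ _ _ => Iff.rfl⟩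
  have adj1 : ∀ P P' c x, gd1 P P' c x → G.Adj (vtx P x) (vtx P' (π1 P P' c x)) := by
    intro P P' c x h
    obtain ⟨h1, h2⟩ := (hgd1 P P' c x).1 h
    rw [hπ1, dif_pos h1]; exact hadj _ _ _ _ h2
  have bad1 : ∀ P P' c, c < q0 P P' → (#(univ.filter fun i => ¬ gd1 P P' c i) : ℝ) ≤ δ * p := by
    intro P P' c h
    refine le_trans (le_of_eq ?_) (hbad P P' ⟨c, h⟩)
    congr 2; ext x; simp only [Finset.mem_filter, Finset.mem_univ, true_and, hgd1, h, exists_true_left]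
  have one1 : ∀ P P' c c' x, gd1 P P' c x → gd1 P P' c' x → π1 P P' c x = π1 P P' c' x → c = c' := by
    intro P P' c c' x h h' he
    obtain ⟨h1, h2⟩ := (hgd1 P P' c x).1 h
    obtain ⟨h1', h2'⟩ := (hgd1 P P' c' x).1 h'
    rw [hπ1, hπ1, dif_pos h1, dif_pos h1'] at he
    exact congrArg Fin.val (hone _ _ _ _ _ h2 h2' he)
  -- symmetrise
  refine ⟨vtx, fun a => (V a) \ ((univ : Finset (Fin m × Fin p)).image fun r => vtx (a, r.1) r.2),
    fun P P' => if P.1 < P'.1 then q0 P P' else q0 P' P,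
    fun P P' c => if P.1 < P'.1 then π1 P P' c else (π1 P' P c)⁻¹,
    fun P P' c x => if P.1 < P'.1 then gd1 P P' c x else gd1 P' P c ((π1 P' P c)⁻¹ x), ?_⟩
  constructor
  · exact hinj
  · exact hvm
  · intro a; exact Finset.sdiff_subset
  · intro P x a h
    rw [Finset.mem_sdiff] at h
    have ha : a = P.1 := by
      by_contra hne
      exact Finset.disjoint_left.1 (H.disj a P.1 hne) h.1 (hvm P x)
    apply h.2
    rw [ha]
    exact Finset.mem_image.2 ⟨(P.2, x), Finset.mem_univ _, rfl⟩
  · intro a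
    beta_reduce
    rw [Finset.card_sdiff_of_subset, Finset.card_image_of_injective]
    · simp only [Finset.card_univ, Fintype.card_prod, Fintype.card_fin, H.card]; omega
    · rintro ⟨j, x⟩ ⟨j', x'⟩ h
      have := hinj _ _ _ _ h
      simp only [Prod.mk.injEq, true_and] at this ⊢
      exact this
    · intro v hv
      obtain ⟨r, _, rfl⟩ := Finset.mem_image.1 hv
      exact hvm (a, r.1) r.2
  · intro P P' hne
    rcases lt_or_gt_of_ne hne with h | h
    · simp [h, h.not_gt]
    · simp [h, h.not_gt]
  · intro P P' hne c
    rcases lt_or_gt_of_ne hne with h | h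
    · simp [h, h.not_gt]
    · simp [h, h.not_gt]
  · intro P P' hne c x
    rcases lt_or_gt_of_ne hne with h | h
    · simp [h, h.not_gt]
    · simp [h, h.not_gt]
  · intro P P' c x hne hg
    rcases lt_or_gt_of_ne hne with h | h
    · simp only [h, if_true] at hg ⊢
      exact adj1 _ _ _ _ hg
    · simp only [h.not_gt, if_false] at hg ⊢
      have := adj1 _ _ _ _ hg
      simp only [perm_apply_inv] at this
      exact this.symm
  · intro P P' c hne hc
    rcases lt_or_gt_of_ne hne with h | h
    · simp only [h, if_true] at hc ⊢
      exact bad1 _ _ _ hc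
    · simp only [h.not_gt, if_false] at hc ⊢
      refine le_trans (le_of_eq ?_) (bad1 _ _ _ hc)
      norm_cast
      refine Finset.card_bij (fun x _ => (π1 P' P c)⁻¹ x) ?_ ?_ ?_
      · intro x hx; simpa using hx
      · intro x _ x' _ h; exact (Equiv.injective _) h
      · intro x hx; exact ⟨π1 P' P c x, by simpa using hx, by simp⟩
  · intro P P' c c' x hne hg hg' he
    rcases lt_or_gt_of_ne hne with h | h
    · simp only [h, if_true] at hg hg' he
      exact one1 _ _ _ _ _ hg hg' he
    · simp only [h.not_gt, if_false] at hg hg' he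
      refine one1 _ _ _ _ _ hg (he ▸ hg') ?_
      rw [perm_apply_inv, he, perm_apply_inv]
  · intro P P' hd
    have hne : P.1 ≠ P'.1 := fun h => hd (by rw [h]; exact H.diag _)
    rcases lt_or_gt_of_ne hne with h | h
    · simp only [h, if_true]
      exact hlow _ _ hd
    · simp only [h.not_gt, if_false]
      rw [H.symm] at hd ⊢
      exact hlow _ _ hd

end ModG5
end ApproxDecomp

open SimpleGraph
namespace ApproxDecomp
section ModG6a
open scoped Classical
open Finset

abbrev Ro (L k m : ℕ) := (Fin L × QT k) × Fin m × Fin k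

def QT.ok {k : ℕ} (q : QT k) : Prop := ∀ i, q.pres i →
  (q.qpar i < i → q.pres (q.qpar i) ∧ q.odd (q.qpar i) = !q.odd i) ∧ (q.mark i → q.odd i = false)

variable {L k m : ℕ}

noncomputable def actR (mu : Fin L × QT k → ℕ) : Finset (Ro L k m) :=
  univ.filter fun ρ => ρ.2.1.val < mu ρ.1 ∧ ρ.1.2.pres ρ.2.2
noncomputable def clR (σ : Fin L → Fin L) (ρ : Ro L k m) : Fin L := if ρ.1.2.odd ρ.2.2 then ρ.1.1 else σ ρ.1.1
def prR (ρ : Ro L k m) : Ro L k m := (ρ.1, ρ.2.1, ρ.1.2.qpar ρ.2.2)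
noncomputable def egR (mu : Fin L × QT k → ℕ) : Finset (Ro L k m) :=
  (actR mu).filter fun ρ => ρ.1.2.qpar ρ.2.2 < ρ.2.2
noncomputable def mkR (mu : Fin L × QT k → ℕ) : Finset (Ro L k m) :=
  (actR mu).filter fun ρ => ρ.1.2.mark ρ.2.2
noncomputable def rcS (m : ℕ) (mu : Fin L × QT k → ℕ) (F : QT k → Fin k → Prop) (a : Fin L) : Finset (Ro L k m) :=
  (actR (m := m) mu).filter fun ρ => ρ.1.1 = a ∧ F ρ.1.2 ρ.2.2
noncomputable def rcR (m : ℕ) (mu : Fin L × QT k → ℕ) (F : QT k → Fin k → Prop) (a : Fin L) : ℕ := #(rcS m mu F a)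

lemma mem_rcS (mu : Fin L × QT k → ℕ) (F : QT k → Fin k → Prop) (a : Fin L) (ρ : Ro L k m) :
    ρ ∈ rcS m mu F a ↔ ρ ∈ actR mu ∧ ρ.1.1 = a ∧ F ρ.1.2 ρ.2.2 := by unfold rcS; rw [Finset.mem_filter]

lemma mem_actR (mu : Fin L × QT k → ℕ) (ρ : Ro L k m) :
    ρ ∈ actR mu ↔ ρ.2.1.val < mu ρ.1 ∧ ρ.1.2.pres ρ.2.2 := by simp [actR]

lemma cl_count (mu : Fin L × QT k → ℕ) (dom : Finset (Fin L)) (σ : Fin L → Fin L) (hσ : Set.InjOn σ dom)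
    (hmu : ∀ κ, 0 < mu κ → κ.1 ∈ dom) (b : Fin L) (U : ℝ) (hU : 0 ≤ U)
    (h : ∀ a ∈ dom, (rcR m mu (fun q i => q.odd i = false) a : ℝ) ≤ U) :
    (#((actR (m := m) mu).filter fun ρ => clR σ ρ = b) : ℝ) ≤ rcR m mu (fun q i => q.odd i = true) b + U := by
  by_cases hb : ∃ a ∈ dom, σ a = b
  · obtain ⟨a, ha, hab⟩ := hb
    have hsub : ((actR (m := m) mu).filter fun ρ => clR σ ρ = b) ⊆
        (rcS m mu (fun q i => q.odd i = true) b) ∪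
        (rcS m mu (fun q i => q.odd i = false) a) := by
      intro ρ hρ
      rw [Finset.mem_filter] at hρ
      rw [Finset.mem_union, mem_rcS, mem_rcS]
      unfold clR at hρ
      by_cases ho : ρ.1.2.odd ρ.2.2 = true
      · rw [if_pos ho] at hρ; exact Or.inl ⟨hρ.1, hρ.2, ho⟩
      · rw [if_neg ho] at hρ
        refine Or.inr ⟨hρ.1, ?_, by simpa using ho⟩
        have h1 := (mem_actR _ _).1 hρ.1
        exact hσ (hmu _ (by omega)) ha (by rw [hρ.2, hab])
    have h1 := le_trans (Finset.card_le_card hsub) (Finset.card_union_le _ _)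
    have h2 := h a ha
    unfold rcR at h2 ⊢
    have h3 : (#((actR (m := m) mu).filter fun ρ => clR σ ρ = b) : ℝ) ≤ _ := Nat.cast_le.2 h1
    push_cast at h3
    linarith
  · have hsub : ((actR (m := m) mu).filter fun ρ => clR σ ρ = b) ⊆
        (rcS m mu (fun q i => q.odd i = true) b) := by
      intro ρ hρ
      rw [Finset.mem_filter] at hρ
      rw [mem_rcS]
      unfold clR at hρ
      by_cases ho : ρ.1.2.odd ρ.2.2 = true
      · rw [if_pos ho] at hρ; exact ⟨hρ.1, hρ.2, ho⟩
      · rw [if_neg ho] at hρ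
        exfalso
        have h1 := (mem_actR _ _).1 hρ.1
        exact hb ⟨_, hmu _ (by omega), hρ.2⟩
    have h3 : (#((actR (m := m) mu).filter fun ρ => clR σ ρ = b) : ℝ) ≤ _ := Nat.cast_le.2 (Finset.card_le_card hsub)
    unfold rcR
    linarith

lemma eg_count1 (mu : Fin L × QT k → ℕ) (dom : Finset (Fin L)) (σ : Fin L → Fin L)
    (hmu : ∀ κ, 0 < mu κ → κ.1 ∈ dom) (hok : ∀ κ, 0 < mu κ → κ.2.ok) (b b' : Fin L) :
    #((egR (m := m) mu).filter fun ρ => clR σ ρ = b ∧ clR σ (prR ρ) = b') ≤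
      (if b ∈ dom ∧ σ b = b' then rcR m mu (fun q i => q.qpar i < i ∧ q.odd i = true) b else 0) +
      (if b' ∈ dom ∧ σ b' = b then rcR m mu (fun q i => q.qpar i < i ∧ q.odd i = false) b' else 0) := by
  have hsub : ((egR (m := m) mu).filter fun ρ => clR σ ρ = b ∧ clR σ (prR ρ) = b') ⊆
      (if b ∈ dom ∧ σ b = b' then
        (rcS m mu (fun q i => q.qpar i < i ∧ q.odd i = true) b) else ∅) ∪
      (if b' ∈ dom ∧ σ b' = b then
        (rcS m mu (fun q i => q.qpar i < i ∧ q.odd i = false) b') else ∅) := by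
    intro ρ hρ
    simp only [Finset.mem_filter, egR] at hρ
    obtain ⟨⟨h1, h2⟩, h3, h4⟩ := hρ
    have h5 := (mem_actR _ _).1 h1
    have h6 := hmu _ (by omega : 0 < mu ρ.1)
    have h7 := ((hok _ (by omega : 0 < mu ρ.1)) ρ.2.2 h5.2).1 h2
    rw [Finset.mem_union]
    unfold clR at h3 h4
    by_cases ho : ρ.1.2.odd ρ.2.2 = true
    · left
      have ho' : ¬ ((prR ρ).1.2.odd (prR ρ).2.2 = true) := by
        show ¬ (ρ.1.2.odd (ρ.1.2.qpar ρ.2.2) = true)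
        rw [h7.2, ho]; simp
      rw [if_pos ho] at h3; rw [if_neg ho'] at h4
      have h8 : ρ.1.1 = b := h3
      have h9 : σ b = b' := by rw [← h8]; exact h4
      rw [if_pos ⟨h8 ▸ h6, h9⟩, mem_rcS]
      exact ⟨h1, h8, h2, ho⟩
    · right
      have ho2 : ρ.1.2.odd ρ.2.2 = false := by simpa using ho
      have ho' : ((prR ρ).1.2.odd (prR ρ).2.2 = true) := by
        show (ρ.1.2.odd (ρ.1.2.qpar ρ.2.2) = true)
        rw [h7.2, ho2]; simp
      rw [if_neg ho] at h3; rw [if_pos ho'] at h4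
      have h8 : ρ.1.1 = b' := h4
      have h9 : σ b' = b := by rw [← h8]; exact h3
      rw [if_pos ⟨h8 ▸ h6, h9⟩, mem_rcS]
      exact ⟨h1, h8, h2, ho2⟩
  refine le_trans (Finset.card_le_card hsub) (le_trans (Finset.card_union_le _ _) (add_le_add ?_ ?_))
  · split_ifs <;> simp [rcR]
  · split_ifs <;> simp [rcR]

lemma rc_split (mu : Fin L × QT k → ℕ) (a : Fin L) :
    rcR m mu (fun q i => q.qpar i < i ∧ q.odd i = true) a + rcR m mu (fun q i => q.qpar i < i ∧ q.odd i = false) a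
      = rcR m mu (fun q i => q.qpar i < i) a := by
  unfold rcR
  rw [← Finset.card_union_of_disjoint]
  · congr 1; ext ρ
    simp only [mem_rcS, Finset.mem_union]
    cases ρ.1.2.odd ρ.2.2 <;> simp
  · refine Finset.disjoint_left.2 ?_
    intro ρ h1 h2
    simp only [mem_rcS] at h1 h2
    rw [h1.2.2.2] at h2; simp at h2

lemma eg_count (mu : Fin L × QT k → ℕ) (dom : Finset (Fin L)) (σ : Fin L → Fin L)
    (hmu : ∀ κ, 0 < mu κ → κ.1 ∈ dom) (hok : ∀ κ, 0 < mu κ → κ.2.ok) (b b' : Fin L) (U : ℝ)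
    (hU : ∀ a, a ∈ dom → (rcR m mu (fun q i => q.qpar i < i) a : ℝ) ≤ U) :
    (#((egR (m := m) mu).filter fun ρ => clR σ ρ = b ∧ clR σ (prR ρ) = b') : ℝ) +
    #((egR (m := m) mu).filter fun ρ => clR σ ρ = b' ∧ clR σ (prR ρ) = b) ≤
      (if b ∈ dom ∧ σ b = b' then U else 0) + (if b' ∈ dom ∧ σ b' = b then U else 0) := by
  have h1 := eg_count1 (m := m) mu dom σ hmu hok b b'
  have h2 := eg_count1 (m := m) mu dom σ hmu hok b' b
  have h3 : #((egR (m := m) mu).filter fun ρ => clR σ ρ = b ∧ clR σ (prR ρ) = b') +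
    #((egR (m := m) mu).filter fun ρ => clR σ ρ = b' ∧ clR σ (prR ρ) = b) ≤
      (if b ∈ dom ∧ σ b = b' then rcR m mu (fun q i => q.qpar i < i) b else 0) +
      (if b' ∈ dom ∧ σ b' = b then rcR m mu (fun q i => q.qpar i < i) b' else 0) := by
    rw [← rc_split, ← rc_split]
    split_ifs at * <;> omega
  have h4 : ((#((egR (m := m) mu).filter fun ρ => clR σ ρ = b ∧ clR σ (prR ρ) = b') +
    #((egR (m := m) mu).filter fun ρ => clR σ ρ = b' ∧ clR σ (prR ρ) = b) : ℕ) : ℝ) ≤ _ := Nat.cast_le.2 h3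
  push_cast at h4
  refine le_trans h4 (add_le_add ?_ ?_)
  · split_ifs with h
    · exact hU b h.1
    · exact le_rfl
  · split_ifs with h
    · exact hU b' h.1
    · exact le_rfl

lemma mk_count (mu : Fin L × QT k → ℕ) (dom : Finset (Fin L)) (σ : Fin L → Fin L)
    (hmu : ∀ κ, 0 < mu κ → κ.1 ∈ dom) (hok : ∀ κ, 0 < mu κ → κ.2.ok) (a b : Fin L) (U : ℝ)
    (hU : ∀ a, a ∈ dom → (rcR m mu (fun q i => q.mark i) a : ℝ) ≤ U) :
    (#((mkR (m := m) mu).filter fun ρ => ρ.1.1 = a ∧ clR σ ρ = b) : ℝ) ≤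
      (if a ∈ dom ∧ σ a = b then U else 0) := by
  have key : ∀ ρ ∈ (mkR (m := m) mu).filter fun ρ => ρ.1.1 = a ∧ clR σ ρ = b,
      (a ∈ dom ∧ σ a = b) ∧ ρ ∈ rcS m mu (fun q i => q.mark i) a := by
    intro ρ hρ
    simp only [Finset.mem_filter, mkR] at hρ
    obtain ⟨⟨h1, h2⟩, h3, h4⟩ := hρ
    have h5 := (mem_actR _ _).1 h1
    have h6 := hmu _ (by omega : 0 < mu ρ.1)
    have h7 := ((hok _ (by omega : 0 < mu ρ.1)) ρ.2.2 h5.2).2 h2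
    unfold clR at h4
    rw [h7] at h4
    simp only [Bool.false_eq_true, if_false] at h4
    refine ⟨⟨h3 ▸ h6, h3 ▸ h4⟩, ?_⟩
    rw [mem_rcS]; exact ⟨h1, h3, h2⟩
  split_ifs with h
  · refine le_trans ?_ (hU a h.1)
    unfold rcR
    exact_mod_cast Finset.card_le_card fun ρ hρ => (key ρ hρ).2
  · have : ((mkR (m := m) mu).filter fun ρ => ρ.1.1 = a ∧ clR σ ρ = b) = ∅ := by
      rw [Finset.eq_empty_iff_forall_notMem]
      intro ρ hρ; exact h (key ρ hρ).1
    rw [this]; simp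

variable {N : ℕ} {par : Fin N → Fin N}

lemma ok_of_typed (C : Cut N par) {idx : Fin N → Fin k} {Q : Fin N → QT k}
    (T : Typed C k idx Q) (c : Fin N) (hc : C.ptop c) : (Q c).ok := by
  intro i hi
  obtain ⟨v, hv, htv, rfl⟩ := T.surj c hc i hi
  rw [← htv]
  refine ⟨fun hlt => ?_, fun hmk => ?_⟩
  · have hne : C.top v ≠ v := by
      intro h
      rw [(T.rt v hv h).1] at hlt
      exact lt_irrefl _ hlt
    obtain ⟨h1, h2, h3, h4⟩ := C.top_par v hv.1 hv.2 hne
    rw [(T.nrt v hv hne).1]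
    have hp : C.comp (par v) := ⟨h1, h2⟩
    rw [← h3]
    refine ⟨T.pres _ hp, ?_⟩
    rw [T.odd _ hp, h3, T.odd _ hv, C.odd_par v h4]; simp
  · rw [T.odd _ hv]
    rcases (T.mark v hv).1 hmk with h | ⟨x, hx, hxv⟩
    · have hX := C.X_odd _ h.2
      have hne : par v ≠ v := fun hh => hv.1 (hh ▸ h.2)
      rw [C.odd_par v hne, hX]; rfl
    · have hX := C.X_odd _ hx
      have hne : par x ≠ x := by
        intro hh
        rw [C.odd_root x hh] at hX; simp at hX
      have := C.odd_par x hne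
      rw [hX, hxv] at this
      cases h : C.odd v
      · rfl
      · rw [h] at this; simp at this

lemma rc_eq (mu : Fin L × QT k → ℕ) (F : QT k → Fin k → Prop) (a : Fin L) :
    rcR m mu F a = #((univ : Finset (QT k × Fin m × Fin k)).filter fun r =>
      r.2.1.val < mu (a, r.1) ∧ r.1.pres r.2.2 ∧ F r.1 r.2.2) := by
  unfold rcR
  symm
  refine Finset.card_bij (fun r _ => ((a, r.1), r.2.1, r.2.2)) ?_ ?_ ?_
  · rintro ⟨q, j, i⟩ h
    simp only [Finset.mem_filter, Finset.mem_univ, true_and, mem_rcS, mem_actR] at h ⊢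
    exact ⟨⟨h.1, h.2.1⟩, h.2.2⟩
  · rintro ⟨q, j, i⟩ _ ⟨q', j', i'⟩ _ h
    simp only [Prod.mk.injEq, true_and] at h ⊢
    exact h
  · rintro ⟨⟨a', q⟩, j, i⟩ h
    simp only [mem_rcS, mem_actR] at h
    obtain ⟨⟨h1, h2⟩, h3, h4⟩ := h
    subst h3
    exact ⟨(q, j, i), by simp only [Finset.mem_filter, Finset.mem_univ, true_and]; exact ⟨h1, h2, h4⟩, rfl⟩

/-- marked vertices are few -/
lemma mark_le (C : Cut N par) (Δ : ℕ) (hΔ : ∀ v, #(univ.filter fun u => par u = v ∧ u ≠ v) ≤ Δ) :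
    #(univ.filter fun v => C.comp v ∧ C.mk' v) ≤ (Δ + 1) * #C.X := by
  have hsub : (univ.filter fun v => C.comp v ∧ C.mk' v) ⊆
      (C.X.biUnion fun x => univ.filter fun u => par u = x ∧ u ≠ x) ∪ C.X.image par := by
    intro v hv
    simp only [Finset.mem_filter, Finset.mem_univ, true_and, Finset.mem_union, Finset.mem_biUnion, Finset.mem_image] at hv ⊢
    rcases hv.2 with h | ⟨x, hx, hxv⟩
    · exact Or.inl ⟨par v, h.2, rfl, fun hh => hv.1.1 (hh ▸ h.2)⟩
    · exact Or.inr ⟨x, hx, hxv⟩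
  refine le_trans (Finset.card_le_card hsub) (le_trans (Finset.card_union_le _ _) ?_)
  have h1 := Finset.card_biUnion_le_card_mul C.X (fun x => univ.filter fun u => par u = x ∧ u ≠ x) Δ (fun x _ => hΔ x)
  have h2 := Finset.card_image_le (s := C.X) (f := par)
  nlinarith

theorem assign0 (hpar : ∀ v, par v ≤ v) (C : Cut N par) (Δ : ℕ) (hΔ : ∀ v, #(univ.filter fun u => par u = v ∧ u ≠ v) ≤ Δ)
    {idx : Fin N → Fin k} {Q : Fin N → QT k} (T : Typed C k idx Q)
    (sz : ℕ) (hsz : ∀ c, #(univ.filter fun u => C.topR u = c) ≤ sz) (B : ℕ) (hB : 0 < B)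
    (dom : Finset (Fin L)) (hdom : dom.Nonempty) (hL : (0:ℝ) < #dom) (err : ℝ) (herr0 : 0 ≤ err)
    (herr : ((5 * L : ℕ) : ℝ) * ((sz : ℝ) * N) ≤ err ^ 2) :
    ∃ pc : Fin N → Fin L, (∀ v, pc v ∈ dom) ∧ (∀ v, v ∉ C.R → pc v = pc (par v)) ∧
      (∀ v, C.comp v → pc v = pc (C.top v)) ∧
      ∀ a, 
        (rcR m (fun κ => multOf B (C.ncol pc Q κ)) (fun q i => q.odd i = true) a : ℝ) ≤
          ((#(univ.filter fun v => C.odd v = true) : ℝ) / #dom + err) / B + (Fintype.card (QT k) * k : ℕ) ∧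
        (rcR m (fun κ => multOf B (C.ncol pc Q κ)) (fun q i => q.odd i = false) a : ℝ) ≤
          ((#(univ.filter fun v => C.odd v = false) : ℝ) / #dom + err) / B + (Fintype.card (QT k) * k : ℕ) ∧
        (rcR m (fun κ => multOf B (C.ncol pc Q κ)) (fun q i => q.qpar i < i) a : ℝ) ≤
          ((#(univ.filter fun v => par v ≠ v) : ℝ) / #dom + err) / B + (Fintype.card (QT k) * k : ℕ) ∧
        (rcR m (fun κ => multOf B (C.ncol pc Q κ)) (fun q i => q.mark i) a : ℝ) ≤
          ((((Δ + 1) * #C.X : ℕ) : ℝ) / #dom + err) / B + (Fintype.card (QT k) * k : ℕ) ∧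
        (#(C.X.filter fun x => pc x = a) : ℝ) ≤ (#C.X : ℝ) / #dom + err := by
  obtain ⟨f, hf1, hf2⟩ := piece_balance (ι := Fin 5) C.topR sz hsz
    (fun i v => if i = 0 then C.odd v = true else if i = 1 then C.odd v = false else
      if i = 2 then par v ≠ v else if i = 3 then C.comp v ∧ C.mk' v else v ∈ C.X) dom hdom err herr0 (by simpa using herr)
  have hpcR : ∀ v, v ∉ C.R → f (C.topR v) = f (C.topR (par v)) := fun v hv => by rw [C.topR_par v hv]
  have hpct : ∀ v, C.comp v → f (C.topR v) = f (C.topR (C.top v)) := by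
    have key : ∀ i : ℕ, ∀ v : Fin N, v.val = i → C.comp v → C.topR v = C.topR (C.top v) := by
      intro i
      induction i using Nat.strong_induction_on with
      | _ i ih =>
        intro v hvi hv
        by_cases h : C.top v = v
        · rw [h]
        · obtain ⟨h1, h2, h3, h4⟩ := C.top_par v hv.1 hv.2 h
          have h5 : (par v).val < i := by rw [← hvi]; exact Fin.lt_def.1 (lt_of_le_of_ne (hpar v) h4)
          rw [C.topR_par v hv.2, ← h3]
          exact ih _ h5 (par v) rfl ⟨h1, h2⟩
    intro v hv; rw [key _ v rfl hv]
  have hcnt : ∀ (F : QT k → Fin k → Prop) (P : Fin N → Prop) [DecidablePred P] (cn : ℕ), (∀ v, C.comp v → F (Q (C.top v)) (idx v) → P v) →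
      (∀ a, (#(univ.filter fun v => P v ∧ f (C.topR v) = a) : ℝ) ≤ #(univ.filter fun v => P v) / #dom + err) →
      #(univ.filter fun v => P v) ≤ cn → ∀ a,
      (rcR m (fun κ => multOf B (C.ncol (fun v => f (C.topR v)) Q κ)) F a : ℝ) ≤ ((cn : ℝ) / #dom + err) / B + (Fintype.card (QT k) * k : ℕ) := by
    intro F P _ cn hFP hP hcn a
    rw [rc_eq]
    refine le_trans (role_count C T (fun v => f (C.topR v)) hpct B hB F a) (add_le_add ?_ le_rfl)
    have hB' : (0:ℝ) < B := by exact_mod_cast hB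
    rw [div_le_div_iff_of_pos_right hB']
    refine le_trans (b := (#(univ.filter fun v => P v ∧ f (C.topR v) = a) : ℝ)) (Nat.cast_le.2 (Finset.card_le_card ?_))
      (le_trans (hP a) (add_le_add ?_ le_rfl))
    · intro v hv
      simp only [Finset.mem_filter, Finset.mem_univ, true_and] at hv ⊢
      exact ⟨hFP v hv.1 hv.2.2, hv.2.1⟩
    rw [div_le_div_iff_of_pos_right hL]
    exact_mod_cast hcn
  refine ⟨fun v => f (C.topR v), fun v => hf1 _, hpcR, hpct, fun a => ⟨?_, ?_, ?_, ?_, ?_⟩⟩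
  · refine hcnt (fun q i => q.odd i = true) (fun v => C.odd v = true) _ (fun v hv h => by rw [← T.odd v hv]; exact h) ?_ le_rfl a
    intro a; simpa using hf2 0 a
  · refine hcnt (fun q i => q.odd i = false) (fun v => C.odd v = false) _ (fun v hv h => by rw [← T.odd v hv]; exact h) ?_ le_rfl a
    intro a; simpa using hf2 1 a
  · refine hcnt (fun q i => q.qpar i < i) (fun v => par v ≠ v) _ (fun v hv h => ?_) ?_ le_rfl a
    · have hne : C.top v ≠ v := by
        intro h'
        rw [(T.rt v hv h').1] at h
        exact lt_irrefl _ h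
      exact (C.top_par v hv.1 hv.2 hne).2.2.2
    · intro a; simpa using hf2 2 a
  · refine hcnt (fun q i => q.mark i) (fun v => C.comp v ∧ C.mk' v) _ (fun v hv h => ⟨hv, (T.mark v hv).1 h⟩) ?_ (mark_le C Δ hΔ) a
    intro a; simpa using hf2 3 a
  · have := hf2 4 a
    simp only [show (4 : Fin 5) ≠ 0 by decide, show (4 : Fin 5) ≠ 1 by decide, show (4 : Fin 5) ≠ 2 by decide, show (4 : Fin 5) ≠ 3 by decide, if_false] at this
    have e : (univ.filter fun v => v ∈ C.X) = C.X := by ext v; simp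
    have e' : (univ.filter fun v => v ∈ C.X ∧ f (C.topR v) = a) = C.X.filter fun v => f (C.topR v) = a := by ext v; simp
    rw [e, e'] at this
    exact this

end ModG6a
end ApproxDecomp

open SimpleGraph
namespace ApproxDecomp
section ModG6b
open scoped Classical
open Finset

/-- a forest with a cut and component types -/
structure FC (Δ k : ℕ) where
  N : ℕ
  par : Fin N → Fin N
  hpar : ∀ v, par v ≤ v
  hΔ : ∀ v, #(univ.filter fun u => par u = v ∧ u ≠ v) ≤ Δ
  C : Cut N par
  idx : Fin N → Fin k
  Q : Fin N → QT k
  T : Typed C k idx Q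

noncomputable def FC.nr {Δ k : ℕ} (S : FC Δ k) : ℕ := #(univ.filter fun v => S.par v ≠ v)

noncomputable def FC.mu {Δ k L : ℕ} (S : FC Δ k) (B : ℕ) (pc : Fin S.N → Fin L) (κ : Fin L × QT k) : ℕ :=
  multOf B (S.C.ncol pc S.Q κ)

lemma Cut.ncol_zero {N : ℕ} {par : Fin N → Fin N} (C : Cut N par) {A : Type*} {k : ℕ} (pc : Fin N → A) (Q : Fin N → QT k) (κ : A × QT k)
    (h : ∀ c, C.ptop c → (pc c, Q c) ≠ κ) : C.ncol pc Q κ = 0 := by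
  unfold Cut.ncol
  refine Finset.card_eq_zero.2 (Finset.eq_empty_iff_forall_notMem.2 fun c hc => ?_)
  have h2 := (Finset.mem_filter.1 hc).2
  exact h c h2.1 h2.2

lemma FC.mu_pos {Δ k L : ℕ} (S : FC Δ k) (B : ℕ) (hB : 0 < B) (pc : Fin S.N → Fin L) (κ : Fin L × QT k) (h : 0 < S.mu B pc κ) :
    ∃ c, S.C.ptop c ∧ (pc c, S.Q c) = κ := by
  by_contra hcon
  push Not at hcon
  have : S.C.ncol pc S.Q κ = 0 := by
    exact Cut.ncol_zero _ _ _ _ hcon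
  unfold FC.mu at h
  rw [this, multOf_zero B hB] at h
  exact lt_irrefl _ h

lemma sum_ite_le {T : ℕ} (P : Fin T → Prop) [DecidablePred P] (x : Fin T → ℝ) (n A Bc S1 S2 : ℝ) (hn : 0 < n) (hA : 0 ≤ A) (hB : 0 ≤ Bc)
    (h1 : ∑ t, (if P t then x t / n else 0) ≤ S1) (h2 : ∑ t, (if P t then (1:ℝ) else 0) ≤ S2) :
    ∑ t, (if P t then x t * A + Bc else 0) ≤ n * S1 * A + S2 * Bc := by
  have e : ∀ t, (if P t then x t * A + Bc else 0) = (n * A) * (if P t then x t / n else 0) + Bc * (if P t then (1:ℝ) else 0) := by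
    intro t
    split_ifs
    · field_simp
    · simp
  rw [Finset.sum_congr rfl fun t _ => e t, Finset.sum_add_distrib, ← Finset.mul_sum, ← Finset.mul_sum]
  have := mul_le_mul_of_nonneg_left h1 (by positivity : 0 ≤ n * A)
  have := mul_le_mul_of_nonneg_left h2 hB
  linarith

theorem assign {Δ k L m T : ℕ} (S : Fin T → FC Δ k) (hL : 0 < L) (D : Fin L → Fin L → ℝ) (hD : ∀ a b, 0 ≤ D a b)
    (hsym : ∀ a b, D a b = D b a)
    (hr : ∀ a, ∑ b, D a b ≤ 1) (η : ℝ) (hη : 0 < η) (hη1 : η < 1)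
    (htot : (1 - η ^ 2) * L ≤ ∑ a, ∑ b, D a b) (B : ℕ) (hB : 0 < B) (sz : ℕ)
    (hsz : ∀ t c, #(univ.filter fun u => (S t).C.topR u = c) ≤ sz)
    (n : ℝ) (hn : 0 < n) (hN : ∀ t, ((S t).N : ℝ) ≤ n) (xm : ℝ) (hxm0 : 0 ≤ xm) (hxm : ∀ t, (#(S t).C.X : ℝ) ≤ xm)
    (e : ℝ) (he0 : 0 ≤ e) (he1 : ((5 * L : ℕ) : ℝ) * ((sz : ℝ) * n) ≤ e ^ 2)
    (he2 : ((2 * L ^ 2 : ℕ) : ℝ) * (T : ℝ) ≤ e ^ 2) (Z : ℝ) (hZ : Z = (Fintype.card (QT k) * k : ℕ)) :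
    ∃ (σ : Fin T → Fin L → Fin L) (dom : Fin T → Finset (Fin L)) (pc : ∀ t, Fin (S t).N → Fin L),
      (∀ t, Set.InjOn (σ t) (dom t)) ∧ (∀ t, ∀ a ∈ dom t, D a (σ t a) ≠ 0) ∧
      (∀ t v, pc t v ∈ dom t) ∧ (∀ t v, v ∉ (S t).C.R → pc t v = pc t ((S t).par v)) ∧
      (∀ t v, (S t).C.comp v → pc t v = pc t ((S t).C.top v)) ∧
      (∀ t b, (#((actR (m := m) ((S t).mu B (pc t))).filter fun ρ => clR (σ t) ρ = b) : ℝ) ≤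
        (((S t).N : ℝ) / ((1 - η) * L) + 2 * e) / B + 2 * Z) ∧
      (∀ b b', ∑ t, ((#((egR (m := m) ((S t).mu B (pc t))).filter fun ρ => clR (σ t) ρ = b ∧ clR (σ t) (prR ρ) = b') : ℝ) +
          #((egR (m := m) ((S t).mu B (pc t))).filter fun ρ => clR (σ t) ρ = b' ∧ clR (σ t) (prR ρ) = b)) ≤
        2 * ((∑ t, ((S t).nr : ℝ)) * (D b b' / (1 - η)) + n * e) * (1 / ((1 - η) * L * B)) + 2 * (T * (D b b' / (1 - η)) + e) * (e / B + Z)) ∧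
      (∀ a b, ∑ t, (#((mkR (m := m) ((S t).mu B (pc t))).filter fun ρ => ρ.1.1 = a ∧ clR (σ t) ρ = b) : ℝ) ≤
        (T * (D a b / (1 - η)) + e) * (((Δ + 1) * xm / ((1 - η) * L) + e) / B + Z)) ∧
      (∀ t a, (#((S t).C.X.filter fun x => pc t x = a) : ℝ) ≤ xm / ((1 - η) * L) + e) := by
  have hBR : (0:ℝ) < B := by exact_mod_cast hB
  have hLR : (0:ℝ) < L := by exact_mod_cast hL
  have hdl : 0 < (1 - η) * L := mul_pos (by linarith) hLR
  have hZ0 : 0 ≤ Z := by rw [hZ]; positivity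
  have hnr : ∀ t, ((S t).nr : ℝ) ≤ n := fun t => by
    refine le_trans ?_ (hN t)
    have := Finset.card_filter_le (univ : Finset (Fin (S t).N)) (fun v => (S t).par v ≠ v)
    rw [Finset.card_univ, Fintype.card_fin] at this
    unfold FC.nr
    exact_mod_cast this
  obtain ⟨σ, dom, hs1, hs2, hs3, hs4⟩ := sigma_select hL D hD hr (fun b => by
      have := hr b
      rw [Finset.sum_congr rfl fun a _ => hsym a b]; exact this) η hη hη1 htot (ι := Bool)
    (fun i t => if i then 1 else ((S t).nr : ℝ) / n)
    (by intro i t; cases i <;> simp; positivity)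
    (by intro i t; cases i <;> simp; rw [div_le_one hn]; exact hnr t) e he0 (by simpa using he2)
  have hdp : ∀ t, (0:ℝ) < #(dom t) := fun t => lt_of_lt_of_le hdl (hs1 t)
  have hdn : ∀ t, (dom t).Nonempty := fun t => by
    rw [← Finset.card_pos]; exact_mod_cast hdp t
  have h0 := fun t => assign0 (m := m) (S t).hpar (S t).C Δ (S t).hΔ (S t).T sz (hsz t) B hB (dom t) (hdn t) (hdp t) e he0
    (le_trans (by gcongr; exact hN t) he1)
  choose pc hp1 hp2 hp3 hp4 using h0
  have hmu1 : ∀ t κ, 0 < (S t).mu B (pc t) κ → κ.1 ∈ dom t := by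
    intro t κ h
    obtain ⟨c, hc, rfl⟩ := (S t).mu_pos B hB (pc t) κ h
    exact hp1 t c
  have hmu2 : ∀ t κ, 0 < (S t).mu B (pc t) κ → κ.2.ok := by
    intro t κ h
    obtain ⟨c, hc, rfl⟩ := (S t).mu_pos B hB (pc t) κ h
    exact ok_of_typed (S t).C (S t).T c hc
  have hmu3 : ∀ t, (fun κ => multOf B ((S t).C.ncol (pc t) (S t).Q κ)) = (S t).mu B (pc t) := fun t => rfl
  simp only [hmu3] at hp4
  have hdiv : ∀ t (x : ℝ), 0 ≤ x → x / #(dom t) ≤ x / ((1 - η) * L) := fun t x hx => by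
    exact div_le_div_of_nonneg_left hx hdl (hs1 t)
  rw [← hZ] at hp4
  have hsel : ∀ a b, ∑ t, (if a ∈ dom t ∧ σ t a = b then ((S t).nr : ℝ) / n else 0) ≤
      (∑ t, ((S t).nr : ℝ) / n) * (D a b / (1 - η)) + e := fun a b => by simpa using hs4 false a b
  have hsel1 : ∀ a b, ∑ t, (if a ∈ dom t ∧ σ t a = b then (1:ℝ) else 0) ≤
      T * (D a b / (1 - η)) + e := fun a b => by simpa using hs4 true a b
  refine ⟨σ, dom, pc, hs2, hs3, hp1, hp2, hp3, ?_, ?_, ?_, ?_⟩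
  · intro t b
    have h1 := cl_count (m := m) ((S t).mu B (pc t)) (dom t) (σ t) (hs2 t) (hmu1 t) b
      (((#(univ.filter fun v => (S t).C.odd v = false) : ℝ) / ((1 - η) * L) + e) / B + Z) (by positivity)
      (fun a _ => le_trans (hp4 t a).2.1 (by gcongr; exact hs1 t))
    refine le_trans h1 ?_
    have h2 := (hp4 t b).1
    have h3 : ((#(univ.filter fun v => (S t).C.odd v = true) : ℝ) / #(dom t) + e) / B ≤
      ((#(univ.filter fun v => (S t).C.odd v = true) : ℝ) / ((1 - η) * L) + e) / B := by gcongr; exact hs1 t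
    have h4 : #(univ.filter fun v => (S t).C.odd v = true) + #(univ.filter fun v => (S t).C.odd v = false) = (S t).N := by
      have := Finset.card_filter_add_card_filter_not (s := (univ : Finset (Fin (S t).N))) (fun v => (S t).C.odd v = true)
      simp only [Bool.not_eq_true, Finset.card_univ, Fintype.card_fin] at this
      exact this
    have h5 : ((S t).N : ℝ) = #(univ.filter fun v => (S t).C.odd v = true) + #(univ.filter fun v => (S t).C.odd v = false) := by
      exact_mod_cast h4.symm
    rw [h5]
    have h6 : ((((#(univ.filter fun v => (S t).C.odd v = true) : ℝ) + #(univ.filter fun v => (S t).C.odd v = false)) / ((1 - η) * L)) + 2 * e) / B + 2 * Z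
      = ((#(univ.filter fun v => (S t).C.odd v = true) : ℝ) / ((1 - η) * L) + e) / B + Z + (((#(univ.filter fun v => (S t).C.odd v = false) : ℝ) / ((1 - η) * L) + e) / B + Z) := by ring
    rw [h6]
    linarith
  · intro b b'
    have h1 : ∀ t, _ := fun t => eg_count (m := m) ((S t).mu B (pc t)) (dom t) (σ t) (hmu1 t) (hmu2 t) b b'
      (((S t).nr : ℝ) * (1 / ((1 - η) * L * B)) + (e / B + Z))
      (fun a _ => le_trans (hp4 t a).2.2.1 (by
        have h3 : ((#(univ.filter fun v => (S t).par v ≠ v) : ℝ) / #(dom t) + e) / B + Z ≤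
          ((#(univ.filter fun v => (S t).par v ≠ v) : ℝ) / ((1 - η) * L) + e) / B + Z := by gcongr; exact hs1 t
        refine le_trans h3 (le_of_eq ?_)
        unfold FC.nr
        field_simp
        ring))
    refine le_trans (Finset.sum_le_sum fun t _ => h1 t) ?_
    rw [Finset.sum_add_distrib]
    have A0 : (0:ℝ) ≤ 1 / ((1 - η) * L * B) := by positivity
    have B0 : (0:ℝ) ≤ e / B + Z := by positivity
    have h2 := sum_ite_le (fun t => b ∈ dom t ∧ σ t b = b') (fun t => ((S t).nr : ℝ)) n _ _ _ _ hn A0 B0 (hsel b b') (hsel1 b b')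
    have h3 := sum_ite_le (fun t => b' ∈ dom t ∧ σ t b' = b) (fun t => ((S t).nr : ℝ)) n _ _ _ _ hn A0 B0 (hsel b' b) (hsel1 b' b)
    rw [hsym b' b] at h3
    have h4 : n * ((∑ t, ((S t).nr : ℝ) / n) * (D b b' / (1 - η)) + e) = (∑ t, ((S t).nr : ℝ)) * (D b b' / (1 - η)) + n * e := by
      rw [← Finset.sum_div]; field_simp
    rw [h4] at h2 h3
    linarith
  · intro a b
    have h1 : ∀ t, _ := fun t => mk_count (m := m) ((S t).mu B (pc t)) (dom t) (σ t) (hmu1 t) (hmu2 t) a b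
      (((Δ + 1) * xm / ((1 - η) * L) + e) / B + Z)
      (fun a _ => le_trans (hp4 t a).2.2.2.1 (by
        push_cast
        have : ((Δ:ℝ) + 1) * #(S t).C.X / #(dom t) ≤ (Δ + 1) * xm / ((1 - η) * L) := by
          refine le_trans (hdiv t _ (by positivity)) ?_
          gcongr; exact hxm t
        gcongr))
    refine le_trans (Finset.sum_le_sum fun t _ => h1 t) ?_
    have e1 : ∀ (U : ℝ), ∑ t, (if a ∈ dom t ∧ σ t a = b then U else 0) = (∑ t, (if a ∈ dom t ∧ σ t a = b then (1:ℝ) else 0)) * U := by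
      intro U; rw [Finset.sum_mul]; refine Finset.sum_congr rfl fun t _ => ?_; split_ifs <;> simp
    rw [e1]
    exact mul_le_mul_of_nonneg_right (hsel1 a b) (by positivity)
  · intro t a
    refine le_trans (hp4 t a).2.2.2.2 (add_le_add ?_ le_rfl)
    refine le_trans (hdiv t _ (by positivity)) ?_
    gcongr; exact hxm t

end ModG6b
end ApproxDecomp

open SimpleGraph
namespace ApproxDecomp
section ModG6c
open scoped Classical
open Finset

theorem colour_exists {ι β : Type*} [Fintype ι] (E : Finset ι) (f : ι → β) :
    ∃ col : ι → ℕ, (∀ a ∈ E, col a < #(E.filter fun a' => f a' = f a)) ∧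
      ∀ a ∈ E, ∀ b ∈ E, f a = f b → col a = col b → a = b := by
  let e := Fintype.equivFin ι
  have hlt : ∀ a ∈ E, ∀ b ∈ E, f a = f b → e a < e b →
      #(E.filter fun a' => f a' = f a ∧ e a' < e a) < #(E.filter fun a' => f a' = f b ∧ e a' < e b) := by
    intro a ha b hb hf hab
    refine Finset.card_lt_card ?_
    rw [Finset.ssubset_iff_of_subset]
    · exact ⟨a, by simp [ha, hf, hab], by simp⟩
    · intro c; simp only [Finset.mem_filter]
      exact fun h => ⟨h.1, h.2.1.trans hf, h.2.2.trans hab⟩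
  refine ⟨fun a => #(E.filter fun a' => f a' = f a ∧ e a' < e a), ?_, ?_⟩
  · intro a ha
    refine Finset.card_lt_card ?_
    rw [Finset.ssubset_iff_of_subset]
    · exact ⟨a, by simp [ha], by simp⟩
    · intro c; simp only [Finset.mem_filter]
      exact fun h => ⟨h.1, h.2.1⟩
  · intro a ha b hb hf hc
    rcases lt_trichotomy (e a) (e b) with h | h | h
    · exact absurd hc (hlt a ha b hb hf h).ne
    · exact e.injective h
    · exact absurd hc (hlt b hb a ha hf.symm h).ne'

variable {L k m p n Δ : ℕ}

/-- position of the copy `q` of vertex `i` of type `κ` -/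
def cpos (vtx : Fin L × Fin m → Fin p → Fin n) (part : Ro L k m → Fin L × Fin m) (perm : Ro L k m → Equiv.Perm (Fin p))
    (κ : Fin L × QT k) (i : Fin k) (q : Fin m × Fin p) : Fin n := vtx (part (κ, q.1, i)) (perm (κ, q.1, i) q.2)

def FC.kap (S : FC Δ k) (pc : Fin S.N → Fin L) (v : Fin S.N) : Fin L × QT k := (pc v, S.Q v)

/-- the plan for one tree -/
structure TP (S : FC Δ k) (G : SimpleGraph (Fin n)) (d : Fin L → Fin L → ℝ) (Y : Fin L → Finset (Fin n))
    (vtx : Fin L × Fin m → Fin p → Fin n) (d0 β : ℝ) (B : ℕ) (pc : Fin S.N → Fin L) (σ : Fin L → Fin L)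
    (part : Ro L k m → Fin L × Fin m) (perm : Ro L k m → Equiv.Perm (Fin p))
    (Copies : Fin L × QT k → Finset (Fin m × Fin p)) : Prop where
  hdom : ∀ v, d (pc v) (σ (pc v)) ≠ 0
  pcpar : ∀ v, v ∉ S.C.R → pc v = pc (S.par v)
  pctop : ∀ v, S.C.comp v → pc v = pc (S.C.top v)
  mum : ∀ κ, S.mu B pc κ ≤ m
  cop : ∀ κ q, q ∈ Copies κ → q.1.val < S.mu B pc κ
  cnt : ∀ κ (j : Fin m), j.val < S.mu B pc κ → (#(univ.filter fun z => (j, z) ∉ Copies κ) : ℝ) ≤ β * p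
  cl : ∀ ρ, (part ρ).1 = clR σ ρ
  pinj : Set.InjOn part (actR (m := m) (S.mu B pc))
  adj : ∀ v, S.C.comp v → S.C.top v ≠ v → ∀ q ∈ Copies (S.kap pc (S.C.top v)),
    G.Adj (cpos vtx part perm (S.kap pc (S.C.top v)) (S.idx v) q) (cpos vtx part perm (S.kap pc (S.C.top v)) (S.idx (S.par v)) q)
  typ : ∀ v, S.C.comp v → S.C.mk' v → ∀ q ∈ Copies (S.kap pc (S.C.top v)),
    d0 / 2 * #(Y (pc v)) ≤ #((Y (pc v)).filter fun w => G.Adj (cpos vtx part perm (S.kap pc (S.C.top v)) (S.idx v) q) w)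

/-- the plan for all trees -/
structure GP {T : ℕ} (S : Fin T → FC Δ k) (G : SimpleGraph (Fin n)) (d : Fin L → Fin L → ℝ) (Y : Fin L → Finset (Fin n))
    (vtx : Fin L × Fin m → Fin p → Fin n) (d0 β : ℝ) (B : ℕ) (KM : ℝ) (pc : ∀ t, Fin (S t).N → Fin L) (σ : Fin T → Fin L → Fin L)
    (part : Fin T → Ro L k m → Fin L × Fin m) (perm : Fin T → Ro L k m → Equiv.Perm (Fin p))
    (Copies : Fin T → Fin L × QT k → Finset (Fin m × Fin p)) : Prop where
  tp : ∀ t, TP (S t) G d Y vtx d0 β B (pc t) (σ t) (part t) (perm t) (Copies t)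
  mkl : ∀ a P, ∑ t, (#((mkR ((S t).mu B (pc t))).filter fun ρ => ρ.1.1 = a ∧ part t ρ = P) : ℝ) ≤ KM
  disj : ∀ t t', t ≠ t' → ∀ v v', (S t).C.comp v → (S t').C.comp v' → (S t).C.top v ≠ v → (S t').C.top v' ≠ v' →
    ∀ q ∈ Copies t ((S t).kap (pc t) ((S t).C.top v)), ∀ q' ∈ Copies t' ((S t').kap (pc t') ((S t').C.top v')),
    s(cpos vtx (part t) (perm t) ((S t).kap (pc t) ((S t).C.top v)) ((S t).idx v) q,
      cpos vtx (part t) (perm t) ((S t).kap (pc t) ((S t).C.top v)) ((S t).idx ((S t).par v)) q) ≠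
    s(cpos vtx (part t') (perm t') ((S t').kap (pc t') ((S t').C.top v')) ((S t').idx v') q',
      cpos vtx (part t') (perm t') ((S t').kap (pc t') ((S t').C.top v')) ((S t').idx ((S t').par v')) q')

/-- recursive definition of permutations along a type -/
lemma perm_rec (q : QT k) (g : Fin k → Equiv.Perm (Fin p)) :
    ∃ f : Fin k → Equiv.Perm (Fin p), ∀ i, q.qpar i < i → f i = g i * f (q.qpar i) := by
  obtain ⟨f, hf⟩ := forest_rec (par := fun i => if q.qpar i < i then q.qpar i else i)
    (fun i => by split_ifs with h; exacts [h.le, le_rfl]) (fun _ => (1 : Equiv.Perm (Fin p))) (fun i x => g i * x)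
  refine ⟨f, fun i hi => ?_⟩
  rw [hf i]
  simp only [if_pos hi]
  rw [if_neg hi.ne]

/-- edge disjointness of matchings -/
lemma match_disj {G : SimpleGraph (Fin n)} {s : ℕ} {V : Fin L → Finset (Fin n)} {d : Fin L → Fin L → ℝ} {η δ : ℝ}
    {vtx : Fin L × Fin m → Fin p → Fin n} {Y : Fin L → Finset (Fin n)}
    {q : Fin L × Fin m → Fin L × Fin m → ℕ} {mt : Fin L × Fin m → Fin L × Fin m → ℕ → Equiv.Perm (Fin p)}
    {gd : Fin L × Fin m → Fin L × Fin m → ℕ → Fin p → Prop} (hP : Parts (s := s) G V d η δ m p vtx Y q mt gd)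
    (P P' Q Q' : Fin L × Fin m) (c c' : ℕ) (x x' : Fin p) (hne : P.1 ≠ P'.1) (hne' : Q.1 ≠ Q'.1)
    (h1 : gd P' P c x) (h2 : gd Q' Q c' x')
    (h : s(vtx P (mt P' P c x), vtx P' x) = s(vtx Q (mt Q' Q c' x'), vtx Q' x')) :
    s(P, P') = s(Q, Q') ∧ c = c' := by
  rw [Sym2.eq_iff] at h
  rcases h with ⟨h3, h4⟩ | ⟨h3, h4⟩
  · obtain ⟨rfl, h5⟩ := hP.vinj _ _ _ _ h3
    obtain ⟨rfl, rfl⟩ := hP.vinj _ _ _ _ h4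
    exact ⟨rfl, hP.once _ _ _ _ _ hne.symm h1 h2 h5⟩
  · obtain ⟨rfl, h5⟩ := hP.vinj _ _ _ _ h3
    obtain ⟨rfl, h6⟩ := hP.vinj _ _ _ _ h4
    refine ⟨Sym2.eq_swap, ?_⟩
    have h7 := (hP.gsymm P P' hne c' x').1 h2
    rw [← h6] at h7
    refine hP.once _ _ _ _ _ hne.symm h1 h7 ?_
    rw [h5, h6, hP.msymm P P' hne c', perm_apply_inv]

end ModG6c
end ApproxDecomp

open SimpleGraph
namespace ApproxDecomp
section ModG6d
open scoped Classical
open Finset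

variable {L k m p n Δ : ℕ}

lemma eg_cl (mu : Fin L × QT k → ℕ) (σ : Fin L → Fin L) (d : Fin L → Fin L → ℝ) (hsym : ∀ a b, d a b = d b a)
    (hmu : ∀ κ, 0 < mu κ → d κ.1 (σ κ.1) ≠ 0 ∧ κ.2.ok) (ρ : Ro L k m) (hρ : ρ ∈ egR mu) :
    d (clR σ ρ) (clR σ (prR ρ)) ≠ 0 := by
  unfold egR at hρ
  rw [Finset.mem_filter, mem_actR] at hρ
  obtain ⟨⟨h1, h2⟩, h3⟩ := hρ
  obtain ⟨h4, h5⟩ := hmu ρ.1 (by omega)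
  have h6 := ((h5 ρ.2.2 h2).1 h3).2
  unfold clR prR
  simp only
  rw [h6]
  cases h7 : ρ.1.2.odd ρ.2.2 <;> simp
  · rw [hsym]; exact h4
  · exact h4

lemma mu_lt (S : FC Δ k) (B : ℕ) (hB : 0 < B) (pc : Fin S.N → Fin L) (σ : Fin L → Fin L)
    (hA : ∀ b, #((actR (m := m) (S.mu B pc)).filter fun ρ => clR σ ρ = b) + 1 ≤ m) (κ : Fin L × QT k) :
    S.mu B pc κ ≤ m := by
  by_contra hcon
  push Not at hcon
  obtain ⟨c, hc, hκ⟩ := S.mu_pos B hB pc κ (by omega)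
  have hQ : κ.2 = S.Q c := by rw [← hκ]
  have hcomp : S.C.comp c := ⟨hc.1, hc.2.1⟩
  have hpres : κ.2.pres (S.idx c) := by
    have := S.T.pres c hcomp
    rw [hc.2.2] at this; rw [hQ]; exact this
  have h2 : #(univ : Finset (Fin m)) ≤ #((actR (m := m) (S.mu B pc)).filter fun ρ => clR σ ρ = if κ.2.odd (S.idx c) then κ.1 else σ κ.1) := by
    refine Finset.card_le_card_of_injOn (fun j => (κ, j, S.idx c)) ?_ ?_
    · intro j _
      refine Finset.mem_coe.2 (Finset.mem_filter.2 ⟨(mem_actR _ _).2 ⟨?_, hpres⟩, rfl⟩)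
      exact lt_trans j.2 hcon
    · intro j _ j' _ h
      simpa using h
  rw [Finset.card_univ, Fintype.card_fin] at h2
  have := hA (if κ.2.odd (S.idx c) then κ.1 else σ κ.1)
  omega

lemma card_sigma_le {T : ℕ} {Ro P : Type*} [Fintype Ro] [DecidableEq P] (eg : Fin T → Finset Ro) (f g : Fin T → Ro → P) (x y : P) :
    (#(((univ : Finset (Fin T × Ro)).filter fun a => a.2 ∈ eg a.1).filter fun a => s(f a.1 a.2, g a.1 a.2) = s(x, y)) : ℝ) ≤
     ∑ t, (#((eg t).filter fun ρ => f t ρ = x ∧ g t ρ = y) : ℝ) + ∑ t, (#((eg t).filter fun ρ => f t ρ = y ∧ g t ρ = x) : ℝ) := by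
  rw [← Finset.sum_add_distrib]
  have h1 : #(((univ : Finset (Fin T × Ro)).filter fun a => a.2 ∈ eg a.1).filter fun a => s(f a.1 a.2, g a.1 a.2) = s(x, y)) ≤
      ∑ t, (#((eg t).filter fun ρ => f t ρ = x ∧ g t ρ = y) + #((eg t).filter fun ρ => f t ρ = y ∧ g t ρ = x)) := by
    rw [Finset.filter_filter, Finset.card_filter, Fintype.sum_prod_type]
    refine Finset.sum_le_sum fun t _ => ?_
    rw [← Finset.card_filter]
    refine le_trans (Finset.card_le_card ?_) (Finset.card_union_le _ _)
    intro ρ hρ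
    rw [Finset.mem_filter, Sym2.eq_iff] at hρ
    rw [Finset.mem_union, Finset.mem_filter, Finset.mem_filter]
    rcases hρ.2.2 with h | h
    · exact Or.inl ⟨hρ.2.1, h⟩
    · exact Or.inr ⟨hρ.2.1, h⟩
  exact_mod_cast h1

theorem plan_exists {G : SimpleGraph (Fin n)} {α ε d0 : ℝ} {s : ℕ} {V : Fin L → Finset (Fin n)} {d : Fin L → Fin L → ℝ}
    (H : Host G α ε d0 L s V d) {η δ : ℝ} (hε : 0 ≤ ε) (hs : 0 < s)
    {vtx : Fin L × Fin m → Fin p → Fin n} {Y : Fin L → Finset (Fin n)}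
    {q : Fin L × Fin m → Fin L × Fin m → ℕ} {mt : Fin L × Fin m → Fin L × Fin m → ℕ → Equiv.Perm (Fin p)}
    {gd : Fin L × Fin m → Fin L × Fin m → ℕ → Fin p → Prop} (hP : Parts (s := s) G V d η δ m p vtx Y q mt gd)
    (hm : 0 < m) (hδ : 0 ≤ δ) {T : ℕ} (S : Fin T → FC Δ k) (pc : ∀ t, Fin (S t).N → Fin L) (σ : Fin T → Fin L → Fin L) (B : ℕ) (hB : 0 < B)
    (hdom : ∀ t v, d (pc t v) (σ t (pc t v)) ≠ 0)
    (pcpar : ∀ t v, v ∉ (S t).C.R → pc t v = pc t ((S t).par v))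
    (pctop : ∀ t v, (S t).C.comp v → pc t v = pc t ((S t).C.top v))
    (hA : ∀ t b, #((actR (m := m) ((S t).mu B (pc t))).filter fun ρ => clR (σ t) ρ = b) + 1 ≤ m)
    (err : ℝ) (herr0 : 0 ≤ err)
    (herr : (((L * m) * (L * m) + L * (L * m) : ℕ) : ℝ) * (T * (Fintype.card (Ro L k m) : ℝ) ^ 2) ≤ err ^ 2)
    (hE : ∀ b b', d b b' ≠ 0 → (∑ t, ((#((egR (m := m) ((S t).mu B (pc t))).filter fun ρ => clR (σ t) ρ = b ∧ clR (σ t) (prR ρ) = b') : ℝ) +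
          #((egR (m := m) ((S t).mu B (pc t))).filter fun ρ => clR (σ t) ρ = b' ∧ clR (σ t) (prR ρ) = b))) / (m * m) + 2 * err ≤
          (1 - η) * d b b' * p)
    (KM : ℝ) (hM : ∀ a b, (∑ t, (#((mkR (m := m) ((S t).mu B (pc t))).filter fun ρ => ρ.1.1 = a ∧ clR (σ t) ρ = b) : ℝ)) / m + err ≤ KM)
    (hε2 : ε ≤ d0 / 2) (hYs : ∀ a, ε * s ≤ #(Y a)) (β : ℝ) (hβ : k * (δ * p + ε * s) ≤ β * p) :
    ∃ part perm Copies, GP S G d Y vtx d0 β B KM pc σ part perm Copies := by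
  have hmu : ∀ t κ, 0 < (S t).mu B (pc t) κ → d κ.1 (σ t κ.1) ≠ 0 ∧ κ.2.ok := by
    intro t κ h
    obtain ⟨c, hc, hκ⟩ := (S t).mu_pos B hB (pc t) κ h
    rw [← hκ]
    exact ⟨hdom t c, ok_of_typed _ (S t).T c hc⟩
  obtain ⟨part, hp1, hp2, hp3, hp4⟩ := shifts_exist hm (fun t => actR (m := m) ((S t).mu B (pc t))) (fun t => clR (σ t))
    (fun t b => by have := hA t b; beta_reduce; omega) prR (fun t => egR ((S t).mu B (pc t))) (fun t => mkR ((S t).mu B (pc t))) (fun ρ => ρ.1.1) err herr0 herr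
  have hegne : ∀ t, ∀ ρ ∈ egR (m := m) ((S t).mu B (pc t)), d (part t ρ).1 (part t (prR ρ)).1 ≠ 0 := by
    intro t ρ hρ
    rw [hp1, hp1]
    exact eg_cl _ _ d H.symm (hmu t) ρ hρ
  have hne' : ∀ a b, d a b ≠ 0 → a ≠ b := by
    rintro a b h rfl; exact h (H.diag a)
  obtain ⟨eg, heg⟩ : ∃ eg : Fin T → Finset (Ro L k m), ∀ t, eg t = egR ((S t).mu B (pc t)) := ⟨_, fun _ => rfl⟩
  obtain ⟨col, hc1, hc2⟩ := colour_exists ((univ : Finset (Fin T × Ro L k m)).filter fun a : Fin T × Ro L k m => a.2 ∈ eg a.1)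
    (fun a : Fin T × Ro L k m => s(part a.1 a.2, part a.1 (prR a.2)))
  have hcol : ∀ t, ∀ ρ ∈ egR (m := m) ((S t).mu B (pc t)), col (t, ρ) < q (part t (prR ρ)) (part t ρ) := by
    intro t ρ hρ
    have h1 := hc1 (t, ρ) (by simpa [heg] using hρ)
    have h2 := card_sigma_le eg part (fun t ρ => part t (prR ρ)) (part t ρ) (part t (prR ρ))
    have hd := hegne t ρ hρ
    have h3 := hp3 (part t ρ) (part t (prR ρ)) (hne' _ _ hd)
    have h4 := hp3 (part t (prR ρ)) (part t ρ) (hne' _ _ hd).symm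
    have h5 := hE _ _ hd
    have h6 := hP.qlow _ _ hd
    rw [hP.qsymm _ _ (hne' _ _ hd).symm]
    rw [Finset.sum_add_distrib, add_div] at h5
    have h7 : ((col (t, ρ) : ℕ) : ℝ) < q (part t ρ) (part t (prR ρ)) := by
      refine lt_of_lt_of_le (Nat.cast_lt.2 h1) (le_trans (le_of_eq ?_) (le_trans h2 ?_))
      · congr!
      simp only [heg]
      linarith
    exact_mod_cast h7
  choose pm hpm using fun (t : Fin T) (κ : Fin L × QT k) (j : Fin m) => perm_rec (p := p) κ.2
    (fun i => mt (part t (κ, j, κ.2.qpar i)) (part t (κ, j, i)) (col (t, (κ, j, i))))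
  obtain ⟨perm, hperm⟩ : ∃ perm : Fin T → Ro L k m → Equiv.Perm (Fin p), ∀ t ρ, ρ.1.2.qpar ρ.2.2 < ρ.2.2 →
      perm t ρ = mt (part t (prR ρ)) (part t ρ) (col (t, ρ)) * perm t (prR ρ) :=
    ⟨fun t ρ => pm t ρ.1 ρ.2.1 ρ.2.2, fun t ρ h => hpm t ρ.1 ρ.2.1 ρ.2.2 h⟩
  obtain ⟨good, hgood⟩ : ∃ good : Fin T → Ro L k m → Fin p → Prop, ∀ t ρ z, good t ρ z ↔
      ((ρ.1.2.qpar ρ.2.2 < ρ.2.2 → gd (part t (prR ρ)) (part t ρ) (col (t, ρ)) (perm t (prR ρ) z)) ∧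
        (ρ.1.2.mark ρ.2.2 → d0 / 2 * (#(Y ρ.1.1) : ℝ) ≤ #((Y ρ.1.1).filter fun w => G.Adj (vtx (part t ρ) (perm t ρ z)) w))) :=
    ⟨_, fun _ _ _ => Iff.rfl⟩
  have hgoodc : ∀ t, ∀ ρ ∈ actR (m := m) ((S t).mu B (pc t)), (#(univ.filter fun z => ¬ good t ρ z) : ℝ) ≤ δ * p + ε * s := by
    intro t ρ hρ
    have hρ' := (mem_actR _ _).1 hρ
    obtain ⟨hd, hok⟩ := hmu t ρ.1 (by omega)
    have e1 : (#(univ.filter fun z => ρ.1.2.qpar ρ.2.2 < ρ.2.2 ∧ ¬ gd (part t (prR ρ)) (part t ρ) (col (t, ρ)) (perm t (prR ρ) z)) : ℝ) ≤ δ * p := by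
      by_cases hlt : ρ.1.2.qpar ρ.2.2 < ρ.2.2
      · have hρe : ρ ∈ egR (m := m) ((S t).mu B (pc t)) := Finset.mem_filter.2 ⟨hρ, hlt⟩
        refine le_trans (Nat.cast_le.2 ?_) (hP.bad _ _ _ (hne' _ _ (hegne t ρ hρe)).symm (hcol t ρ hρe))
        refine Finset.card_le_card_of_injOn (fun z => perm t (prR ρ) z) ?_ ((perm t (prR ρ)).injective.injOn)
        intro z hz
        simp only [Finset.coe_filter, Finset.mem_univ, true_and, Set.mem_ofPred_eq] at hz ⊢
        exact hz.2
      · rw [Finset.filter_false_of_mem (fun z _ h => hlt h.1)]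
        simp; positivity
    have e2 : (#(univ.filter fun z => ρ.1.2.mark ρ.2.2 ∧ ¬ (d0 / 2 * (#(Y ρ.1.1) : ℝ) ≤ #((Y ρ.1.1).filter fun w => G.Adj (vtx (part t ρ) (perm t ρ z)) w))) : ℝ) ≤ ε * s := by
      by_cases hmk : ρ.1.2.mark ρ.2.2
      · have hodd := (hok _ hρ'.2).2 hmk
        have hcl : (part t ρ).1 = σ t ρ.1.1 := by rw [hp1]; unfold clR; rw [hodd]; simp
        have hd' : d (σ t ρ.1.1) ρ.1.1 ≠ 0 := by rw [H.symm]; exact hd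
        have h1 := light_few H hε (σ t ρ.1.1) ρ.1.1 hd' (Y ρ.1.1) (hP.Ysub _) (hYs _)
          ((univ.filter fun z => ρ.1.2.mark ρ.2.2 ∧ ¬ (d0 / 2 * (#(Y ρ.1.1) : ℝ) ≤ #((Y ρ.1.1).filter fun w => G.Adj (vtx (part t ρ) (perm t ρ z)) w))).image
            fun z => vtx (part t ρ) (perm t ρ z))
          (by
            intro w hw
            obtain ⟨z, _, rfl⟩ := Finset.mem_image.1 hw
            rw [← hcl]; exact hP.vmem _ _) hs
          (by
            intro w hw
            obtain ⟨z, hz, rfl⟩ := Finset.mem_image.1 hw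
            have hz' := (Finset.mem_filter.1 hz).2.2
            refine lt_of_lt_of_le (not_le.1 hz') ?_
            have := H.lower _ _ hd'
            refine mul_le_mul_of_nonneg_right ?_ (by positivity)
            linarith)
        rw [Finset.card_image_of_injective _ (fun z z' h => (perm t ρ).injective (hP.vinj _ _ _ _ h).2)] at h1
        exact h1
      · rw [Finset.filter_false_of_mem (fun z _ h => hmk h.1)]
        simp; positivity
    refine le_trans (b := ((#(univ.filter fun z => ρ.1.2.qpar ρ.2.2 < ρ.2.2 ∧ ¬ gd (part t (prR ρ)) (part t ρ) (col (t, ρ)) (perm t (prR ρ) z)) +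
      #(univ.filter fun z => ρ.1.2.mark ρ.2.2 ∧ ¬ (d0 / 2 * (#(Y ρ.1.1) : ℝ) ≤ #((Y ρ.1.1).filter fun w => G.Adj (vtx (part t ρ) (perm t ρ z)) w))) : ℕ) : ℝ)) (Nat.cast_le.2 (le_trans (Finset.card_le_card ?_) (Finset.card_union_le _ _))) (by push_cast; linarith)
    intro z hz
    have hz' := (Finset.mem_filter.1 hz).2
    rw [hgood] at hz'
    rw [Finset.mem_union, Finset.mem_filter, Finset.mem_filter]
    by_contra hcon
    push Not at hcon
    exact hz' ⟨fun h => hcon.1 (Finset.mem_univ _) h, fun h => hcon.2 (Finset.mem_univ _) h⟩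
  obtain ⟨Copies, hCop⟩ : ∃ Copies : Fin T → Fin L × QT k → Finset (Fin m × Fin p), ∀ t κ q, q ∈ Copies t κ ↔
      (q.1.val < (S t).mu B (pc t) κ ∧ ∀ i, κ.2.pres i → good t (κ, q.1, i) q.2) :=
    ⟨fun t κ => univ.filter fun q => q.1.val < (S t).mu B (pc t) κ ∧ ∀ i, κ.2.pres i → good t (κ, q.1, i) q.2, by
      intro t κ q; simp⟩
  have hkk : ∀ t v, (S t).C.comp v → ∀ q ∈ Copies t ((S t).kap (pc t) ((S t).C.top v)),
      ((((S t).kap (pc t) ((S t).C.top v)), q.1, (S t).idx v) : Ro L k m) ∈ actR ((S t).mu B (pc t)) ∧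
      good t (((S t).kap (pc t) ((S t).C.top v)), q.1, (S t).idx v) q.2 := by
    intro t v hv q hq
    have h1 := (hCop _ _ _).1 hq
    have h2 : ((S t).kap (pc t) ((S t).C.top v)).2.pres ((S t).idx v) := (S t).T.pres v hv
    exact ⟨(mem_actR _ _).2 ⟨h1.1, h2⟩, h1.2 _ h2⟩
  have hqpar : ∀ t v, (S t).C.comp v → (S t).C.top v ≠ v → ((S t).kap (pc t) ((S t).C.top v)).2.qpar ((S t).idx v) = (S t).idx ((S t).par v) ∧
      (S t).idx ((S t).par v) < (S t).idx v := fun t v hv h => (S t).T.nrt v hv h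
  have hedge : ∀ t v, (S t).C.comp v → (S t).C.top v ≠ v → ∀ q ∈ Copies t ((S t).kap (pc t) ((S t).C.top v)),
      ∃ ρ, ρ = (((S t).kap (pc t) ((S t).C.top v)), q.1, (S t).idx v) ∧ ρ ∈ egR ((S t).mu B (pc t)) ∧ 
      gd (part t (prR ρ)) (part t ρ) (col (t, ρ)) (perm t (prR ρ) q.2) ∧
      cpos vtx (part t) (perm t) ((S t).kap (pc t) ((S t).C.top v)) ((S t).idx v) q = vtx (part t ρ) (mt (part t (prR ρ)) (part t ρ) (col (t, ρ)) (perm t (prR ρ) q.2)) ∧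
      cpos vtx (part t) (perm t) ((S t).kap (pc t) ((S t).C.top v)) ((S t).idx ((S t).par v)) q = vtx (part t (prR ρ)) (perm t (prR ρ) q.2) := by
    intro t v hv ht q hq
    obtain ⟨h1, h2⟩ := hkk t v hv q hq
    obtain ⟨h3, h4⟩ := hqpar t v hv ht
    refine ⟨_, rfl, ?_, ?_, ?_, ?_⟩
    · unfold egR
      rw [Finset.mem_filter]
      refine ⟨h1, ?_⟩
      simp only
      rw [h3]; exact h4
    · refine ((hgood _ _ _).1 h2).1 ?_
      simp only
      rw [h3]; exact h4
    · unfold cpos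
      rw [hperm _ _ (by simp only; rw [h3]; exact h4)]
      rfl
    · unfold cpos prR
      simp only
      rw [h3]
  refine ⟨part, perm, Copies, ⟨fun t => ⟨hdom t, pcpar t, pctop t, ?_, ?_, ?_, hp1 t, hp2 t, ?_, ?_⟩, ?_, ?_⟩⟩
  · exact fun κ => mu_lt (S t) B hB (pc t) (σ t) (hA t) κ
  · exact fun κ q hq => ((hCop _ _ _).1 hq).1
  · intro κ j hj
    refine le_trans ?_ hβ
    refine le_trans (b := ((∑ i ∈ univ.filter (fun i => κ.2.pres i), #(univ.filter fun z => ¬ good t (κ, j, i) z) : ℕ) : ℝ)) (Nat.cast_le.2 (le_trans (Finset.card_le_card ?_) Finset.card_biUnion_le)) ?_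
    · intro z hz
      have hz' := (Finset.mem_filter.1 hz).2
      rw [hCop] at hz'
      push Not at hz'
      obtain ⟨i, hi, hi'⟩ := hz' hj
      rw [Finset.mem_biUnion]
      exact ⟨i, by simpa using hi, by simpa using hi'⟩
    · push_cast
      refine le_trans (Finset.sum_le_card_nsmul _ _ (δ * p + ε * s) ?_) ?_
      · intro i hi
        exact hgoodc t _ ((mem_actR _ _).2 ⟨hj, (Finset.mem_filter.1 hi).2⟩)
      · rw [nsmul_eq_mul]
        refine mul_le_mul_of_nonneg_right ?_ (by positivity)
        have := Finset.card_filter_le (univ : Finset (Fin k)) (fun i => κ.2.pres i)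
        rw [Finset.card_univ, Fintype.card_fin] at this
        exact_mod_cast this
  · intro v hv ht q hq
    obtain ⟨ρ, hρ, he, hg, h1, h2⟩ := hedge t v hv ht q hq
    rw [h1, h2]
    exact (hP.gadj _ _ _ _ (hne' _ _ (hegne t ρ he)).symm hg).symm
  · intro v hv hmk q hq
    obtain ⟨h1, h2⟩ := hkk t v hv q hq
    have h3 := ((hgood _ _ _).1 h2).2 (((S t).T.mark v hv).2 hmk)
    rw [pctop t v hv]
    exact h3
  · exact fun a P => le_trans (hp4 a P) (hM a P.1)
  · intro t t' htt v v' hv hv' ht ht' q hq q' hq' h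
    obtain ⟨ρ, hρ, he, hg, h1, h2⟩ := hedge t v hv ht q hq
    obtain ⟨ρ', hρ', he', hg', h1', h2'⟩ := hedge t' v' hv' ht' q' hq'
    rw [h1, h2, h1', h2'] at h
    obtain ⟨h3, h4⟩ := match_disj hP _ _ _ _ _ _ _ _ (hne' _ _ (hegne t ρ he)) (hne' _ _ (hegne t' ρ' he')) hg hg' h
    have := hc2 (t, ρ) (by simpa [heg] using he) (t', ρ') (by simpa [heg] using he') h3 h4
    exact htt (Prod.ext_iff.1 this).1

end ModG6d
end ApproxDecomp

open SimpleGraph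
namespace ApproxDecomp
section ModI1
open scoped Classical
open Finset

variable {L k m p n Δ : ℕ}

def FC.lt (S : FC Δ k) (v : Fin S.N) : Prop := v ∈ S.C.X ∨ v ∈ S.C.R ∨ (S.C.ptop v ∧ S.par v ≠ v)

/-- the embedding of one tree -/
structure Emb (S : FC Δ k) (G : SimpleGraph (Fin n)) (Y : Fin L → Finset (Fin n))
    (vtx : Fin L × Fin m → Fin p → Fin n) (pc : Fin S.N → Fin L) (σ : Fin L → Fin L)
    (part : Ro L k m → Fin L × Fin m) (perm : Ro L k m → Equiv.Perm (Fin p))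
    (Copies : Fin L × QT k → Finset (Fin m × Fin p)) (U : Set (Sym2 (Fin n))) (φ : Fin S.N → Fin n) : Prop where
  inj : Function.Injective φ
  onX : ∀ x ∈ S.C.X, φ x ∈ Y (pc x)
  onR : ∀ r ∈ S.C.R, φ r ∈ Y (σ (pc r))
  onC : ∃ z : Fin S.N → Fin m × Fin p, ∀ v, S.C.comp v → z (S.C.top v) ∈ Copies (S.kap pc (S.C.top v)) ∧
    φ v = cpos vtx part perm (S.kap pc (S.C.top v)) (S.idx v) (z (S.C.top v))
  light : ∀ v, S.lt v → G.Adj (φ v) (φ (S.par v)) ∧ s(φ v, φ (S.par v)) ∉ U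

/-- pigeonhole for copies -/
lemma copies_pig (D : Finset (Fin m × Fin p)) (M B : ℕ) (hM : M ≤ m) (hD : #D < M * B) :
    ∃ j : Fin m, j.val < M ∧ #(univ.filter fun z => (j, z) ∈ D) < B := by
  by_contra hcon
  push Not at hcon
  have h1 : M * B ≤ #D := by
    calc M * B ≤ ∑ j ∈ univ.filter (fun j : Fin m => j.val < M), B := by
          rw [Finset.sum_const, smul_eq_mul]
          refine Nat.mul_le_mul_right _ ?_
          have : #(Finset.univ : Finset (Fin M)) ≤ #(univ.filter (fun j : Fin m => j.val < M)) := by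
            refine Finset.card_le_card_of_injOn (fun j => Fin.castLE hM j) ?_ ?_
            · intro j _; simp
            · intro j _ j' _ h; simpa using h
          simpa using this
      _ ≤ ∑ j ∈ univ.filter (fun j : Fin m => j.val < M), #(univ.filter fun z => (j, z) ∈ D) :=
          Finset.sum_le_sum fun j hj => hcon j (Finset.mem_filter.1 hj).2
      _ ≤ ∑ j : Fin m, #(univ.filter fun z => (j, z) ∈ D) :=
          Finset.sum_le_sum_of_subset (Finset.filter_subset _ _)
      _ = #D := by
          simp only [Finset.card_filter]
          rw [← Fintype.sum_prod_type (f := fun x : Fin m × Fin p => if x ∈ D then 1 else 0), ← Finset.card_filter]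
          congr 1; ext x; simp
  omega

/-- double counting -/
lemma dcount {α β : Type*} (A : Finset α) (X : Finset β) (r : α → β → Prop) (o D : ℝ) (ho : 0 < o)
    (h1 : ∀ x ∈ X, (#(A.filter fun a => r a x) : ℝ) ≤ D) (h2 : ∀ a ∈ A, o ≤ #(X.filter fun x => r a x)) :
    (#A : ℝ) ≤ #X * D / o := by
  rw [le_div_iff₀ ho]
  calc (#A : ℝ) * o = ∑ a ∈ A, o := by rw [Finset.sum_const, nsmul_eq_mul]
    _ ≤ ∑ a ∈ A, (#(X.filter fun x => r a x) : ℝ) := Finset.sum_le_sum h2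
    _ = ∑ x ∈ X, (#(A.filter fun a => r a x) : ℝ) := by
        exact_mod_cast Finset.sum_card_bipartiteAbove_eq_sum_card_bipartiteBelow r
    _ ≤ ∑ x ∈ X, D := Finset.sum_le_sum h1
    _ = #X * D := by rw [Finset.sum_const, nsmul_eq_mul]

lemma split_filter {α : Type*} (A : Finset α) (P Q : α → Prop) :
    (#(A.filter P) : ℝ) ≤ #(A.filter fun a => P a ∧ ¬ Q a) + #(A.filter Q) := by
  have : A.filter P ⊆ (A.filter fun a => P a ∧ ¬ Q a) ∪ A.filter Q := by
    intro a ha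
    rw [Finset.mem_filter] at ha
    rw [Finset.mem_union, Finset.mem_filter, Finset.mem_filter]
    by_cases h : Q a
    · exact Or.inr ⟨ha.1, h⟩
    · exact Or.inl ⟨ha.1, ha.2, h⟩
  exact_mod_cast le_trans (Finset.card_le_card this) (Finset.card_union_le _ _)

lemma par_mk (S : FC Δ k) (x : Fin S.N) (hx : x ∈ S.C.X) (h : S.par x ∉ S.C.R) :
    S.C.comp (S.par x) ∧ S.C.mk' (S.par x) := by
  have h1 : S.par x ≠ x := fun h1 => by
    have h2 := S.C.X_odd x hx
    rw [S.C.odd_root x h1] at h2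
    exact absurd h2 (by simp)
  refine ⟨⟨fun h2 => ?_, h⟩, Or.inr ⟨x, hx, rfl⟩⟩
  have h3 := S.C.odd_par x h1
  rw [S.C.X_odd x hx, S.C.X_odd _ h2] at h3
  exact absurd h3 (by simp)

lemma x_notR (S : FC Δ k) (x : Fin S.N) (hx : x ∈ S.C.X) : x ∉ S.C.R := fun h => by
  have h2 := S.C.X_odd x hx
  rw [S.C.R_even x h] at h2
  exact absurd h2 (by simp)

lemma top_ptop (S : FC Δ k) (v : Fin S.N) (hv : S.C.comp v) : S.C.ptop (S.C.top v) :=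
  ⟨(S.C.top_comp v hv.1 hv.2).1, (S.C.top_comp v hv.1 hv.2).2, S.C.top_top v⟩

theorem emb_of_ginv {S : FC Δ k} {G g : SimpleGraph (Fin n)} {d : Fin L → Fin L → ℝ} {Y : Fin L → Finset (Fin n)}
    {vtx : Fin L × Fin m → Fin p → Fin n} {d0 β : ℝ} {B : ℕ} {pc : Fin S.N → Fin L} {σ : Fin L → Fin L}
    {part : Ro L k m → Fin L × Fin m} {perm : Ro L k m → Equiv.Perm (Fin p)}
    {Copies : Fin L × QT k → Finset (Fin m × Fin p)} (P : TP S G d Y vtx d0 β B pc σ part perm Copies)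
    (hvi : ∀ P x P' x', vtx P x = vtx P' x' → P = P' ∧ x = x') (hvY : ∀ P x a, vtx P x ∉ Y a)
    (U : Set (Sym2 (Fin n))) (q1 : ℕ) (y : Fin S.N → Fin n) (z : Fin S.N → Fin m × Fin p)
    (I : GInv S.C (fun v w => G.Adj v w ∧ s(v, w) ∉ U) (fun v w => g.Adj v w ∧ s(v, w) ∉ U) Y pc σ (S.kap pc) Copies
      (fun v q => cpos vtx part perm (S.kap pc (S.C.top v)) (S.idx v) q) q1 S.N y z) :
    ∃ φ, Emb S (G ⊔ g) Y vtx pc σ part perm Copies U φ := by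
  obtain ⟨φ, hφ1, hφ2⟩ : ∃ φ : Fin S.N → Fin n, (∀ v, (v ∈ S.C.X ∨ v ∈ S.C.R) → φ v = y v) ∧
      ∀ v, S.C.comp v → φ v = cpos vtx part perm (S.kap pc (S.C.top v)) (S.idx v) (z (S.C.top v)) := by
    refine ⟨fun v => if v ∈ S.C.X ∨ v ∈ S.C.R then y v else cpos vtx part perm (S.kap pc (S.C.top v)) (S.idx v) (z (S.C.top v)), ?_, ?_⟩
    · intro v hv; exact if_pos hv
    · intro v hv; exact if_neg (by rintro (h | h); exacts [hv.1 h, hv.2 h])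
  have hz : ∀ v, S.C.comp v → z (S.C.top v) ∈ Copies (S.kap pc (S.C.top v)) :=
    fun v hv => I.zC _ (top_ptop S v hv) (Fin.is_lt _)
  have hY1 : ∀ v, v ∈ S.C.X ∨ v ∈ S.C.R → ∃ a, φ v ∈ Y a := by
    rintro v (h | h)
    · rw [hφ1 v (Or.inl h)]; exact ⟨_, I.yX v h v.2⟩
    · rw [hφ1 v (Or.inr h)]; exact ⟨_, (I.yR v h (Fin.is_lt _)).1⟩
  have hcomp : ∀ v, ¬ (v ∈ S.C.X ∨ v ∈ S.C.R) → S.C.comp v := fun v h => ⟨fun h1 => h (Or.inl h1), fun h1 => h (Or.inr h1)⟩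
  have hY2 : ∀ v, S.C.comp v → ∀ a, φ v ∉ Y a := fun v hv a => by rw [hφ2 v hv]; exact hvY _ _ _
  refine ⟨φ, ⟨?_, ?_, ?_, ⟨z, fun v hv => ⟨hz v hv, hφ2 v hv⟩⟩, ?_⟩⟩
  · intro u v huv
    by_cases hu : u ∈ S.C.X ∨ u ∈ S.C.R
    · by_cases hv : v ∈ S.C.X ∨ v ∈ S.C.R
      · rw [hφ1 u hu, hφ1 v hv] at huv
        rcases hu with hu | hu <;> rcases hv with hv | hv
        · exact I.injXX u hu v hv u.2 v.2 huv
        · exact absurd huv (I.injXR u hu v hv u.2 (Fin.is_lt _))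
        · exact absurd huv.symm (I.injXR v hv u hu v.2 (Fin.is_lt _))
        · exact I.injRR u hu v hv (Fin.is_lt _) (Fin.is_lt _) huv
      · obtain ⟨a, ha⟩ := hY1 u hu
        rw [huv] at ha
        exact absurd ha (hY2 v (hcomp v hv) a)
    · by_cases hv : v ∈ S.C.X ∨ v ∈ S.C.R
      · obtain ⟨a, ha⟩ := hY1 v hv
        rw [← huv] at ha
        exact absurd ha (hY2 u (hcomp u hu) a)
      · have hu := hcomp u hu
        have hv := hcomp v hv
        rw [hφ2 u hu, hφ2 v hv] at huv
        obtain ⟨h1, h2⟩ := hvi _ _ _ _ huv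
        have h3 := P.pinj (Finset.mem_coe.2 ((mem_actR _ _).2 ⟨P.cop _ _ (hz u hu), S.T.pres u hu⟩))
          (Finset.mem_coe.2 ((mem_actR _ _).2 ⟨P.cop _ _ (hz v hv), S.T.pres v hv⟩)) h1
        rw [h3] at h2
        have h4 := (perm _).injective h2
        simp only [Prod.mk.injEq] at h3
        have h5 := I.injC _ (top_ptop S u hu) _ (top_ptop S v hv) (Fin.is_lt _) (Fin.is_lt _) h3.1 (Prod.ext h3.2.1 h4)
        exact S.T.inj u v hu hv h5 h3.2.2
  · intro x hx; rw [hφ1 x (Or.inl hx)]; exact I.yX x hx x.2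
  · intro r hr; rw [hφ1 r (Or.inr hr)]; exact (I.yR r hr (Fin.is_lt _)).1
  · rintro v (hv | hv | ⟨hv, hv'⟩)
    · rw [hφ1 v (Or.inl hv)]
      by_cases h : S.par v ∈ S.C.R
      · rw [hφ1 _ (Or.inr h)]
        have h1 := I.aXR v hv v.2 h
        exact ⟨Or.inl h1.1, h1.2⟩
      · rw [hφ2 _ (par_mk S v hv h).1]
        have h1 := I.aXC v hv v.2 h
        exact ⟨Or.inl h1.1, h1.2⟩
    · have h1 := I.aR v hv (Fin.is_lt _)
      rw [hφ1 v (Or.inr hv), hφ1 _ (Or.inl (S.C.R_par v hv)), Sym2.eq_swap]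
      exact ⟨Or.inr h1.1.symm, h1.2⟩
    · have h1 := I.aC v hv hv' (Fin.is_lt _)
      have hX := (S.C.top_root v hv.1 hv.2.1 hv.2.2).resolve_left hv'
      rw [hφ1 _ (Or.inl hX), hφ2 v ⟨hv.1, hv.2.1⟩, Sym2.eq_swap]
      have h2 : z (S.C.top v) = z v := by rw [hv.2.2]
      rw [h2]
      exact ⟨Or.inl h1.1.symm, h1.2⟩

end ModI1
end ApproxDecomp

open SimpleGraph
namespace ApproxDecomp
section ModI2
open scoped Classical
open Finset

variable {L k m p n Δ : ℕ}

lemma h3_lemma {g : SimpleGraph (Fin n)} {δg γ : ℝ} {K : ℕ} (hg : GoodG n δg K γ g) (U : Set (Sym2 (Fin n))) (A Bs S : Finset (Fin n))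
    (KU : ℕ) (hU : #((A ×ˢ Bs).filter fun q => s(q.1, q.2) ∈ U) ≤ KU) (hS : S ⊆ Bs) (q3 q4 : ℕ) (hq4 : δg * n ≤ q4) (hq3 : q3 = 2 * q4)
    (hSc : q3 ≤ #S) (Δ : ℕ) (hK : Δ * q4 + KU < K * n) :
    #(A.filter fun v => #(S.filter fun w => g.Adj v w ∧ s(v, w) ∉ U) ≤ Δ) ≤ q4 := by
  by_contra hcon
  push Not at hcon
  obtain ⟨B', hB', hBc⟩ := Finset.exists_subset_card_eq hcon.le
  have hS' : q4 ≤ #(S \ B') := by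
    have := Finset.le_card_sdiff B' S
    omega
  have h1 := hg.1 B' (S \ B') Finset.disjoint_sdiff (by rw [hBc]; exact hq4) (le_trans hq4 (by exact_mod_cast hS'))
  have h2 : #((B' ×ˢ (S \ B')).filter fun q => g.Adj q.1 q.2) ≤
      #((B' ×ˢ S).filter fun q => g.Adj q.1 q.2 ∧ s(q.1, q.2) ∉ U) + #((A ×ˢ Bs).filter fun q => s(q.1, q.2) ∈ U) := by
    refine le_trans (Finset.card_le_card ?_) (Finset.card_union_le _ _)
    intro q hq
    rw [Finset.mem_filter, Finset.mem_product, Finset.mem_sdiff] at hq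
    rw [Finset.mem_union, Finset.mem_filter, Finset.mem_filter, Finset.mem_product, Finset.mem_product]
    by_cases h : s(q.1, q.2) ∈ U
    · exact Or.inr ⟨⟨(Finset.mem_filter.1 (hB' hq.1.1)).1, hS hq.1.2.1⟩, h⟩
    · exact Or.inl ⟨⟨hq.1.1, hq.1.2.1⟩, hq.2, h⟩
  have h3 : #((B' ×ˢ S).filter fun q => g.Adj q.1 q.2 ∧ s(q.1, q.2) ∉ U) ≤ Δ * q4 := by
    rw [Finset.card_filter, Finset.sum_product]
    refine le_trans (Finset.sum_le_card_nsmul _ _ Δ ?_) (by rw [hBc, smul_eq_mul, mul_comm])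
    intro v hv
    rw [← Finset.card_filter]
    exact (Finset.mem_filter.1 (hB' hv)).2
  omega

lemma h4_lemma {G : SimpleGraph (Fin n)} {α ε d0 : ℝ} {s : ℕ} {V : Fin L → Finset (Fin n)} {d : Fin L → Fin L → ℝ}
    (H : Host G α ε d0 L s V d) (hε : 0 ≤ ε) (hs : 0 < s) (hε2 : ε ≤ d0 / 2) (a b : Fin L) (hd : d b a ≠ 0)
    (Ya Yb : Finset (Fin n)) (hYa : Ya ⊆ V a) (hYb : Yb ⊆ V b) (hYs : ε * s ≤ #Ya) (U : Set (Sym2 (Fin n)))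
    (KU : ℕ) (hU : #((Ya ×ˢ Yb).filter fun q => s(q.1, q.2) ∈ U) ≤ KU) (q1 q5 : ℕ) (ov : ℝ) (hov : 0 < ov)
    (hq1 : q1 + ov ≤ d0 / 2 * #Ya) (hq5 : ε * s + KU / ov ≤ q5) :
    #(Yb.filter fun w => #(Ya.filter fun v => G.Adj v w ∧ s(v, w) ∉ U) < q1) ≤ q5 := by
  have hcov : (Yb.filter fun w => #(Ya.filter fun v => G.Adj v w ∧ s(v, w) ∉ U) < q1) ⊆
      (Yb.filter fun w => (#(Ya.filter fun v => G.Adj w v) : ℝ) < (d b a - ε) * #Ya) ∪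
      (Yb.filter fun w => ov ≤ #(Ya.filter fun v => s(v, w) ∈ U)) := by
    intro w hw
    rw [Finset.mem_filter] at hw
    rw [Finset.mem_union, Finset.mem_filter, Finset.mem_filter]
    by_contra hcon
    push Not at hcon
    have h1 := hcon.1 hw.1
    have h2 := hcon.2 hw.1
    have h3 : (d0 / 2) * (#Ya : ℝ) ≤ (d b a - ε) * #Ya := by
      have := H.lower _ _ hd
      exact mul_le_mul_of_nonneg_right (by linarith) (by positivity)
    have h4 := split_filter Ya (fun v => G.Adj w v) (fun v => s(v, w) ∈ U)
    have h5 : (#(Ya.filter fun v => G.Adj w v ∧ ¬ s(v, w) ∈ U) : ℝ) < q1 := by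
      have : #(Ya.filter fun v => G.Adj w v ∧ ¬ s(v, w) ∈ U) < q1 := by
        refine lt_of_le_of_lt (Finset.card_le_card ?_) hw.2
        intro v hv
        rw [Finset.mem_filter] at hv ⊢
        exact ⟨hv.1, hv.2.1.symm, hv.2.2⟩
      exact_mod_cast this
    linarith
  have h1 := light_few H hε b a hd Ya hYa hYs (Yb.filter fun w => (#(Ya.filter fun v => G.Adj w v) : ℝ) < (d b a - ε) * #Ya)
    (fun w hw => hYb (Finset.mem_filter.1 hw).1) hs (fun w hw => (Finset.mem_filter.1 hw).2)
  have h2 : (#(Yb.filter fun w => ov ≤ #(Ya.filter fun v => s(v, w) ∈ U)) : ℝ) ≤ KU / ov := by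
    rw [le_div_iff₀ hov]
    calc (#(Yb.filter fun w => ov ≤ #(Ya.filter fun v => s(v, w) ∈ U)) : ℝ) * ov
        = ∑ w ∈ (Yb.filter fun w => ov ≤ #(Ya.filter fun v => s(v, w) ∈ U)), ov := by rw [Finset.sum_const, nsmul_eq_mul]
      _ ≤ ∑ w ∈ (Yb.filter fun w => ov ≤ #(Ya.filter fun v => s(v, w) ∈ U)), (#(Ya.filter fun v => s(v, w) ∈ U) : ℝ) :=
          Finset.sum_le_sum fun w hw => (Finset.mem_filter.1 hw).2
      _ ≤ ∑ w ∈ Yb, (#(Ya.filter fun v => s(v, w) ∈ U) : ℝ) :=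
          Finset.sum_le_sum_of_subset_of_nonneg (Finset.filter_subset _ _) (fun _ _ _ => by positivity)
      _ = (#((Ya ×ˢ Yb).filter fun q => s(q.1, q.2) ∈ U) : ℝ) := by
          rw [Finset.card_filter, Finset.sum_product_right]
          push_cast
          refine Finset.sum_congr rfl fun w _ => ?_
          rw [Finset.card_filter]; push_cast; rfl
      _ ≤ KU := by exact_mod_cast hU
  have h3 := le_trans (Finset.card_le_card hcov) (Finset.card_union_le _ _)
  have h4 : (#(Yb.filter fun w => #(Ya.filter fun v => G.Adj v w ∧ s(v, w) ∉ U) < q1) : ℝ) ≤ q5 := by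
    refine le_trans (Nat.cast_le.2 h3) ?_
    push_cast
    linarith
  exact_mod_cast h4

lemma h2_lemma {G : SimpleGraph (Fin n)} {α ε d0 : ℝ} {s : ℕ} {V : Fin L → Finset (Fin n)} {d : Fin L → Fin L → ℝ}
    (H : Host G α ε d0 L s V d) (hε : 0 ≤ ε) (hs : 0 < s) (hε2 : ε ≤ d0 / 2) (a b : Fin L) (hd : d a b ≠ 0) (hd0 : 0 ≤ d0)
    (Ya : Finset (Fin n)) (hYa : Ya ⊆ V a) (f : Fin p → Fin n) (hf : Function.Injective f) (hfV : ∀ z, f z ∈ V b)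
    (Zs : Finset (Fin p)) (ω : ℝ) (hω : ω * p ≤ #Zs) (hωs : ε * s ≤ ω * p) (U : Set (Sym2 (Fin n)))
    (Du : ℝ) (hU : ∀ x, (#(Ya.filter fun v => s(v, f x) ∈ U) : ℝ) ≤ Du) (ou : ℝ) (hou : 0 < ou) (hou2 : ou + Δ ≤ d0 / 2 * (ω * p))
    (bad : Finset (Fin n)) (hbad : bad ⊆ Ya) (hbad2 : ∀ y ∈ bad, #(Zs.filter fun z => G.Adj y (f z) ∧ s(y, f z) ∉ U) ≤ Δ) (q2 : ℕ)
    (hq2 : ε * s + p * Du / ou ≤ q2) : #bad ≤ q2 := by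
  have hWc : #(Zs.image f) = #Zs := Finset.card_image_of_injective _ hf
  have hcov : bad ⊆ (Ya.filter fun y => (#((Zs.image f).filter fun w => G.Adj y w) : ℝ) < (d a b - ε) * #(Zs.image f)) ∪
      (Ya.filter fun y => ou ≤ #(univ.filter fun x => s(y, f x) ∈ U)) := by
    intro y hy
    rw [Finset.mem_union, Finset.mem_filter, Finset.mem_filter]
    by_contra hcon
    push Not at hcon
    have h1 := hcon.1 (hbad hy)
    have h2 := hcon.2 (hbad hy)
    rw [hWc] at h1
    have h3 : (d0 / 2) * (ω * p) ≤ (d a b - ε) * #Zs := by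
      have := H.lower _ _ hd
      calc (d0 / 2) * (ω * p) ≤ (d0 / 2) * #Zs := mul_le_mul_of_nonneg_left hω (by positivity)
        _ ≤ _ := mul_le_mul_of_nonneg_right (by linarith) (by positivity)
    have h4 := split_filter Zs (fun z => G.Adj y (f z)) (fun z => s(y, f z) ∈ U)
    have h5 : (#(Zs.filter fun z => G.Adj y (f z) ∧ ¬ s(y, f z) ∈ U) : ℝ) ≤ Δ := by exact_mod_cast hbad2 y hy
    have h6 : (#((Zs.image f).filter fun w => G.Adj y w) : ℝ) ≤ #(Zs.filter fun z => G.Adj y (f z)) := by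
      rw [Finset.filter_image]
      exact_mod_cast Finset.card_image_le
    have h7 : (#(Zs.filter fun z => s(y, f z) ∈ U) : ℝ) ≤ #(univ.filter fun x => s(y, f x) ∈ U) := by
      exact_mod_cast Finset.card_le_card (Finset.filter_subset_filter _ (Finset.subset_univ _))
    linarith
  have h1 := light_few H hε a b hd (Zs.image f) (by
      intro w hw; obtain ⟨z, _, rfl⟩ := Finset.mem_image.1 hw; exact hfV z) (by rw [hWc]; linarith)
    (Ya.filter fun y => (#((Zs.image f).filter fun w => G.Adj y w) : ℝ) < (d a b - ε) * #(Zs.image f))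
    (fun w hw => hYa (Finset.mem_filter.1 hw).1) hs (fun w hw => (Finset.mem_filter.1 hw).2)
  have h2 := dcount (Ya.filter fun y => ou ≤ #(univ.filter fun x => s(y, f x) ∈ U)) (univ : Finset (Fin p)) (fun y x => s(y, f x) ∈ U) ou Du hou
    (fun x _ => le_trans (Nat.cast_le.2 (Finset.card_le_card (Finset.filter_subset_filter _ (Finset.filter_subset _ _)))) (hU x))
    (fun y hy => (Finset.mem_filter.1 hy).2)
  rw [Finset.card_univ, Fintype.card_fin] at h2
  have h3 := le_trans (Finset.card_le_card hcov) (Finset.card_union_le _ _)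
  have h4 : (#bad : ℝ) ≤ q2 := by
    refine le_trans (Nat.cast_le.2 h3) ?_
    push_cast
    linarith
  exact_mod_cast h4

end ModI2
end ApproxDecomp

open SimpleGraph
namespace ApproxDecomp
section ModI3
open scoped Classical
open Finset

variable {L k m p n Δ : ℕ}

/-- numerical side conditions for the greedy embedding -/
structure NumC (n s p Δ B K KU q1 q2 q3 q4 q5 q6 ysz : ℕ) (d0 ε β ω Du ou ov δg : ℝ) : Prop where
  Bpos : 0 < B
  e0 : 0 ≤ ε
  e2 : ε ≤ d0 / 2
  d0n : 0 ≤ d0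
  hs : 0 < s
  hp : 0 < p
  hYs : ε * s ≤ ysz
  hDu : q1 + Du ≤ d0 / 2 * ysz
  om0 : 0 ≤ ω
  hB : B + ω * p ≤ (1 - β) * p
  hωs : ε * s ≤ ω * p
  hou : 0 < ou
  hou2 : ou + Δ ≤ d0 / 2 * (ω * p)
  hq2 : ε * s + p * Du / ou ≤ q2
  hq4 : δg * n ≤ q4
  hq3 : q3 = 2 * q4
  hK : Δ * q4 + KU < K * n
  hov : 0 < ov
  hq1 : q1 + ov ≤ d0 / 2 * ysz
  hq5 : ε * s + KU / ov ≤ q5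
  h5 : q6 + Δ * q2 + Δ * q4 < q1
  h5' : q3 + q5 + q6 ≤ ysz

lemma ncol_eq (S : FC Δ k) (pc : Fin S.N → Fin L) (c : Fin S.N) :
    #(univ.filter fun c' => S.C.ptop c' ∧ S.kap pc c' = S.kap pc c) = S.C.ncol pc S.Q (S.kap pc c) := by
  unfold Cut.ncol FC.kap
  congr!

lemma slice_big (Cp : Finset (Fin m × Fin p)) (D : Finset (Fin m × Fin p)) (j : Fin m) (β ω : ℝ) (B : ℕ)
    (hc : (#(univ.filter fun z => (j, z) ∉ Cp) : ℝ) ≤ β * p) (hD : #(univ.filter fun z => (j, z) ∈ D) < B)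
    (hB : B + ω * p ≤ (1 - β) * p) : ω * p ≤ #(univ.filter fun z => (j, z) ∈ Cp \ D) := by
  have h1 : (Finset.univ : Finset (Fin p)) ⊆ ((univ.filter fun z => (j, z) ∈ Cp \ D) ∪ (univ.filter fun z => (j, z) ∉ Cp)) ∪
      (univ.filter fun z => (j, z) ∈ D) := by
    intro z _
    simp only [Finset.mem_union, Finset.mem_filter, Finset.mem_univ, true_and, Finset.mem_sdiff]
    tauto
  have h2 := le_trans (Finset.card_le_card h1) (le_trans (Finset.card_union_le _ _) (Nat.add_le_add_right (Finset.card_union_le _ _) _))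
  rw [Finset.card_univ, Fintype.card_fin] at h2
  have h3 : (p : ℝ) ≤ #(univ.filter fun z => (j, z) ∈ Cp \ D) + #(univ.filter fun z => (j, z) ∉ Cp) + #(univ.filter fun z => (j, z) ∈ D) := by
    exact_mod_cast h2
  have h4 : (#(univ.filter fun z => (j, z) ∈ D) : ℝ) ≤ B := by exact_mod_cast hD.le
  linarith

theorem step_exists {S : FC Δ k} {G g : SimpleGraph (Fin n)} {α ε d0 : ℝ} {s : ℕ} {V : Fin L → Finset (Fin n)}
    {d : Fin L → Fin L → ℝ} (H : Host G α ε d0 L s V d) {Y : Fin L → Finset (Fin n)}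
    {vtx : Fin L × Fin m → Fin p → Fin n} {β : ℝ} {B : ℕ} {pc : Fin S.N → Fin L} {σ : Fin L → Fin L}
    {part : Ro L k m → Fin L × Fin m} {perm : Ro L k m → Equiv.Perm (Fin p)}
    {Copies : Fin L × QT k → Finset (Fin m × Fin p)} (P : TP S G d Y vtx d0 β B pc σ part perm Copies)
    (hvi : ∀ P x P' x', vtx P x = vtx P' x' → P = P' ∧ x = x') (hvY : ∀ P x a, vtx P x ∉ Y a)
    (hvV : ∀ P x, vtx P x ∈ V P.1) (hYV : ∀ a, Y a ⊆ V a) (hm : 0 < m) (hn : 0 < n)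
    {K KU q1 q2 q3 q4 q5 q6 ysz : ℕ} {ω Du ou ov δg γ : ℝ} (hYc : ∀ a, #(Y a) = ysz)
    (hN : NumC n s p Δ B K KU q1 q2 q3 q4 q5 q6 ysz d0 ε β ω Du ou ov δg)
    (hg : GoodG n δg K γ g) (hq6 : ∀ a, #(S.C.X.filter fun x => pc x = a) + #S.C.R ≤ q6)
    (U : Set (Sym2 (Fin n))) (hU1 : ∀ a P x, (#((Y a).filter fun v => s(v, vtx P x) ∈ U) : ℝ) ≤ Du)
    (hU2 : ∀ a b, #((Y a ×ˢ Y b).filter fun q => s(q.1, q.2) ∈ U) ≤ KU) :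
    ∃ φ, Emb S (G ⊔ g) Y vtx pc σ part perm Copies U φ := by
  have : Nonempty (Fin n) := ⟨⟨0, hn⟩⟩
  have : Nonempty (Fin m × Fin p) := ⟨(⟨0, hm⟩, ⟨0, hN.hp⟩)⟩
  have hpig : ∀ c, ∀ D : Finset (Fin m × Fin p), #D < #(univ.filter fun c' => S.C.ptop c' ∧ S.kap pc c' = S.kap pc c) →
      ∃ j : Fin m, j.val < S.mu B pc (S.kap pc c) ∧ #(univ.filter fun z => (j, z) ∈ D) < B := by
    intro c D hD
    rw [ncol_eq] at hD
    exact copies_pig D _ B (P.mum _) (lt_of_lt_of_le hD (multOf_le B _ hN.Bpos))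
  suffices key : ∃ y z, GInv S.C (fun v w => G.Adj v w ∧ s(v, w) ∉ U) (fun v w => g.Adj v w ∧ s(v, w) ∉ U) Y pc σ (S.kap pc) Copies
      (fun v q => cpos vtx part perm (S.kap pc (S.C.top v)) (S.idx v) q) q1 S.N y z by
    obtain ⟨y, z, I⟩ := key
    exact emb_of_ginv P hvi hvY U q1 y z I
  refine greedy S.hpar S.C Δ S.hΔ (fun v w => G.Adj v w ∧ s(v, w) ∉ U) (fun v w => g.Adj v w ∧ s(v, w) ∉ U)
    (fun v h => (g.loopless.irrefl v) h.1) Y (fun a b hab => Finset.disjoint_of_subset_left (hYV a) (Finset.disjoint_of_subset_right (hYV b) (H.disj a b hab)))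
    pc P.pcpar σ (S.kap pc) Copies (fun v q => cpos vtx part perm (S.kap pc (S.C.top v)) (S.idx v) q) q1 q2 q3 q4 q5 q6
    ?_ ?_ ?_ ?_ ?_ hN.h5 ?_ (fun a => by convert hq6 a)
  · intro c hc
    by_contra hcon
    push Not at hcon
    obtain ⟨j, hj, hjB⟩ := hpig c _ (lt_of_lt_of_eq hcon (by congr!))
    have h1 := slice_big (Copies (S.kap pc c)) (Copies (S.kap pc c)) j β ω B (P.cnt _ j hj) hjB hN.hB
    have h2 := P.cnt _ j hj
    have h3 : (p : ℝ) = #(univ.filter fun z => (j, z) ∈ Copies (S.kap pc c)) + #(univ.filter fun z => (j, z) ∉ Copies (S.kap pc c)) := by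
      have := Finset.card_filter_add_card_filter_not (s := (Finset.univ : Finset (Fin p))) (fun z => (j, z) ∈ Copies (S.kap pc c))
      rw [Finset.card_univ, Fintype.card_fin] at this
      exact_mod_cast this.symm
    have h4 : (#(univ.filter fun z => (j, z) ∈ Copies (S.kap pc c)) : ℝ) < B := by exact_mod_cast hjB
    have h5 := hN.hB
    have h6 : 0 ≤ ω * p := mul_nonneg hN.om0 (by positivity)
    linarith
  · intro x hx hxR q hq
    obtain ⟨h1, h2⟩ := par_mk S x hx hxR
    have h3 := P.typ _ h1 h2 q hq
    rw [← P.pcpar x (x_notR S x hx), hYc] at h3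
    have h4 := split_filter (Y (pc x)) (fun w => G.Adj (cpos vtx part perm (S.kap pc (S.C.top (S.par x))) (S.idx (S.par x)) q) w)
      (fun w => s(w, cpos vtx part perm (S.kap pc (S.C.top (S.par x))) (S.idx (S.par x)) q) ∈ U)
    have h5 := hU1 (pc x) (part (S.kap pc (S.C.top (S.par x)), q.1, S.idx (S.par x))) (perm (S.kap pc (S.C.top (S.par x)), q.1, S.idx (S.par x)) q.2)
    have h6 := hN.hDu
    have h7 : (q1 : ℝ) ≤ #((Y (pc x)).filter fun w => G.Adj (cpos vtx part perm (S.kap pc (S.C.top (S.par x))) (S.idx (S.par x)) q) w ∧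
        ¬ s(w, cpos vtx part perm (S.kap pc (S.C.top (S.par x))) (S.idx (S.par x)) q) ∈ U) := by
      unfold cpos at *
      linarith
    have h8 : q1 ≤ #((Y (pc x)).filter fun w => G.Adj (cpos vtx part perm (S.kap pc (S.C.top (S.par x))) (S.idx (S.par x)) q) w ∧
        ¬ s(w, cpos vtx part perm (S.kap pc (S.C.top (S.par x))) (S.idx (S.par x)) q) ∈ U) := by exact_mod_cast h7
    refine le_trans h8 (Finset.card_le_card ?_)
    intro w hw
    rw [Finset.mem_filter] at hw
    refine (@Finset.mem_filter _ _ (_) _ _).2 ⟨hw.1, hw.2.1.symm, hw.2.2⟩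
  · intro c hc hcr D hD hDc
    obtain ⟨j, hj, hjB⟩ := hpig c _ (lt_of_lt_of_eq hDc (by congr!))
    have hcc : S.C.comp c := ⟨hc.1, hc.2.1⟩
    have hX := (S.C.top_root c hc.1 hc.2.1 hc.2.2).resolve_left hcr
    have hodd : S.C.odd c = false := by
      rw [S.C.odd_par c hcr, S.C.X_odd _ hX]; rfl
    have hodd2 : (S.Q c).odd (S.idx c) = false := by
      have := S.T.odd c hcc
      rw [hc.2.2] at this
      rw [this, hodd]
    obtain ⟨ρ, hρ⟩ : ∃ ρ : Ro L k m, ρ = (S.kap pc c, j, S.idx c) := ⟨_, rfl⟩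
    have hcl : (part ρ).1 = σ (pc c) := by
      rw [P.cl ρ, hρ]
      unfold clR FC.kap
      rw [hodd2]
      simp
    refine h2_lemma (Δ := Δ) H hN.e0 hN.hs hN.e2 (pc c) (σ (pc c)) (P.hdom c) hN.d0n (Y (pc c)) (hYV _) (fun z => vtx (part ρ) (perm ρ z))
      ?_ ?_ (univ.filter fun z => (j, z) ∈ Copies (S.kap pc c) \ D) ω (slice_big _ _ j β ω B (P.cnt _ j hj) hjB hN.hB) hN.hωs U Du
      ?_ ou hN.hou hN.hou2 _ (Finset.filter_subset _ _) ?_ q2 hN.hq2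
    · intro z z' h
      exact (perm ρ).injective (hvi _ _ _ _ h).2
    · intro z
      rw [← hcl]; exact hvV _ _
    · intro z; exact hU1 _ _ _
    · intro y hy
      rw [Finset.mem_filter] at hy
      refine le_trans ?_ hy.2
      refine Finset.card_le_card_of_injOn (fun z => (j, z)) ?_ ?_
      · intro z hz
        rw [Finset.mem_coe, Finset.mem_filter, Finset.mem_filter] at hz
        rw [Finset.mem_coe]
        refine (@Finset.mem_filter _ _ (_) _ _).2 ⟨(@Finset.mem_sdiff _ (_) _ _ _).2 (Finset.mem_sdiff.1 hz.1.2), ?_⟩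
        rw [hc.2.2]
        unfold cpos
        rw [hρ] at hz
        exact hz.2
      · intro z _ z' _ h
        exact (Prod.mk.inj h).2
  · intro a b S' hS' hc
    refine le_trans (le_of_eq ?_) (h3_lemma hg U (Y a) (Y b) S' KU (hU2 a b) hS' q3 q4 hN.hq4 hN.hq3 hc Δ hN.hK)
    congr!
  · intro r hr
    refine le_trans (le_of_eq ?_) (h4_lemma H hN.e0 hN.hs hN.e2 (pc r) (σ (pc r)) ?_ (Y (pc r)) (Y (σ (pc r))) (hYV _) (hYV _) ?_ U KU (hU2 _ _) q1 q5 ov hN.hov ?_ hN.hq5)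
    · congr!
    · rw [H.symm]; exact P.hdom r
    · rw [hYc]; exact hN.hYs
    · rw [hYc]; exact hN.hq1
  · intro r _
    rw [hYc]; exact hN.h5'

end ModI3
end ApproxDecomp

open SimpleGraph
namespace ApproxDecomp
section ModI4
open scoped Classical
open Finset

lemma seq_exists {E : Type*} {T : ℕ} {β : Fin T → Type*} [∀ t, Nonempty (β t)] (use : ∀ t, β t → Set E)
    (Good : ∀ t, Set E → β t → Prop)
    (step : ∀ t (f : ∀ t, β t), (∀ t' < t, Good t' {e | ∃ t'' < t', e ∈ use t'' (f t'')} (f t')) →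
      ∃ b, Good t {e | ∃ t' < t, e ∈ use t' (f t')} b) :
    ∃ f : ∀ t, β t, ∀ t, Good t {e | ∃ t' < t, e ∈ use t' (f t')} (f t) := by
  suffices key : ∀ i : ℕ, i ≤ T → ∃ f : ∀ t, β t, ∀ t : Fin T, t.val < i → Good t {e | ∃ t' < t, e ∈ use t' (f t')} (f t) by
    obtain ⟨f, hf⟩ := key T le_rfl
    exact ⟨f, fun t => hf t t.2⟩
  intro i
  induction i with
  | zero => intro _; exact ⟨fun t => Classical.arbitrary _, fun t h => absurd h (by omega)⟩
  | succ i ih =>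
    intro hi
    obtain ⟨f, hf⟩ := ih (by omega)
    obtain ⟨b, hb⟩ := step ⟨i, hi⟩ f (fun t' ht' => hf t' ht')
    have hset : ∀ t : Fin T, t.val ≤ i → {e | ∃ t' < t, e ∈ use t' (Function.update f ⟨i, hi⟩ b t')} = {e | ∃ t' < t, e ∈ use t' (f t')} := by
      intro t ht
      ext e
      simp only [Set.mem_ofPred_eq]
      refine exists_congr fun t' => and_congr_right fun h => ?_
      rw [Function.update_of_ne]
      intro h2
      have : t'.val = i := by rw [h2]
      have : t'.val < t.val := h
      omega
    refine ⟨Function.update f ⟨i, hi⟩ b, fun t ht => ?_⟩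
    rw [hset t (by omega)]
    rcases Nat.lt_succ_iff_lt_or_eq.1 ht with h | h
    · rw [Function.update_of_ne]
      · exact hf t h
      · intro h2
        have : t.val = i := by rw [h2]
        omega
    · obtain rfl : t = ⟨i, hi⟩ := Fin.ext h
      rw [Function.update_self]
      exact hb

variable {L k m p n Δ : ℕ}

/-- light edges of an embedded tree -/
def useE (S : FC Δ k) (φ : Fin S.N → Fin n) : Set (Sym2 (Fin n)) := {e | ∃ v, S.lt v ∧ e = s(φ v, φ (S.par v))}

section
variable {S : FC Δ k} {G' : SimpleGraph (Fin n)} {Y : Fin L → Finset (Fin n)}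
    {vtx : Fin L × Fin m → Fin p → Fin n} {pc : Fin S.N → Fin L} {σ : Fin L → Fin L}
    {part : Ro L k m → Fin L × Fin m} {perm : Ro L k m → Equiv.Perm (Fin p)}
    {Copies : Fin L × QT k → Finset (Fin m × Fin p)} {U : Set (Sym2 (Fin n))} {φ : Fin S.N → Fin n}

lemma emb_comp (E : Emb S G' Y vtx pc σ part perm Copies U φ) (hvY : ∀ P x a, vtx P x ∉ Y a) (v : Fin S.N)
    (hv : S.C.comp v) (a : Fin L) : φ v ∉ Y a := by
  obtain ⟨z, hz⟩ := E.onC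
  rw [(hz v hv).2]
  exact hvY _ _ _

lemma emb_mk (E : Emb S G' Y vtx pc σ part perm Copies U φ) (hvY : ∀ P x a, vtx P x ∉ Y a)
    (hYd : ∀ a b, a ≠ b → Disjoint (Y a) (Y b)) (hpc : ∀ v, v ∉ S.C.R → pc v = pc (S.par v))
    (a : Fin L) (P : Fin L × Fin m) (x : Fin p) (y : Fin n) (hy : y ∈ Y a)
    (h : s(y, vtx P x) ∈ useE S φ) :
    ∃ v, S.C.comp v ∧ S.C.mk' v ∧ φ v = vtx P x ∧ pc v = a ∧ ∃ u, (u = S.par v ∨ (S.par u = v ∧ u ≠ v)) ∧ y = φ u := by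
  obtain ⟨u, hu, he⟩ := h
  have hYu : ∀ b, y ∈ Y b → b = a := by
    intro b hb
    by_contra hne
    exact Finset.disjoint_left.1 (hYd b a hne) hb hy
  have hw := hvY P x
  rw [Sym2.eq_iff] at he
  rcases hu with hu | hu | ⟨hu, hu'⟩
  · have h1 := E.onX u hu
    by_cases hR : S.par u ∈ S.C.R
    · have h2 := E.onR _ hR
      rcases he with ⟨h3, h4⟩ | ⟨h3, h4⟩
      · rw [← h4] at h2; exact absurd h2 (hw _)
      · rw [← h4] at h1; exact absurd h1 (hw _)
    · obtain ⟨h3, h4⟩ := par_mk S u hu hR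
      rcases he with ⟨h5, h6⟩ | ⟨h5, h6⟩
      · refine ⟨S.par u, h3, h4, h6.symm, ?_, u, Or.inr ⟨rfl, fun h7 => h3.1 (by rw [← h7]; exact hu)⟩, h5⟩
        rw [← hpc u (x_notR S u hu)]
        rw [← h5] at h1
        exact hYu _ h1
      · rw [← h6] at h1; exact absurd h1 (hw _)
  · have h1 := E.onR u hu
    have h2 := E.onX _ (S.C.R_par u hu)
    rcases he with ⟨h3, h4⟩ | ⟨h3, h4⟩
    · rw [← h4] at h2; exact absurd h2 (hw _)
    · rw [← h4] at h1; exact absurd h1 (hw _)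
  · have hX := (S.C.top_root u hu.1 hu.2.1 hu.2.2).resolve_left hu'
    have h1 := E.onX _ hX
    rcases he with ⟨h3, h4⟩ | ⟨h3, h4⟩
    · rw [← h4] at h1; exact absurd h1 (hw _)
    · refine ⟨u, ⟨hu.1, hu.2.1⟩, Or.inl ⟨hu.2.2, hX⟩, h4.symm, ?_, S.par u, Or.inl rfl, h3⟩
      rw [hpc u hu.2.1]
      rw [← h3] at h1
      exact hYu _ h1

lemma emb_b1 {G : SimpleGraph (Fin n)} {d : Fin L → Fin L → ℝ} {d0 β : ℝ} {B : ℕ}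
    (TPt : TP S G d Y vtx d0 β B pc σ part perm Copies)
    (E : Emb S G' Y vtx pc σ part perm Copies U φ) (hvY : ∀ P x a, vtx P x ∉ Y a)
    (hvi : ∀ P x P' x', vtx P x = vtx P' x' → P = P' ∧ x = x')
    (hYd : ∀ a b, a ≠ b → Disjoint (Y a) (Y b))
    (a : Fin L) (P : Fin L × Fin m) (x : Fin p) :
    #((Y a).filter fun v => s(v, vtx P x) ∈ useE S φ) ≤
      (Δ + 1) * #((mkR (m := m) (S.mu B pc)).filter fun ρ => ρ.1.1 = a ∧ part ρ = P) := by
  rcases Finset.eq_empty_or_nonempty ((Y a).filter fun v => s(v, vtx P x) ∈ useE S φ) with h0 | ⟨y0, hy0⟩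
  · rw [h0]; simp
  rw [Finset.mem_filter] at hy0
  obtain ⟨v, hv, hm, hφ, hpa, -⟩ := emb_mk E hvY hYd TPt.pcpar a P x y0 hy0.1 hy0.2
  have h1 : #((Y a).filter fun v => s(v, vtx P x) ∈ useE S φ) ≤ Δ + 1 := by
    calc #((Y a).filter fun v => s(v, vtx P x) ∈ useE S φ) ≤ #((insert (S.par v) (univ.filter fun u => S.par u = v ∧ u ≠ v)).image φ) := by
          refine Finset.card_le_card ?_
          intro y hy
          rw [Finset.mem_filter] at hy
          obtain ⟨v', _, _, hφ', _, u, hu, hyu⟩ := emb_mk E hvY hYd TPt.pcpar a P x y hy.1 hy.2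
          have : v' = v := E.inj (by rw [hφ, hφ'])
          subst this
          rw [Finset.mem_image]
          refine ⟨u, ?_, hyu.symm⟩
          rw [Finset.mem_insert, Finset.mem_filter]
          rcases hu with hu | hu
          · exact Or.inl hu
          · exact Or.inr ⟨Finset.mem_univ _, hu⟩
      _ ≤ _ := le_trans Finset.card_image_le (Finset.card_insert_le _ _)
      _ ≤ Δ + 1 := by
          have := S.hΔ v
          refine Nat.add_le_add_right (le_trans (le_of_eq ?_) this) 1
          congr!
  have h2 : 0 < #((mkR (m := m) (S.mu B pc)).filter fun ρ => ρ.1.1 = a ∧ part ρ = P) := by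
    rw [Finset.card_pos]
    obtain ⟨z, hz⟩ := E.onC
    obtain ⟨hz1, hz2⟩ := hz v hv
    refine ⟨(S.kap pc (S.C.top v), (z (S.C.top v)).1, S.idx v), ?_⟩
    rw [Finset.mem_filter]
    refine ⟨?_, ?_, ?_⟩
    · unfold mkR
      rw [Finset.mem_filter]
      exact ⟨(mem_actR _ _).2 ⟨TPt.cop _ _ hz1, S.T.pres v hv⟩, (S.T.mark v hv).2 hm⟩
    · show pc (S.C.top v) = a
      rw [← TPt.pctop v hv, hpa]
    · rw [hφ] at hz2
      exact (hvi _ _ _ _ hz2).1.symm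
  nlinarith

lemma emb_b2 (E : Emb S G' Y vtx pc σ part perm Copies U φ) (hvY : ∀ P x a, vtx P x ∉ Y a) (a b : Fin L) :
    #((Y a ×ˢ Y b).filter fun q => s(q.1, q.2) ∈ useE S φ) ≤ 2 * ((Δ + 1) * #S.C.R) := by
  obtain ⟨W, hW⟩ : ∃ W : Finset (Fin S.N), W = S.C.R ∪ S.C.R.biUnion fun r => univ.filter fun u => S.par u = r ∧ u ≠ r := ⟨_, rfl⟩
  have hWc : #W ≤ (Δ + 1) * #S.C.R := by
    rw [hW]
    refine le_trans (Finset.card_union_le _ _) ?_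
    have : #(S.C.R.biUnion fun r => univ.filter fun u => S.par u = r ∧ u ≠ r) ≤ #S.C.R * Δ := by
      refine Finset.card_biUnion_le_card_mul _ _ _ fun r _ => le_trans (le_of_eq ?_) (S.hΔ r)
      congr!
    nlinarith
  calc #((Y a ×ˢ Y b).filter fun q => s(q.1, q.2) ∈ useE S φ)
      ≤ #((W.image fun u => (φ u, φ (S.par u))) ∪ (W.image fun u => (φ (S.par u), φ u))) := by
        refine Finset.card_le_card ?_
        intro q hq
        rw [Finset.mem_filter, Finset.mem_product] at hq
        obtain ⟨⟨ha, hb⟩, u, hu, he⟩ := hq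
        rw [Sym2.eq_iff] at he
        have hn1 : ¬ S.C.comp u := by
          intro h
          rcases he with ⟨h1, h2⟩ | ⟨h1, h2⟩
          · rw [h1] at ha; exact emb_comp E hvY u h a ha
          · rw [h2] at hb; exact emb_comp E hvY u h b hb
        have hn2 : ¬ S.C.comp (S.par u) := by
          intro h
          rcases he with ⟨h1, h2⟩ | ⟨h1, h2⟩
          · rw [h2] at hb; exact emb_comp E hvY _ h b hb
          · rw [h1] at ha; exact emb_comp E hvY _ h a ha
        have huW : u ∈ W := by
          rw [hW, Finset.mem_union, Finset.mem_biUnion]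
          rcases hu with hu | hu | hu
          · right
            have h1 : S.par u ∈ S.C.R := by
              by_contra h
              exact hn2 (par_mk S u hu h).1
            refine ⟨S.par u, h1, ?_⟩
            rw [Finset.mem_filter]
            refine ⟨Finset.mem_univ _, rfl, fun h => x_notR S u hu (by rw [h]; exact h1)⟩
          · exact Or.inl hu
          · exact absurd ⟨hu.1.1, hu.1.2.1⟩ hn1
        rw [Finset.mem_union, Finset.mem_image, Finset.mem_image]
        rcases he with ⟨h1, h2⟩ | ⟨h1, h2⟩
        · exact Or.inl ⟨u, huW, Prod.ext h1.symm h2.symm⟩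
        · exact Or.inr ⟨u, huW, Prod.ext h1.symm h2.symm⟩
    _ ≤ #W + #W := le_trans (Finset.card_union_le _ _) (Nat.add_le_add Finset.card_image_le Finset.card_image_le)
    _ ≤ _ := by omega

lemma nonroot_cases (S : FC Δ k) (v : Fin S.N) (h : S.par v ≠ v) : S.lt v ∨ (S.C.comp v ∧ S.C.top v ≠ v) := by
  by_cases h1 : v ∈ S.C.X
  · exact Or.inl (Or.inl h1)
  by_cases h2 : v ∈ S.C.R
  · exact Or.inl (Or.inr (Or.inl h2))
  by_cases h3 : S.C.top v = v
  · exact Or.inl (Or.inr (Or.inr ⟨⟨h1, h2, h3⟩, h⟩))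
  · exact Or.inr ⟨⟨h1, h2⟩, h3⟩

lemma lt_Y (E : Emb S G' Y vtx pc σ part perm Copies U φ) (v : Fin S.N) (h : S.lt v) :
    ∃ a, φ v ∈ Y a ∨ φ (S.par v) ∈ Y a := by
  rcases h with h | h | h
  · exact ⟨_, Or.inl (E.onX v h)⟩
  · exact ⟨_, Or.inl (E.onR v h)⟩
  · exact ⟨_, Or.inr (E.onX _ ((S.C.top_root v h.1.1 h.1.2.1 h.1.2.2).resolve_left h.2))⟩

end

theorem pack_exists {T : ℕ} {S : Fin T → FC Δ k} {G g : SimpleGraph (Fin n)} {α ε d0 : ℝ} {s : ℕ} {V : Fin L → Finset (Fin n)}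
    {d : Fin L → Fin L → ℝ} (H : Host G α ε d0 L s V d) {Y : Fin L → Finset (Fin n)}
    {vtx : Fin L × Fin m → Fin p → Fin n} {β : ℝ} {B : ℕ} {KM : ℝ} {pc : ∀ t, Fin (S t).N → Fin L} {σ : Fin T → Fin L → Fin L}
    {part : Fin T → Ro L k m → Fin L × Fin m} {perm : Fin T → Ro L k m → Equiv.Perm (Fin p)}
    {Copies : Fin T → Fin L × QT k → Finset (Fin m × Fin p)} (P : GP S G d Y vtx d0 β B KM pc σ part perm Copies)
    (hvi : ∀ P x P' x', vtx P x = vtx P' x' → P = P' ∧ x = x') (hvY : ∀ P x a, vtx P x ∉ Y a)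
    (hvV : ∀ P x, vtx P x ∈ V P.1) (hYV : ∀ a, Y a ⊆ V a) (hm : 0 < m) (hn : 0 < n)
    {K KU q1 q2 q3 q4 q5 q6 ysz : ℕ} {ω Du ou ov δg γ : ℝ} (hYc : ∀ a, #(Y a) = ysz)
    (hN : NumC n s p Δ B K KU q1 q2 q3 q4 q5 q6 ysz d0 ε β ω Du ou ov δg)
    (hg : GoodG n δg K γ g) (hq6 : ∀ t a, #((S t).C.X.filter fun x => pc t x = a) + #(S t).C.R ≤ q6)
    (hDu : (Δ + 1) * KM ≤ Du) (M : ℕ) (hM : ∀ t, #(S t).C.R ≤ M) (hKU : T * (2 * ((Δ + 1) * M)) ≤ KU) :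
    ∃ φ : ∀ t, Fin (S t).N → Fin n, (∀ t, Function.Injective (φ t)) ∧
      (∀ t v, (S t).par v ≠ v → (G ⊔ g).Adj (φ t v) (φ t ((S t).par v))) ∧
      ∀ t t', t ≠ t' → ∀ v v', (S t).par v ≠ v → (S t').par v' ≠ v' →
        s(φ t v, φ t ((S t).par v)) ≠ s(φ t' v', φ t' ((S t').par v')) := by
  have hne : ∀ t, Nonempty (Fin (S t).N → Fin n) := fun t => ⟨fun _ => ⟨0, hn⟩⟩
  have hYd : ∀ a b, a ≠ b → Disjoint (Y a) (Y b) := fun a b hab =>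
    Finset.disjoint_of_subset_left (hYV a) (Finset.disjoint_of_subset_right (hYV b) (H.disj a b hab))
  obtain ⟨φ, hφ⟩ := seq_exists (β := fun t => Fin (S t).N → Fin n) (fun t f => useE (S t) f)
    (fun t U f => Emb (S t) (G ⊔ g) Y vtx (pc t) (σ t) (part t) (perm t) (Copies t) U f) (by
      intro t f hf
      obtain ⟨U, hU⟩ : ∃ U : Set (Sym2 (Fin n)), U = {e | ∃ t' < t, e ∈ useE (S t') (f t')} := ⟨_, rfl⟩
      have hUm : ∀ e, e ∈ U → ∃ t' < t, e ∈ useE (S t') (f t') := fun e he => by rw [hU] at he; exact he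
      show ∃ b, Emb (S t) (G ⊔ g) Y vtx (pc t) (σ t) (part t) (perm t) (Copies t) {e | ∃ t' < t, e ∈ useE (S t') (f t')} b
      rw [← hU]
      refine step_exists H (P.tp t) hvi hvY hvV hYV hm hn hYc hN hg (hq6 t) U ?_ ?_
      · intro a Q x
        have h1 : #((Y a).filter fun v => s(v, vtx Q x) ∈ U) ≤
            ∑ t' : Fin T, (Δ + 1) * #((mkR (m := m) ((S t').mu B (pc t'))).filter fun ρ => ρ.1.1 = a ∧ part t' ρ = Q) := by
          calc #((Y a).filter fun v => s(v, vtx Q x) ∈ U)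
              ≤ #((univ.filter fun t' => t' < t).biUnion fun t' => (Y a).filter fun v => s(v, vtx Q x) ∈ useE (S t') (f t')) := by
                refine Finset.card_le_card ?_
                intro v hv
                rw [Finset.mem_filter] at hv
                obtain ⟨hv1, hv3⟩ := hv
                obtain ⟨t', ht', hv2⟩ := hUm _ hv3
                rw [Finset.mem_biUnion]
                exact ⟨t', by simpa using ht', Finset.mem_filter.2 ⟨hv1, hv2⟩⟩
            _ ≤ ∑ t' ∈ univ.filter (fun t' => t' < t), #((Y a).filter fun v => s(v, vtx Q x) ∈ useE (S t') (f t')) := Finset.card_biUnion_le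
            _ ≤ ∑ t' ∈ univ.filter (fun t' => t' < t), (Δ + 1) * #((mkR (m := m) ((S t').mu B (pc t'))).filter fun ρ => ρ.1.1 = a ∧ part t' ρ = Q) := by
                refine Finset.sum_le_sum fun t' ht' => ?_
                exact emb_b1 (P.tp t') (hf t' (Finset.mem_filter.1 ht').2) hvY hvi hYd a Q x
            _ ≤ _ := Finset.sum_le_sum_of_subset (Finset.filter_subset _ _)
        have h2 := P.mkl a Q
        have h3 : (#((Y a).filter fun v => s(v, vtx Q x) ∈ U) : ℝ) ≤
            (Δ + 1) * ∑ t' : Fin T, (#((mkR (m := m) ((S t').mu B (pc t'))).filter fun ρ => ρ.1.1 = a ∧ part t' ρ = Q) : ℝ) := by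
          rw [Finset.mul_sum]
          exact_mod_cast h1
        refine le_trans h3 (le_trans (mul_le_mul_of_nonneg_left ?_ (by positivity)) hDu)
        exact h2
      · intro a b
        calc #((Y a ×ˢ Y b).filter fun q => s(q.1, q.2) ∈ U)
              ≤ #((univ.filter fun t' => t' < t).biUnion fun t' => (Y a ×ˢ Y b).filter fun q => s(q.1, q.2) ∈ useE (S t') (f t')) := by
                refine Finset.card_le_card ?_
                intro v hv
                rw [Finset.mem_filter] at hv
                obtain ⟨hv1, hv3⟩ := hv
                obtain ⟨t', ht', hv2⟩ := hUm _ hv3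
                rw [Finset.mem_biUnion]
                exact ⟨t', by simpa using ht', Finset.mem_filter.2 ⟨hv1, hv2⟩⟩
            _ ≤ ∑ t' ∈ univ.filter (fun t' => t' < t), #((Y a ×ˢ Y b).filter fun q => s(q.1, q.2) ∈ useE (S t') (f t')) := Finset.card_biUnion_le
            _ ≤ ∑ t' ∈ univ.filter (fun t' => t' < t), 2 * ((Δ + 1) * M) := by
                refine Finset.sum_le_sum fun t' ht' => le_trans (emb_b2 (hf t' (Finset.mem_filter.1 ht').2) hvY a b) ?_
                have := hM t'
                gcongr
            _ ≤ ∑ t' : Fin T, 2 * ((Δ + 1) * M) := Finset.sum_le_sum_of_subset (Finset.filter_subset _ _)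
            _ ≤ _ := by simpa using hKU)
  have hcE : ∀ t v, (S t).C.comp v → (S t).C.top v ≠ v → (S t).C.comp ((S t).par v) ∧ (S t).C.top ((S t).par v) = (S t).C.top v := by
    intro t v hv ht
    have := (S t).C.top_par v hv.1 hv.2 ht
    exact ⟨⟨this.1, this.2.1⟩, this.2.2.1⟩
  have hlc : ∀ t t' v v', (S t).lt v → (S t').C.comp v' → (S t').C.top v' ≠ v' →
      s(φ t v, φ t ((S t).par v)) ≠ s(φ t' v', φ t' ((S t').par v')) := by
    intro t t' v v' hv hv' ht' he
    obtain ⟨a, ha⟩ := lt_Y (hφ t) v hv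
    have h1 := emb_comp (hφ t') hvY v' hv' a
    have h2 := emb_comp (hφ t') hvY _ (hcE t' v' hv' ht').1 a
    rw [Sym2.eq_iff] at he
    rcases he with ⟨h3, h4⟩ | ⟨h3, h4⟩
    · rw [h3, h4] at ha; tauto
    · rw [h3, h4] at ha; tauto
  have hll : ∀ t t' v v', t < t' → (S t).lt v → (S t').lt v' →
      s(φ t v, φ t ((S t).par v)) ≠ s(φ t' v', φ t' ((S t').par v')) := by
    intro t t' v v' htt hv hv' he
    have h1 := ((hφ t').light v' hv').2
    rw [← he] at h1
    exact h1 ⟨t, htt, v, hv, rfl⟩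
  refine ⟨φ, fun t => (hφ t).inj, ?_, ?_⟩
  · intro t v hv
    rcases nonroot_cases (S t) v hv with h | ⟨h, h'⟩
    · exact ((hφ t).light v h).1
    · obtain ⟨z, hz⟩ := (hφ t).onC
      have h1 := hz v h
      have h2 := hz _ (hcE t v h h').1
      rw [(hcE t v h h').2] at h2
      rw [h1.2, h2.2]
      exact Or.inl ((P.tp t).adj v h h' _ h1.1)
  · intro t t' htt v v' hv hv'
    rcases nonroot_cases (S t) v hv with h | ⟨h, h'⟩
    · rcases nonroot_cases (S t') v' hv' with h1 | ⟨h1, h1'⟩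
      · rcases lt_or_gt_of_ne htt with hlt | hlt
        · exact hll t t' v v' hlt h h1
        · exact (hll t' t v' v hlt h1 h).symm
      · exact hlc t t' v v' h h1 h1'
    · rcases nonroot_cases (S t') v' hv' with h1 | ⟨h1, h1'⟩
      · exact (hlc t' t v' v h1 h h').symm
      · obtain ⟨z, hz⟩ := (hφ t).onC
        have h2 := hz v h
        have h3 := hz _ (hcE t v h h').1
        rw [(hcE t v h h').2] at h3
        obtain ⟨z', hz'⟩ := (hφ t').onC
        have h4 := hz' v' h1
        have h5 := hz' _ (hcE t' v' h1 h1').1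
        rw [(hcE t' v' h1 h1').2] at h5
        rw [h2.2, h3.2, h4.2, h5.2]
        exact P.disj t t' htt v v' h h1 h' h1' _ h2.1 _ h4.1

end ModI4
end ApproxDecomp

open SimpleGraph
namespace ApproxDecomp
section ModJ1

/-- basic scale relations -/
structure Sc (n L s m p B η W : ℝ) : Prop where
  h0 : 0 < η
  h1 : η ≤ 1 / 60
  hL : 1 ≤ L
  hLW : L ≤ W
  hs : 0 < s
  hm : 1 ≤ m
  hp : 0 < p
  hB : 0 < B
  hn0 : 0 < n
  hn : n ≤ (1 + η) * (L * s)
  hsm : (1 - 2 * η) * s ≤ m * p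
  hpB : (1 - 2 * η) * p ≤ B
  hms : m * p ≤ s

variable {n L s m p B η W : ℝ}

lemma Sc.p2 (h : Sc n L s m p B η W) : p ≤ 2 * B := by
  have := h.hpB; have := h.h1; have := h.hp; nlinarith
lemma Sc.s2 (h : Sc n L s m p B η W) : s ≤ 2 * (m * p) := by
  have := h.hsm; have := h.h1; have := h.hs; nlinarith
lemma Sc.n2s (h : Sc n L s m p B η W) : n ≤ 2 * (L * s) := by
  have h1 := h.hn; have h2 := h.h1
  have h3 : 0 ≤ L * s := mul_nonneg (by linarith [h.hL]) h.hs.le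
  nlinarith
lemma Sc.n2 (h : Sc n L s m p B η W) : n ≤ 2 * (L * (m * p)) := by
  have h1 := h.hn; have h2 := h.h1
  have hL : 0 < L := by linarith [h.hL]
  have h3 : L * ((1 - 2 * η) * s) ≤ L * (m * p) := mul_le_mul_of_nonneg_left h.hsm hL.le
  have h4 : 0 ≤ L * s := mul_nonneg hL.le h.hs.le
  nlinarith
lemma Sc.n4 (h : Sc n L s m p B η W) : n ≤ 4 * (L * (m * B)) := by
  have h1 := h.n2
  have hL : 0 < L := by linarith [h.hL]
  have hm : 0 < m := by linarith [h.hm]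
  have : L * (m * p) ≤ L * (m * (2 * B)) := by gcongr; exact h.p2
  linarith

lemma Sc.eB (h : Sc n L s m p B η W) (θ : ℝ) (hθ : 0 ≤ θ) (hθ2 : 8 * (θ * W * m) ≤ 1) : 2 * (θ * n) ≤ B := by
  have h1 := h.n4
  have hm : 0 < m := by linarith [h.hm]
  have hL : 0 < L := by linarith [h.hL]
  have hB := h.hB
  calc 2 * (θ * n) ≤ 2 * (θ * (4 * (W * (m * B)))) := by
        have : L * (m * B) ≤ W * (m * B) := by gcongr; exact h.hLW
        gcongr; linarith
    _ = 8 * (θ * W * m) * B := by ring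
    _ ≤ 1 * B := by gcongr
    _ = B := one_mul B

lemma scal1 (ν η : ℝ) (hν : 0 < ν) (hν1 : ν < 1) (hη : η = ν / 60) :
    (1 - ν) * (1 + η) ≤ (1 - ν / 2) * ((1 - η) * (1 - 2 * η) ^ 2) := by
  have h1 : 1 - 5 * η ≤ (1 - η) * (1 - 2 * η) ^ 2 := by
    have h0 : 0 < η := by rw [hη]; positivity
    have : η ≤ 1 / 60 := by rw [hη]; linarith
    have e : (1 - η) * (1 - 2 * η) ^ 2 = 1 - 5 * η + η ^ 2 * (8 - 4 * η) := by ring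
    rw [e]
    have : 0 ≤ η ^ 2 * (8 - 4 * η) := mul_nonneg (by positivity) (by linarith)
    linarith
  have h2 : (1 - ν / 2) * (1 - 5 * η) ≤ (1 - ν / 2) * ((1 - η) * (1 - 2 * η) ^ 2) := mul_le_mul_of_nonneg_left h1 (by linarith)
  refine le_trans ?_ h2
  subst hη
  nlinarith

lemma scal2 (ν η : ℝ) (hν : 0 < ν) (hν1 : ν < 1) (hη : η = ν / 60) :
    (1 - ν) * (1 + η) ^ 2 ≤ (1 - ν / 2) * ((1 - η) ^ 2 * (1 - 2 * η) ^ 3) := by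
  have h0 : 0 < η := by rw [hη]; positivity
  have h60 : η ≤ 1 / 60 := by rw [hη]; linarith
  have ha : 1 - 2 * η ≤ (1 - η) ^ 2 := by nlinarith [sq_nonneg η]
  have hb : 1 - 6 * η ≤ (1 - 2 * η) ^ 3 := by
    have e : (1 - 2 * η) ^ 3 = 1 - 6 * η + η ^ 2 * (12 - 8 * η) := by ring
    rw [e]
    have : 0 ≤ η ^ 2 * (12 - 8 * η) := mul_nonneg (by positivity) (by linarith)
    linarith
  have h1 : 1 - 8 * η ≤ (1 - η) ^ 2 * (1 - 2 * η) ^ 3 := by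
    calc 1 - 8 * η ≤ (1 - 2 * η) * (1 - 6 * η) := by nlinarith [sq_nonneg η]
      _ ≤ _ := mul_le_mul ha hb (by linarith) (by positivity)
  have h2 := mul_le_mul_of_nonneg_left h1 (show 0 ≤ 1 - ν / 2 by linarith)
  refine le_trans ?_ h2
  have h3 : (1 + η) ^ 2 ≤ 1 + 3 * η := by nlinarith
  have h4 := mul_le_mul_of_nonneg_left h3 (show 0 ≤ 1 - ν by linarith)
  refine le_trans h4 ?_
  subst hη
  nlinarith

/-- the activity bound -/
lemma ar_A (h : Sc n L s m p B η W) (ν θ N Z : ℝ) (hν : 0 < ν) (hν1 : ν < 1) (hη : η = ν / 60) (hθ : 0 ≤ θ) (hθ2 : 8 * (θ * W * m) ≤ 1)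
    (hN0 : 0 ≤ N) (hN : N ≤ (1 - ν) * n) (hm : 4 * (Z + 1) ≤ ν * m) :
    (N / ((1 - η) * L) + 2 * (θ * n)) / B + 2 * Z + 1 ≤ m := by
  have h1 := h.eB θ hθ hθ2
  have hB := h.hB
  have hL : 0 < L := by linarith [h.hL]
  have h60 := h.h1
  have h0 := h.h0
  have hmm := h.hm
  have hs := h.hs
  have h2 : N / ((1 - η) * L) ≤ (1 - ν / 2) * (m * B) := by
    rw [div_le_iff₀ (mul_pos (by linarith) hL)]
    have e1 : (1 - 2 * η) ^ 2 * s ≤ m * B := by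
      calc (1 - 2 * η) ^ 2 * s = (1 - 2 * η) * ((1 - 2 * η) * s) := by ring
        _ ≤ (1 - 2 * η) * (m * p) := mul_le_mul_of_nonneg_left h.hsm (by linarith)
        _ = m * ((1 - 2 * η) * p) := by ring
        _ ≤ m * B := mul_le_mul_of_nonneg_left h.hpB (by linarith)
    calc N ≤ (1 - ν) * ((1 + η) * (L * s)) := le_trans hN (mul_le_mul_of_nonneg_left h.hn (by linarith))
      _ = (1 - ν) * (1 + η) * (L * s) := by ring
      _ ≤ (1 - ν / 2) * ((1 - η) * (1 - 2 * η) ^ 2) * (L * s) := mul_le_mul_of_nonneg_right (scal1 ν η hν hν1 hη) (by positivity)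
      _ = (1 - ν / 2) * (1 - η) * L * ((1 - 2 * η) ^ 2 * s) := by ring
      _ ≤ (1 - ν / 2) * (1 - η) * L * (m * B) := mul_le_mul_of_nonneg_left e1 (mul_nonneg (mul_nonneg (by linarith) (by linarith)) hL.le)
      _ = _ := by ring
  have h3 : (N / ((1 - η) * L) + 2 * (θ * n)) / B ≤ (1 - ν / 2) * m + 1 := by
    rw [div_le_iff₀ hB]
    calc N / ((1 - η) * L) + 2 * (θ * n) ≤ (1 - ν / 2) * (m * B) + B := by linarith
      _ = _ := by ring
  linarith

/-- the edge load bound -/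
lemma ar_E (h : Sc n L s m p B η W) (ν α ε d d0 θ R T c Z : ℝ) (hν : 0 < ν) (hν1 : ν < 1) (hη : η = ν / 60) (hθ : 0 ≤ θ)
    (hα : 0 < α) (hε : 0 ≤ ε) (hd0 : 0 < d0) (hd01 : d0 ≤ 1) (hd : d0 ≤ d) (hZ : 0 ≤ Z) (hc : 0 ≤ c)
    (hR : R ≤ (1 - ν) * ((α + ε) * n ^ 2 / 2)) (hT0 : 0 ≤ T) (hT : T ≤ c * n) (hθ2 : 1000 * (θ * W * m * (1 + Z)) ≤ ν * d0)
    (hm : 240 * (c * (1 + Z)) ≤ α * ν * m) :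
    (2 * (R * (d / ((α + ε) * L) / (1 - η)) + n * (θ * n)) * (1 / ((1 - η) * L * B)) +
      2 * (T * (d / ((α + ε) * L) / (1 - η)) + θ * n) * (θ * n / B + Z)) / (m * m) + 2 * (θ * n) ≤ (1 - η) * d * p := by
  have hB := h.hB
  have hL : 0 < L := by linarith [h.hL]
  have h60 := h.h1
  have h0 := h.h0
  have hmm : 0 < m := by linarith [h.hm]
  have hs := h.hs
  have hp := h.hp
  have hn0 := h.hn0
  have hαε : 0 < α + ε := by linarith
  have h1η : 0 < 1 - η := by linarith
  have hW : 0 < W := by linarith [h.hLW]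
  have hd' : 0 < d := by linarith
  have hθWm : θ * W * m ≤ θ * W * m * (1 + Z) := by
    have : 0 ≤ θ * W * m := by positivity
    nlinarith
  have hνd : ν * d0 ≤ 1 := by nlinarith
  have hνp : 0 < ν * d0 := mul_pos hν hd0
  have hpos1 : 0 ≤ θ * W * m := by positivity
  have hpos2 : 0 ≤ θ * W * m * (1 + Z) := by positivity
  have h1 := h.eB θ hθ (by linarith)
  have heB : θ * n / B ≤ 1 := by
    rw [div_le_one hB]
    have : 0 ≤ θ * n := by positivity
    linarith
  have hθn : θ * n ≤ 2 * (θ * W * m) * p := by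
    calc θ * n ≤ θ * (2 * (L * (m * p))) := mul_le_mul_of_nonneg_left h.n2 hθ
      _ ≤ θ * (2 * (W * (m * p))) := by gcongr; exact h.hLW
      _ = _ := by ring
  -- main term
  have t1 : R * (d / ((α + ε) * L) / (1 - η)) * (1 / ((1 - η) * L * B)) * 2 / (m * m) ≤ (1 - ν / 2) * (d * p) := by
    have e1 : n ^ 2 * (1 - 2 * η) ^ 3 ≤ (1 + η) ^ 2 * L ^ 2 * (m * m) * (p * B) := by
      have a1 : n * (1 - 2 * η) ≤ (1 + η) * L * (m * p) := by
        calc n * (1 - 2 * η) ≤ (1 + η) * (L * s) * (1 - 2 * η) := mul_le_mul_of_nonneg_right h.hn (by linarith)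
          _ = (1 + η) * L * ((1 - 2 * η) * s) := by ring
          _ ≤ _ := mul_le_mul_of_nonneg_left h.hsm (by positivity)
      have a2 : (n * (1 - 2 * η)) ^ 2 ≤ ((1 + η) * L * (m * p)) ^ 2 :=
        pow_le_pow_left₀ (mul_nonneg hn0.le (by linarith)) a1 2
      calc n ^ 2 * (1 - 2 * η) ^ 3 = (n * (1 - 2 * η)) ^ 2 * (1 - 2 * η) := by ring
        _ ≤ ((1 + η) * L * (m * p)) ^ 2 * (1 - 2 * η) := mul_le_mul_of_nonneg_right a2 (by linarith)
        _ = (1 + η) ^ 2 * L ^ 2 * (m * m) * p * ((1 - 2 * η) * p) := by ring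
        _ ≤ (1 + η) ^ 2 * L ^ 2 * (m * m) * p * B := mul_le_mul_of_nonneg_left h.hpB (by positivity)
        _ = _ := by ring
    have e2 : R * (d / ((α + ε) * L) / (1 - η)) * (1 / ((1 - η) * L * B)) * 2 / (m * m) =
        R * (2 * d) / ((α + ε) * (1 - η) ^ 2 * L ^ 2 * B * (m * m)) := by
      field_simp
    rw [e2, div_le_iff₀ (by positivity)]
    have h12 : 0 < (1 - 2 * η) ^ 3 := pow_pos (by linarith) 3
    refine le_of_mul_le_mul_right ?_ h12
    calc R * (2 * d) * (1 - 2 * η) ^ 3 ≤ (1 - ν) * ((α + ε) * n ^ 2 / 2) * (2 * d) * (1 - 2 * η) ^ 3 := by gcongr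
      _ = (1 - ν) * (α + ε) * d * (n ^ 2 * (1 - 2 * η) ^ 3) := by ring
      _ ≤ (1 - ν) * (α + ε) * d * ((1 + η) ^ 2 * L ^ 2 * (m * m) * (p * B)) :=
          mul_le_mul_of_nonneg_left e1 (mul_nonneg (mul_nonneg (by linarith) hαε.le) hd'.le)
      _ = ((1 - ν) * (1 + η) ^ 2) * ((α + ε) * d * L ^ 2 * (m * m) * (p * B)) := by ring
      _ ≤ ((1 - ν / 2) * ((1 - η) ^ 2 * (1 - 2 * η) ^ 3)) * ((α + ε) * d * L ^ 2 * (m * m) * (p * B)) :=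
          mul_le_mul_of_nonneg_right (scal2 ν η hν hν1 hη) (by positivity)
      _ = _ := by ring
  have t2 : n * (θ * n) * (1 / ((1 - η) * L * B)) * 2 / (m * m) ≤ ν / 30 * (d * p) := by
    have e2 : n * (θ * n) * (1 / ((1 - η) * L * B)) * 2 / (m * m) = 2 * (θ * n) * n / ((1 - η) * L * B * (m * m)) := by
      field_simp
    rw [e2, div_le_iff₀ (by positivity)]
    calc 2 * (θ * n) * n ≤ 2 * (2 * (θ * W * m) * p) * (4 * (L * (m * B))) := by
          gcongr; exact h.n4
      _ = 16 * (θ * W * m) * (p * L * m * B) := by ring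
      _ ≤ (ν * d0 / 60) * (p * L * m * B) := by
          refine mul_le_mul_of_nonneg_right ?_ (by positivity)
          linarith
      _ ≤ (ν * d / 60) * (p * L * m * B) := by gcongr
      _ ≤ ν / 30 * (d * p) * ((1 / 2) * L * B * (m * 1)) := by
          apply le_of_eq; ring
      _ ≤ _ := by
          gcongr
          · linarith
          · exact h.hm
  have t3 : T * (d / ((α + ε) * L) / (1 - η)) * (θ * n / B + Z) * 2 / (m * m) ≤ ν / 30 * (d * p) := by
    have e1 : T * (d / ((α + ε) * L) / (1 - η)) ≤ 4 * c * (m * p) * d / α := by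
      rw [div_div, ← mul_div_assoc, div_le_div_iff₀ (by positivity) hα]
      calc T * d * α ≤ (c * (2 * (L * (m * p)))) * d * (α + ε) := by
            have := le_trans hT (mul_le_mul_of_nonneg_left h.n2 hc)
            gcongr
            linarith
        _ = 4 * c * (m * p) * d * ((α + ε) * L * (1 / 2)) := by ring
        _ ≤ _ := by gcongr; linarith
    have e2 : θ * n / B + Z ≤ 1 + Z := by linarith
    have e0 : 0 ≤ θ * n / B + Z := by positivity
    rw [div_le_iff₀ (by positivity)]
    calc T * (d / ((α + ε) * L) / (1 - η)) * (θ * n / B + Z) * 2 ≤ (4 * c * (m * p) * d / α) * (1 + Z) * 2 := by gcongr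
      _ = (240 * (c * (1 + Z))) * ((m * p) * d / α / 30) := by ring
      _ ≤ (α * ν * m) * ((m * p) * d / α / 30) := by gcongr
      _ = _ := by field_simp
  have t4 : θ * n * (θ * n / B + Z) * 2 / (m * m) ≤ ν / 30 * (d * p) := by
    have e0 : 0 ≤ θ * n / B + Z := by positivity
    rw [div_le_iff₀ (by positivity)]
    calc θ * n * (θ * n / B + Z) * 2 ≤ (2 * (θ * W * m) * p) * (1 + Z) * 2 := by gcongr
      _ = 4 * (θ * W * m * (1 + Z)) * p := by ring
      _ ≤ (ν * d0 / 30) * p := by gcongr; linarith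
      _ ≤ (ν * d / 30) * p := by gcongr
      _ = ν / 30 * (d * p) * (1 * 1) := by ring
      _ ≤ _ := by gcongr <;> exact h.hm
  have t5 : 2 * (θ * n) ≤ ν / 30 * (d * p) := by
    calc 2 * (θ * n) ≤ 2 * (2 * (θ * W * m) * p) := by linarith
      _ = 4 * (θ * W * m) * p := by ring
      _ ≤ (ν * d0 / 30) * p := by gcongr; linarith
      _ ≤ (ν * d / 30) * p := by gcongr
      _ = _ := by ring
  have hsum : (2 * (R * (d / ((α + ε) * L) / (1 - η)) + n * (θ * n)) * (1 / ((1 - η) * L * B)) +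
      2 * (T * (d / ((α + ε) * L) / (1 - η)) + θ * n) * (θ * n / B + Z)) / (m * m) =
      R * (d / ((α + ε) * L) / (1 - η)) * (1 / ((1 - η) * L * B)) * 2 / (m * m) + n * (θ * n) * (1 / ((1 - η) * L * B)) * 2 / (m * m) +
      T * (d / ((α + ε) * L) / (1 - η)) * (θ * n / B + Z) * 2 / (m * m) + θ * n * (θ * n / B + Z) * 2 / (m * m) := by ring
  rw [hsum]
  have hdp : 0 < d * p := by positivity
  have hfin : (1 - η) * d * p = (1 - ν / 60) * (d * p) := by rw [hη]; ring
  rw [hfin]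
  have : (1 - ν / 2) * (d * p) + 4 * (ν / 30 * (d * p)) ≤ (1 - ν / 60) * (d * p) := by
    have : 0 < ν * (d * p) := by positivity
    nlinarith
  linarith

/-- the marked load bound -/
lemma ar_M (h : Sc n L s m p B η W) (α ε d θ T c Z Δ k0 : ℝ) (hθ : 0 ≤ θ)
    (hα : 0 < α) (hα1 : α < 1) (hε : 0 ≤ ε) (hd0 : 0 ≤ d) (hd : d ≤ 1) (hZ : 0 ≤ Z) (hc : 1 ≤ c) (hk0 : 0 < k0) (hΔ : 0 ≤ Δ)
    (hT0 : 0 ≤ T) (hT : T ≤ c * n) (hθ2 : 8 * (θ * W * m) ≤ 1) (hθ3 : 2 * (θ * W) ≤ 1 / k0)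
    (hm : k0 * (1 + Z) ≤ m) :
    ((T * (d / ((α + ε) * L) / (1 - η)) + θ * n) * (((Δ + 1) * (2 * n / k0) / ((1 - η) * L) + θ * n) / B + Z)) / m + θ * n ≤
      86 * c * (Δ + 1) / (α * k0) * s := by
  have hB := h.hB
  have hL : 0 < L := by linarith [h.hL]
  have h60 := h.h1
  have h0 := h.h0
  have hmm : 0 < m := by linarith [h.hm]
  have hs := h.hs
  have hp := h.hp
  have hn0 := h.hn0
  have hαε : 0 < α + ε := by linarith
  have h1η : 0 < 1 - η := by linarith
  have hW : 0 < W := by linarith [h.hLW]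
  have h1 := h.eB θ hθ hθ2
  have hcp : 0 < c := by linarith
  have heB : θ * n / B ≤ 1 := by
    rw [div_le_one hB]
    have : 0 ≤ θ * n := by positivity
    linarith
  have hθn : θ * n ≤ 2 * (θ * W) * (m * p) := by
    calc θ * n ≤ θ * (2 * (L * (m * p))) := mul_le_mul_of_nonneg_left h.n2 hθ
      _ ≤ θ * (2 * (W * (m * p))) := by gcongr; exact h.hLW
      _ = _ := by ring
  have hcα : 1 ≤ c / α := by rw [le_div_iff₀ hα]; linarith
  have e1 : T * (d / ((α + ε) * L) / (1 - η)) ≤ 4 * (c / α) * (m * p) := by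
    have : 4 * (c / α) * (m * p) = 4 * c * (m * p) / α := by ring
    rw [this, div_div, ← mul_div_assoc, div_le_div_iff₀ (by positivity) hα]
    calc T * d * α ≤ (c * (2 * (L * (m * p)))) * 1 * (α + ε) := by
          have := le_trans hT (mul_le_mul_of_nonneg_left h.n2 hcp.le)
          gcongr
          linarith
      _ = 4 * c * (m * p) * ((α + ε) * L * (1 / 2)) := by ring
      _ ≤ _ := by gcongr; linarith
  have e2 : θ * n ≤ 1 * (m * p) := by
    have : 2 * (θ * W) ≤ 1 := by
      have : θ * W * 1 ≤ θ * W * m := by gcongr; exact h.hm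
      linarith
    refine le_trans hθn ?_
    gcongr
  have e3 : T * (d / ((α + ε) * L) / (1 - η)) + θ * n ≤ 5 * (c / α) * (m * p) := by
    have : 1 * (m * p) ≤ (c / α) * (m * p) := by gcongr
    linarith
  have e4 : (Δ + 1) * (2 * n / k0) / ((1 - η) * L) / B ≤ 16 * (Δ + 1) / k0 * m := by
    rw [div_div, div_le_iff₀ (by positivity)]
    calc (Δ + 1) * (2 * n / k0) ≤ (Δ + 1) * (2 * (4 * (L * (m * B))) / k0) := by
          gcongr; exact h.n4
      _ = 16 * (Δ + 1) / k0 * m * (1 / 2 * L * B) := by ring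
      _ ≤ _ := by gcongr; linarith
  have e5 : ((Δ + 1) * (2 * n / k0) / ((1 - η) * L) + θ * n) / B + Z ≤ 17 * (Δ + 1) / k0 * m := by
    rw [add_div]
    have : 1 + Z ≤ (Δ + 1) / k0 * m := by
      rw [div_mul_eq_mul_div, le_div_iff₀ hk0]
      have : m ≤ (Δ + 1) * m := by nlinarith
      linarith
    have e6 : 17 * (Δ + 1) / k0 * m = 16 * (Δ + 1) / k0 * m + (Δ + 1) / k0 * m := by ring
    linarith
  have e0 : 0 ≤ ((Δ + 1) * (2 * n / k0) / ((1 - η) * L) + θ * n) / B + Z := by positivity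
  have e7 : ((T * (d / ((α + ε) * L) / (1 - η)) + θ * n) * (((Δ + 1) * (2 * n / k0) / ((1 - η) * L) + θ * n) / B + Z)) / m ≤
      85 * c * (Δ + 1) / (α * k0) * s := by
    rw [div_le_iff₀ hmm]
    calc _ ≤ (5 * (c / α) * (m * p)) * (17 * (Δ + 1) / k0 * m) := by gcongr
      _ ≤ (5 * (c / α) * s) * (17 * (Δ + 1) / k0 * m) := by gcongr; exact h.hms
      _ = _ := by field_simp; ring
  have e8 : θ * n ≤ c * (Δ + 1) / (α * k0) * s := by
    calc θ * n ≤ 2 * (θ * W) * s := le_trans hθn (by gcongr; exact h.hms)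
      _ ≤ (1 / k0) * s := by gcongr
      _ ≤ ((c / α) * (Δ + 1) / k0) * s := by
          gcongr
          nlinarith
      _ = _ := by field_simp
  have e9 : 86 * c * (Δ + 1) / (α * k0) * s = 85 * c * (Δ + 1) / (α * k0) * s + c * (Δ + 1) / (α * k0) * s := by ring
  linarith

end ModJ1
end ApproxDecomp

open SimpleGraph
namespace ApproxDecomp
section ModJ2

set_option maxHeartbeats 1600000 in
/-- existence of the integer parameters -/
lemma numC_mk (n L s m p B ysz Δ c M k0 : ℕ) (η W κ d0 ε lam δg : ℝ) (h : Sc n L s m p B η W)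
    (hB2 : (B:ℝ) ≤ (1 - η) * p) (hms : (m:ℝ) * p ≤ (1 - η) * s) (hy : ysz + m * p = s)
    (hκ : κ = d0 * η) (hd0 : 0 < d0) (hd01 : d0 ≤ 1) (hε : 0 < ε) (hε2 : ε ≤ d0 / 2)
    (hε3 : 4 * ε * m ≤ η) (hε4 : 1000 * (Δ + 1) * ε ≤ κ) (hlam0 : 0 < lam) (hlam : 1000 * (Δ + 1) * lam ≤ κ ^ 2)
    (hk0 : 1 ≤ lam * k0) (hδg : 0 < δg) (hδg1 : 1000 * (Δ + 1) * (2 * W * δg) ≤ κ)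
    (b1 : 8 * Δ ≤ κ * p) (b2 : 100 * (3 + 3 * Δ) ≤ κ * s) (b3 : 16 * c * W * (Δ + 1) * M ≤ κ * ε * s) :
    ∃ q1 q2 q3 q4 q5 q6 : ℕ, 10 * (s:ℝ) / k0 ≤ q6 ∧
      NumC n s p Δ B (2 * Δ + 2 * c * (Δ + 1) * M + 1) (c * n * (2 * ((Δ + 1) * M))) q1 q2 q3 q4 q5 q6 ysz d0 ε (η / 2) (η / 2)
        (lam * s) (κ * p / 8) (κ * s / 4) δg := by
  have h0 := h.h0
  have h60 := h.h1
  have hs := h.hs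
  have hp := h.hp
  have hn0 := h.hn0
  have hL : (0:ℝ) < L := by linarith [h.hL]
  have hW1 : 1 ≤ W := by linarith [h.hL, h.hLW]
  have hκ0 : 0 < κ := by rw [hκ]; positivity
  have hκη : κ ≤ η := by rw [hκ]; nlinarith
  have hκ1 : κ ≤ 1 := by linarith
  have hΔ0 : (0:ℝ) ≤ Δ := Nat.cast_nonneg _
  have hk0p : (0:ℝ) < k0 := by
    by_contra hh
    have : (k0:ℝ) = 0 := le_antisymm (by linarith) (Nat.cast_nonneg _)
    rw [this] at hk0; linarith
  have hyR : (ysz:ℝ) + m * p = s := by exact_mod_cast hy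
  have hyη : η * s ≤ ysz := by linarith
  have hdy : κ * s / 2 ≤ d0 / 2 * ysz := by
    calc κ * s / 2 = d0 / 2 * (η * s) := by rw [hκ]; ring
      _ ≤ _ := by gcongr
  have hnW : (n:ℝ) ≤ 2 * (W * s) := by
    refine le_trans h.n2s ?_
    have := h.hLW
    gcongr
  have hlamκ : lam * 1000 ≤ κ := by
    have : 1000 * lam ≤ 1000 * (Δ + 1) * lam := by nlinarith
    nlinarith
  have hεκ : ε * 1000 ≤ κ := by
    have : 1000 * ε ≤ 1000 * (Δ + 1) * ε := by nlinarith
    linarith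
  have hδs : δg * n ≤ 2 * W * δg * s := by
    calc δg * n ≤ δg * (2 * (W * s)) := by gcongr
      _ = _ := by ring
  have hδκ : (Δ + 1) * (δg * n) * 1000 ≤ κ * s := by
    calc (Δ + 1) * (δg * n) * 1000 ≤ (Δ + 1) * (2 * W * δg * s) * 1000 := by gcongr
      _ = 1000 * (Δ + 1) * (2 * W * δg) * s := by ring
      _ ≤ _ := by gcongr
  have hδκ' : δg * n * 1000 ≤ κ * s := by
    have : 0 ≤ Δ * (δg * n) := by positivity
    linarith
  have hδ1 : δg ≤ 1 := by
    have : 2 * W * δg * 1000 ≤ 1000 * (Δ + 1) * (2 * W * δg) := by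
      have : 0 ≤ Δ * (2 * W * δg) := by positivity
      linarith
    have : 1 * δg ≤ W * δg := mul_le_mul_of_nonneg_right hW1 hδg.le
    linarith
  have hεs : (Δ + 1) * (ε * s) * 1000 ≤ κ * s := by
    calc (Δ + 1) * (ε * s) * 1000 = 1000 * (Δ + 1) * ε * s := by ring
      _ ≤ _ := by gcongr
  have hls : (Δ + 1) * (8 * lam * s / κ) * 1000 ≤ 8 * (κ * s) := by
    calc (Δ + 1) * (8 * lam * s / κ) * 1000 = (1000 * (Δ + 1) * lam) * (8 * s / κ) := by ring
      _ ≤ κ ^ 2 * (8 * s / κ) := by gcongr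
      _ = _ := by field_simp
  have hks : 10 * (s:ℝ) / k0 * 100 ≤ κ * s := by
    have : 10 * (s:ℝ) / k0 ≤ 10 * lam * s := by
      rw [div_le_iff₀ hk0p]
      nlinarith
    have : lam * s * 1000 ≤ κ * s := by nlinarith
    linarith
  have hκs : κ * s ≤ η * s := by gcongr
  have hΔ1 : (0:ℝ) ≤ ε * s := by positivity
  have hls0 : 0 ≤ 8 * lam * s / κ := by positivity
  obtain ⟨q1, hq1a, hq1b⟩ : ∃ q : ℕ, (q:ℝ) ≤ κ * s / 4 ∧ κ * s / 4 < q + 1 :=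
    ⟨⌊κ * s / 4⌋₊, Nat.floor_le (by positivity), Nat.lt_floor_add_one _⟩
  have hce : ∀ x : ℝ, 0 ≤ x → ∃ q : ℕ, x ≤ q ∧ (q:ℝ) ≤ x + 1 := fun x hx =>
    ⟨⌈x⌉₊, Nat.le_ceil _, (Nat.ceil_lt_add_one hx).le⟩
  obtain ⟨q2, hq2a, hq2b⟩ := hce (ε * s + 8 * lam * s / κ) (by positivity)
  obtain ⟨q4, hq4a, hq4b⟩ := hce (δg * n) (by positivity)
  obtain ⟨q5, hq5a, hq5b⟩ := hce (2 * (ε * s)) (by positivity)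
  obtain ⟨q6, hq6a, hq6b⟩ := hce (10 * (s:ℝ) / k0) (by positivity)
  have hBn : 0 < B := by exact_mod_cast h.hB
  have hsn : 0 < s := by exact_mod_cast hs
  have hpn : 0 < p := by exact_mod_cast hp
  have hnn : 0 < n := by exact_mod_cast hn0
  have hεs2 : ε * s ≤ η / 2 * p := by
    calc ε * s ≤ ε * (2 * (m * p)) := by have := h.s2; gcongr
      _ = (4 * ε * m) * (p / 2) := by ring
      _ ≤ η * (p / 2) := by gcongr
      _ = _ := by ring
  have hεs3 : ε * s * 1000 ≤ κ * s := by nlinarith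
  refine ⟨q1, q2, 2 * q4, q4, q5, q6, hq6a, ⟨hBn, hε.le, hε2, hd0.le, hsn, hpn, ?_, ?_, by positivity, ?_, hεs2, by positivity, ?_, ?_, hq4a, rfl, ?_, by positivity, ?_, ?_, ?_, ?_⟩⟩
  · linarith
  · have : lam * s * 1000 ≤ κ * s := by nlinarith
    nlinarith [mul_pos hκ0 hs]
  · nlinarith
  · have : d0 / 2 * (η / 2 * p) = κ * p / 4 := by rw [hκ]; ring
    rw [this]; linarith
  · have : p * (lam * s) / (κ * p / 8) = 8 * lam * s / κ := by field_simp
    rw [this]; exact hq2a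
  · have hq4n : q4 ≤ 2 * n := by
      have h1 : (1:ℝ) ≤ n := by exact_mod_cast hnn
      have : (q4:ℝ) ≤ 2 * n := by nlinarith
      exact_mod_cast this
    calc Δ * q4 + c * n * (2 * ((Δ + 1) * M)) ≤ Δ * (2 * n) + c * n * (2 * ((Δ + 1) * M)) := by gcongr
      _ = (2 * Δ + 2 * c * (Δ + 1) * M) * n := by ring
      _ < (2 * Δ + 2 * c * (Δ + 1) * M) * n + n := by omega
      _ = _ := by ring
  · linarith
  · refine le_trans ?_ hq5a
    have : ((c * n * (2 * ((Δ + 1) * M)) : ℕ) : ℝ) / (κ * s / 4) ≤ ε * s := by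
      rw [div_le_iff₀ (by positivity)]
      push_cast
      calc (c:ℝ) * n * (2 * ((Δ + 1) * M)) ≤ c * (2 * (W * s)) * (2 * ((Δ + 1) * M)) := by gcongr
        _ = (16 * c * W * (Δ + 1) * M) * (s / 4) := by ring
        _ ≤ (κ * ε * s) * (s / 4) := by gcongr
        _ = _ := by ring
    linarith
  · have : (q6:ℝ) + Δ * q2 + Δ * q4 < q1 := by
      have e1 : Δ * (q2:ℝ) ≤ Δ * (ε * s) + Δ * (8 * lam * s / κ) + Δ := by
        calc Δ * (q2:ℝ) ≤ Δ * (ε * s + 8 * lam * s / κ + 1) := by gcongr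
          _ = _ := by ring
      have e2 : Δ * (q4:ℝ) ≤ Δ * (δg * n) + Δ := by
        calc Δ * (q4:ℝ) ≤ Δ * (δg * n + 1) := by gcongr
          _ = _ := by ring
      have e3 : 0 ≤ δg * n := by positivity
      linarith
    exact_mod_cast this
  · have : (2 * q4 : ℝ) + q5 + q6 ≤ ysz := by linarith
    exact_mod_cast this

end ModJ2
end ApproxDecomp

open SimpleGraph
namespace ApproxDecomp
section ModJ3
open scoped Classical
open Finset

structure C1 (Δ c k0 k Z m : ℕ) (α ν η d0 κ lam δ ε : ℝ) : Prop where
  ν0 : 0 < ν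
  ν1 : ν < 1
  α0 : 0 < α
  α1 : α < 1
  hη : η = ν / 60
  hd0 : d0 = η ^ 2 * α / 2
  hκ : κ = d0 * η
  hc : 1 ≤ c
  hk0 : 1 ≤ k0
  hlam : lam = 86 * c * (Δ + 1) ^ 2 / (α * k0)
  hlam2 : 1000 * (Δ + 1) * lam ≤ κ ^ 2
  hk : k = (Δ + 1) ^ 2 * k0
  hZ : Z = Fintype.card (QT k) * k
  m1 : (k0:ℝ) * (1 + Z) ≤ m
  m2 : 4 * ((Z:ℝ) + 1) ≤ ν * m
  m3 : 240 * ((c:ℝ) * (1 + Z)) ≤ α * ν * m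
  hδ : δ = η / (4 * k)
  ε0 : 0 < ε
  εα : ε ≤ α
  ε1 : ε < 1
  e2 : ε ≤ d0 / 2
  e3 : 12 * ε * m ≤ δ * κ
  e4 : 1000 * (Δ + 1) * ε ≤ κ

structure C2 (Δ c k0 k Z m W M : ℕ) (α ν η d0 κ lam δ ε θ μ δg : ℝ) : Prop extends
    C1 Δ c k0 k Z m α ν η d0 κ lam δ ε where
  W0 : 0 < W
  θ0 : 0 < θ
  t1 : 1000 * (θ * W * m * (1 + Z)) ≤ ν * d0
  t2 : 2 * (θ * W) ≤ 1 / k0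
  μ0 : 0 < μ
  μ1 : 10 * W * (Δ + 1) ^ 2 * μ ≤ θ ^ 2
  hM : 1 ≤ μ * M
  g0 : 0 < δg
  g1 : 1000 * (Δ + 1) * (2 * W * δg) ≤ κ

structure Big (Δ c k0 k m W M : ℕ) (η κ δ ε θ μ : ℝ) (n s : ℕ) : Prop where
  b1 : 1 ≤ η * s
  b2 : 2 * m ≤ η * s
  b3 : 6 * m ≤ δ * κ * s
  b4 : 16 * Δ * m ≤ κ * s
  b5 : 100 * (3 + 3 * Δ) ≤ κ * s
  b6 : 16 * c * W * (Δ + 1) * M ≤ κ * ε * s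
  b7 : (M:ℝ) * k0 ≤ s
  n1 : 1 ≤ μ * n
  n2 : k0 * (Δ + 1) * M ≤ n
  n3 : 2 * (W:ℝ) ^ 2 * c ≤ θ ^ 2 * n
  n4 : ((W:ℝ) ^ 2 * m ^ 2 + W ^ 2 * m) * c * (W * Fintype.card (QT k) * m * k) ^ 2 ≤ θ ^ 2 * n

lemma C1.d0_pos {Δ c k0 k Z m : ℕ} {α ν η d0 κ lam δ ε : ℝ} (h : C1 Δ c k0 k Z m α ν η d0 κ lam δ ε) :
    0 < η ∧ η ≤ 1 / 60 ∧ 0 < d0 ∧ d0 ≤ 1 ∧ 0 < κ ∧ κ ≤ 1 ∧ 0 < lam ∧ 1 ≤ m ∧ 1 ≤ k ∧ 0 < δ ∧ δ ≤ 1 ∧ 1 ≤ lam * k0 := by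
  have hν := h.ν0
  have hν1 := h.ν1
  have hα := h.α0
  have hη : 0 < η := by rw [h.hη]; positivity
  have hη1 : η ≤ 1 / 60 := by rw [h.hη]; linarith
  have hd : 0 < d0 := by rw [h.hd0]; positivity
  have hd1 : d0 ≤ 1 := by
    rw [h.hd0]
    have : η ^ 2 ≤ 1 := by nlinarith
    have := h.α1
    nlinarith
  have hκ : 0 < κ := by rw [h.hκ]; positivity
  have hκ1 : κ ≤ 1 := by rw [h.hκ]; nlinarith
  have hk0 : (1:ℝ) ≤ k0 := by exact_mod_cast h.hk0
  have hc : (1:ℝ) ≤ c := by exact_mod_cast h.hc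
  have hlam : 0 < lam := by rw [h.hlam]; positivity
  have hm : 1 ≤ m := by
    have h1 := h.m1
    have : (0:ℝ) ≤ Z := Nat.cast_nonneg _
    have : (1:ℝ) ≤ m := by nlinarith
    exact_mod_cast this
  have hk : 1 ≤ k := by
    rw [h.hk]; exact Nat.one_le_iff_ne_zero.2 (by have := h.hk0; positivity)
  have hkR : (1:ℝ) ≤ k := by exact_mod_cast hk
  refine ⟨hη, hη1, hd, hd1, hκ, hκ1, hlam, hm, hk, by rw [h.hδ]; positivity, ?_, ?_⟩
  · rw [h.hδ, div_le_one (by positivity)]; linarith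
  · rw [h.hlam]
    have e : 86 * (c:ℝ) * (Δ + 1) ^ 2 / (α * k0) * k0 = 86 * c * (Δ + 1) ^ 2 / α := by field_simp
    rw [e, le_div_iff₀ hα]
    have h1 : (1:ℝ) ≤ ((Δ:ℝ) + 1) ^ 2 := by
      have : (0:ℝ) ≤ Δ := Nat.cast_nonneg _
      nlinarith
    have := h.α1
    nlinarith

lemma scale_exists {n L s m : ℕ} {η W : ℝ} (hη : 0 < η) (hη1 : η ≤ 1 / 60) (hL : 1 ≤ L) (hLW : (L:ℝ) ≤ W) (hs : 0 < s)
    (hm : 1 ≤ m) (hn : 0 < n) (hcov : (n:ℝ) ≤ s * L + L) (b1 : 1 ≤ η * s) (b2 : 2 * m ≤ η * s) :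
    ∃ p B ysz : ℕ, Sc n L s m p B η W ∧ (B:ℝ) ≤ (1 - η) * p ∧ (m:ℝ) * p ≤ (1 - η) * s ∧ ysz + m * p = s := by
  have hmR : (1:ℝ) ≤ m := by exact_mod_cast hm
  have hsR : (0:ℝ) < s := by exact_mod_cast hs
  have hLR : (1:ℝ) ≤ L := by exact_mod_cast hL
  obtain ⟨p, hp1, hp2⟩ : ∃ p : ℕ, (p:ℝ) ≤ (1 - η) * s / m ∧ (1 - η) * s / m < p + 1 :=
    ⟨_, Nat.floor_le (div_nonneg (mul_nonneg (by linarith) hsR.le) (by linarith)), Nat.lt_floor_add_one _⟩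
  obtain ⟨B, hB1, hB2⟩ : ∃ B : ℕ, (B:ℝ) ≤ (1 - η) * p ∧ (1 - η) * p < B + 1 :=
    ⟨_, Nat.floor_le (mul_nonneg (by linarith) (Nat.cast_nonneg _)), Nat.lt_floor_add_one _⟩
  rw [le_div_iff₀ (by linarith)] at hp1
  rw [div_lt_iff₀ (by linarith)] at hp2
  have hmp : (m:ℝ) * p ≤ (1 - η) * s := by linarith
  have hmps : (m:ℝ) * p ≤ s := by nlinarith
  have hsm : (1 - 2 * η) * s ≤ m * p := by nlinarith
  have hηp : 1 ≤ η * p := by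
    have h1 : (s:ℝ) ≤ 2 * (m * p) := by nlinarith
    have h2 : 2 * (m:ℝ) ≤ η * (2 * (m * p)) := le_trans b2 (mul_le_mul_of_nonneg_left h1 hη.le)
    have h3 : 2 * (m:ℝ) * 1 ≤ 2 * m * (η * p) := by linarith
    exact le_of_mul_le_mul_left h3 (by linarith)
  have hpp : (0:ℝ) < p := by
    by_contra hh
    have : (p:ℝ) = 0 := le_antisymm (by linarith) (Nat.cast_nonneg _)
    rw [this] at hηp; linarith
  have hpB : (1 - 2 * η) * p ≤ B := by linarith
  have hBp : (0:ℝ) < B := lt_of_lt_of_le (mul_pos (by linarith) hpp) hpB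
  have hmpn : m * p ≤ s := by exact_mod_cast hmps
  refine ⟨p, B, s - m * p, ⟨hη, hη1, hLR, hLW, hsR, hmR, hpp, hBp, by exact_mod_cast hn, ?_, hsm, hpB, hmps⟩, hB1, hmp, by omega⟩
  have : (L:ℝ) * 1 ≤ L * (η * s) := mul_le_mul_of_nonneg_left b1 (by linarith)
  nlinarith

end ModJ3
end ApproxDecomp

open SimpleGraph
namespace ApproxDecomp
section ModJ4
open scoped Classical
open Finset

lemma fc_exists {N : ℕ} {par : Fin N → Fin N} (hpar : ∀ v, par v ≤ v) (Δ : ℕ)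
    (hΔ : ∀ v, #(univ.filter fun u => par u = v ∧ u ≠ v) ≤ Δ) (k0 k sR : ℕ) (hk0 : 1 ≤ k0) (hk : k = (Δ + 1) ^ 2 * k0) (hsR : 1 ≤ sR) :
    ∃ S : FC Δ k, ∃ h : S.N = N, (∀ v, S.par v = Fin.cast h.symm (par (Fin.cast h v))) ∧ #S.C.R * sR ≤ N ∧
      #S.C.X * k0 ≤ N + k0 * ((Δ + 1) * #S.C.R) ∧ ∀ c, #(univ.filter fun u => S.C.topR u = c) ≤ (Δ + 1) ^ 2 * sR := by
  obtain ⟨C, h1, h2, h3, h4⟩ := cut_exists hpar Δ hΔ k0 sR hk0 hsR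
  rw [← hk] at h3
  obtain ⟨idx, Q, hT⟩ := typed_exists hpar C k h3
  exact ⟨⟨N, par, hpar, hΔ, C, idx, Q, hT⟩, rfl, fun v => rfl, h1, h2, h4⟩

lemma D_arith {L : ℕ} (d : Fin L → Fin L → ℝ) (α ε η d0 : ℝ) (hL : (0:ℝ) < L) (hα : 0 < α) (hε : 0 < ε) (hd : d0 = η ^ 2 * α / 2) (h2 : ε ≤ d0 / 2)
    (hrow : ∀ a, ∑ b, d a b ≤ (α + ε) * L) (htot : (α - ε - d0) * L ^ 2 ≤ ∑ a, ∑ b, d a b) :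
    (∀ a, ∑ b, d a b / ((α + ε) * L) ≤ 1) ∧ (1 - η ^ 2) * L ≤ ∑ a, ∑ b, d a b / ((α + ε) * L) := by
  have h0 : 0 < (α + ε) * L := by positivity
  constructor
  · intro a
    rw [← Finset.sum_div, div_le_one h0]
    exact hrow a
  · simp only [← Finset.sum_div]
    rw [le_div_iff₀ h0]
    refine le_trans ?_ htot
    have e : (1 - η ^ 2) * L * ((α + ε) * L) = ((1 - η ^ 2) * (α + ε)) * L ^ 2 := by ring
    rw [e]
    refine mul_le_mul_of_nonneg_right ?_ (by positivity)
    have : 0 ≤ η ^ 2 * ε := by positivity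
    nlinarith

variable {Δ c k0 k Z m W M n s : ℕ} {α ν η d0 κ lam δ ε θ μ δg : ℝ}

lemma small1 (h : C2 Δ c k0 k Z m W M α ν η d0 κ lam δ ε θ μ δg) : 8 * (θ * W * m) ≤ 1 := by
  obtain ⟨hη, hη1, hd0, hd01, hκ, hκ1, hlam, hm, hk, hδ, hδ1, hlk⟩ := h.toC1.d0_pos
  have h1 := h.t1
  have hθ := h.θ0
  have hpos1 : 0 ≤ θ * W * m := by positivity
  have hpos2 : 0 ≤ θ * W * m * Z := by positivity
  have h3 : ν * d0 ≤ 1 := by have := h.ν0; have := h.ν1; nlinarith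
  linarith

/-- error-term conditions -/
lemma err1 (h : C2 Δ c k0 k Z m W M α ν η d0 κ lam δ ε θ μ δg) (hb : Big Δ c k0 k m W M η κ δ ε θ μ n s) {L sR T : ℕ}
    (hLW : L ≤ W) (hT : T ≤ c * n) (hsR : (sR:ℝ) ≤ 2 * μ * n) :
    ((5 * L : ℕ) : ℝ) * ((((Δ + 1) ^ 2 * sR : ℕ) : ℝ) * n) ≤ (θ * n) ^ 2 ∧ ((2 * L ^ 2 : ℕ) : ℝ) * (T : ℝ) ≤ (θ * n) ^ 2 ∧
    (((L * m) * (L * m) + L * (L * m) : ℕ) : ℝ) * (T * (Fintype.card (Ro L k m) : ℝ) ^ 2) ≤ (θ * n) ^ 2 := by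
  have hLR : (L:ℝ) ≤ W := by exact_mod_cast hLW
  have hTR : (T:ℝ) ≤ c * n := by exact_mod_cast hT
  refine ⟨?_, ?_, ?_⟩
  · push_cast
    calc 5 * (L:ℝ) * ((Δ + 1) ^ 2 * sR * n) ≤ 5 * W * ((Δ + 1) ^ 2 * (2 * μ * n) * n) := by gcongr
      _ = (10 * W * (Δ + 1) ^ 2 * μ) * n ^ 2 := by ring
      _ ≤ θ ^ 2 * n ^ 2 := mul_le_mul_of_nonneg_right h.μ1 (by positivity)
      _ = _ := by ring
  · push_cast
    calc 2 * (L:ℝ) ^ 2 * T ≤ 2 * W ^ 2 * (c * n) := by gcongr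
      _ = (2 * (W:ℝ) ^ 2 * c) * n := by ring
      _ ≤ (θ ^ 2 * n) * n := mul_le_mul_of_nonneg_right hb.n3 (by positivity)
      _ = _ := by ring
  · have hcard : (Fintype.card (Ro L k m) : ℝ) = L * Fintype.card (QT k) * m * k := by
      have : Fintype.card (Ro L k m) = L * Fintype.card (QT k) * (m * k) := by
        simp [Ro, Fintype.card_prod]
      rw [this]; push_cast; ring
    rw [hcard]
    push_cast
    calc ((L:ℝ) * m * (L * m) + L * (L * m)) * (T * (L * Fintype.card (QT k) * m * k) ^ 2)
        ≤ ((W:ℝ) * m * (W * m) + W * (W * m)) * ((c * n) * (W * Fintype.card (QT k) * m * k) ^ 2) := by gcongr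
      _ = (((W:ℝ) ^ 2 * m ^ 2 + W ^ 2 * m) * c * (W * Fintype.card (QT k) * m * k) ^ 2) * n := by ring
      _ ≤ (θ ^ 2 * n) * n := mul_le_mul_of_nonneg_right hb.n4 (by positivity)
      _ = _ := by ring

lemma p_arith (h : C2 Δ c k0 k Z m W M α ν η d0 κ lam δ ε θ μ δg) (hb : Big Δ c k0 k m W M η κ δ ε θ μ n s) {L p B : ℕ}
    (hsc : Sc n L s m p B η W) : 8 * Δ ≤ κ * p ∧ ε * s ≤ p ∧ 2 * ε * p + 1 + 2 * ε * s ≤ δ * (η * d0 * p) ∧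
      k * (δ * p + ε * s) ≤ η / 2 * p ∧ 4 * ε * m ≤ η := by
  obtain ⟨hη, hη1, hd0, hd01, hκ, hκ1, hlam, hm, hk, hδ, hδ1, hlk⟩ := h.toC1.d0_pos
  have hs2 := hsc.s2
  have hp := hsc.hp
  have hs := hsc.hs
  have hmR : (1:ℝ) ≤ m := by exact_mod_cast hm
  have hkR : (1:ℝ) ≤ k := by exact_mod_cast hk
  have hε := h.ε0
  have hps : (p:ℝ) ≤ s := by have := hsc.hms; nlinarith
  have hεs : ε * s ≤ (2 * ε * m) * p := by
    calc ε * s ≤ ε * (2 * (m * p)) := by gcongr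
      _ = _ := by ring
  have hκη : κ ≤ η := by rw [h.hκ]; nlinarith
  have hδκ : 0 < δ * κ := by positivity
  have hδκ1 : δ * κ ≤ κ := by nlinarith
  have h3 := h.e3
  have hεs6 : 6 * (ε * s) ≤ δ * κ * p := by
    calc 6 * (ε * s) ≤ 6 * ((2 * ε * m) * p) := by linarith
      _ = (12 * ε * m) * p := by ring
      _ ≤ _ := by gcongr
  have up : ∀ x y : ℝ, 0 ≤ y → 2 * m * x ≤ y * s → x ≤ y * p := by
    intro x y hy hx
    have h1 : 2 * (m:ℝ) * x ≤ y * (2 * (m * p)) := le_trans hx (mul_le_mul_of_nonneg_left hs2 hy)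
    have h2 : 2 * (m:ℝ) * x ≤ 2 * m * (y * p) := by linarith
    exact le_of_mul_le_mul_left h2 (by linarith)
  have h31 : 3 ≤ δ * κ * p := up 3 _ hδκ.le (by linarith [hb.b3])
  refine ⟨up _ κ hκ.le (by linarith [hb.b4]), ?_, ?_, ?_, by linarith⟩
  · have : δ * κ * p ≤ 1 * p := mul_le_mul_of_nonneg_right (by linarith) hp.le
    have : 0 ≤ ε * s := by positivity
    linarith
  · have e : δ * (η * d0 * p) = δ * κ * p := by rw [h.hκ]; ring
    rw [e]
    have : ε * p ≤ ε * s := by gcongr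
    linarith
  · have e1 : k * (δ * p) = η / 4 * p := by rw [h.hδ]; field_simp
    have e2 : k * (δ * κ * p) = η / 4 * κ * p := by rw [h.hδ]; field_simp
    have e3 : k * (6 * (ε * s)) ≤ k * (δ * κ * p) := mul_le_mul_of_nonneg_left hεs6 (by linarith)
    have e4 : η / 4 * κ * p ≤ η / 4 * 1 * p := by gcongr
    have e5 : 0 < η * p := by positivity
    linarith

lemma q_arith (h : C2 Δ c k0 k Z m W M α ν η d0 κ lam δ ε θ μ δg) (hb : Big Δ c k0 k m W M η κ δ ε θ μ n s) {L p B : ℕ}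
    (hsc : Sc n L s m p B η W) : 2 * (n:ℝ) / k0 / ((1 - η) * L) + θ * n + M ≤ 10 * (s:ℝ) / k0 := by
  have hk0 : (0:ℝ) < k0 := by exact_mod_cast h.hk0
  have hη1 := hsc.h1
  have hη0 := hsc.h0
  have hL : (0:ℝ) < L := by linarith [hsc.hL]
  have hs := hsc.hs
  have hθ := h.θ0
  have e1 : 2 * (n:ℝ) / k0 / ((1 - η) * L) ≤ 8 * s / k0 := by
    rw [div_div, div_le_div_iff₀ (mul_pos hk0 (mul_pos (by linarith) hL)) hk0]
    calc 2 * (n:ℝ) * k0 ≤ 2 * (2 * (L * s)) * k0 := by have := hsc.n2s; gcongr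
      _ = 8 * s * (k0 * ((1 / 2) * L)) := by ring
      _ ≤ _ := by gcongr; linarith
  have e2 : θ * n ≤ s / k0 := by
    calc θ * n ≤ θ * (2 * (L * s)) := by have := hsc.n2s; gcongr
      _ ≤ θ * (2 * (W * s)) := by have := hsc.hLW; gcongr
      _ = 2 * (θ * W) * s := by ring
      _ ≤ 1 / k0 * s := mul_le_mul_of_nonneg_right h.t2 hs.le
      _ = _ := by ring
  have e3 : (M:ℝ) ≤ s / k0 := by
    rw [le_div_iff₀ hk0]; exact hb.b7
  have e4 : 10 * (s:ℝ) / k0 = 8 * s / k0 + s / k0 + s / k0 := by ring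
  linarith

end ModJ4
end ApproxDecomp

open SimpleGraph
namespace ApproxDecomp
section ModJ5
open scoped Classical
open Finset

variable {Δ c k0 k Z m W M n s : ℕ} {α ν η d0 κ lam δ ε θ μ δg : ℝ}

set_option maxHeartbeats 1000000 in
/-- packing forests, with all constants given -/
theorem fp_core (h : C2 Δ c k0 k Z m W M α ν η d0 κ lam δ ε θ μ δg) (hb : Big Δ c k0 k m W M η κ δ ε θ μ n s)
    {G g : SimpleGraph (Fin n)} {L : ℕ} {V : Fin L → Finset (Fin n)} {d : Fin L → Fin L → ℝ} (hL : 0 < L) (hLW : L ≤ W) (hs : 0 < s) (hn : 0 < n)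
    (H : Host G α ε d0 L s V d) {γ : ℝ} (hg : GoodG n δg (2 * Δ + 2 * c * (Δ + 1) * M + 1) γ g)
    {T : ℕ} (hT : T ≤ c * n) (S : Fin T → FC Δ k) (sR : ℕ) (hsR1 : μ * n ≤ sR) (hsR2 : (sR:ℝ) ≤ 2 * μ * n)
    (hN : ∀ t, ((S t).N : ℝ) ≤ (1 - ν) * n) (hR : ∀ t, #(S t).C.R * sR ≤ (S t).N)
    (hX : ∀ t, #(S t).C.X * k0 ≤ (S t).N + k0 * ((Δ + 1) * #(S t).C.R))
    (htopR : ∀ t c, #(univ.filter fun u => (S t).C.topR u = c) ≤ (Δ + 1) ^ 2 * sR)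
    (hE : ∑ t, ((S t).nr : ℝ) ≤ (1 - ν) * ((α + ε) * (n:ℝ) ^ 2 / 2)) :
    ∃ φ : ∀ t, Fin (S t).N → Fin n, (∀ t, Function.Injective (φ t)) ∧
      (∀ t v, (S t).par v ≠ v → (G ⊔ g).Adj (φ t v) (φ t ((S t).par v))) ∧
      ∀ t t', t ≠ t' → ∀ v v', (S t).par v ≠ v → (S t').par v' ≠ v' →
        s(φ t v, φ t ((S t).par v)) ≠ s(φ t' v', φ t' ((S t').par v')) := by
  obtain ⟨hη, hη1, hd0, hd01, hκ, hκ1, hlam, hm, hk, hδ, hδ1, hlk⟩ := h.toC1.d0_pos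
  have hLR : (0:ℝ) < L := by exact_mod_cast hL
  have hnR : (0:ℝ) < n := by exact_mod_cast hn
  have hα := h.α0
  have hε := h.ε0
  have hν0 := h.ν0
  have hν1 := h.ν1
  have hθ := h.θ0
  have hk0R : (0:ℝ) < k0 := by exact_mod_cast h.hk0
  have hcR : (1:ℝ) ≤ c := by exact_mod_cast h.hc
  obtain ⟨p, B, ysz, hsc, hB2, hms, hy⟩ := scale_exists (n := n) (L := L) (s := s) (m := m) (W := (W:ℝ)) hη hη1 hL (by exact_mod_cast hLW) hs hm hn H.cover hb.b1 hb.b2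
  obtain ⟨pa1, pa2, pa3, pa4, pa5⟩ := p_arith h hb hsc
  obtain ⟨er1, er2, er3⟩ := err1 h hb hLW hT hsR2
  have hBn : 0 < B := by exact_mod_cast hsc.hB
  have hpn : 0 < p := by exact_mod_cast hsc.hp
  have hNn : ∀ t, ((S t).N : ℝ) ≤ n := fun t => le_trans (hN t) (by nlinarith)
  have hRM : ∀ t, #(S t).C.R ≤ M := by
    intro t
    have h1 : (#(S t).C.R : ℝ) * sR ≤ (S t).N := by exact_mod_cast hR t
    have h2 : (#(S t).C.R : ℝ) * (μ * n) ≤ n := le_trans (mul_le_mul_of_nonneg_left hsR1 (by positivity)) (le_trans h1 (hNn t))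
    have h3 : (#(S t).C.R : ℝ) * μ ≤ 1 := by
      have : (#(S t).C.R : ℝ) * μ * n ≤ 1 * n := by linarith
      exact le_of_mul_le_mul_right this hnR
    have h4 : μ * (#(S t).C.R : ℝ) ≤ μ * M := by linarith [h.hM]
    exact_mod_cast le_of_mul_le_mul_left h4 h.μ0
  have hXM : ∀ t, (#(S t).C.X : ℝ) ≤ 2 * n / k0 := by
    intro t
    rw [le_div_iff₀ hk0R]
    have h1 : (#(S t).C.X : ℝ) * k0 ≤ (S t).N + k0 * ((Δ + 1) * #(S t).C.R) := by exact_mod_cast hX t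
    have h2 : (#(S t).C.R : ℝ) ≤ M := by exact_mod_cast hRM t
    have h3 : (k0:ℝ) * ((Δ + 1) * #(S t).C.R) ≤ k0 * ((Δ + 1) * M) := by gcongr
    have h4 : (k0:ℝ) * (Δ + 1) * M ≤ n := by exact_mod_cast hb.n2
    have h5 := hNn t
    linarith
  obtain ⟨D1, D2⟩ := D_arith d α ε η d0 hLR hα hε h.hd0 h.e2 H.row H.tot
  have hsm1 := small1 h
  obtain ⟨σ, dom, pc, -, as2, as3, as4, as5, asA, asE, asM, asX⟩ := assign (m := m) S hL (fun a b => d a b / ((α + ε) * L))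
    (fun a b => div_nonneg (H.nonneg a b) (by positivity)) (fun a b => by beta_reduce; rw [H.symm]) D1 η hη (by linarith) D2 B hBn _ htopR n hnR hNn
    (2 * n / k0) (by positivity) hXM (θ * n) (by positivity) er1 er2 Z (by rw [h.hZ])
  obtain ⟨vtx, Y, q, mt, gd, hP⟩ := parts_exist H hε.le hs m p (by omega) hpn pa2 δ η hδ hη.le pa3
  have hYc : ∀ a, #(Y a) = ysz := fun a => by have := hP.Ycard a; omega
  obtain ⟨q1, q2, q3, q4, q5, q6, hq6, hNum⟩ := numC_mk n L s m p B ysz Δ c M k0 η W κ d0 ε lam δg hsc hB2 hms hy h.hκ hd0 hd01 hε h.e2 pa5 h.e4 hlam h.hlam2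
    hlk h.g0 h.g1 pa1 hb.b5 hb.b6
  have hTR : (T:ℝ) ≤ c * n := by exact_mod_cast hT
  have hDu : ((Δ:ℝ) + 1) * (86 * c * (Δ + 1) / (α * k0) * s) = lam * s := by rw [h.hlam]; ring
  obtain ⟨KM, hKM⟩ : ∃ KM : ℝ, KM = 86 * c * (Δ + 1) / (α * k0) * s := ⟨_, rfl⟩
  obtain ⟨part, perm, Copies, hGP⟩ := plan_exists H hε.le hs hP hm hδ.le S pc σ B hBn
    (fun t v hh => as2 t (pc t v) (as3 t v) (by beta_reduce; rw [hh, zero_div])) as4 as5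
    (by
      intro t b
      have h1 := asA t b
      have h2 := ar_A hsc ν θ (S t).N Z hν0 hν1 h.hη hθ.le hsm1 (Nat.cast_nonneg _) (hN t) h.m2
      have h3 := le_trans (add_le_add_left h1 1) h2
      exact_mod_cast h3)
    (θ * n) (by positivity) er3
    (by
      intro b b' hbb
      have h1 := asE b b'
      have h2 := ar_E hsc ν α ε (d b b') d0 θ _ T c Z hν0 hν1 h.hη hθ.le hα hε.le hd0 hd01 (H.lower b b' hbb) (Nat.cast_nonneg _) (by linarith) hE
        (Nat.cast_nonneg _) hTR h.t1 h.m3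
      refine le_trans ?_ h2
      gcongr)
    KM
    (by
      intro a b
      have h1 := asM a b
      have h2 := ar_M hsc α ε (d a b) θ T c Z Δ k0 hθ.le hα h.α1 hε.le (H.nonneg a b) (H.le_one a b) (Nat.cast_nonneg _) hcR hk0R (Nat.cast_nonneg _)
        (Nat.cast_nonneg _) hTR hsm1 h.t2 h.m1
      rw [hKM]
      refine le_trans ?_ h2
      gcongr)
    h.e2 (fun a => by rw [hYc]; exact hNum.hYs) (η / 2) pa4
  refine pack_exists H hGP hP.vinj hP.vY hP.vmem hP.Ysub hm hn hYc hNum hg ?_ (le_of_eq (by rw [hKM]; exact hDu)) M hRM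
    (by
      calc T * (2 * ((Δ + 1) * M)) ≤ c * n * (2 * ((Δ + 1) * M)) := Nat.mul_le_mul_right _ hT
        _ = _ := rfl)
  intro t a
  have h1 := asX t a
  have h2 := q_arith h hb hsc
  have h3 : (#(S t).C.R : ℝ) ≤ M := by exact_mod_cast hRM t
  have h4 : (#((S t).C.X.filter fun x => pc t x = a) : ℝ) + #(S t).C.R ≤ q6 := by linarith
  exact_mod_cast h4

end ModJ5
end ApproxDecomp

open SimpleGraph
namespace ApproxDecomp
section ModJ6
open scoped Classical
open Finset

lemma small_exists (a b : ℝ) (hb : 0 < b) : ∃ x : ℝ, 0 < x ∧ ∀ y, 0 ≤ y → y ≤ x → a * y ≤ b := by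
  refine ⟨b / (|a| + 1), by positivity, fun y hy h => ?_⟩
  have h1 : a * y ≤ (|a| + 1) * y := by nlinarith [le_abs_self a]
  have h2 : (|a| + 1) * y ≤ (|a| + 1) * (b / (|a| + 1)) := by gcongr
  have h3 : (|a| + 1) * (b / (|a| + 1)) = b := by field_simp
  linarith

lemma big_exists (a b : ℝ) (hb : 0 < b) : ∃ N : ℕ, ∀ n : ℕ, N ≤ n → a ≤ b * n := by
  obtain ⟨N, hN⟩ := exists_nat_ge (a / b)
  refine ⟨N, fun n hn => ?_⟩
  have h1 : a / b ≤ n := le_trans hN (by exact_mod_cast hn)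
  rw [div_le_iff₀ hb] at h1
  linarith

lemma C1_exists (Δ c : ℕ) (hc : 1 ≤ c) (α ν : ℝ) (hα0 : 0 < α) (hα1 : α < 1) (hν0 : 0 < ν) (hν1 : ν < 1) :
    ∃ (k0 k Z m : ℕ) (η d0 κ lam δ ε : ℝ), C1 Δ c k0 k Z m α ν η d0 κ lam δ ε := by
  obtain ⟨η, hη⟩ : ∃ η, η = ν / 60 := ⟨_, rfl⟩
  have hη0 : 0 < η := by rw [hη]; positivity
  obtain ⟨d0, hd0⟩ : ∃ d0, d0 = η ^ 2 * α / 2 := ⟨_, rfl⟩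
  have hd00 : 0 < d0 := by rw [hd0]; positivity
  obtain ⟨κ, hκ⟩ : ∃ κ, κ = d0 * η := ⟨_, rfl⟩
  have hκ0 : 0 < κ := by rw [hκ]; positivity
  obtain ⟨k1, hk1⟩ := big_exists (1000 * (Δ + 1) * (86 * c * (Δ + 1) ^ 2) / α) (κ ^ 2) (by positivity)
  obtain ⟨k0, hk0⟩ : ∃ k0, k0 = k1 + 1 := ⟨_, rfl⟩
  have hk00 : 1 ≤ k0 := by omega
  have hk0R : (0:ℝ) < k0 := by exact_mod_cast hk00
  obtain ⟨k, hk⟩ : ∃ k, k = (Δ + 1) ^ 2 * k0 := ⟨_, rfl⟩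
  have hk1' : 1 ≤ k := by rw [hk]; exact Nat.one_le_iff_ne_zero.2 (by positivity)
  have hkR : (0:ℝ) < k := by exact_mod_cast hk1'
  obtain ⟨Z, hZ⟩ : ∃ Z, Z = Fintype.card (QT k) * k := ⟨_, rfl⟩
  obtain ⟨m1, hm1⟩ := big_exists ((k0:ℝ) * (1 + Z)) 1 one_pos
  obtain ⟨m2, hm2⟩ := big_exists (4 * ((Z:ℝ) + 1)) ν hν0
  obtain ⟨m3, hm3⟩ := big_exists (240 * ((c:ℝ) * (1 + Z))) (α * ν) (by positivity)
  obtain ⟨m, hm⟩ : ∃ m, m = m1 + m2 + m3 := ⟨_, rfl⟩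
  obtain ⟨δ, hδ⟩ : ∃ δ, δ = η / (4 * k) := ⟨_, rfl⟩
  have hδ0 : 0 < δ := by rw [hδ]; positivity
  obtain ⟨x1, hx1, hy1⟩ := small_exists (12 * m) (δ * κ) (by positivity)
  obtain ⟨x2, hx2, hy2⟩ := small_exists (1000 * (Δ + 1)) κ (by positivity)
  obtain ⟨ε, hε0, h1, h2, h3, h4, h5⟩ : ∃ ε : ℝ, 0 < ε ∧ ε ≤ α ∧ ε ≤ 1 / 2 ∧ ε ≤ d0 / 2 ∧ ε ≤ x1 ∧ ε ≤ x2 := by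
    refine ⟨min α (min (1 / 2) (min (d0 / 2) (min x1 x2))), by positivity, ?_, ?_, ?_, ?_, ?_⟩
    · exact min_le_left _ _
    · exact le_trans (min_le_right _ _) (min_le_left _ _)
    · exact le_trans (min_le_right _ _) (le_trans (min_le_right _ _) (min_le_left _ _))
    · exact le_trans (min_le_right _ _) (le_trans (min_le_right _ _) (le_trans (min_le_right _ _) (min_le_left _ _)))
    · exact le_trans (min_le_right _ _) (le_trans (min_le_right _ _) (le_trans (min_le_right _ _) (min_le_right _ _)))
  refine ⟨k0, k, Z, m, η, d0, κ, _, δ, ε, ⟨hν0, hν1, hα0, hα1, hη, hd0, hκ, hc, hk00, rfl, ?_, hk, hZ, ?_, hm2 m (by omega), hm3 m (by omega), hδ, hε0, h1, by linarith, h3, ?_, hy2 ε hε0.le h5⟩⟩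
  · have := hk1 k0 (by omega)
    rw [← mul_div_assoc, div_le_iff₀ (by positivity)]
    rw [div_le_iff₀ hα0] at this
    linarith
  · have := hm1 m (by omega)
    linarith
  · have := hy1 ε hε0.le h4
    linarith

lemma C2_exists {Δ c k0 k Z m : ℕ} {α ν η d0 κ lam δ ε : ℝ} (h : C1 Δ c k0 k Z m α ν η d0 κ lam δ ε) (W : ℕ) (hW : 0 < W) :
    ∃ (M : ℕ) (θ μ δg : ℝ), C2 Δ c k0 k Z m W M α ν η d0 κ lam δ ε θ μ δg := by
  obtain ⟨hη, hη1, hd0, hd01, hκ, hκ1, hlam, hm, hk, hδ, hδ1, hlk⟩ := h.d0_pos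
  have hν := h.ν0
  have hk0R : (0:ℝ) < k0 := by exact_mod_cast h.hk0
  obtain ⟨x1, hx1, hy1⟩ := small_exists (1000 * (W * m * (1 + Z))) (ν * d0) (by positivity)
  obtain ⟨x2, hx2, hy2⟩ := small_exists (2 * W) (1 / k0) (by positivity)
  obtain ⟨θ, hθ0, hθ1, hθ2⟩ : ∃ θ : ℝ, 0 < θ ∧ θ ≤ x1 ∧ θ ≤ x2 := ⟨min x1 x2, by positivity, min_le_left _ _, min_le_right _ _⟩
  obtain ⟨μ, hμ0, hμ⟩ := small_exists (10 * W * (Δ + 1) ^ 2) (θ ^ 2) (by positivity)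
  obtain ⟨M, hM⟩ := big_exists 1 μ hμ0
  obtain ⟨δg, hg0, hg⟩ := small_exists (1000 * (Δ + 1) * (2 * W)) κ hκ
  refine ⟨M, θ, μ, δg, { toC1 := h, W0 := hW, θ0 := hθ0, t1 := ?_, t2 := ?_, μ0 := hμ0, μ1 := hμ μ hμ0.le le_rfl, hM := hM M le_rfl, g0 := hg0, g1 := ?_ }⟩
  · have := hy1 θ hθ0.le hθ1; linarith
  · have := hy2 θ hθ0.le hθ2; linarith
  · have := hg δg hg0.le le_rfl; linarith

lemma Big_exists {Δ c k0 k Z m W M : ℕ} {α ν η d0 κ lam δ ε θ μ δg : ℝ} (h : C2 Δ c k0 k Z m W M α ν η d0 κ lam δ ε θ μ δg) :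
    ∃ s0 : ℕ, ∀ n s : ℕ, s0 ≤ s → s ≤ n → Big Δ c k0 k m W M η κ δ ε θ μ n s := by
  obtain ⟨hη, hη1, hd0, hd01, hκ, hκ1, hlam, hm, hk, hδ, hδ1, hlk⟩ := h.toC1.d0_pos
  have hε := h.ε0
  have hθ := h.θ0
  have hμ := h.μ0
  obtain ⟨s1, h1⟩ := big_exists 1 η hη
  obtain ⟨s2, h2⟩ := big_exists (2 * m) η hη
  obtain ⟨s3, h3⟩ := big_exists (6 * m) (δ * κ) (by positivity)
  obtain ⟨s4, h4⟩ := big_exists (16 * Δ * m) κ hκ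
  obtain ⟨s5, h5⟩ := big_exists (100 * (3 + 3 * Δ)) κ hκ
  obtain ⟨s6, h6⟩ := big_exists (16 * c * W * (Δ + 1) * M) (κ * ε) (by positivity)
  obtain ⟨t1, g1⟩ := big_exists 1 μ hμ
  obtain ⟨t3, g3⟩ := big_exists (2 * (W:ℝ) ^ 2 * c) (θ ^ 2) (by positivity)
  obtain ⟨t4, g4⟩ := big_exists (((W:ℝ) ^ 2 * m ^ 2 + W ^ 2 * m) * c * (W * Fintype.card (QT k) * m * k) ^ 2) (θ ^ 2) (by positivity)
  refine ⟨s1 + s2 + s3 + s4 + s5 + s6 + t1 + t3 + t4 + M * k0 + k0 * (Δ + 1) * M, fun n s hs hn => ?_⟩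
  refine ⟨h1 s (by omega), h2 s (by omega), h3 s (by omega), h4 s (by omega), h5 s (by omega), h6 s (by omega), ?_, g1 n (by omega), by omega, g3 n (by omega), g4 n (by omega)⟩
  have : M * k0 ≤ s := by omega
  exact_mod_cast this

/-- packing of rooted forests -/
theorem fp (Δ c : ℕ) (hc : 1 ≤ c) (α ν : ℝ) (hα0 : 0 < α) (hα1 : α < 1) (hν0 : 0 < ν) (hν1 : ν < 1) :
    ∃ ξ0 : ℝ, 0 < ξ0 ∧ ∃ δg : ℝ, 0 < δg ∧ ∃ K n0 : ℕ, ∀ n ≥ n0, ∀ G g : SimpleGraph (Fin n),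
      ((#((univ : Finset (Fin n)).filter fun v => ¬ ((α - ξ0) * n ≤ (deg G v : ℝ) ∧ (deg G v : ℝ) ≤ (α + ξ0) * n)) : ℝ)
        ≤ ξ0 * n) → GoodG n δg K 1 g → ∀ (T : ℕ) (N : Fin T → ℕ) (par : ∀ t, Fin (N t) → Fin (N t)), T ≤ c * n →
      (∀ t v, par t v ≤ v) → (∀ t v, #(univ.filter fun u => par t u = v ∧ u ≠ v) ≤ Δ) → (∀ t, (N t : ℝ) ≤ (1 - ν) * n) →
      (∑ t, (#(univ.filter fun v => par t v ≠ v) : ℝ) ≤ (1 - ν) * ((α + 2 * ξ0) * (n:ℝ) ^ 2 / 2)) →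
      ∃ φ : ∀ t, Fin (N t) → Fin n, (∀ t, Function.Injective (φ t)) ∧
        (∀ t v, par t v ≠ v → (G ⊔ g).Adj (φ t v) (φ t (par t v))) ∧
        ∀ t t', t ≠ t' → ∀ v v', par t v ≠ v → par t' v' ≠ v' →
          s(φ t v, φ t (par t v)) ≠ s(φ t' v', φ t' (par t' v')) := by
  obtain ⟨k0, k, Z, m, η, d0, κ, lam, δ, ε, h1⟩ := C1_exists Δ c hc α ν hα0 hα1 hν0 hν1
  have hd0 := h1.d0_pos.2.2.1
  have hε := h1.ε0
  obtain ⟨W, ξh, hξh, hW, hhost⟩ := host_exists α ε d0 hα0 h1.εα hα1 h1.ε0 h1.ε1 hd0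
  obtain ⟨M, θ, μ, δg, h2⟩ := C2_exists h1 W hW
  obtain ⟨s0, hs0⟩ := Big_exists h2
  obtain ⟨n0, hn0⟩ := hhost (s0 + 1)
  obtain ⟨ξ0, hξ0, hξ1, hξ2⟩ : ∃ ξ : ℝ, 0 < ξ ∧ ξ ≤ ξh ∧ ξ ≤ ε / 2 := ⟨min ξh (ε / 2), by positivity, min_le_left _ _, min_le_right _ _⟩
  refine ⟨ξ0, hξ0, δg, h2.g0, 2 * Δ + 2 * c * (Δ + 1) * M + 1, n0, fun n hn G g hG hg T N par hT hpar hΔ hN hE => ?_⟩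
  have hG' : ((#((univ : Finset (Fin n)).filter fun v => ¬ ((α - ξh) * n ≤ (deg G v : ℝ) ∧ (deg G v : ℝ) ≤ (α + ξh) * n)) : ℝ)
        ≤ ξh * n) := by
    refine le_trans ?_ (le_trans hG (by gcongr))
    have : #((univ : Finset (Fin n)).filter fun v => ¬ ((α - ξh) * n ≤ (deg G v : ℝ) ∧ (deg G v : ℝ) ≤ (α + ξh) * n)) ≤
      #((univ : Finset (Fin n)).filter fun v => ¬ ((α - ξ0) * n ≤ (deg G v : ℝ) ∧ (deg G v : ℝ) ≤ (α + ξ0) * n)) := by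
      refine Finset.card_le_card ?_
      intro v
      simp only [Finset.mem_filter, Finset.mem_univ, true_and]
      intro hv hv'
      refine hv ⟨le_trans ?_ hv'.1, le_trans hv'.2 ?_⟩
      · gcongr
      · gcongr
    exact_mod_cast this
  obtain ⟨L, s, V, d, hL, hLW, hs, hsL, H⟩ := hn0 n hn G hG'
  have hsn : s ≤ n := le_trans (Nat.le_mul_of_pos_right s hL) hsL
  have hb := hs0 n s (by omega) hsn
  have hn1 : 0 < n := by omega
  have hμn := hb.n1
  have hn1b : (1:ℝ) ≤ 2 * μ * n := by linarith
  have hsR : 1 ≤ ⌈μ * n⌉₊ := Nat.one_le_iff_ne_zero.2 (by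
    intro h0
    rw [Nat.ceil_eq_zero] at h0
    linarith)
  have hfc := fun t => fc_exists (hpar t) Δ (hΔ t) k0 k ⌈μ * n⌉₊ h1.hk0 h1.hk hsR
  choose S hSN hSp hS1 hS2 hS3 using hfc
  have hnr : ∀ t, (S t).nr = #(univ.filter fun v => par t v ≠ v) := by
    intro t
    unfold FC.nr
    refine Finset.card_bij' (fun v _ => Fin.cast (hSN t) v) (fun v _ => Fin.cast (hSN t).symm v) ?_ ?_ ?_ ?_
    · intro v
      simp only [Finset.mem_filter, Finset.mem_univ, true_and]
      intro hv hh
      exact hv (by rw [hSp, hh]; rfl)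
    · intro v
      simp only [Finset.mem_filter, Finset.mem_univ, true_and]
      intro hv hh
      rw [hSp] at hh
      exact hv (by simpa [Fin.ext_iff] using hh)
    · intro v _; rfl
    · intro v _; rfl
  obtain ⟨φ, hφ1, hφ2, hφ3⟩ := fp_core h2 hb hL hLW (by omega) hn1 H hg hT S ⌈μ * n⌉₊ (Nat.le_ceil _)
    (le_trans (Nat.ceil_lt_add_one (by linarith)).le (by linarith))
    (fun t => by rw [hSN]; exact hN t) (fun t => (hS1 t).trans (hSN t).ge) (fun t => (hS2 t).trans (Nat.add_le_add_right (hSN t).ge _)) hS3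
    (by
      simp only [hnr]
      refine le_trans hE ?_
      refine mul_le_mul_of_nonneg_left ?_ (by linarith)
      gcongr
      linarith)
  have hpc : ∀ t v, (S t).par (Fin.cast (hSN t).symm v) = Fin.cast (hSN t).symm (par t v) := by
    intro t v; rw [hSp]; rfl
  have hpne : ∀ t v, par t v ≠ v → (S t).par (Fin.cast (hSN t).symm v) ≠ Fin.cast (hSN t).symm v := by
    intro t v hv hh
    rw [hpc] at hh
    exact hv (by simpa [Fin.ext_iff] using hh)
  refine ⟨fun t v => φ t (Fin.cast (hSN t).symm v), fun t x y hxy => ?_, fun t v hv => ?_, fun t t' htt v v' hv hv' => ?_⟩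
  · have := hφ1 t hxy
    simpa [Fin.ext_iff] using this
  · have := hφ2 t _ (hpne t v hv)
    rwa [hpc] at this
  · have := hφ3 t t' htt _ _ (hpne t v hv) (hpne t' v' hv')
    rwa [hpc, hpc] at this

end ModJ6
end ApproxDecomp

open SimpleGraph
namespace ApproxDecomp
section ModB1
open scoped Classical
open Finset

lemma sort_exists {X : Type*} [Fintype X] (ρ : X → ℕ) : ∃ e : X ≃ Fin (Fintype.card X), ∀ x y, ρ x < ρ y → e x ≤ e y := by
  refine ⟨(Fintype.equivFin X).trans (Tuple.sort (ρ ∘ (Fintype.equivFin X).symm)).symm, fun x y h => ?_⟩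
  have hm := Tuple.monotone_sort (ρ ∘ (Fintype.equivFin X).symm)
  by_contra hlt
  push Not at hlt
  have := hm hlt.le
  simp at this
  omega

lemma fpX {Δ c n T : ℕ} {ν E : ℝ} {H : SimpleGraph (Fin n)} (hT : T ≤ c * n)
    (hfp : ∀ (T : ℕ) (N : Fin T → ℕ) (par : ∀ t, Fin (N t) → Fin (N t)), T ≤ c * n →
      (∀ t v, par t v ≤ v) → (∀ t v, #(univ.filter fun u => par t u = v ∧ u ≠ v) ≤ Δ) → (∀ t, (N t : ℝ) ≤ (1 - ν) * n) →
      (∑ t, (#(univ.filter fun v => par t v ≠ v) : ℝ) ≤ E) →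
      ∃ φ : ∀ t, Fin (N t) → Fin n, (∀ t, Function.Injective (φ t)) ∧
        (∀ t v, par t v ≠ v → H.Adj (φ t v) (φ t (par t v))) ∧
        ∀ t t', t ≠ t' → ∀ v v', par t v ≠ v → par t' v' ≠ v' →
          s(φ t v, φ t (par t v)) ≠ s(φ t' v', φ t' (par t' v')))
    {X : Type*} [Fintype X] (p : X → X) (ρ : X → ℕ) (hρ : ∀ x, p x ≠ x → ρ (p x) < ρ x) (f : X → Fin T) (hf : ∀ x, f (p x) = f x)
    (hΔ : ∀ y, #(univ.filter fun x => p x = y ∧ x ≠ y) ≤ Δ) (hN : ∀ t, (#(univ.filter fun x => f x = t) : ℝ) ≤ (1 - ν) * n)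
    (hE : (#(univ.filter fun x => p x ≠ x) : ℝ) ≤ E) :
    ∃ φ : X → Fin n, (∀ x y, f x = f y → φ x = φ y → x = y) ∧ (∀ x, p x ≠ x → H.Adj (φ x) (φ (p x))) ∧
      ∀ x y, f x ≠ f y → p x ≠ x → p y ≠ y → s(φ x, φ (p x)) ≠ s(φ y, φ (p y)) := by
  have hsort := fun t : Fin T => sort_exists (X := {x : X // f x = t}) (fun x => ρ x.1)
  choose e he using hsort
  obtain ⟨pt, hpt⟩ : ∃ pt : ∀ t : Fin T, {x : X // f x = t} → {x : X // f x = t}, ∀ t x, (pt t x).1 = p x.1 :=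
    ⟨fun t x => ⟨p x.1, by rw [hf]; exact x.2⟩, fun t x => rfl⟩
  have hcard : ∀ t (P : X → Prop), #(univ.filter fun v : Fin (Fintype.card {x : X // f x = t}) => P ((e t).symm v).1) =
      #((univ.filter fun x => P x).filter fun x => f x = t) := by
    intro t P
    refine Finset.card_bij (fun v _ => ((e t).symm v).1) ?_ ?_ ?_
    · intro v hv
      simp only [Finset.mem_filter, Finset.mem_univ, true_and] at hv ⊢
      exact ⟨hv, ((e t).symm v).2⟩
    · intro v _ w _ h
      exact (e t).symm.injective (Subtype.ext h)
    · intro x hx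
      simp only [Finset.mem_filter, Finset.mem_univ, true_and] at hx
      exact ⟨e t ⟨x, hx.2⟩, by simpa using hx.1, by simp⟩
  have hne : ∀ t v, e t (pt t ((e t).symm v)) ≠ v ↔ p ((e t).symm v).1 ≠ ((e t).symm v).1 := by
    intro t v
    rw [← hpt t, not_iff_not, ← Subtype.ext_iff, ← Equiv.eq_symm_apply]
  obtain ⟨φ, h1, h2, h3⟩ := hfp T (fun t => Fintype.card {x : X // f x = t}) (fun t v => e t (pt t ((e t).symm v))) hT
    (by
      intro t v
      by_cases hv : e t (pt t ((e t).symm v)) = v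
      · exact hv.le
      · have := (hne t v).1 hv
        have h4 := he t (pt t ((e t).symm v)) ((e t).symm v) (by rw [hpt]; exact hρ _ this)
        rwa [Equiv.apply_symm_apply] at h4)
    (by
      intro t v
      refine le_trans ?_ (hΔ ((e t).symm v).1)
      refine Finset.card_le_card_of_injOn (fun u => ((e t).symm u).1) ?_ ?_
      · intro u hu
        simp only [Finset.coe_filter, Finset.mem_univ, true_and, Set.mem_ofPred_eq] at hu ⊢
        refine ⟨?_, ?_⟩
        · rw [← hpt, ← hu.1, Equiv.symm_apply_apply]
        · intro h
          exact hu.2 ((e t).symm.injective (Subtype.ext h))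
      · intro u _ w _ h
        exact (e t).symm.injective (Subtype.ext h))
    (by
      intro t
      refine le_trans (le_of_eq ?_) (hN t)
      rw [Fintype.card_subtype])
    (by
      refine le_trans (le_of_eq ?_) hE
      rw [Finset.card_eq_sum_card_fiberwise (f := f) (t := univ) (fun _ _ => Finset.mem_coe.2 (Finset.mem_univ _))]
      push_cast
      refine Finset.sum_congr rfl fun t _ => ?_
      have h5 := hcard t (fun x => p x ≠ x)
      refine congrArg _ (Eq.trans ?_ (Eq.trans h5 (by congr!)))
      congr 1
      ext v
      simp only [Finset.mem_filter, Finset.mem_univ, true_and]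
      exact hne t v)
  obtain ⟨ψ, hψ⟩ : ∃ ψ : X → Fin n, ∀ x, ψ x = φ (f x) (e (f x) ⟨x, rfl⟩) := ⟨_, fun x => rfl⟩
  have hψ' : ∀ t x (h : f x = t), ψ x = φ t (e t ⟨x, h⟩) := by
    rintro t x rfl; exact hψ x
  have hpe : ∀ x, ψ (p x) = φ (f x) (e (f x) (pt (f x) ((e (f x)).symm (e (f x) ⟨x, rfl⟩)))) := by
    intro x
    rw [hψ' (f x) (p x) (hf x), Equiv.symm_apply_apply]
    congr 2
    exact Subtype.ext (hpt (f x) ⟨x, rfl⟩).symm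
  have hnx : ∀ x, p x ≠ x → e (f x) (pt (f x) ((e (f x)).symm (e (f x) ⟨x, rfl⟩))) ≠ e (f x) ⟨x, rfl⟩ := by
    intro x hx
    rw [hne, Equiv.symm_apply_apply]
    exact hx
  refine ⟨ψ, ?_, ?_, ?_⟩
  · intro x y hxy h
    rw [hψ' (f x) x rfl, hψ' (f x) y hxy.symm] at h
    have := (e (f x)).injective (h1 _ h)
    exact congrArg Subtype.val this
  · intro x hx
    rw [hpe, hψ]
    exact h2 _ _ (hnx x hx)
  · intro x y hxy hx hy
    rw [hpe, hpe, hψ x, hψ y]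
    exact h3 _ _ hxy _ _ (hnx x hx) (hnx y hy)

lemma tree_parent {N : ℕ} (T : SimpleGraph (Fin N)) (hT : T.IsTree) : ∃ (p : Fin N → Fin N) (ρ : Fin N → ℕ),
    (∀ x, p x ≠ x → ρ (p x) < ρ x) ∧ (∀ x, p x ≠ x → T.Adj x (p x)) ∧ (∀ a b, T.Adj a b → p a = b ∨ p b = a) ∧
    #(univ.filter fun x => p x ≠ x) = T.edgeSet.ncard ∧ T.edgeSet.ncard + 1 = N := by
  have hcon := hT.connected
  obtain ⟨r⟩ := hcon.nonempty
  have hex : ∀ v, v ≠ r → ∃ u, T.Adj v u ∧ T.dist r u < T.dist r v := by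
    intro v hv
    obtain ⟨w, hw⟩ := (hcon v r).exists_walk_length_eq_dist
    cases w with
    | nil => exact absurd rfl hv
    | cons h w' =>
      rename_i u
      refine ⟨u, h, ?_⟩
      rw [Walk.length_cons] at hw
      have := SimpleGraph.dist_le w'
      rw [SimpleGraph.dist_comm (u := r) (v := v), ← hw, SimpleGraph.dist_comm]
      omega
  choose! p hp using hex
  obtain ⟨q, hq⟩ : ∃ q : Fin N → Fin N, ∀ v, q v = if v = r then r else p v := ⟨_, fun v => rfl⟩
  have hqr : ∀ v, q v ≠ v ↔ v ≠ r := by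
    intro v
    rw [hq]
    by_cases hv : v = r
    · simp [hv]
    · rw [if_neg hv]
      exact ⟨fun _ => hv, fun _ => (hp v hv).1.ne.symm⟩
  have hq1 : ∀ v, v ≠ r → T.Adj v (q v) ∧ T.dist r (q v) < T.dist r v := by
    intro v hv
    rw [hq, if_neg hv]; exact hp v hv
  have hcardT : #T.edgeFinset + 1 = N := by
    have := hT.card_edgeFinset
    rwa [Fintype.card_fin] at this
  have hnc : T.edgeSet.ncard = #T.edgeFinset := by
    rw [← SimpleGraph.coe_edgeFinset, Set.ncard_coe_finset]
  have hcr : #(univ.filter fun x => q x ≠ x) + 1 = N := by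
    have : (univ.filter fun x => q x ≠ x) = univ.erase r := by
      ext v; simp [hqr v]
    rw [this, Finset.card_erase_add_one (Finset.mem_univ _), Finset.card_univ, Fintype.card_fin]
  have himg : (univ.filter fun x => q x ≠ x).image (fun v => s(v, q v)) = T.edgeFinset := by
    refine Finset.eq_of_subset_of_card_le ?_ ?_
    · intro e he
      simp only [Finset.mem_image, Finset.mem_filter, Finset.mem_univ, true_and] at he
      obtain ⟨v, hv, rfl⟩ := he
      rw [SimpleGraph.mem_edgeFinset, SimpleGraph.mem_edgeSet]
      exact (hq1 v ((hqr v).1 hv)).1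
    · rw [Finset.card_image_of_injOn]
      · omega
      · intro v hv w hw h
        simp only [Finset.coe_filter, Finset.mem_univ, true_and, Set.mem_ofPred_eq] at hv hw
        have a1 := (hq1 v ((hqr v).1 hv)).2
        have a2 := (hq1 w ((hqr w).1 hw)).2
        simp only [Sym2.eq_iff] at h
        rcases h with h | h
        · exact h.1
        · rw [← h.1] at a2
          rw [h.2] at a1
          omega
  refine ⟨q, fun v => T.dist r v, fun v hv => (hq1 v ((hqr v).1 hv)).2, fun v hv => (hq1 v ((hqr v).1 hv)).1, ?_, by omega, by omega⟩
  intro a b hab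
  have : s(a, b) ∈ T.edgeFinset := by rw [SimpleGraph.mem_edgeFinset]; exact hab
  rw [← himg] at this
  simp only [Finset.mem_image, Finset.mem_filter, Finset.mem_univ, true_and, Sym2.eq_iff] at this
  obtain ⟨v, hv, h | h⟩ := this
  · left; rw [← h.1, h.2]
  · right; rw [← h.1, h.2]

lemma group_exists {ι : Type*} [Fintype ι] (w : ι → ℝ) (hw : ∀ i, 0 ≤ w i) (cap : ℝ) (hcap0 : 0 ≤ cap) (hcap : ∀ i, w i ≤ cap) :
    ∃ (T : ℕ) (f : ι → Fin T), (∀ t, ∑ i ∈ univ.filter (fun i => f i = t), w i ≤ cap) ∧ ((T:ℝ) - 1) * cap ≤ 2 * ∑ i, w i := by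
  have hex : ∃ T : ℕ, ∃ f : ι → ι, (∀ t ∈ univ.image f, ∑ i ∈ univ.filter (fun i => f i = t), w i ≤ cap) ∧ #(univ.image f) = T := by
    refine ⟨_, id, ?_, rfl⟩
    intro t _
    have : (univ.filter fun i => id i = t) = {t} := by ext; simp
    rw [this, Finset.sum_singleton]
    exact hcap t
  obtain ⟨f, hf1, hf2⟩ := Nat.find_spec hex
  have hmin := fun {m : ℕ} (h : m < Nat.find hex) => Nat.find_min hex h
  rw [← hf2] at hmin
  have hpair : ∀ t ∈ univ.image f, ∀ t' ∈ univ.image f, t ≠ t' →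
      cap < ∑ i ∈ univ.filter (fun i => f i = t), w i + ∑ i ∈ univ.filter (fun i => f i = t'), w i := by
    intro t ht t' ht' htt
    by_contra hle
    push Not at hle
    obtain ⟨f', hf'⟩ : ∃ f' : ι → ι, ∀ i, f' i = if f i = t' then t else f i := ⟨_, fun _ => rfl⟩
    have hsub : univ.image f' ⊆ (univ.image f).erase t' := by
      intro x hx
      obtain ⟨i, -, rfl⟩ := Finset.mem_image.1 hx
      rw [hf']
      split_ifs with h
      · exact Finset.mem_erase.2 ⟨htt, ht⟩
      · exact Finset.mem_erase.2 ⟨h, Finset.mem_image_of_mem _ (Finset.mem_univ _)⟩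
    refine hmin (lt_of_le_of_lt (Finset.card_le_card hsub) (Finset.card_erase_lt_of_mem ht')) ⟨f', ?_, rfl⟩
    intro x hx
    have hx' := Finset.mem_erase.1 (hsub hx)
    by_cases hxt : x = t
    · subst hxt
      refine le_trans (le_of_eq ?_) hle
      rw [← Finset.sum_union]
      · refine Finset.sum_congr ?_ fun _ _ => rfl
        ext i
        simp only [Finset.mem_union, Finset.mem_filter, Finset.mem_univ, true_and, hf']
        by_cases h : f i = t'
        · simp [h]
        · simp [h]
      · rw [Finset.disjoint_filter]
        intro i _ h1 h2
        exact htt (h1.symm.trans h2)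
    · refine le_trans (le_of_eq ?_) (hf1 x hx'.2)
      refine Finset.sum_congr ?_ fun _ _ => rfl
      ext i
      simp only [Finset.mem_filter, Finset.mem_univ, true_and, hf']
      by_cases h : f i = t'
      · rw [if_pos h, h]
        exact ⟨fun h => absurd h.symm hxt, fun h => absurd h.symm hx'.1⟩
      · rw [if_neg h]
  obtain ⟨e⟩ : Nonempty ((univ.image f : Finset ι) ≃ Fin #(univ.image f)) := ⟨(univ.image f).equivFin⟩
  refine ⟨#(univ.image f), fun i => e ⟨f i, Finset.mem_image_of_mem _ (Finset.mem_univ _)⟩, ?_, ?_⟩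
  · intro t
    refine le_trans (le_of_eq ?_) (hf1 (e.symm t).1 (e.symm t).2)
    refine Finset.sum_congr ?_ fun _ _ => rfl
    ext i
    simp only [Finset.mem_filter, Finset.mem_univ, true_and]
    rw [← Equiv.eq_symm_apply, Subtype.ext_iff]
  · have hsum : ∑ t ∈ univ.image f, ∑ i ∈ univ.filter (fun i => f i = t), w i = ∑ i, w i :=
      Finset.sum_fiberwise_of_maps_to (fun i _ => Finset.mem_image_of_mem _ (Finset.mem_univ _)) _
    rw [← hsum]
    by_cases hne : (univ.image f).Nonempty
    · obtain ⟨t0, ht0, hmin0⟩ := Finset.exists_min_image (univ.image f) (fun t => ∑ i ∈ univ.filter (fun i => f i = t), w i) hne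
      have h1 : ∑ t ∈ (univ.image f).erase t0, cap / 2 ≤ ∑ t ∈ (univ.image f).erase t0, ∑ i ∈ univ.filter (fun i => f i = t), w i := by
        refine Finset.sum_le_sum fun t ht => ?_
        have ht' := Finset.mem_erase.1 ht
        have a1 := hpair t ht'.2 t0 ht0 ht'.1
        have a2 := hmin0 t ht'.2
        linarith
      have h2 : ∑ t ∈ (univ.image f).erase t0, ∑ i ∈ univ.filter (fun i => f i = t), w i ≤ ∑ t ∈ univ.image f, ∑ i ∈ univ.filter (fun i => f i = t), w i :=
        Finset.sum_le_sum_of_subset_of_nonneg (Finset.erase_subset _ _) fun t _ _ => Finset.sum_nonneg fun i _ => hw i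
      rw [Finset.sum_const, nsmul_eq_mul] at h1
      have h3 : (#((univ.image f).erase t0) : ℝ) = #(univ.image f) - 1 := by
        rw [eq_sub_iff_add_eq]; exact_mod_cast Finset.card_erase_add_one ht0
      rw [h3] at h1
      linarith
    · rw [Finset.not_nonempty_iff_eq_empty] at hne
      have hem : IsEmpty ι := by
        by_contra hh
        rw [not_isEmpty_iff] at hh
        obtain ⟨i⟩ := hh
        have := Finset.mem_image_of_mem f (Finset.mem_univ i)
        rw [hne] at this
        simp at this
      rw [hne]
      simp
      linarith

end ModB1
end ApproxDecomp

open SimpleGraph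
namespace ApproxDecomp
section ModB2
open scoped Classical
open Finset

lemma packs_of_fp {Δ c n : ℕ} {ν E : ℝ} {H : SimpleGraph (Fin n)} (hn : 1 ≤ n) (hν1 : ν < 1)
    (hfp : ∀ (T : ℕ) (N : Fin T → ℕ) (par : ∀ t, Fin (N t) → Fin (N t)), T ≤ c * n →
      (∀ t v, par t v ≤ v) → (∀ t v, #(univ.filter fun u => par t u = v ∧ u ≠ v) ≤ Δ) → (∀ t, (N t : ℝ) ≤ (1 - ν) * n) →
      (∑ t, (#(univ.filter fun v => par t v ≠ v) : ℝ) ≤ E) →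
      ∃ φ : ∀ t, Fin (N t) → Fin n, (∀ t, Function.Injective (φ t)) ∧
        (∀ t v, par t v ≠ v → H.Adj (φ t v) (φ t (par t v))) ∧
        ∀ t t', t ≠ t' → ∀ v v', par t v ≠ v → par t' v' ≠ v' →
          s(φ t v, φ t (par t v)) ≠ s(φ t' v', φ t' (par t' v')))
    {τ : ℕ} (m : Fin τ → ℕ) (T : ∀ i, SimpleGraph (Fin (m i)))
    (hT : ∀ i, (T i).IsTree) (hm : ∀ i, (m i : ℝ) ≤ (1 - ν) * n) (hΔ : ∀ i v, deg (T i) v ≤ Δ)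
    (hE : (∑ i, ((T i).edgeSet.ncard : ℝ)) ≤ E) (hM : (∑ i, ((T i).edgeSet.ncard : ℝ)) ≤ (n:ℝ) ^ 2 / 2)
    (hc : 1 + 2 / (1 - ν) ≤ (c:ℝ)) : PacksInto T H := by
  have htp := fun i => tree_parent (T i) (hT i)
  choose p ρ h1 h2 h3 h4 h5 using htp
  have hn0 : (1:ℝ) ≤ n := by exact_mod_cast hn
  have h1ν : 0 < 1 - ν := by linarith
  have hcap : 0 < (1 - ν) * n := by positivity
  obtain ⟨S, f, hf1, hf2⟩ := group_exists (ι := {i : Fin τ // 2 ≤ m i}) (fun i => (m i.1 : ℝ)) (fun i => by positivity)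
    ((1 - ν) * n) hcap.le (fun i => hm i.1)
  have hsub : ∀ w : Fin τ → ℝ, (∀ i, 0 ≤ w i) → ∑ i : {i : Fin τ // 2 ≤ m i}, w i.1 ≤ ∑ i, w i := by
    intro w hw
    rw [← Finset.sum_subtype (univ.filter fun i => 2 ≤ m i) (by simp) w]
    exact Finset.sum_le_sum_of_subset_of_nonneg (Finset.filter_subset _ _) fun i _ _ => hw i
  have hS : S ≤ c * n := by
    have a1 : ∑ i : {i : Fin τ // 2 ≤ m i}, (m i.1 : ℝ) ≤ (n:ℝ) ^ 2 := by
      have : ∑ i : {i : Fin τ // 2 ≤ m i}, (m i.1 : ℝ) ≤ ∑ i : {i : Fin τ // 2 ≤ m i}, 2 * ((T i.1).edgeSet.ncard : ℝ) := by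
        refine Finset.sum_le_sum fun i _ => ?_
        have b1 := h5 i.1
        have b2 := i.2
        have : m i.1 ≤ 2 * (T i.1).edgeSet.ncard := by omega
        exact_mod_cast this
      have b3 := hsub (fun i => 2 * ((T i).edgeSet.ncard : ℝ)) (fun i => by positivity)
      rw [← Finset.mul_sum (a := (2:ℝ)) (s := (univ : Finset (Fin τ)))] at b3
      linarith
    have a2 : ((S:ℝ) - 1) * (1 - ν) ≤ 2 * n := by
      have : (((S:ℝ) - 1) * (1 - ν)) * n ≤ (2 * n) * n := by nlinarith
      exact le_of_mul_le_mul_right this (by linarith)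
    have a3 : (S:ℝ) - 1 ≤ 2 * n / (1 - ν) := by rwa [le_div_iff₀ h1ν]
    have a4 : (S:ℝ) ≤ c * n := by
      have : (1 + 2 / (1 - ν)) * n ≤ c * n := by gcongr
      have e : (1 + 2 / (1 - ν)) * n = n + 2 * n / (1 - ν) := by ring
      linarith
    exact_mod_cast a4
  obtain ⟨φ, k1, k2, k3⟩ := fpX hS hfp (X := Σ i : {i : Fin τ // 2 ≤ m i}, Fin (m i.1))
    (fun x => ⟨x.1, p x.1.1 x.2⟩) (fun x => ρ x.1.1 x.2)
    (by
      rintro ⟨i, a⟩ hx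
      refine h1 i.1 a fun h => hx ?_
      simp only [h])
    (fun x => f x.1) (fun x => rfl)
    (by
      rintro ⟨j, b⟩
      refine le_trans ?_ (hΔ j.1 b)
      rw [deg_eq]
      refine le_trans (Finset.card_le_card (t := ((univ : Finset (Fin (m j.1))).filter fun w => (T j.1).Adj b w).image
        (fun a => (⟨j, a⟩ : Σ i : {i : Fin τ // 2 ≤ m i}, Fin (m i.1)))) ?_) Finset.card_image_le
      rintro ⟨i, a⟩ hx
      simp only [Finset.mem_filter, Finset.mem_univ, true_and] at hx
      obtain ⟨hx1, hx2⟩ := hx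
      rw [Sigma.mk.injEq] at hx1
      obtain ⟨rfl, hx1⟩ := hx1
      have hx1 := eq_of_heq hx1
      refine Finset.mem_image.2 ⟨a, ?_, rfl⟩
      simp only [Finset.mem_filter, Finset.mem_univ, true_and]
      rw [← hx1]
      refine (h2 i.1 a fun h => hx2 ?_).symm
      rw [← hx1, h])
    (by
      intro t
      refine le_trans (le_of_eq ?_) (hf1 t)
      have : (univ.filter fun x : Σ i : {i : Fin τ // 2 ≤ m i}, Fin (m i.1) => f x.1 = t) =
          (univ.filter fun i => f i = t).sigma (fun i => univ) := by
        ext x; simp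
      rw [this, Finset.card_sigma]
      push_cast
      simp)
    (by
      refine le_trans (le_trans (le_of_eq ?_) (hsub (fun i => ((T i).edgeSet.ncard : ℝ)) (fun i => by positivity))) hE
      have : (univ.filter fun x : Σ i : {i : Fin τ // 2 ≤ m i}, Fin (m i.1) => (⟨x.1, p x.1.1 x.2⟩ : Σ i : {i : Fin τ // 2 ≤ m i}, Fin (m i.1)) ≠ x) =
          univ.sigma (fun i => univ.filter fun a => p i.1 a ≠ a) := by
        ext ⟨i, a⟩; simp
      have e2 := congrArg Finset.card this
      rw [Finset.card_sigma] at e2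
      refine Eq.trans (b := ((∑ i : {i : Fin τ // 2 ≤ m i}, #(univ.filter fun a => p i.1 a ≠ a) : ℕ) : ℝ)) ?_ ?_
      · rw [← e2]
        congr!
      · push_cast
        refine Finset.sum_congr rfl fun i _ => ?_
        rw [← h4 i.1])
  have hz : ∀ i a b, (T i).Adj a b → 2 ≤ m i := by
    intro i a b h
    have := h.ne
    by_contra hlt
    exact this (Fin.ext (by omega))
  have hpx : ∀ i (hi : 2 ≤ m i) a, p i a ≠ a → (⟨⟨i, hi⟩, p i a⟩ : Σ i : {i : Fin τ // 2 ≤ m i}, Fin (m i.1)) ≠ ⟨⟨i, hi⟩, a⟩ := by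
    intro i hi a h h'
    rw [Sigma.mk.injEq] at h'
    exact h (eq_of_heq h'.2)
  obtain ⟨ψ, hψ1, hψ2⟩ : ∃ ψ : ∀ i, Fin (m i) → Fin n, (∀ i (hi : 2 ≤ m i) a, ψ i a = φ ⟨⟨i, hi⟩, a⟩) ∧
      ∀ i, ¬ 2 ≤ m i → Function.Injective (ψ i) := by
    refine ⟨fun i a => if hi : 2 ≤ m i then φ ⟨⟨i, hi⟩, a⟩ else ⟨0, hn⟩, fun i hi a => dif_pos hi, ?_⟩
    intro i hi a b _
    exact Fin.ext (by omega)
  have hadj : ∀ i (hi : 2 ≤ m i) a, p i a ≠ a → H.Adj (ψ i a) (ψ i (p i a)) := by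
    intro i hi a ha
    rw [hψ1 i hi, hψ1 i hi]
    exact k2 _ (hpx i hi a ha)
  have hedge : ∀ i, ∀ e ∈ (T i).edgeSet, 2 ≤ m i ∧ ∃ a, p i a ≠ a ∧ e = s(a, p i a) := by
    intro i e he
    induction e using Sym2.ind with
    | h a b =>
      rw [SimpleGraph.mem_edgeSet] at he
      refine ⟨hz i a b he, ?_⟩
      rcases h3 i a b he with h | h
      · exact ⟨a, by rw [h]; exact he.ne.symm, by rw [h]⟩
      · exact ⟨b, by rw [h]; exact he.ne, by rw [h, Sym2.eq_swap]⟩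
  refine ⟨ψ, ?_, ?_, ?_⟩
  · intro i
    by_cases hi : 2 ≤ m i
    · intro a b hab
      rw [hψ1 i hi, hψ1 i hi] at hab
      have := k1 ⟨⟨i, hi⟩, a⟩ ⟨⟨i, hi⟩, b⟩ rfl hab
      rw [Sigma.mk.injEq] at this
      exact eq_of_heq this.2
    · exact hψ2 i hi
  · intro i a b hab
    have hi := hz i a b hab
    rcases h3 i a b hab with h | h
    · rw [← h]; exact hadj i hi a (by rw [h]; exact hab.ne.symm)
    · rw [← h]; exact (hadj i hi b (by rw [h]; exact hab.ne)).symm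
  · intro i j hij e he e' he'
    obtain ⟨hi, a, ha, rfl⟩ := hedge i e he
    obtain ⟨hj, b, hb, rfl⟩ := hedge j e' he'
    rw [Sym2.map_mk, Sym2.map_mk]
    simp only [hψ1 i hi, hψ1 j hj]
    by_cases hl : f ⟨i, hi⟩ = f ⟨j, hj⟩
    · intro h
      rw [Sym2.eq_iff] at h
      rcases h with h | h
      · have := k1 ⟨⟨i, hi⟩, a⟩ ⟨⟨j, hj⟩, b⟩ hl h.1
        rw [Sigma.mk.injEq] at this
        exact hij (congrArg Subtype.val this.1)
      · have := k1 ⟨⟨i, hi⟩, a⟩ ⟨⟨j, hj⟩, p j b⟩ hl h.1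
        rw [Sigma.mk.injEq] at this
        exact hij (congrArg Subtype.val this.1)
    · exact k3 ⟨⟨i, hi⟩, a⟩ ⟨⟨j, hj⟩, b⟩ hl (hpx i hi a ha) (hpx j hj b hb)

lemma two_edges {n : ℕ} (G : SimpleGraph (Fin n)) : 2 * (G.edgeSet.ncard : ℝ) = ∑ v, (deg G v : ℝ) := by
  have h := G.sum_degrees_eq_twice_card_edges
  have hnc : G.edgeSet.ncard = #G.edgeFinset := by
    rw [← SimpleGraph.coe_edgeFinset, Set.ncard_coe_finset]
  have hd : ∀ v, deg G v = G.degree v := by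
    intro v
    rw [deg_eq, ← SimpleGraph.card_neighborFinset_eq_degree]
    congr 1; ext w; simp
  simp only [hd, hnc]
  exact_mod_cast h.symm

lemma deg_le_n {n : ℕ} (G : SimpleGraph (Fin n)) (v : Fin n) : (deg G v : ℝ) ≤ n := by
  rw [deg_eq]
  have := Finset.card_filter_le (univ : Finset (Fin n)) (fun w => G.Adj v w)
  simp only [Finset.card_univ, Fintype.card_fin] at this
  exact_mod_cast this

lemma edges_le_sq {n : ℕ} (G : SimpleGraph (Fin n)) : (G.edgeSet.ncard : ℝ) ≤ (n:ℝ) ^ 2 / 2 := by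
  have h := two_edges G
  have h2 : ∑ v, (deg G v : ℝ) ≤ ∑ v : Fin n, (n:ℝ) := Finset.sum_le_sum fun v _ => deg_le_n G v
  rw [Finset.sum_const, nsmul_eq_mul, Finset.card_univ, Fintype.card_fin] at h2
  nlinarith

lemma edges_le_deg {n : ℕ} {α ξ : ℝ} (hα : 0 < α) (hξ : 0 < ξ) (G : SimpleGraph (Fin n))
    (hG : (#((univ : Finset (Fin n)).filter fun v => ¬ ((α - ξ) * n ≤ (deg G v : ℝ) ∧ (deg G v : ℝ) ≤ (α + ξ) * n)) : ℝ) ≤ ξ * n) :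
    (G.edgeSet.ncard : ℝ) ≤ (α + 2 * ξ) * (n:ℝ) ^ 2 / 2 := by
  have h := two_edges G
  have h2 : ∑ v, (deg G v : ℝ) ≤ ∑ v : Fin n, ((α + ξ) * n + if ¬ ((α - ξ) * n ≤ (deg G v : ℝ) ∧ (deg G v : ℝ) ≤ (α + ξ) * n) then (n:ℝ) else 0) := by
    refine Finset.sum_le_sum fun v _ => ?_
    by_cases hv : (α - ξ) * n ≤ (deg G v : ℝ) ∧ (deg G v : ℝ) ≤ (α + ξ) * n
    · rw [if_neg (not_not.2 hv)]
      linarith [hv.2]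
    · rw [if_pos hv]
      have := deg_le_n G v
      have : 0 ≤ (α + ξ) * n := by positivity
      linarith
  rw [Finset.sum_add_distrib, ← Finset.sum_filter, Finset.sum_const, Finset.sum_const, nsmul_eq_mul, nsmul_eq_mul, Finset.card_univ, Fintype.card_fin] at h2
  have h3 := mul_le_mul_of_nonneg_right hG (Nat.cast_nonneg (α := ℝ) n)
  nlinarith

end ModB2

/-- Corollary 2: whp, the randomly perturbed graph `G ∪ G(n, C/n)` has an
approximate decomposition into every collection of bounded-degree trees on at
most `(1-ν)n` vertices. -/
theorem perturbed_tree_packing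
    (Δ : ℕ) (α ν : ℝ) (hα0 : 0 < α) (hα1 : α < 1) (hν0 : 0 < ν) (hν1 : ν < 1) :
    ∃ (ξ₀ : ℝ) (n₀ C : ℕ), 0 < ξ₀ ∧
      ∀ ξ : ℝ, 0 < ξ → ξ ≤ ξ₀ →
      ∀ εP : ℝ, 0 < εP → ∃ n₁ : ℕ, ∀ n : ℕ, n₀ ≤ n → n₁ ≤ n →
      ∀ G : SimpleGraph (Fin n),
        (({v : Fin n | ¬ ((α - ξ) * n ≤ (deg G v : ℝ) ∧ (deg G v : ℝ) ≤ (α + ξ) * n)}.ncard : ℝ)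
          ≤ ξ * n) →
        1 - εP ≤ binomialProb n ((C : ℝ) / n) (fun g =>
          ∀ (τ : ℕ) (m : Fin τ → ℕ) (T : ∀ i, SimpleGraph (Fin (m i))),
            (∀ i, (T i).IsTree) →
            (∀ i, (m i : ℝ) ≤ (1 - ν) * n) →
            (∀ i v, deg (T i) v ≤ Δ) →
            ((∑ i, ((T i).edgeSet.ncard) : ℝ) ≤ (1 - ν) * (G.edgeSet.ncard : ℝ)) →
            PacksInto T (G ⊔ g)) := by
  classical
  have h1ν : 0 < 1 - ν := by linarith
  obtain ⟨c, hc⟩ := exists_nat_ge (1 + 2 / (1 - ν))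
  have hc1 : 1 ≤ c := by
    have : 0 < 2 / (1 - ν) := by positivity
    have : (1:ℝ) ≤ c := by linarith
    exact_mod_cast this
  obtain ⟨ξ0, hξ0, δg, hδg, K, n0, hfp⟩ := fp Δ c hc1 α ν hα0 hα1 hν0 hν1
  obtain ⟨C, hC⟩ := goodG_whp δg hδg K 1 one_pos
  refine ⟨ξ0, max n0 1, C, hξ0, fun ξ hξ hξ' εP hεP => ?_⟩
  obtain ⟨n1, hn1⟩ := hC εP hεP
  refine ⟨n1, fun n hn hn' G hG => ?_⟩
  obtain ⟨c1, c2, c3⟩ := hn1 n hn'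
  refine c3.trans (binomialProb_mono c1 c2 ?_)
  intro g hg τ m T hT hm hΔ hE
  have hn0 : n0 ≤ n := (le_max_left _ _).trans hn
  have hn1' : 1 ≤ n := (le_max_right _ _).trans hn
  have hnR : (0:ℝ) ≤ n := Nat.cast_nonneg n
  have hle : ξ * n ≤ ξ0 * n := mul_le_mul_of_nonneg_right hξ' hnR
  have hGF : (({v : Fin n | ¬ ((α - ξ0) * n ≤ (deg G v : ℝ) ∧ (deg G v : ℝ) ≤ (α + ξ0) * n)}.ncard : ℝ) ≤ ξ0 * n) := by
    refine le_trans ?_ (hG.trans hle)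
    refine Nat.cast_le.2 (Set.ncard_le_ncard ?_ (Set.toFinite _))
    intro v hv
    simp only [Set.mem_ofPred_eq] at hv ⊢
    intro h
    exact hv ⟨by linarith [h.1], by linarith [h.2]⟩
  have hG' : (((Finset.univ : Finset (Fin n)).filter fun v => ¬ ((α - ξ0) * n ≤ (deg G v : ℝ) ∧ (deg G v : ℝ) ≤ (α + ξ0) * n)).card : ℝ) ≤ ξ0 * n := by
    refine le_trans (le_of_eq ?_) hGF
    rw [← Set.ncard_coe_finset]
    congr 2
    ext v
    simp
  have hEG := edges_le_deg hα0 hξ0 G (by convert hG')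
  have hEn := edges_le_sq G
  have hG0 : (0:ℝ) ≤ G.edgeSet.ncard := Nat.cast_nonneg _
  refine packs_of_fp (c := c) (Δ := Δ) (ν := ν) (E := (1 - ν) * ((α + 2 * ξ0) * (n:ℝ) ^ 2 / 2)) hn1' hν1 ?_ m T hT hm hΔ ?_ ?_ hc
  · intro S N par
    have := hfp n hn0 G g (by convert hG') hg S N par
    convert this
  · exact hE.trans (mul_le_mul_of_nonneg_left hEG h1ν.le)
  · refine hE.trans (le_trans ?_ hEn)
    nlinarith

end ApproxDecomp
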